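/- Let k be a field, I a monomial ideal in k[x_1,…,x_t] generated by monomials of degree at least 2 with minimal generating set M, and R = k[x_1,…,x_t]/I. Then R is a Golod ring if and only if every non-empty subset of M of the form M_m with m ∈ L_I is pre-Golod over k. -/

import Mathlib

noncomputable section
attribute [local instance] Classical.propDecidable

namespace MonomialRings

/-- Monomials in variables indexed by `σ`, represented by their exponent vectors. -/
abbrev Mon (σ : Type*) := σ → ℕ

/-- Two monomials have a non-trivial common factor. -/
def NCF {σ : Type*} (a b : Mon σ) : Prop := ∃ i, a i ≠ 0 ∧ b i ≠ 0

/-- Adjacency in the graph associated to a set of monomials: edges go between distinct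
monomials having a non-trivial common factor. -/
def mAdj {σ : Type*} (a b : Mon σ) : Prop := a ≠ b ∧ NCF a b

/-- `a` and `b` are joined by a path inside `S`. -/
def ConnIn {σ : Type*} (S : Finset (Mon σ)) (a b : Mon σ) : Prop :=
  a ∈ S ∧ b ∈ S ∧ Relation.ReflTransGen (fun u v => u ∈ S ∧ v ∈ S ∧ mAdj u v) a b

/-- A monomial set is connected (in particular nonempty). -/
def IsConnected {σ : Type*} (S : Finset (Mon σ)) : Prop :=
  S.Nonempty ∧ ∀ a ∈ S, ∀ b ∈ S, ConnIn S a b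

/-- The connected component of `a` in `S`. -/
def compOf {σ : Type*} (S : Finset (Mon σ)) (a : Mon σ) : Finset (Mon σ) :=
  S.filter (fun b => ConnIn S a b)

/-- The set of connected components of a monomial set. -/
def components {σ : Type*} (S : Finset (Mon σ)) : Finset (Finset (Mon σ)) :=
  S.image (compOf S)

/-- The number of connected components of a monomial set. -/
def ncomp {σ : Type*} (S : Finset (Mon σ)) : ℕ := (components S).card

/-- The least common multiple `m_S` of a finite set of monomials (`m_∅ = 1`). -/
def mlcm {σ : Type*} (S : Finset (Mon σ)) : Mon σ := S.sup id

/-- `S` is saturated in `M`: for all `m ∈ M` and every connected subset `T ⊆ S`,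
`m ∣ m_T` implies `m ∈ S`. -/
def Saturated {σ : Type*} (M S : Finset (Mon σ)) : Prop :=
  S ⊆ M ∧ ∀ m ∈ M, ∀ T ⊆ S, IsConnected T → m ≤ mlcm T → m ∈ S

/-- The set `sat M` of non-empty saturated subsets of `M`. -/
def satSets {σ : Type*} (M : Finset (Mon σ)) : Finset (Finset (Mon σ)) :=
  M.powerset.filter (fun S => S.Nonempty ∧ Saturated M S)

/-- The saturation `S̄` of `S` in `M`. -/
def saturation {σ : Type*} (M S : Finset (Mon σ)) : Finset (Mon σ) :=
  M.filter (fun m => ∃ C ∈ components S, m ≤ mlcm C)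

/-- The simplicial complex `Δ'_S`: faces are the `T ⊆ S` with `m_T ≠ m_S`, or such that
`S_i ∩ T` is disconnected for some connected component `S_i` of `S`. -/
def dprime {σ : Type*} (S : Finset (Mon σ)) : Set (Finset (Mon σ)) :=
  {T | T ⊆ S ∧ (mlcm T ≠ mlcm S ∨ ∃ C ∈ components S, ¬ IsConnected (C ∩ T))}

/-- The simplicial complex `Δ_N`: faces are the `S ⊆ N` with `m_S ≠ m_N` or `S`
disconnected. -/
def dcomplex {σ : Type*} (N : Finset (Mon σ)) : Set (Finset (Mon σ)) :=
  {T | T ⊆ N ∧ (mlcm T ≠ mlcm N ∨ ¬ IsConnected T)}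

/-- A discrete monomial set: the monomials are pairwise without common factors. -/
def Discrete {σ : Type*} (S : Finset (Mon σ)) : Prop :=
  ∀ a ∈ S, ∀ b ∈ S, a ≠ b → ¬ NCF a b

/-- The lcm-lattice of the monomial set `M` (as a finite set of monomials,
ordered by divisibility i.e. by `≤` on exponent vectors). -/
def lcmLattice {σ : Type*} (M : Finset (Mon σ)) : Finset (Mon σ) :=
  M.powerset.image mlcm

/-- `M_l`: the set of monomials in `M` dividing the monomial `l`. -/
def divisorsIn {σ : Type*} (M : Finset (Mon σ)) (l : Mon σ) : Finset (Mon σ) :=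
  M.filter (fun m => m ≤ l)

/-- `M_N`: the set of monomials in `M` dividing some monomial of `N`. -/
def divisorsInSet {σ : Type*} (M N : Finset (Mon σ)) : Finset (Mon σ) :=
  M.filter (fun m => ∃ l ∈ N, m ≤ l)

/-- An antichain of monomials (the minimal generating set of the monomial ideal
it generates). -/
def IsAntichain' {σ : Type*} (M : Finset (Mon σ)) : Prop :=
  ∀ m ∈ M, ∀ n ∈ M, m ≤ n → m = n

/-- total degree of a monomial -/
def mdeg {t : ℕ} (m : Mon (Fin t)) : ℕ := ∑ i, m i

end MonomialRings
namespace MonomialRings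

/-- An auxiliary (classically chosen) linear order on any type, used to orient simplices. -/
def vOrd (V : Type*) : LinearOrder V := IsWellOrder.linearOrder WellOrderingRel

/-- The position of a vertex `x` inside a face `F` (w.r.t. the auxiliary order). -/
def rankIn {V : Type*} (F : Finset V) (x : V) : ℕ :=
  (F.filter (fun y => (vOrd V).lt y x)).card

/-- The boundary of a single oriented simplex. -/
def bdryAux (k : Type*) [Field k] {V : Type*} (F : Finset V) : Finset V →₀ k :=
  ∑ x ∈ F, ((-1 : k) ^ (rankIn F x)) • Finsupp.single (F.erase x) (1 : k)

/-- The simplicial boundary operator on the module spanned by all finite subsets of `V`. -/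
def bdry (k : Type*) [Field k] (V : Type*) :
    (Finset V →₀ k) →ₗ[k] (Finset V →₀ k) :=
  Finsupp.linearCombination k (bdryAux k)

/-- The subspace of chains of a simplicial complex `Δ` spanned by the faces with `n`
vertices (i.e. of dimension `n - 1`). -/
def chainSub (k : Type*) [Field k] {V : Type*} (Δ : Set (Finset V)) (n : ℕ) :
    Submodule k (Finset V →₀ k) :=
  Submodule.span k ((fun F => Finsupp.single F (1 : k)) '' {F | F ∈ Δ ∧ F.card = n})

/-- Reduced cycles of `Δ` in the degree of faces with `n` vertices. -/
def cycles (k : Type*) [Field k] {V : Type*} (Δ : Set (Finset V)) (n : ℕ) :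
    Submodule k (Finset V →₀ k) :=
  chainSub k Δ n ⊓ LinearMap.ker (bdry k V)

/-- Reduced boundaries of `Δ` in the degree of faces with `n` vertices. -/
def bdries (k : Type*) [Field k] {V : Type*} (Δ : Set (Finset V)) (n : ℕ) :
    Submodule k (Finset V →₀ k) :=
  Submodule.map (bdry k V) (chainSub k Δ (n + 1))

/-- `dim_k H̃_{n-1}(Δ; k)`: the dimension of the reduced homology of `Δ` in the degree of
faces with `n` vertices (homological dimension `n - 1`; `n = 0` corresponds to `H̃₋₁`). -/
def hdim (k : Type*) [Field k] {V : Type*} (Δ : Set (Finset V)) (n : ℕ) : ℕ :=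
  Module.finrank k ↥(cycles k Δ n) - Module.finrank k ↥(bdries k Δ n)

/-- `hdim` with integer index (`0` below the allowed range). -/
def hdimZ (k : Type*) [Field k] {V : Type*} (Δ : Set (Finset V)) (n : ℤ) : ℕ :=
  if 0 ≤ n then hdim k Δ n.toNat else 0

/-- The subquotient `K / (B ∩ K)` of a module, used to form homology. -/
def subquot (k : Type*) [Field k] {M : Type*} [AddCommGroup M] [Module k M]
    (K B : Submodule k M) :=
  ↥K ⧸ B.comap K.subtype

instance (k : Type*) [Field k] {M : Type*} [AddCommGroup M] [Module k M]
    (K B : Submodule k M) : AddCommGroup (subquot k K B) := by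
  unfold subquot; infer_instance

instance (k : Type*) [Field k] {M : Type*} [AddCommGroup M] [Module k M]
    (K B : Submodule k M) : Module k (subquot k K B) := by
  unfold subquot; infer_instance

/-- The reduced homology `H̃_{n-1}(Δ; k)` itself, as a `k`-module. -/
def homologyMod (k : Type*) [Field k] {V : Type*} (Δ : Set (Finset V)) (n : ℕ) :=
  subquot k (cycles k Δ n) (bdries k Δ n)

instance (k : Type*) [Field k] {V : Type*} (Δ : Set (Finset V)) (n : ℕ) :
    AddCommGroup (homologyMod k Δ n) := by
  unfold homologyMod; infer_instance

instance (k : Type*) [Field k] {V : Type*} (Δ : Set (Finset V)) (n : ℕ) :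
    Module k (homologyMod k Δ n) := by
  unfold homologyMod; infer_instance

/-- The generating function `H̃(Δ;k)(z) = ∑ᵢ dim_k H̃ᵢ(Δ;k) zⁱ` of the reduced homology of a
complex all of whose faces have at most `bound` vertices, as a Laurent polynomial
(the `H̃₋₁` term contributes `z⁻¹`). -/
def hgen (k : Type*) [Field k] {V : Type*} (Δ : Set (Finset V)) (bound : ℕ) :
    LaurentPolynomial ℤ :=
  ∑ n ∈ Finset.range (bound + 1), (hdim k Δ n : ℤ) • LaurentPolynomial.T ((n : ℤ) - 1)

/-- The order complex of a subset `P` of a partially ordered type: its faces are the finite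
chains contained in `P`. -/
def orderComplex {V : Type*} [PartialOrder V] (P : Set V) : Set (Finset V) :=
  {F | ↑F ⊆ P ∧ IsChain (· ≤ ·) (F : Set V)}

end MonomialRings
namespace MonomialRings

/-! ### The multigraded Poincaré series, via the bar resolution

For a monomial ring `R = k[x₁,…,x_t]/I`, the multigraded vector spaces `Tor^R_{i,α}(k,k)`
are computed by the (normalized) bar resolution of `k` over `R`.  The monomial ring is
determined by the set `J` of exponents of monomials lying in `I`; `R` has `k`-basis the
monomials `x^β` with `β ∉ J`, and the degree-`(i,α)` part of the bar complex has basis the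
lists `[β₁,…,β_i]` of nonzero exponent vectors not in `J` with `β₁ + ⋯ + β_i = α`. -/

/-- Lists forming the basis of the multigraded piece of the bar complex. -/
def barBasis {σ : Type*} (J : Set (Mon σ)) (i : ℕ) (α : Mon σ) : Set (List (Mon σ)) :=
  {l | l.length = i ∧ l.sum = α ∧ ∀ β ∈ l, β ≠ 0 ∧ β ∉ J}

/-- Merging the entries at positions `j` and `j+1` of a list. -/
def mergeAt {σ : Type*} (l : List (Mon σ)) (j : ℕ) : List (Mon σ) :=
  l.take j ++ [l.getD j 0 + l.getD (j + 1) 0] ++ l.drop (j + 2)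

/-- The bar differential on a basis element. -/
def barAux (k : Type*) [Field k] {σ : Type*} (J : Set (Mon σ)) (l : List (Mon σ)) :
    List (Mon σ) →₀ k :=
  ∑ j ∈ Finset.range (l.length - 1),
    if l.getD j 0 + l.getD (j + 1) 0 ∉ J then
      ((-1 : k) ^ (j + 1)) • Finsupp.single (mergeAt l j) (1 : k)
    else 0

/-- The bar differential. -/
def barD (k : Type*) [Field k] {σ : Type*} (J : Set (Mon σ)) :
    (List (Mon σ) →₀ k) →ₗ[k] (List (Mon σ) →₀ k) :=
  Finsupp.linearCombination k (barAux k J)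

/-- The degree-`(i,α)` part of the bar complex. -/
def barSub (k : Type*) [Field k] {σ : Type*} (J : Set (Mon σ)) (i : ℕ) (α : Mon σ) :
    Submodule k (List (Mon σ) →₀ k) :=
  Submodule.span k ((fun l => Finsupp.single l (1 : k)) '' barBasis J i α)

/-- `dim_k Tor^R_{i,α}(k,k)` for the monomial ring `R` determined by `J`. -/
def torDim (k : Type*) [Field k] {σ : Type*} (J : Set (Mon σ)) (i : ℕ) (α : Mon σ) : ℕ :=
  Module.finrank k ↥(barSub k J i α ⊓ LinearMap.ker (barD k J))
    - Module.finrank k ↥(Submodule.map (barD k J) (barSub k J (i + 1) α))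

/-- The set of exponent vectors of monomials lying in the ideal `I`. -/
def expSet {t : ℕ} {k : Type*} [Field k] (I : Ideal (MvPolynomial (Fin t) k)) :
    Set (Mon (Fin t)) :=
  {β | MvPolynomial.monomial (Finsupp.equivFunOnFinite.symm β) (1 : k) ∈ I}

/-- The exponent (in `ℕ^t × ℕ`) of the monomial `x^α z^d`; the extra variable `none`
is the homological variable `z`. -/
def expOf {t : ℕ} (α : Mon (Fin t)) (d : ℕ) : Option (Fin t) →₀ ℕ :=
  Finsupp.equivFunOnFinite.symm (fun o => Option.elim o d α)

/-- The multigraded Poincaré series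
`P^R_k(x,z) = ∑_{i,α} dim_k Tor^R_{i,α}(k,k) x^α z^i` of the monomial ring `R`
determined by `J`, as a formal power series in `x₁,…,x_t` and `z` (the variable `none`). -/
def poincareSeries (k : Type*) [Field k] {t : ℕ} (J : Set (Mon (Fin t))) :
    MvPowerSeries (Option (Fin t)) ℤ :=
  fun e => (torDim k J (e none) (fun i => e (some i)) : ℤ)

/-- The statement that `b` is the Backelin denominator of the Poincaré series:
`P^R_k(x,z) = ∏ᵢ(1+xᵢz) / b(x,z)`. -/
def IsDenominator (k : Type*) [Field k] {t : ℕ} (J : Set (Mon (Fin t)))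
    (b : MvPolynomial (Option (Fin t)) ℤ) : Prop :=
  (b : MvPowerSeries (Option (Fin t)) ℤ) * poincareSeries k J
    = ∏ i : Fin t, (1 + MvPowerSeries.X (some i) * MvPowerSeries.X none)

/-- The multigraded ideal of a monomial set: the exponents `β` with `x^m ∣ x^β` for some
`m ∈ M`. -/
def upperSet {σ : Type*} (M : Finset (Mon σ)) : Set (Mon σ) :=
  {β | ∃ m ∈ M, m ≤ β}

/-- `I` is the monomial ideal generated by the monomial set `M`. -/
def IsMonomialIdealOf {t : ℕ} {k : Type*} [Field k] (M : Finset (Mon (Fin t)))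
    (I : Ideal (MvPolynomial (Fin t) k)) : Prop :=
  I = Ideal.span ((fun m => MvPolynomial.monomial (Finsupp.equivFunOnFinite.symm m) (1 : k)) '' ↑M)

/-- The specialization `b(z) = b(1,…,1,z)` of a polynomial in `x₁,…,x_t,z`. -/
def zSpecialize {t : ℕ} (b : MvPolynomial (Option (Fin t)) ℤ) : Polynomial ℤ :=
  MvPolynomial.aeval (fun o : Option (Fin t) => Option.elim o Polynomial.X (fun _ => 1)) b

end MonomialRings
namespace MonomialRings

/-! ### Multigraded Betti numbers via the Koszul complex

`Tor^Q_{i,α}(R,k)` is the `i`-th homology of the multidegree-`α` component of the Koszul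
complex `R ⊗ Λ(e₁,…,e_t)`; it has basis the subsets `F ⊆ {1,…,t}` with `χ_F ≤ α` and
`α - χ_F ∉ J`, where `J` is the set of exponents of monomials of `I`. -/

/-- Indicator exponent vector of a set of variables. -/
def chi {t : ℕ} (F : Finset (Fin t)) : Mon (Fin t) := fun i => if i ∈ F then 1 else 0

/-- The Koszul differential (in multidegree `α`) on a basis element. -/
def koszulAux (k : Type*) [Field k] {t : ℕ} (J : Set (Mon (Fin t))) (α : Mon (Fin t))
    (F : Finset (Fin t)) : Finset (Fin t) →₀ k :=
  ∑ i ∈ F,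
    if (fun j => α j - chi (F.erase i) j) ∉ J then
      ((-1 : k) ^ (rankIn F i)) • Finsupp.single (F.erase i) (1 : k)
    else 0

/-- The Koszul differential in multidegree `α`. -/
def koszulD (k : Type*) [Field k] {t : ℕ} (J : Set (Mon (Fin t))) (α : Mon (Fin t)) :
    (Finset (Fin t) →₀ k) →ₗ[k] (Finset (Fin t) →₀ k) :=
  Finsupp.linearCombination k (koszulAux k J α)

/-- The homological degree `n` part of the multidegree `α` component of the Koszul
complex. -/
def koszulSub (k : Type*) [Field k] {t : ℕ} (J : Set (Mon (Fin t))) (α : Mon (Fin t))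
    (n : ℕ) : Submodule k (Finset (Fin t) →₀ k) :=
  Submodule.span k ((fun F => Finsupp.single F (1 : k)) ''
    {F | F.card = n ∧ chi F ≤ α ∧ (fun j => α j - chi F j) ∉ J})

/-- `dim_k Tor^Q_{n,α}(R,k)`, for the monomial ring `R = Q/I` determined by `J`. -/
def bettiDim (k : Type*) [Field k] {t : ℕ} (J : Set (Mon (Fin t))) (n : ℕ)
    (α : Mon (Fin t)) : ℕ :=
  Module.finrank k ↥(koszulSub k J α n ⊓ LinearMap.ker (koszulD k J α))
    - Module.finrank k ↥(Submodule.map (koszulD k J α) (koszulSub k J α (n + 1)))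

/-- The series `P^Q_R(x,z) = ∑_{i,α} dim_k Tor^Q_{i,α}(R,k) x^α zⁱ`. -/
def bettiSeries (k : Type*) [Field k] {t : ℕ} (J : Set (Mon (Fin t))) :
    MvPowerSeries (Option (Fin t)) ℤ :=
  fun e => (bettiDim k J (e none) (fun i => e (some i)) : ℤ)

/-- `R` is a Golod ring:
`P^R_k(x,z) = ∏ᵢ(1+xᵢz) / (1 - z(P^Q_R(x,z) - 1))`. -/
def IsGolod (k : Type*) [Field k] {t : ℕ} (J : Set (Mon (Fin t))) : Prop :=
  poincareSeries k J * (1 - MvPowerSeries.X none * (bettiSeries k J - 1))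
    = ∏ i : Fin t, (1 + MvPowerSeries.X (some i) * MvPowerSeries.X none)

end MonomialRings
namespace MonomialRings

/-- The open interval `(∅, S)` in the lattice `satt(N)` of saturated subsets of `N`. -/
def openInterval {σ : Type*} (N S : Finset (Mon σ)) : Set (Finset (Mon σ)) :=
  {T | Saturated N T ∧ T.Nonempty ∧ T ⊂ S}

/-- The truncated lcm-lattice `L̄_N = L_N \ {1, m_N}`. -/
def truncatedLcmLattice {σ : Type*} (N : Finset (Mon σ)) : Finset (Mon σ) :=
  ((lcmLattice N).erase 0).erase (mlcm N)

/-- A monomial set `N` is pre-Golod over `k` if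
`H̃(L̄_N;k)(z) = ∑_{S ∈ sat(N), m_S = m_N} (-z)^{c(S)-1} H̃((∅,S)_{satt(N)};k)(z)`,
where the homology of a poset is the reduced homology of its order complex. -/
def IsPreGolod (k : Type*) [Field k] {σ : Type*} (N : Finset (Mon σ)) : Prop :=
  hgen k (orderComplex {l : Mon σ | l ∈ truncatedLcmLattice N}) (lcmLattice N).card
    = ∑ S ∈ (satSets N).filter (fun S => mlcm S = mlcm N),
        ((-1 : ℤ) ^ (ncomp S - 1)) •
          (LaurentPolynomial.T ((ncomp S : ℤ) - 1) *
            hgen k (orderComplex (openInterval N S)) N.powerset.card)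

end MonomialRings

namespace MonomialRings

set_option linter.unusedSectionVars false

section LinAlg
variable {k : Type*} [Field k]

/-- The dimension of the homology in degree `n` of a graded family `G` under `D`. -/
def hh {V : Type*} [AddCommGroup V] [Module k V] (D : V →ₗ[k] V) (G : ℕ → Submodule k V)
    (n : ℕ) : ℕ :=
  Module.finrank k ↥(G n ⊓ LinearMap.ker D) - Module.finrank k ↥(Submodule.map D (G (n + 1)))

theorem finrank_quot_sub {V : Type*} [AddCommGroup V] [Module k V] (Z B : Submodule k V)
    [FiniteDimensional k Z] (hBZ : B ≤ Z) :
    Module.finrank k (↥Z ⧸ B.comap Z.subtype) = Module.finrank k Z - Module.finrank k B := by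
  have h := Submodule.finrank_quotient_add_finrank (B.comap Z.subtype)
  have h2 : Module.finrank k (B.comap Z.subtype) = Module.finrank k B :=
    (Submodule.comapSubtypeEquivOfLe hBZ).finrank_eq
  omega

theorem finrank_sub_eq_of_map {V W : Type*} [AddCommGroup V] [Module k V] [AddCommGroup W]
    [Module k W] (Z B : Submodule k V) (Z' B' : Submodule k W)
    [FiniteDimensional k Z] [FiniteDimensional k Z'] (hBZ : B ≤ Z) (hBZ' : B' ≤ Z')
    (f : V →ₗ[k] W) (h1 : ∀ v ∈ Z, f v ∈ Z') (h2 : ∀ v ∈ B, f v ∈ B')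
    (inj : ∀ v ∈ Z, f v ∈ B' → v ∈ B) (surj : ∀ w ∈ Z', ∃ v ∈ Z, w - f v ∈ B') :
    Module.finrank k Z - Module.finrank k B = Module.finrank k Z' - Module.finrank k B' := by
  rw [← finrank_quot_sub Z B hBZ, ← finrank_quot_sub Z' B' hBZ']
  let g : ↥Z →ₗ[k] ↥Z' := f.restrict h1
  have hg : B.comap Z.subtype ≤ (B'.comap Z'.subtype).comap g := fun _ hv => h2 _ hv
  refine (LinearEquiv.ofBijective (Submodule.mapQ _ _ g hg) ⟨?_, ?_⟩).finrank_eq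
  · rw [← LinearMap.ker_eq_bot, LinearMap.ker_eq_bot']
    intro q hq
    obtain ⟨v, rfl⟩ := Submodule.Quotient.mk_surjective _ q
    rw [Submodule.mapQ_apply, Submodule.Quotient.mk_eq_zero] at hq
    rw [Submodule.Quotient.mk_eq_zero]
    exact inj v v.2 hq
  · intro q
    obtain ⟨w, rfl⟩ := Submodule.Quotient.mk_surjective _ q
    obtain ⟨v, hv, hvw⟩ := surj w w.2
    refine ⟨Submodule.Quotient.mk ⟨v, hv⟩, ?_⟩
    rw [Submodule.mapQ_apply, eq_comm, Submodule.Quotient.eq]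
    exact hvw

variable {X Y : Type*}

/-- The span of the basis elements of `C` of degree `n`. -/
def Fam (k : Type*) [Field k] (C : Set X) (deg : X → ℕ) (n : ℕ) : Submodule k (X →₀ k) :=
  Finsupp.supported k k {x | x ∈ C ∧ deg x = n}

theorem mem_Fam {C : Set X} {deg : X → ℕ} {n : ℕ} {v : X →₀ k} :
    v ∈ Fam k C deg n ↔ ∀ x, v x ≠ 0 → x ∈ C ∧ deg x = n := by
  simp [Fam, Finsupp.mem_supported, Set.subset_def]

theorem single_mem_Fam {C : Set X} {deg : X → ℕ} {x : X} (hx : x ∈ C) (c : k) :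
    Finsupp.single x c ∈ Fam k C deg (deg x) := by
  rw [mem_Fam]
  intro y hy
  rw [Finsupp.single_apply] at hy
  by_cases h : x = y
  · subst h; exact ⟨hx, rfl⟩
  · simp [h] at hy

theorem Fam_eq_span (C : Set X) (deg : X → ℕ) (n : ℕ) :
    Fam k C deg n = Submodule.span k
      ((fun x => Finsupp.single x (1 : k)) '' {x | x ∈ C ∧ deg x = n}) :=
  Finsupp.supported_eq_span_single k _

theorem Fam_mono {C C' : Set X} (h : C ⊆ C') (deg : X → ℕ) (n : ℕ) :
    Fam k C deg n ≤ Fam k C' deg n :=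
  fun _ hv => mem_Fam.2 fun x hx => ⟨h (mem_Fam.1 hv x hx).1, (mem_Fam.1 hv x hx).2⟩

/-- Linear statements about `Fam` can be checked on basis elements. -/
theorem Fam_le_iff {C : Set X} {deg : X → ℕ} {n : ℕ} {W : Submodule k (X →₀ k)} :
    Fam k C deg n ≤ W ↔ ∀ x ∈ C, deg x = n → Finsupp.single x (1 : k) ∈ W := by
  rw [Fam_eq_span, Submodule.span_le, Set.image_subset_iff]
  exact ⟨fun h x hx hn => h ⟨hx, hn⟩, fun h x hx => h x hx.1 hx.2⟩

theorem Fam_map_mem {W : Type*} [AddCommGroup W] [Module k W] {C : Set X} {deg : X → ℕ} {n : ℕ}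
    {f : (X →₀ k) →ₗ[k] W} {Q : Submodule k W}
    (h : ∀ x ∈ C, deg x = n → f (Finsupp.single x 1) ∈ Q) {v : X →₀ k}
    (hv : v ∈ Fam k C deg n) : f v ∈ Q :=
  (Fam_le_iff (W := Q.comap f)).2 h hv

theorem Fam_map_eq {W : Type*} [AddCommGroup W] [Module k W] {C : Set X} {deg : X → ℕ} {n : ℕ}
    {f g : (X →₀ k) →ₗ[k] W}
    (h : ∀ x ∈ C, deg x = n → f (Finsupp.single x 1) = g (Finsupp.single x 1)) {v : X →₀ k}
    (hv : v ∈ Fam k C deg n) : f v = g v :=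
  (Fam_le_iff (W := LinearMap.eqLocus f g)).2 h hv

/-- `C` spans a subcomplex of locally finite type under `D`. -/
structure Cx (D : (X →₀ k) →ₗ[k] (X →₀ k)) (C : Set X) (deg : X → ℕ) : Prop where
  face : ∀ x ∈ C, ∀ y, D (Finsupp.single x 1) y ≠ 0 → y ∈ C ∧ deg y + 1 = deg x
  sq : ∀ x ∈ C, D (D (Finsupp.single x 1)) = 0
  fin : ∀ n, {x | x ∈ C ∧ deg x = n}.Finite

/-- `Z` is closed under `D`. -/
def Closed (D : (X →₀ k) →ₗ[k] (X →₀ k)) (Z : Set X) : Prop :=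
  ∀ x ∈ Z, ∀ y, D (Finsupp.single x 1) y ≠ 0 → y ∈ Z

/-- The projection onto the span of the basis elements in `Z`. -/
def proj (k : Type*) [Field k] (Z : Set X) : (X →₀ k) →ₗ[k] (X →₀ k) :=
  Finsupp.linearCombination k (fun x => if x ∈ Z then Finsupp.single x (1 : k) else 0)

/-- The differential truncated to `Z`. -/
def tr (D : (X →₀ k) →ₗ[k] (X →₀ k)) (Z : Set X) : (X →₀ k) →ₗ[k] (X →₀ k) := proj k Z ∘ₗ D

theorem proj_apply (Z : Set X) (v : X →₀ k) (x : X) :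
    proj k Z v x = if x ∈ Z then v x else 0 := by
  induction v using Finsupp.induction_linear with
  | zero => simp
  | add f g hf hg => simp only [map_add, Finsupp.add_apply, hf, hg]; split_ifs <;> simp
  | single y c =>
    simp only [proj, Finsupp.linearCombination_single, Finsupp.smul_apply]
    by_cases hyx : y = x
    · subst hyx; split_ifs <;> simp
    · split_ifs <;> simp [hyx]

theorem tr_apply (D : (X →₀ k) →ₗ[k] (X →₀ k)) (Z : Set X) (v : X →₀ k) (x : X) :
    tr D Z v x = if x ∈ Z then D v x else 0 := proj_apply Z _ x

theorem proj_eq_self {Z : Set X} {v : X →₀ k} (h : ∀ x, v x ≠ 0 → x ∈ Z) : proj k Z v = v := by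
  ext x
  rw [proj_apply]
  split_ifs with hx
  · rfl
  · by_contra h'; exact hx (h x (Ne.symm h'))

theorem finDim_Fam {C : Set X} {deg : X → ℕ} {n : ℕ} (h : {x | x ∈ C ∧ deg x = n}.Finite) :
    FiniteDimensional k (Fam k C deg n) := by
  rw [Fam_eq_span]
  exact FiniteDimensional.span_of_finite k (h.image _)

namespace Cx
variable {D : (X →₀ k) →ₗ[k] (X →₀ k)} {C : Set X} {deg : X → ℕ}

theorem finDim (hC : Cx D C deg) (n : ℕ) : FiniteDimensional k (Fam k C deg n) :=
  finDim_Fam (hC.fin n)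

theorem map_mem (hC : Cx D C deg) {n : ℕ} {v : X →₀ k} (hv : v ∈ Fam k C deg (n + 1)) :
    D v ∈ Fam k C deg n := by
  refine Fam_map_mem (fun x hx hn => mem_Fam.2 fun y hy => ?_) hv
  have := hC.face x hx y hy
  exact ⟨this.1, by omega⟩

theorem map_zero (hC : Cx D C deg) {v : X →₀ k} (hv : v ∈ Fam k C deg 0) : D v = 0 := by
  refine Fam_map_eq (g := 0) (fun x hx hn => ?_) hv
  ext y
  by_contra h
  have := hC.face x hx y h
  omega

theorem map_map (hC : Cx D C deg) {n : ℕ} {v : X →₀ k} (hv : v ∈ Fam k C deg n) :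
    D (D v) = 0 :=
  Fam_map_eq (f := D ∘ₗ D) (g := 0) (fun x hx _ => hC.sq x hx) hv

theorem map_mem' (hC : Cx D C deg) {n : ℕ} {v : X →₀ k} (hv : v ∈ Fam k C deg n) :
    D v ∈ Fam k C deg (n - 1) := by
  cases n with
  | zero => rw [hC.map_zero hv]; exact zero_mem _
  | succ n => exact hC.map_mem hv

theorem sub (hC : Cx D C deg) {Z : Set X} (hZC : Z ⊆ C) (hZ : Closed D Z) : Cx D Z deg where
  face x hx y hy := ⟨hZ x hx y hy, (hC.face x (hZC hx) y hy).2⟩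
  sq x hx := hC.sq x (hZC hx)
  fin n := (hC.fin n).subset fun _ hx => ⟨hZC hx.1, hx.2⟩

theorem tr_proj {Z : Set X} (hY : Closed D (C \ Z)) {n : ℕ} {v : X →₀ k}
    (hv : v ∈ Fam k C deg n) : tr D Z (proj k Z v) = proj k Z (D v) := by
  refine Fam_map_eq (f := tr D Z ∘ₗ proj k Z) (g := proj k Z ∘ₗ D) (fun x hx _ => ?_) hv
  ext y
  simp only [LinearMap.comp_apply, tr_apply, proj_apply]
  split_ifs with hy
  · by_cases hxZ : x ∈ Z
    · rw [proj_eq_self]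
      intro z hz
      rw [Finsupp.single_apply] at hz
      by_cases h : x = z
      · exact h ▸ hxZ
      · simp [h] at hz
    · have : proj k Z (Finsupp.single x 1) = 0 := by
        simp [proj, hxZ]
      rw [this]
      by_contra h
      have := hY x ⟨hx, hxZ⟩ y (by simpa using Ne.symm h)
      exact this.2 hy
  · rfl

theorem quot (hC : Cx D C deg) {Z : Set X} (hZC : Z ⊆ C) (hY : Closed D (C \ Z)) :
    Cx (tr D Z) Z deg where
  face x hx y hy := by
    rw [tr_apply] at hy
    split_ifs at hy with h
    · exact ⟨h, (hC.face x (hZC hx) y hy).2⟩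
    · exact absurd rfl hy
  sq x hx := by
    have h1 : tr D Z (Finsupp.single x 1) = proj k Z (D (Finsupp.single x 1)) := rfl
    rw [h1, tr_proj hY (hC.map_mem' (single_mem_Fam (hZC hx) 1)), hC.sq x (hZC hx), LinearMap.map_zero]
  fin n := (hC.fin n).subset fun _ hx => ⟨hZC hx.1, hx.2⟩

theorem bdry_le (hC : Cx D C deg) (n : ℕ) :
    Submodule.map D (Fam k C deg (n + 1)) ≤ Fam k C deg n ⊓ LinearMap.ker D := by
  rintro _ ⟨v, hv, rfl⟩
  exact ⟨hC.map_mem hv, hC.map_map hv⟩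

/-- A map inducing an isomorphism on homology preserves the dimension. -/
theorem hh_eq_of_map (hC : Cx D C deg) {D' : (Y →₀ k) →ₗ[k] (Y →₀ k)} {C' : Set Y}
    {deg' : Y → ℕ} (hC' : Cx D' C' deg') {n n' : ℕ} (f : (X →₀ k) →ₗ[k] (Y →₀ k))
    (h1 : ∀ v ∈ Fam k C deg n, D v = 0 → f v ∈ Fam k C' deg' n' ∧ D' (f v) = 0)
    (h2 : ∀ v ∈ Fam k C deg (n + 1), ∃ w ∈ Fam k C' deg' (n' + 1), f (D v) = D' w)
    (inj : ∀ v ∈ Fam k C deg n, D v = 0 → ∀ w ∈ Fam k C' deg' (n' + 1), f v = D' w →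
      ∃ u ∈ Fam k C deg (n + 1), v = D u)
    (surj : ∀ w ∈ Fam k C' deg' n', D' w = 0 → ∃ v ∈ Fam k C deg n, D v = 0 ∧
      ∃ u ∈ Fam k C' deg' (n' + 1), w = f v + D' u) :
    hh D (Fam k C deg) n = hh D' (Fam k C' deg') n' := by
  have := hC.finDim n
  have := hC'.finDim n'
  refine finrank_sub_eq_of_map _ _ _ _ (hC.bdry_le n) (hC'.bdry_le n') f ?_ ?_ ?_ ?_
  · exact fun v hv => h1 v hv.1 hv.2
  · rintro _ ⟨v, hv, rfl⟩
    obtain ⟨w, hw, h⟩ := h2 v hv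
    exact ⟨w, hw, h.symm⟩
  · rintro v ⟨hv, hv0⟩ ⟨w, hw, h⟩
    obtain ⟨u, hu, h'⟩ := inj v hv hv0 w hw h.symm
    exact ⟨u, hu, h'.symm⟩
  · rintro w ⟨hw, hw0⟩
    obtain ⟨v, hv, hv0, u, hu, h⟩ := surj w hw hw0
    exact ⟨v, ⟨hv, hv0⟩, u, hu, by rw [h]; abel⟩

end Cx

end LinAlg

section Morse
variable {k : Type*} [Field k] {X Y : Type*}

/-- An acyclic matching on `Y` pairing each `x ∈ Lo` with `up x ∈ Y \ Lo`; acyclicity is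
witnessed by the level function `lev`. -/
structure Matching (D : (X →₀ k) →ₗ[k] (X →₀ k)) (deg : X → ℕ) (Y Lo : Set X) (up : X → X)
    {ι : Type*} [LT ι] (lev : X → ι) : Prop where
  lo_sub : Lo ⊆ Y
  up_mem : ∀ x ∈ Lo, up x ∈ Y ∧ up x ∉ Lo ∧ deg (up x) = deg x + 1
  surj : ∀ y ∈ Y, y ∉ Lo → ∃ x ∈ Lo, up x = y
  coeff : ∀ x ∈ Lo, D (Finsupp.single (up x) 1) x ≠ 0
  lt : ∀ x ∈ Lo, ∀ y ∈ Lo, y ≠ x → D (Finsupp.single (up x) 1) y ≠ 0 → lev y < lev x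

theorem Finsupp_sum_single_smul (v : X →₀ k) :
    v = ∑ x ∈ v.support, v x • Finsupp.single x (1 : k) := by
  conv_lhs => rw [← Finsupp.sum_single v]
  simp [Finsupp.sum]

namespace Matching
variable {D : (X →₀ k) →ₗ[k] (X →₀ k)} {deg : X → ℕ} {C Y Lo : Set X} {up : X → X}
  {ι : Type*} [Preorder ι] [WellFoundedLT ι] {lev : X → ι}

/-- Every chain is, modulo boundaries of chains in `Y`, supported off the lower cells. -/
theorem exists_bdry (hM : Matching D deg Y Lo up lev) (hC : Cx D C deg) (hYC : Y ⊆ C)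
    {n : ℕ} {v : X →₀ k} (hv : v ∈ Fam k C deg n) :
    ∃ b ∈ Fam k Y deg (n + 1), ∀ x ∈ Lo, (v - D b) x = 0 := by
  let N : Submodule k (X →₀ k) := Finsupp.supported k k Loᶜ
  let W : Submodule k (X →₀ k) := (Fam k Y deg (n + 1)).map D ⊔ N
  have hN : ∀ x, x ∉ Lo → Finsupp.single x (1 : k) ∈ N := fun x hx =>
    Finsupp.single_mem_supported k _ hx
  have key : ∀ i : ι, ∀ x ∈ C, deg x = n → lev x = i → Finsupp.single x (1 : k) ∈ W := by
    intro i
    induction i using WellFoundedLT.induction with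
    | ind i ih =>
    intro x hx hn hi
    by_cases hL : x ∈ Lo
    · have hup := hM.up_mem x hL
      have hmem : D (Finsupp.single (up x) 1) ∈ W := by
        refine Submodule.mem_sup_left ⟨_, ?_, rfl⟩
        have := single_mem_Fam (k := k) (deg := deg) hup.1 1
        rwa [hup.2.2, hn] at this
      have hsum := Finsupp_sum_single_smul (D (Finsupp.single (up x) (1 : k)))
      have hc := hM.coeff x hL
      rw [← Finset.add_sum_erase _ _ (Finsupp.mem_support_iff.2 hc)] at hsum
      have hrest : ∑ y ∈ (D (Finsupp.single (up x) (1 : k))).support.erase x,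
          D (Finsupp.single (up x) (1 : k)) y • Finsupp.single y (1 : k) ∈ W := by
        refine Submodule.sum_mem _ fun y hy => Submodule.smul_mem _ _ ?_
        rw [Finset.mem_erase, Finsupp.mem_support_iff] at hy
        by_cases hyL : y ∈ Lo
        · have hf := hC.face _ (hYC hup.1) y hy.2
          exact ih (lev y) (hi ▸ hM.lt x hL y hyL hy.1 hy.2) y hf.1 (by omega) rfl
        · exact Submodule.mem_sup_right (hN y hyL)
      have h3 : D (Finsupp.single (up x) (1 : k)) x • Finsupp.single x (1 : k) ∈ W := by
        rw [eq_comm, ← eq_sub_iff_add_eq] at hsum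
        rw [hsum]
        exact Submodule.sub_mem _ hmem hrest
      rwa [Submodule.smul_mem_iff _ hc] at h3
    · exact Submodule.mem_sup_right (hN x hL)
  have hvW : v ∈ W := (Fam_le_iff (W := W)).2 (fun x hx hn => key _ x hx hn rfl) hv
  obtain ⟨_, ⟨b, hb, rfl⟩, w, hw, hbw⟩ := Submodule.mem_sup.1 hvW
  refine ⟨b, hb, fun x hx => ?_⟩
  rw [← hbw, add_sub_cancel_left]
  by_contra h
  exact (Finsupp.mem_supported k _).1 hw (Finsupp.mem_support_iff.2 h) hx

/-- A chain off the lower cells with boundary off the lower cells is supported off `Y`. -/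
theorem support_off (hM : Matching D deg Y Lo up lev)
    (hZ : ∀ z ∈ C, z ∉ Y → ∀ x ∈ Lo, D (Finsupp.single z 1) x = 0)
    {v : X →₀ k} (hvC : ∀ x, v x ≠ 0 → x ∈ C) (hv : ∀ x ∈ Lo, v x = 0)
    (hDv : ∀ x ∈ Lo, D v x = 0) : ∀ x, v x ≠ 0 → x ∉ Y := by
  by_contra hcon
  push Not at hcon
  obtain ⟨y0, hy0, hy0Y⟩ := hcon
  choose g hg using fun y (hy : y ∈ Y ∧ y ∉ Lo) => hM.surj y hy.1 hy.2
  let T : Finset X := v.support.filter (· ∈ Y)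
  have hT : ∀ y ∈ T, y ∈ Y ∧ y ∉ Lo := fun y hy => by
    rw [Finset.mem_filter, Finsupp.mem_support_iff] at hy
    exact ⟨hy.2, fun h => hy.1 (hv y h)⟩
  have hTne : T.Nonempty := ⟨y0, by simp [T, hy0, hy0Y]⟩
  let g' : X → X := fun y => if h : y ∈ Y ∧ y ∉ Lo then g y h else y
  have hg' : ∀ y ∈ T, g' y ∈ Lo ∧ up (g' y) = y := fun y hy => by
    simp only [g', dif_pos (hT y hy)]
    exact hg y (hT y hy)
  obtain ⟨y, hyT, hmax⟩ := Finset.exists_maximalFor (fun y => lev (g' y)) T hTne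
  have hL := (hg' y hyT).1
  have h0 := hDv _ hL
  rw [Finsupp_sum_single_smul v, map_sum, Finsupp.finsetSum_apply,
    Finset.sum_eq_single y] at h0
  · rw [map_smul, Finsupp.smul_apply, smul_eq_mul, mul_eq_zero] at h0
    rcases h0 with h0 | h0
    · rw [Finset.mem_filter, Finsupp.mem_support_iff] at hyT
      exact hyT.1 h0
    · have := hM.coeff _ hL
      rw [(hg' y hyT).2] at this
      exact this h0
  · intro w hw hwy
    rw [map_smul, Finsupp.smul_apply]
    by_cases hwY : w ∈ Y
    · have hwT : w ∈ T := Finset.mem_filter.2 ⟨hw, hwY⟩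
      by_contra hne
      have hne' : D (Finsupp.single w (1 : k)) (g' y) ≠ 0 := fun h => hne (by rw [h, smul_zero])
      rw [← (hg' w hwT).2] at hne'
      have hneq : g' y ≠ g' w := fun h => hwy (by rw [← (hg' w hwT).2, ← h, (hg' y hyT).2])
      have hlt := hM.lt _ (hg' w hwT).1 _ hL hneq hne'
      exact absurd (hmax hwT hlt.le) (not_le_of_gt hlt)
    · rw [hZ w (hvC w (Finsupp.mem_support_iff.1 hw)) hwY _ hL, smul_zero]
  · intro h
    exact absurd (Finset.mem_filter.1 hyT).1 h

/-- A complex with an acyclic matching off a subcomplex `Z` has the homology of `Z`. -/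
theorem hh_sub (hC : Cx D C deg) {Z : Set X} (hZC : Z ⊆ C) (hZ : Closed D Z)
    (hM : Matching D deg (C \ Z) Lo up lev) (n : ℕ) :
    hh D (Fam k C deg) n = hh D (Fam k Z deg) n := by
  have hZ0 : ∀ z ∈ C, z ∉ C \ Z → ∀ x ∈ Lo, D (Finsupp.single z 1) x = 0 := by
    intro z hz hzY x hx
    by_contra h
    have hzZ : z ∈ Z := by by_contra h'; exact hzY ⟨hz, h'⟩
    exact (hM.lo_sub hx).2 (hZ z hzZ x h)
  have hoff : ∀ {m : ℕ} {v : X →₀ k}, v ∈ Fam k C deg m → (∀ x ∈ Lo, v x = 0) →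
      (∀ x ∈ Lo, D v x = 0) → v ∈ Fam k Z deg m := by
    intro m v hv h1 h2
    have := hM.support_off hZ0 (fun x hx => (mem_Fam.1 hv x hx).1) h1 h2
    refine mem_Fam.2 fun x hx => ⟨?_, (mem_Fam.1 hv x hx).2⟩
    by_contra h'
    exact this x hx ⟨(mem_Fam.1 hv x hx).1, h'⟩
  have hzero : ∀ {m : ℕ} {v : X →₀ k}, v ∈ Fam k Z deg m → ∀ x ∈ Lo, v x = 0 := by
    intro m v hv x hx
    by_contra h
    exact (hM.lo_sub hx).2 (mem_Fam.1 hv x h).1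
  have hZx := hC.sub hZC hZ
  symm
  refine hZx.hh_eq_of_map hC LinearMap.id ?_ ?_ ?_ ?_
  · exact fun v hv h => ⟨Fam_mono hZC _ _ hv, h⟩
  · exact fun v hv => ⟨v, Fam_mono hZC _ _ hv, rfl⟩
  · intro v hv hv0 w hw hvw
    obtain ⟨b, hb, hb0⟩ := hM.exists_bdry hC Set.sdiff_subset hw
    have hbC := Fam_mono Set.sdiff_subset _ _ hb
    have hDD : D (w - D b) = v := by rw [map_sub, hC.map_map hbC, sub_zero]; exact hvw.symm
    refine ⟨w - D b, hoff (Submodule.sub_mem _ hw (hC.map_mem hbC)) hb0 ?_, hDD.symm⟩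
    rw [hDD]
    exact hzero hv
  · intro w hw hw0
    obtain ⟨b, hb, hb0⟩ := hM.exists_bdry hC Set.sdiff_subset hw
    have hbC := Fam_mono Set.sdiff_subset _ _ hb
    have hDD : D (w - D b) = 0 := by rw [map_sub, hC.map_map hbC, sub_zero, hw0]
    exact ⟨w - D b, hoff (Submodule.sub_mem _ hw (hC.map_mem hbC)) hb0 (by simp [hDD]), hDD,
      b, hbC, by simp⟩

/-- A complex with a perfect acyclic matching is acyclic. -/
theorem acyclic (hC : Cx D Y deg) (hM : Matching D deg Y Lo up lev) {n : ℕ} {v : X →₀ k}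
    (hv : v ∈ Fam k Y deg n) (h0 : D v = 0) : ∃ b ∈ Fam k Y deg (n + 1), v = D b := by
  obtain ⟨b, hb, hb0⟩ := hM.exists_bdry hC subset_rfl hv
  refine ⟨b, hb, ?_⟩
  have hDD : D (v - D b) = 0 := by rw [map_sub, hC.map_map hb, sub_zero, h0]
  have hmem : v - D b ∈ Fam k Y deg n := Submodule.sub_mem _ hv (hC.map_mem hb)
  have := hM.support_off (C := Y) (fun z hz hz' => absurd hz hz')
    (fun x hx => (mem_Fam.1 hmem x hx).1) hb0 (by simp [hDD])
  rw [← sub_eq_zero]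
  ext x
  by_contra h
  exact this x h (mem_Fam.1 hmem x h).1

/-- A complex with an acyclic matching on a subcomplex has the homology of the quotient. -/
theorem hh_quot (hC : Cx D C deg) {Z : Set X} (hZC : Z ⊆ C) (hY : Closed D (C \ Z))
    (hM : Matching D deg (C \ Z) Lo up lev) (n : ℕ) :
    hh D (Fam k C deg) n = hh (tr D Z) (Fam k Z deg) n := by
  have hYx : Cx D (C \ Z) deg := hC.sub Set.sdiff_subset hY
  have hQ := hC.quot hZC hY
  have hprojmem : ∀ {m : ℕ} {v : X →₀ k}, v ∈ Fam k C deg m → proj k Z v ∈ Fam k Z deg m := by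
    intro m v hv
    refine mem_Fam.2 fun x hx => ?_
    rw [proj_apply] at hx
    split_ifs at hx with h
    · exact ⟨h, (mem_Fam.1 hv x hx).2⟩
    · exact absurd rfl hx
  have hprojZ : ∀ {m : ℕ} {v : X →₀ k}, v ∈ Fam k Z deg m → proj k Z v = v := fun hv =>
    proj_eq_self fun x hx => (mem_Fam.1 hv x hx).1
  have hker : ∀ {m : ℕ} {v : X →₀ k}, v ∈ Fam k C deg m → proj k Z v = 0 →
      v ∈ Fam k (C \ Z) deg m := by
    intro m v hv h0
    refine mem_Fam.2 fun x hx => ⟨⟨(mem_Fam.1 hv x hx).1, fun hxZ => hx ?_⟩, (mem_Fam.1 hv x hx).2⟩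
    have := DFunLike.congr_fun h0 x
    rwa [proj_apply, if_pos hxZ] at this
  refine hC.hh_eq_of_map hQ (proj k Z) ?_ ?_ ?_ ?_
  · exact fun v hv h => ⟨hprojmem hv, by rw [Cx.tr_proj hY hv, h, LinearMap.map_zero]⟩
  · exact fun v hv => ⟨proj k Z v, hprojmem hv, (Cx.tr_proj hY hv).symm⟩
  · intro v hv hv0 w hw hvw
    have hwC := Fam_mono hZC _ _ hw
    obtain ⟨b, hb, h⟩ := hM.acyclic hYx (v := v - D w)
      (hker (Submodule.sub_mem _ hv (hC.map_mem hwC)) (by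
        rw [map_sub, hvw]; exact sub_self _))
      (by rw [map_sub, hv0, hC.map_map hwC, sub_zero])
    exact ⟨b + w, Submodule.add_mem _ (Fam_mono Set.sdiff_subset _ _ hb) hwC, by
      rw [map_add, ← h]; abel⟩
  · intro w hw hw0
    have hwC := Fam_mono hZC _ _ hw
    have : ∃ b ∈ Fam k (C \ Z) deg n, D w = D b := by
      cases n with
      | zero => exact ⟨0, zero_mem _, by rw [hC.map_zero hwC, LinearMap.map_zero]⟩
      | succ m => exact hM.acyclic hYx (hker (hC.map_mem hwC) hw0) (hC.map_map hwC)
    obtain ⟨b, hb, h⟩ := this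
    have hbC := Fam_mono Set.sdiff_subset _ _ hb
    refine ⟨w - b, Submodule.sub_mem _ hwC hbC, by rw [map_sub, h, sub_self], 0, zero_mem _, ?_⟩
    have hb0 : proj k Z b = 0 := by
      ext x
      rw [proj_apply]
      split_ifs with hx
      · by_contra h'
        exact (mem_Fam.1 hb x h').1.2 hx
      · rfl
    rw [map_sub, hb0, hprojZ hw]
    simp

/-- The connecting isomorphism: in an acyclic complex, the homology of a subcomplex is the
shifted homology of the quotient. -/
theorem hh_shift (hC : Cx D C deg) (hM : Matching D deg C Lo up lev) {Z : Set X} (hZC : Z ⊆ C)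
    (hZ : Closed D Z) (n : ℕ) :
    hh (tr D (C \ Z)) (Fam k (C \ Z) deg) (n + 1) = hh D (Fam k Z deg) n := by
  have hZ' : C \ (C \ Z) = Z := by rw [Set.sdiff_sdiff_cancel_left hZC]
  have hQ : Cx (tr D (C \ Z)) (C \ Z) deg := hC.quot Set.sdiff_subset (by rw [hZ']; exact hZ)
  have hZx := hC.sub hZC hZ
  have hmemZ : ∀ {m : ℕ} {v : X →₀ k}, v ∈ Fam k C deg m → proj k (C \ Z) v = 0 →
      v ∈ Fam k Z deg m := by
    intro m v hv h0
    refine mem_Fam.2 fun x hx => ⟨?_, (mem_Fam.1 hv x hx).2⟩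
    by_contra hxZ
    have := DFunLike.congr_fun h0 x
    rw [proj_apply, if_pos ⟨(mem_Fam.1 hv x hx).1, hxZ⟩] at this
    exact hx this
  have hprojmem : ∀ {m : ℕ} {v : X →₀ k}, v ∈ Fam k C deg m →
      proj k (C \ Z) v ∈ Fam k (C \ Z) deg m ∧ v - proj k (C \ Z) v ∈ Fam k Z deg m := by
    intro m v hv
    have h1 : proj k (C \ Z) v ∈ Fam k (C \ Z) deg m := by
      refine mem_Fam.2 fun x hx => ?_
      rw [proj_apply] at hx
      split_ifs at hx with h
      · exact ⟨h, (mem_Fam.1 hv x hx).2⟩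
      · exact absurd rfl hx
    refine ⟨h1, hmemZ (Submodule.sub_mem _ hv (Fam_mono Set.sdiff_subset _ _ h1)) ?_⟩
    rw [map_sub, proj_eq_self (v := proj k (C \ Z) v) fun x hx => (mem_Fam.1 h1 x hx).1, sub_self]
  have hmC : ∀ {m : ℕ} {v : X →₀ k}, v ∈ Fam k (C \ Z) deg m → v ∈ Fam k C deg m :=
    fun hv => Fam_mono Set.sdiff_subset _ _ hv
  refine hQ.hh_eq_of_map hZx D ?_ ?_ ?_ ?_
  · exact fun v hv h => ⟨hmemZ (hC.map_mem (hmC hv)) h, hC.map_map (hmC hv)⟩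
  · intro v hv
    have hDv := hC.map_mem (hmC hv)
    refine ⟨-(D v - proj k (C \ Z) (D v)), Submodule.neg_mem _ (hprojmem hDv).2, ?_⟩
    rw [map_neg, map_sub, hC.map_map (hmC hv)]
    simp [tr]
  · intro v hv _ w hw hvw
    obtain ⟨b, hb, h⟩ := hM.acyclic hC (v := v - w)
      (Submodule.sub_mem _ (hmC hv) (Fam_mono hZC _ _ hw)) (by rw [map_sub, hvw, sub_self])
    have hpm := hprojmem hb
    refine ⟨proj k (C \ Z) b, hpm.1, ?_⟩
    have hcl : Closed D (C \ (C \ Z)) := by rw [hZ']; exact hZ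
    have := Cx.tr_proj hcl hb
    rw [this, ← h, map_sub]
    have e1 : proj k (C \ Z) v = v := proj_eq_self fun x hx => (mem_Fam.1 hv x hx).1
    have e2 : proj k (C \ Z) w = 0 := by
      ext x
      rw [proj_apply]
      split_ifs with hx
      · by_contra h'
        exact hx.2 (mem_Fam.1 hw x h').1
      · rfl
    rw [e1, e2, sub_zero]
  · intro w hw hw0
    obtain ⟨b, hb, h⟩ := hM.acyclic hC (Fam_mono hZC _ _ hw) hw0
    have hpm := hprojmem hb
    have hD : D (b - proj k (C \ Z) b) ∈ Fam k Z deg n := hZx.map_mem hpm.2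
    refine ⟨proj k (C \ Z) b, hpm.1, ?_, b - proj k (C \ Z) b, hpm.2, by rw [h, map_sub]; abel⟩
    have hcl : Closed D (C \ (C \ Z)) := by rw [hZ']; exact hZ
    rw [Cx.tr_proj hcl hb, ← h]
    ext x
    rw [proj_apply]
    split_ifs with hx
    · by_contra h'
      exact hx.2 (mem_Fam.1 hw x h').1
    · rfl

end Matching

end Morse

section Tensor
variable {k : Type*} [Field k] {X Y : Type*}

theorem finrank_Fam {C : Set X} {deg : X → ℕ} {n : ℕ} (h : {x | x ∈ C ∧ deg x = n}.Finite) :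
    Module.finrank k (Fam k C deg n) = {x | x ∈ C ∧ deg x = n}.ncard := by
  have := h.fintype
  rw [Fam, LinearEquiv.finrank_eq (Finsupp.supportedEquivFinsupp {x | x ∈ C ∧ deg x = n}),
    Module.finrank_finsupp_self, Set.ncard_eq_toFinset_card', Set.toFinset_card]

theorem hh_zero_map {C : Set X} {deg : X → ℕ} {n : ℕ} (h : {x | x ∈ C ∧ deg x = n}.Finite) :
    hh (0 : (X →₀ k) →ₗ[k] (X →₀ k)) (Fam k C deg) n = {x | x ∈ C ∧ deg x = n}.ncard := by
  rw [hh, LinearMap.ker_zero, inf_top_eq, Submodule.map_zero, finrank_bot, Nat.sub_zero,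
    finrank_Fam h]

/-- Homology only depends on the values of the differential on the complex. -/
theorem hh_congr {D D' : (X →₀ k) →ₗ[k] (X →₀ k)} {C : Set X} {deg : X → ℕ}
    (h : ∀ x ∈ C, D (Finsupp.single x 1) = D' (Finsupp.single x 1)) (n : ℕ) :
    hh D (Fam k C deg) n = hh D' (Fam k C deg) n := by
  have h1 : ∀ m, ∀ v ∈ Fam k C deg m, D v = D' v := fun m v hv =>
    Fam_map_eq (fun x hx _ => h x hx) hv
  have e1 : Fam k C deg n ⊓ LinearMap.ker D = Fam k C deg n ⊓ LinearMap.ker D' := by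
    ext v
    simp only [Submodule.mem_inf, LinearMap.mem_ker]
    exact and_congr_right fun hv => by rw [h1 n v hv]
  have e2 : Submodule.map D (Fam k C deg (n + 1)) = Submodule.map D' (Fam k C deg (n + 1)) := by
    ext v
    simp only [Submodule.mem_map]
    exact exists_congr fun w => and_congr_right fun hw => by rw [h1 _ w hw]
  rw [hh, hh, e1, e2]

/-- A relabelling of the basis, up to nonzero scalars, commuting with the differentials up to
a scalar and shifting degrees, preserves homology. -/
theorem hh_relabel {D : (X →₀ k) →ₗ[k] (X →₀ k)} {D' : (Y →₀ k) →ₗ[k] (Y →₀ k)}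
    {C : Set X} {C' : Set Y} {deg : X → ℕ} {deg' : Y → ℕ}
    (hC : Cx D C deg) (hC' : Cx D' C' deg') (φ : X → Y) (u : X → k) (s : ℕ) (ε : k) (hε : ε ≠ 0)
    (hφ : Set.BijOn φ C C') (hu : ∀ x ∈ C, u x ≠ 0) (hdeg : ∀ x ∈ C, deg' (φ x) = deg x + s)
    (f : (X →₀ k) →ₗ[k] (Y →₀ k))
    (hf : ∀ x ∈ C, f (Finsupp.single x 1) = u x • Finsupp.single (φ x) 1)
    (hcomm : ∀ x ∈ C, D' (f (Finsupp.single x 1)) = ε • f (D (Finsupp.single x 1))) (n : ℕ) :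
    hh D (Fam k C deg) n = hh D' (Fam k C' deg') (n + s) := by
  let gfun : Y → (X →₀ k) := fun y => if h : y ∈ C' then
    (u (hφ.surjOn h).choose)⁻¹ • Finsupp.single (hφ.surjOn h).choose 1 else 0
  let g : (Y →₀ k) →ₗ[k] (X →₀ k) := Finsupp.linearCombination k gfun
  have hg : ∀ x ∈ C, g (Finsupp.single (φ x) 1) = (u x)⁻¹ • Finsupp.single x 1 := by
    intro x hx
    have hy : φ x ∈ C' := hφ.mapsTo hx
    have hch := (hφ.surjOn hy).choose_spec
    have : (hφ.surjOn hy).choose = x := hφ.injOn hch.1 hx hch.2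
    simp only [g, Finsupp.linearCombination_single, one_smul, gfun, dif_pos hy, this]
  have hgf : ∀ m, ∀ v ∈ Fam k C deg m, g (f v) = v := fun m v hv =>
    Fam_map_eq (f := g ∘ₗ f) (g := LinearMap.id) (fun x hx _ => by
      rw [LinearMap.comp_apply, hf x hx, map_smul, hg x hx, smul_smul, mul_inv_cancel₀ (hu x hx),
        one_smul]; rfl) hv
  have hfg : ∀ m, ∀ w ∈ Fam k C' deg' m, f (g w) = w := fun m w hw =>
    Fam_map_eq (f := f ∘ₗ g) (g := LinearMap.id) (fun y hy _ => by
      obtain ⟨x, hx, rfl⟩ := hφ.surjOn hy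
      rw [LinearMap.comp_apply, hg x hx, map_smul, hf x hx, smul_smul, inv_mul_cancel₀ (hu x hx),
        one_smul]; rfl) hw
  have hfm : ∀ m, ∀ v ∈ Fam k C deg m, f v ∈ Fam k C' deg' (m + s) := fun m v hv =>
    Fam_map_mem (fun x hx hn => by
      rw [hf x hx]
      have := single_mem_Fam (k := k) (deg := deg') (hφ.mapsTo hx) 1
      rw [hdeg x hx, hn] at this
      exact Submodule.smul_mem _ _ this) hv
  have hgm : ∀ m, ∀ w ∈ Fam k C' deg' (m + s), g w ∈ Fam k C deg m := fun m w hw =>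
    Fam_map_mem (fun y hy hn => by
      obtain ⟨x, hx, rfl⟩ := hφ.surjOn hy
      rw [hg x hx]
      have := single_mem_Fam (k := k) (deg := deg) hx 1
      rw [hdeg x hx] at hn
      rw [show deg x = m by omega] at this
      exact Submodule.smul_mem _ _ this) hw
  have hcm : ∀ m, ∀ v ∈ Fam k C deg m, D' (f v) = ε • f (D v) := fun m v hv =>
    Fam_map_eq (f := D' ∘ₗ f) (g := ε • (f ∘ₗ D)) (fun x hx _ => hcomm x hx) hv
  refine hC.hh_eq_of_map hC' f ?_ ?_ ?_ ?_
  · exact fun v hv h0 => ⟨hfm n v hv, by rw [hcm n v hv, h0, map_zero, smul_zero]⟩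
  · refine fun v hv => ⟨ε⁻¹ • f v, Submodule.smul_mem _ _ ?_, ?_⟩
    · have := hfm _ v hv
      rwa [add_right_comm] at this
    · rw [map_smul, hcm _ v hv, smul_smul, inv_mul_cancel₀ hε, one_smul]
  · intro v hv hv0 w hw h
    have hw' : w ∈ Fam k C' deg' ((n + 1) + s) := by rwa [add_right_comm]
    have hgw := hgm _ w hw'
    refine ⟨ε • g w, Submodule.smul_mem _ _ hgw, ?_⟩
    have h2 := hcm _ _ hgw
    rw [hfg _ w hw', ← h] at h2
    have := congrArg g h2
    rw [map_smul, hgf n v hv, hgf n _ (hC.map_mem hgw)] at this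
    rw [map_smul]
    exact this
  · intro w hw hw0
    have hgw := hgm n w hw
    refine ⟨g w, hgw, ?_, 0, zero_mem _, by rw [hfg _ w hw]; simp⟩
    have h2 := hcm _ _ hgw
    rw [hfg _ w hw, hw0, eq_comm, smul_eq_zero_iff_right hε] at h2
    have := congrArg g h2
    cases n with
    | zero => exact hC.map_zero hgw
    | succ n => rwa [hgf n _ (hC.map_mem hgw), map_zero] at this

/-- Homology is additive over disjoint closed pieces. -/
theorem hh_union {D : (X →₀ k) →ₗ[k] (X →₀ k)} {A B : Set X} {deg : X → ℕ}
    (hAB : Disjoint A B) (hA : Cx D A deg) (hB : Cx D B deg) (n : ℕ) :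
    hh D (Fam k (A ∪ B) deg) n = hh D (Fam k A deg) n + hh D (Fam k B deg) n := by
  have hsup : ∀ m, Fam k (A ∪ B) deg m = Fam k A deg m ⊔ Fam k B deg m := by
    intro m
    rw [Fam, Fam, Fam, ← Finsupp.supported_union]
    congr 1
    ext x
    simp only [Set.mem_ofPred_eq, Set.mem_union]
    tauto
  have hdis : ∀ m, Disjoint (Fam k A deg m) (Fam k B deg m) := by
    intro m
    rw [Submodule.disjoint_def]
    intro v hv hv'
    ext x
    by_contra h
    exact Set.disjoint_left.1 hAB (mem_Fam.1 hv x h).1 (mem_Fam.1 hv' x h).1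
  have hfin : ∀ (U W : Submodule k (X →₀ k)) [FiniteDimensional k U] [FiniteDimensional k W],
      Disjoint U W → Module.finrank k ↥(U ⊔ W) = Module.finrank k U + Module.finrank k W := by
    intro U W _ _ h
    have := Submodule.finrank_sup_add_finrank_inf_eq U W
    rw [disjoint_iff.1 h, finrank_bot] at this
    omega
  have := hA.finDim
  have := hB.finDim
  have hker : Fam k (A ∪ B) deg n ⊓ LinearMap.ker D =
      (Fam k A deg n ⊓ LinearMap.ker D) ⊔ (Fam k B deg n ⊓ LinearMap.ker D) := by
    apply le_antisymm
    · rintro v ⟨hv, hv0⟩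
      rw [hsup] at hv
      obtain ⟨a, ha, b, hb, rfl⟩ := Submodule.mem_sup.1 hv
      have h0 : D a + D b = 0 := by rw [← map_add]; exact hv0
      have h1 : D a ∈ Fam k B deg (n - 1) := by
        rw [eq_neg_of_add_eq_zero_left h0]
        exact Submodule.neg_mem _ (hB.map_mem' hb)
      have h2 : D a = 0 := Submodule.disjoint_def.1 (hdis _) _ (hA.map_mem' ha) h1
      rw [h2, zero_add] at h0
      exact Submodule.add_mem_sup ⟨ha, h2⟩ ⟨hb, h0⟩
    · rw [hsup]
      exact sup_le (inf_le_inf_right _ le_sup_left) (inf_le_inf_right _ le_sup_right)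
  have hdB : Disjoint (Submodule.map D (Fam k A deg (n + 1)))
      (Submodule.map D (Fam k B deg (n + 1))) :=
    (hdis n).mono ((hA.bdry_le n).trans inf_le_left) ((hB.bdry_le n).trans inf_le_left)
  have hle1 := Submodule.finrank_mono (hA.bdry_le n)
  have hle2 := Submodule.finrank_mono (hB.bdry_le n)
  rw [hh, hh, hh, hker, hsup, Submodule.map_sup, hfin _ _ hdB,
    hfin _ _ ((hdis n).mono inf_le_left inf_le_left)]
  omega

/-- The bilinear map `(X →₀ k) × (Y →₀ k) → (X × Y →₀ k)`. -/
def box (k : Type*) [Field k] (X Y : Type*) :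
    (X →₀ k) →ₗ[k] (Y →₀ k) →ₗ[k] (X × Y →₀ k) :=
  Finsupp.linearCombination k (fun x => Finsupp.lmapDomain k k (Prod.mk x))

theorem box_single (x : X) (y : Y) :
    box k X Y (Finsupp.single x 1) (Finsupp.single y 1) = Finsupp.single (x, y) 1 := by
  simp [box]

theorem box_apply (v : X →₀ k) (w : Y →₀ k) (x : X) (y : Y) :
    box k X Y v w (x, y) = v x * w y := by
  induction v using Finsupp.induction_linear with
  | zero => simp
  | add f g hf hg => simp [hf, hg, add_mul]
  | single a b =>
    simp only [box, Finsupp.linearCombination_single, LinearMap.smul_apply,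
      Finsupp.lmapDomain_apply, Finsupp.smul_apply, smul_eq_mul]
    by_cases h : a = x
    · subst h
      rw [Finsupp.mapDomain_apply (Prod.mk_right_injective a)]
      simp
    · rw [Finsupp.mapDomain_of_notMem_range _ _ (by simp [h])]
      simp [h]

/-- Extensionality of linear maps of the form `box v w ↦ _`, for homogeneous `v` and `w`. -/
theorem Fam_bilin_eq {W : Type*} [AddCommGroup W] [Module k W] {C : Set X} {C' : Set Y}
    {deg : X → ℕ} {deg' : Y → ℕ} {n m : ℕ} (f g : (X →₀ k) →ₗ[k] (Y →₀ k) →ₗ[k] W)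
    (h : ∀ x ∈ C, deg x = n → ∀ y ∈ C', deg' y = m →
      f (Finsupp.single x 1) (Finsupp.single y 1) = g (Finsupp.single x 1) (Finsupp.single y 1))
    {v : X →₀ k} (hv : v ∈ Fam k C deg n) {w : Y →₀ k} (hw : w ∈ Fam k C' deg' m) :
    f v w = g v w :=
  Fam_map_eq (fun y hy hym => Fam_map_eq (f := f.flip (Finsupp.single y 1))
    (g := g.flip (Finsupp.single y 1)) (fun x hx hxn => h x hx hxn y hy hym) hv) hw

/-- The operator `x ⊗ y ↦ A x ⊗ y + (-1)^{deg x} B x ⊗ E y`. -/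
def tens (deg : X → ℕ) {X' Y' : Type*} (A : (X →₀ k) →ₗ[k] (X' →₀ k))
    (A' : (Y →₀ k) →ₗ[k] (Y' →₀ k))
    (B : (X →₀ k) →ₗ[k] (X' →₀ k)) (E : (Y →₀ k) →ₗ[k] (Y' →₀ k)) :
    (X × Y →₀ k) →ₗ[k] (X' × Y' →₀ k) :=
  Finsupp.linearCombination k fun p =>
    box k X' Y' (A (Finsupp.single p.1 1)) (A' (Finsupp.single p.2 1)) +
      (-1 : k) ^ deg p.1 • box k X' Y' (B (Finsupp.single p.1 1)) (E (Finsupp.single p.2 1))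

theorem tens_box {deg : X → ℕ} {X' Y' : Type*} {A : (X →₀ k) →ₗ[k] (X' →₀ k)}
    {A' : (Y →₀ k) →ₗ[k] (Y' →₀ k)}
    {B : (X →₀ k) →ₗ[k] (X' →₀ k)} {E : (Y →₀ k) →ₗ[k] (Y' →₀ k)} {C : Set X} {C' : Set Y}
    {deg' : Y → ℕ} {n m : ℕ} {v : X →₀ k} (hv : v ∈ Fam k C deg n) {w : Y →₀ k}
    (hw : w ∈ Fam k C' deg' m) :
    tens deg A A' B E (box k X Y v w) =
      box k X' Y' (A v) (A' w) + (-1 : k) ^ n • box k X' Y' (B v) (E w) := by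
  refine Fam_bilin_eq ((box k X Y).compr₂ (tens deg A A' B E))
    ((box k X' Y').compl₁₂ A A' + (-1 : k) ^ n • (box k X' Y').compl₁₂ B E) ?_ hv hw
  intro x hx hxn y hy hym
  simp only [LinearMap.compr₂_apply, box_single, tens, Finsupp.linearCombination_single, one_smul,
    LinearMap.add_apply, LinearMap.compl₁₂_apply, LinearMap.smul_apply, hxn]

/-- The differential of the tensor product of two complexes. -/
def tensD (deg : X → ℕ) (D : (X →₀ k) →ₗ[k] (X →₀ k)) (E : (Y →₀ k) →ₗ[k] (Y →₀ k)) :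
    (X × Y →₀ k) →ₗ[k] (X × Y →₀ k) :=
  tens deg D LinearMap.id LinearMap.id E

/-- Degrees in a tensor product. -/
def pdeg (deg : X → ℕ) (deg' : Y → ℕ) (p : X × Y) : ℕ := deg p.1 + deg' p.2

theorem box_mem {C : Set X} {C' : Set Y} {deg : X → ℕ} {deg' : Y → ℕ} {n m : ℕ} {v : X →₀ k}
    (hv : v ∈ Fam k C deg n) {w : Y →₀ k} (hw : w ∈ Fam k C' deg' m) :
    box k X Y v w ∈ Fam k (C ×ˢ C') (pdeg deg deg') (n + m) := by
  refine mem_Fam.2 fun p hp => ?_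
  rw [← Prod.mk.eta (p := p), box_apply] at hp
  have h1 := mem_Fam.1 hv p.1 (left_ne_zero_of_mul hp)
  have h2 := mem_Fam.1 hw p.2 (right_ne_zero_of_mul hp)
  exact ⟨⟨h1.1, h2.1⟩, by rw [pdeg, h1.2, h2.2]⟩

theorem tensD_single (deg : X → ℕ) (D : (X →₀ k) →ₗ[k] (X →₀ k)) (D' : (Y →₀ k) →ₗ[k] (Y →₀ k))
    (x : X) (y : Y) : tensD deg D D' (Finsupp.single (x, y) 1) =
      box k X Y (D (Finsupp.single x 1)) (Finsupp.single y 1) +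
      (-1 : k) ^ deg x • box k X Y (Finsupp.single x 1) (D' (Finsupp.single y 1)) := by
  simp [tensD, tens]

theorem tensD_apply (deg : X → ℕ) (D : (X →₀ k) →ₗ[k] (X →₀ k)) (D' : (Y →₀ k) →ₗ[k] (Y →₀ k))
    (x x' : X) (y y' : Y) : tensD deg D D' (Finsupp.single (x, y) 1) (x', y') =
      (if y = y' then D (Finsupp.single x 1) x' else 0) +
      (if x = x' then (-1 : k) ^ deg x * D' (Finsupp.single y 1) y' else 0) := by
  rw [tensD_single, Finsupp.add_apply, Finsupp.smul_apply, box_apply, box_apply,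
    Finsupp.single_apply, Finsupp.single_apply]
  split_ifs <;> simp

theorem Cx.tens {D : (X →₀ k) →ₗ[k] (X →₀ k)} {D' : (Y →₀ k) →ₗ[k] (Y →₀ k)} {C : Set X}
    {C' : Set Y} {deg : X → ℕ} {deg' : Y → ℕ} (hC : Cx D C deg) (hC' : Cx D' C' deg') :
    Cx (tensD deg D D') (C ×ˢ C') (pdeg deg deg') where
  face := by
    rintro ⟨x, y⟩ ⟨hx, hy⟩ ⟨x', y'⟩ h
    rw [tensD_apply] at h
    by_cases h1 : y = y' ∧ D (Finsupp.single x 1) x' ≠ 0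
    · have := hC.face x hx x' h1.2
      refine ⟨⟨this.1, h1.1 ▸ hy⟩, ?_⟩
      simp only [pdeg, ← h1.1]
      omega
    · by_cases h2 : x = x' ∧ D' (Finsupp.single y 1) y' ≠ 0
      · have := hC'.face y hy y' h2.2
        refine ⟨⟨h2.1 ▸ hx, this.1⟩, ?_⟩
        simp only [pdeg, ← h2.1]
        omega
      · exfalso
        apply h
        have e1 : (if y = y' then D (Finsupp.single x 1) x' else 0) = 0 := by
          split_ifs with hh
          · by_contra h'; exact h1 ⟨hh, h'⟩
          · rfl
        have e2 : (if x = x' then (-1 : k) ^ deg x * D' (Finsupp.single y 1) y' else 0) = 0 := by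
          split_ifs with hh
          · by_contra h'; exact h2 ⟨hh, right_ne_zero_of_mul h'⟩
          · rfl
        rw [e1, e2, add_zero]
  sq := by
    rintro ⟨x, y⟩ ⟨hx, hy⟩
    have hxm := single_mem_Fam (k := k) (deg := deg) hx 1
    have hym := single_mem_Fam (k := k) (deg := deg') hy 1
    rw [tensD_single, map_add, map_smul, tensD, tens_box hxm (hC'.map_mem' hym),
      tens_box (hC.map_mem' hxm) hym]
    simp only [hC.sq x hx, hC'.sq y hy, LinearMap.id_apply, LinearMap.map_zero,
      LinearMap.zero_apply, zero_add, smul_zero, add_zero]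
    rcases Nat.eq_zero_or_pos (deg x) with h0 | h0
    · have : D (Finsupp.single x 1) = 0 := hC.map_zero (h0 ▸ hxm)
      simp [this]
    · rw [← add_smul]
      obtain ⟨m, hm⟩ : ∃ m, deg x = m + 1 := ⟨deg x - 1, by omega⟩
      simp [hm, pow_succ]
  fin n := by
    have : {p : X × Y | p ∈ C ×ˢ C' ∧ pdeg deg deg' p = n} ⊆
        ⋃ i ∈ Finset.range (n + 1), {x | x ∈ C ∧ deg x = i} ×ˢ
          (⋃ j ∈ Finset.range (n + 1), {y | y ∈ C' ∧ deg' y = j}) := by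
      rintro ⟨x, y⟩ ⟨⟨hx, hy⟩, h⟩
      simp only [pdeg] at h
      simp only [Set.mem_iUnion, Set.mem_prod, Finset.mem_range, exists_prop]
      exact ⟨deg x, by omega, ⟨hx, rfl⟩, deg' y, by omega, hy, rfl⟩
    refine Set.Finite.subset ?_ this
    exact Set.Finite.biUnion (Finset.finite_toSet _) fun i _ => (hC.fin i).prod
      (Set.Finite.biUnion (Finset.finite_toSet _) fun j _ => hC'.fin j)

end Tensor

section Kunneth
variable {k : Type*} [Field k] {X Y : Type*}

/-- A homotopy equivalence of the complex on `C` with a based complex with zero differential. -/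
structure Splitting (D : (X →₀ k) →ₗ[k] (X →₀ k)) (C : Set X) (deg : X → ℕ) {I : Type*}
    (degI : I → ℕ) where
  F : (I →₀ k) →ₗ[k] (X →₀ k)
  G : (X →₀ k) →ₗ[k] (I →₀ k)
  S : (X →₀ k) →ₗ[k] (X →₀ k)
  F_mem : ∀ i, F (Finsupp.single i 1) ∈ Fam k C deg (degI i)
  DF : ∀ i, D (F (Finsupp.single i 1)) = 0
  G_mem : ∀ n, ∀ v ∈ Fam k C deg n, G v ∈ Fam k Set.univ degI n
  GD : ∀ n, ∀ v ∈ Fam k C deg n, G (D v) = 0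
  S_mem : ∀ n, ∀ v ∈ Fam k C deg n, S v ∈ Fam k C deg (n + 1)
  GF : ∀ i, G (F (Finsupp.single i 1)) = Finsupp.single i 1
  htpy : ∀ n, ∀ v ∈ Fam k C deg n, v = F (G v) + D (S v) + S (D v)
  fin : ∀ n, {i | degI i = n}.Finite

namespace Splitting
variable {D : (X →₀ k) →ₗ[k] (X →₀ k)} {C : Set X} {deg : X → ℕ} {I : Type*} {degI : I → ℕ}

theorem DF' (s : Splitting D C deg degI) (w : I →₀ k) : D (s.F w) = 0 := by
  have : D ∘ₗ s.F = 0 := by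
    ext1 i
    ext1
    simpa using s.DF i
  exact LinearMap.congr_fun this w

theorem GF' (s : Splitting D C deg degI) (w : I →₀ k) : s.G (s.F w) = w := by
  have : s.G ∘ₗ s.F = LinearMap.id := by
    ext1 i
    ext1
    simpa using s.GF i
  exact LinearMap.congr_fun this w

theorem F_mem' (s : Splitting D C deg degI) {n : ℕ} {w : I →₀ k}
    (hw : w ∈ Fam k Set.univ degI n) : s.F w ∈ Fam k C deg n :=
  Fam_map_mem (fun i _ hi => hi ▸ s.F_mem i) hw

theorem hh_eq (s : Splitting D C deg degI) (hC : Cx D C deg) (n : ℕ) :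
    hh D (Fam k C deg) n = {i | degI i = n}.ncard := by
  have hfin : ∀ n, {i | i ∈ Set.univ ∧ degI i = n}.Finite := by simpa using s.fin
  have h0 : Cx (0 : (I →₀ k) →ₗ[k] (I →₀ k)) Set.univ degI :=
    ⟨fun x _ y h => absurd rfl h, fun x _ => rfl, hfin⟩
  have := hh_zero_map (k := k) (hfin n)
  simp only [Set.mem_univ, true_and] at this
  rw [← this]
  symm
  refine h0.hh_eq_of_map hC s.F ?_ ?_ ?_ ?_
  · exact fun v hv _ => ⟨s.F_mem' hv, s.DF' v⟩
  · exact fun v hv => ⟨0, zero_mem _, by simp⟩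
  · intro v hv _ w hw h
    refine ⟨0, zero_mem _, ?_⟩
    rw [← s.GF' v, h, s.GD _ w hw]
    rfl
  · intro w hw hw0
    refine ⟨s.G w, s.G_mem n w hw, rfl, s.S w, s.S_mem n w hw, ?_⟩
    have := s.htpy n w hw
    rwa [hw0, map_zero, add_zero] at this

end Splitting

theorem exists_retraction {V : Type*} [AddCommGroup V] [Module k V] (H : Submodule k V) :
    ∃ q : V →ₗ[k] H, ∀ v : H, q v = v := by
  obtain ⟨p, hp⟩ := H.subtype.exists_leftInverse_of_injective (Submodule.ker_subtype _)
  exact ⟨p, fun v => LinearMap.congr_fun hp v⟩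

theorem exists_quasi_inverse {V W : Type*} [AddCommGroup V] [Module k V] [AddCommGroup W]
    [Module k W] (f : V →ₗ[k] W) : ∃ g : W →ₗ[k] V, ∀ v, f (g (f v)) = f v := by
  obtain ⟨r, hr⟩ := f.rangeRestrict.exists_rightInverse_of_surjective f.range_rangeRestrict
  obtain ⟨p, hp⟩ := exists_retraction (LinearMap.range f)
  refine ⟨r ∘ₗ p, fun v => ?_⟩
  have h1 : p (f v) = f.rangeRestrict v := hp (f.rangeRestrict v)
  have h2 := LinearMap.congr_fun hr (f.rangeRestrict v)
  rw [LinearMap.comp_apply, h1]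
  exact congrArg Subtype.val h2

theorem exists_quasi_inverse_on {V : Type*} [AddCommGroup V] [Module k V] (D : V →ₗ[k] V)
    (H : Submodule k V) : ∃ T : V →ₗ[k] V, (∀ v, T v ∈ H) ∧ ∀ u ∈ H, D (T (D u)) = D u := by
  obtain ⟨g, hg⟩ := exists_quasi_inverse (D ∘ₗ H.subtype)
  exact ⟨H.subtype ∘ₗ g, fun v => (g v).2, fun u hu => hg ⟨u, hu⟩⟩

theorem nonempty_finBasis {V : Type*} [AddCommGroup V] [Module k V] (H : Submodule k V)
    [FiniteDimensional k H] : Nonempty (Module.Basis (Fin (Module.finrank k H)) k H) :=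
  ⟨Module.finBasis k H⟩

theorem exists_splitting {D : (X →₀ k) →ₗ[k] (X →₀ k)} {C : Set X} {deg : X → ℕ}
    (hC : Cx D C deg) :
    ∃ d : ℕ → ℕ, Nonempty (Splitting D C deg (fun i : Σ n, Fin (d n) => i.1)) := by
  have hT : ∀ n, ∃ T : (X →₀ k) →ₗ[k] (X →₀ k), (∀ v, T v ∈ Fam k C deg (n + 1)) ∧
      ∀ u ∈ Fam k C deg (n + 1), D (T (D u)) = D u := by
    intro n
    exact exists_quasi_inverse_on D _
  choose T hTm hTD using hT
  let κ : ℕ → (X →₀ k) →ₗ[k] (X →₀ k) := fun n => LinearMap.id - T (n - 1) ∘ₗ D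
  let π : ℕ → (X →₀ k) →ₗ[k] (X →₀ k) := fun n => κ n - D ∘ₗ T n ∘ₗ κ n
  let H : ℕ → Submodule k (X →₀ k) := fun n =>
    Fam k C deg n ⊓ LinearMap.ker D ⊓ LinearMap.ker (D ∘ₗ T n)
  have hTprev : ∀ n, ∀ v ∈ Fam k C deg n, T (n - 1) (D v) ∈ Fam k C deg n ∧
      D (T (n - 1) (D v)) = D v := by
    intro n v hv
    cases n with
    | zero => rw [hC.map_zero hv, LinearMap.map_zero, LinearMap.map_zero]; exact ⟨zero_mem _, rfl⟩
    | succ n => exact ⟨hTm n _, hTD n v hv⟩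
  have hκ : ∀ n, ∀ v ∈ Fam k C deg n, κ n v ∈ Fam k C deg n ∧ D (κ n v) = 0 := by
    intro n v hv
    simp only [κ, LinearMap.sub_apply, LinearMap.id_apply, LinearMap.comp_apply, map_sub,
      (hTprev n v hv).2, sub_self, and_true]
    exact Submodule.sub_mem _ hv (hTprev n v hv).1
  have hπ : ∀ n, ∀ v ∈ Fam k C deg n, π n v ∈ H n := by
    intro n v hv
    have h2 := hTm n (κ n v)
    refine ⟨⟨Submodule.sub_mem _ (hκ n v hv).1 (hC.map_mem h2), ?_⟩, ?_⟩
    · change D (π n v) = 0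
      simp only [π, LinearMap.sub_apply, LinearMap.comp_apply, map_sub,
        (hκ n v hv).2, hC.map_map h2, sub_self]
    · change D (T n (π n v)) = 0
      simp only [π, LinearMap.sub_apply, LinearMap.comp_apply, map_sub,
        hTD n _ h2, sub_self]
  have hπH : ∀ n, ∀ v ∈ H n, π n v = v := by
    rintro n v ⟨⟨hv, hv0⟩, hvT⟩
    change D v = 0 at hv0
    change D (T n v) = 0 at hvT
    have h1 : κ n v = v := by simp [κ, hv0]
    simp only [π, LinearMap.sub_apply, LinearMap.comp_apply, h1]
    rw [hvT, sub_zero]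
  have hq : ∀ n, ∃ q : (X →₀ k) →ₗ[k] ↥(H n), ∀ v : H n, q v = v := fun n =>
    exists_retraction (H n)
  choose q hqH using hq
  have hfd : ∀ n, FiniteDimensional k (H n) := fun n => by
    have := hC.finDim n
    exact Submodule.finiteDimensional_of_le (inf_le_left.trans inf_le_left : H n ≤ Fam k C deg n)
  have hb : ∀ n, Nonempty (Module.Basis (Fin (Module.finrank k (H n))) k (H n)) := fun n =>
    have := hfd n
    nonempty_finBasis (H n)
  let b := fun n => (hb n).some
  let I := Σ n, Fin (Module.finrank k (H n))
  let c : ∀ n, (X →₀ k) →ₗ[k] (I →₀ k) := fun n =>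
    Finsupp.lmapDomain k k (Sigma.mk n) ∘ₗ (b n).repr.toLinearMap ∘ₗ q n ∘ₗ π n
  let F : (I →₀ k) →ₗ[k] (X →₀ k) := Finsupp.linearCombination k fun i => (b i.1 i.2 : X →₀ k)
  let G : (X →₀ k) →ₗ[k] (I →₀ k) :=
    Finsupp.linearCombination k fun x => c (deg x) (Finsupp.single x 1)
  let S : (X →₀ k) →ₗ[k] (X →₀ k) :=
    Finsupp.linearCombination k fun x => T (deg x) (κ (deg x) (Finsupp.single x 1))
  have hG : ∀ n, ∀ v ∈ Fam k C deg n, G v = c n v := fun n v hv =>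
    Fam_map_eq (fun x _ hx => by simp [G, hx]) hv
  have hS : ∀ n, ∀ v ∈ Fam k C deg n, S v = T n (κ n v) := fun n v hv =>
    Fam_map_eq (g := T n ∘ₗ κ n) (fun x _ hx => by simp [S, hx]) hv
  have hFc : ∀ n (w : H n), F (Finsupp.lmapDomain k k (Sigma.mk n) ((b n).repr w)) = w := by
    intro n w
    simp only [F, Finsupp.lmapDomain_apply, Finsupp.linearCombination_mapDomain]
    have h := congrArg (H n).subtype ((b n).linearCombination_repr w)
    rw [Finsupp.linearCombination_apply, Finsupp.sum, map_sum] at h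
    rw [Finsupp.linearCombination_apply, Finsupp.sum]
    simpa using h
  have hFG : ∀ n, ∀ v ∈ Fam k C deg n, F (G v) = π n v := by
    intro n v hv
    rw [hG n v hv]
    have := hqH n ⟨π n v, hπ n v hv⟩
    simp only [c, LinearMap.comp_apply] at *
    erw [hFc, this]
  have hFs : ∀ i : I, F (Finsupp.single i 1) = (b i.1 i.2 : X →₀ k) := by simp [F]
  have hFm : ∀ i : I, F (Finsupp.single i 1) ∈ H i.1 := fun i => by
    rw [hFs]; exact (b i.1 i.2).2
  refine ⟨fun n => Module.finrank k (H n), ⟨{ F := F, G := G, S := S, F_mem := ?_, DF := ?_, G_mem := ?_, GD := ?_, S_mem := ?_, GF := ?_, htpy := ?_, fin := ?_ }⟩⟩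
  · exact fun i => (hFm i).1.1
  · exact fun i => (hFm i).1.2
  · intro n v hv
    rw [hG n v hv]
    refine mem_Fam.2 fun i hi => ⟨trivial, ?_⟩
    by_contra hne
    apply hi
    simp only [c, LinearMap.comp_apply, Finsupp.lmapDomain_apply]
    rw [Finsupp.mapDomain_of_notMem_range]
    rintro ⟨j, rfl⟩
    exact hne rfl
  · intro n v hv
    have h1 : π (n - 1) (D v) = 0 := by
      have h0 : κ (n - 1) (D v) = D v := by simp [κ, hC.map_map hv]
      simp only [π, LinearMap.sub_apply, LinearMap.comp_apply, h0, (hTprev n v hv).2, sub_self]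
    rw [hG _ _ (hC.map_mem' hv)]
    simp only [c, LinearMap.comp_apply, h1, map_zero]
  · intro n v hv
    rw [hS n v hv]
    exact hTm n _
  · intro i
    have hm := hFm i
    rw [hG _ _ hm.1.1]
    simp only [c, LinearMap.comp_apply]
    rw [hπH _ _ hm, hFs]
    have := hqH i.1 (b i.1 i.2)
    rw [this]
    simp
  · intro n v hv
    rw [hFG n v hv, hS n v hv, hS _ _ (hC.map_mem' hv)]
    have h0 : κ (n - 1) (D v) = D v := by simp [κ, hC.map_map hv]
    rw [h0]
    simp only [π, LinearMap.sub_apply, LinearMap.comp_apply]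
    simp only [κ, LinearMap.sub_apply, LinearMap.comp_apply, LinearMap.id_apply]
    abel
  · intro n
    refine Set.Finite.subset (Set.finite_range (Sigma.mk n)) ?_
    rintro ⟨m, i⟩ h
    obtain rfl : m = n := h
    exact ⟨i, rfl⟩

theorem hh_tens_eq_ncard {D : (X →₀ k) →ₗ[k] (X →₀ k)} {D' : (Y →₀ k) →ₗ[k] (Y →₀ k)} {C : Set X}
    {C' : Set Y} {deg : X → ℕ} {deg' : Y → ℕ} (hC : Cx D C deg) (hC' : Cx D' C' deg')
    {I J : Type*} {degI : I → ℕ} {degJ : J → ℕ} (s : Splitting D C deg degI)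
    (s' : Splitting D' C' deg' degJ) (n : ℕ) :
    hh (tensD deg D D') (Fam k (C ×ˢ C') (pdeg deg deg')) n =
      {p : I × J | pdeg degI degJ p = n}.ncard := by
  have hFF : ∀ i : I, ∀ j : J, tens degI s.F s'.F (0 : (I →₀ k) →ₗ[k] (X →₀ k))
      (0 : (J →₀ k) →ₗ[k] (Y →₀ k)) (Finsupp.single (i, j) 1) =
      box k X Y (s.F (Finsupp.single i 1)) (s'.F (Finsupp.single j 1)) := by
    intro i j; simp [tens]
  have hbasis : ∀ {Q : Submodule k (X × Y →₀ k)} {m : ℕ},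
      (∀ a b, a + b = m → ∀ v ∈ Fam k C deg a, ∀ w ∈ Fam k C' deg' b, box k X Y v w ∈ Q) →
      Fam k (C ×ˢ C') (pdeg deg deg') m ≤ Q := by
    intro Q m h
    rw [Fam_le_iff]
    rintro ⟨x, y⟩ ⟨hx, hy⟩ hm
    rw [← box_single]
    exact h _ _ hm _ (single_mem_Fam hx 1) _ (single_mem_Fam hy 1)
  have hGb : ∀ a b, ∀ v ∈ Fam k C deg a, ∀ w ∈ Fam k C' deg' b,
      tens deg s.G s'.G (0 : (X →₀ k) →ₗ[k] (I →₀ k)) (0 : (Y →₀ k) →ₗ[k] (J →₀ k))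
        (box k X Y v w) = box k I J (s.G v) (s'.G w) := by
    intro a b v hv w hw
    rw [tens_box hv hw]; simp
  have hFb : ∀ a b, ∀ v ∈ Fam k Set.univ degI a, ∀ w ∈ Fam k Set.univ degJ b,
      tens degI s.F s'.F (0 : (I →₀ k) →ₗ[k] (X →₀ k)) (0 : (J →₀ k) →ₗ[k] (Y →₀ k))
        (box k I J v w) = box k X Y (s.F v) (s'.F w) := by
    intro a b v hv w hw
    rw [tens_box hv hw]; simp
  have hD : ∀ a b, ∀ v ∈ Fam k C deg a, ∀ w ∈ Fam k C' deg' b,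
      tensD deg D D' (box k X Y v w) = box k X Y (D v) w + (-1 : k) ^ a • box k X Y v (D' w) := by
    intro a b v hv w hw
    rw [tensD, tens_box hv hw]; rfl
  have hS : ∀ a b, ∀ v ∈ Fam k C deg a, ∀ w ∈ Fam k C' deg' b,
      tens deg s.S LinearMap.id (s.F ∘ₗ s.G) s'.S (box k X Y v w) =
        box k X Y (s.S v) w + (-1 : k) ^ a • box k X Y (s.F (s.G v)) (s'.S w) := by
    intro a b v hv w hw
    rw [tens_box hv hw]; rfl
  have hFGm : ∀ a, ∀ v ∈ Fam k C deg a, s.F (s.G v) ∈ Fam k C deg a := fun a v hv =>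
    s.F_mem' (s.G_mem a v hv)
  refine Splitting.hh_eq (degI := pdeg degI degJ)
    { F := tens degI s.F s'.F 0 0
      G := tens deg s.G s'.G 0 0
      S := tens deg s.S LinearMap.id (s.F ∘ₗ s.G) s'.S
      F_mem := ?_, DF := ?_, G_mem := ?_, GD := ?_, S_mem := ?_, GF := ?_, htpy := ?_
      fin := ?_ } (hC.tens hC') n
  · rintro ⟨i, j⟩
    rw [hFF]
    exact box_mem (s.F_mem i) (s'.F_mem j)
  · rintro ⟨i, j⟩
    rw [hFF, hD _ _ _ (s.F_mem i) _ (s'.F_mem j), s.DF, s'.DF]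
    simp
  · intro m v hv
    refine hbasis (Q := (Fam k Set.univ (pdeg degI degJ) m).comap _) ?_ hv
    rintro a b rfl v hv w hw
    rw [Submodule.mem_comap, hGb a b v hv w hw]
    exact Fam_mono (Set.subset_univ _) _ _ (box_mem (s.G_mem a v hv) (s'.G_mem b w hw))
  · intro m v hv
    have := hbasis (Q := LinearMap.ker (tens deg s.G s'.G 0 0 ∘ₗ tensD deg D D')) (m := m) ?_ hv
    · exact this
    rintro a b rfl v hv w hw
    rw [LinearMap.mem_ker, LinearMap.comp_apply, hD a b v hv w hw, map_add, map_smul,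
      hGb _ _ _ (hC.map_mem' hv) _ hw, hGb _ _ _ hv _ (hC'.map_mem' hw), s.GD a v hv,
      s'.GD b w hw]
    simp
  · intro m v hv
    refine hbasis (Q := (Fam k (C ×ˢ C') (pdeg deg deg') (m + 1)).comap _) ?_ hv
    rintro a b rfl v hv w hw
    rw [Submodule.mem_comap, hS a b v hv w hw]
    refine Submodule.add_mem _ ?_ (Submodule.smul_mem _ _ ?_)
    · rw [add_right_comm]; exact box_mem (s.S_mem a v hv) hw
    · exact box_mem (hFGm a v hv) (s'.S_mem b w hw)
  · rintro ⟨i, j⟩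
    rw [hFF, hGb _ _ _ (s.F_mem i) _ (s'.F_mem j), s.GF, s'.GF, box_single]
  · intro m v hv
    have := hbasis (m := m) (Q := LinearMap.eqLocus LinearMap.id
      (tens degI s.F s'.F 0 0 ∘ₗ tens deg s.G s'.G 0 0 + tensD deg D D' ∘ₗ
        tens deg s.S LinearMap.id (s.F ∘ₗ s.G) s'.S + tens deg s.S LinearMap.id (s.F ∘ₗ s.G) s'.S
          ∘ₗ tensD deg D D')) ?_ hv
    · exact this
    rintro a b rfl v hv w hw
    rw [LinearMap.mem_eqLocus]
    simp only [LinearMap.add_apply, LinearMap.comp_apply, LinearMap.id_apply]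
    rw [hGb a b v hv w hw, hFb a b _ (s.G_mem a v hv) _ (s'.G_mem b w hw), hS a b v hv w hw,
      hD a b v hv w hw, map_add, map_add, map_smul, map_smul,
      hD _ _ _ (s.S_mem a v hv) _ hw, hD _ _ _ (hFGm a v hv) _ (s'.S_mem b w hw),
      hS _ _ _ (hC.map_mem' hv) _ hw, hS _ _ _ hv _ (hC'.map_mem' hw), s.GD a v hv, s.DF']
    have ev := s.htpy a v hv
    have ew := s'.htpy b w hw
    have e1 : box k X Y v w = box k X Y (s.F (s.G v)) w + box k X Y (D (s.S v)) w +
        box k X Y (s.S (D v)) w := by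
      conv_lhs => rw [ev]
      simp
    have e2 : box k X Y (s.F (s.G v)) w = box k X Y (s.F (s.G v)) (s'.F (s'.G w)) +
        box k X Y (s.F (s.G v)) (D' (s'.S w)) + box k X Y (s.F (s.G v)) (s'.S (D' w)) := by
      conv_lhs => rw [ew]
      simp
    rw [e1, e2]
    have hsq : (-1 : k) ^ a * (-1) ^ a = 1 := by rw [← mul_pow]; simp
    simp only [map_zero, LinearMap.zero_apply, smul_add, smul_smul, hsq, one_smul, zero_add,
      smul_zero, add_zero, pow_succ, mul_neg, mul_one, neg_smul]
    abel
  · intro m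
    have : {p : I × J | pdeg degI degJ p = m} ⊆
        (⋃ i ∈ Finset.range (m + 1), {x | degI x = i}) ×ˢ
          (⋃ j ∈ Finset.range (m + 1), {y | degJ y = j}) := by
      rintro ⟨x, y⟩ h
      simp only [pdeg, Set.mem_ofPred_eq] at h
      simp only [Set.mem_iUnion, Set.mem_prod, Finset.mem_range, exists_prop]
      exact ⟨⟨degI x, by omega, rfl⟩, degJ y, by omega, rfl⟩
    have hJ := Set.Finite.biUnion (Finset.finite_toSet (Finset.range (m + 1))) fun j _ => s'.fin j
    have hI := Set.Finite.biUnion (Finset.finite_toSet (Finset.range (m + 1))) fun i _ => s.fin i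
    exact (hI.prod hJ).subset this

/-- The Künneth formula for dimensions. -/
theorem hh_tens {D : (X →₀ k) →ₗ[k] (X →₀ k)} {D' : (Y →₀ k) →ₗ[k] (Y →₀ k)} {C : Set X}
    {C' : Set Y} {deg : X → ℕ} {deg' : Y → ℕ} (hC : Cx D C deg) (hC' : Cx D' C' deg') (n : ℕ) :
    hh (tensD deg D D') (Fam k (C ×ˢ C') (pdeg deg deg')) n =
      ∑ p ∈ Finset.HasAntidiagonal.antidiagonal n, hh D (Fam k C deg) p.1 * hh D' (Fam k C' deg') p.2 := by
  obtain ⟨d, ⟨s⟩⟩ := exists_splitting hC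
  obtain ⟨d', ⟨s'⟩⟩ := exists_splitting hC'
  rw [hh_tens_eq_ncard hC hC' s s' n]
  simp only [s.hh_eq hC, s'.hh_eq hC']
  have hU : {p : (Σ n, Fin (d n)) × (Σ n, Fin (d' n)) |
      pdeg (fun i : Σ n, Fin (d n) => i.1) (fun i : Σ n, Fin (d' n) => i.1) p = n} =
      ⋃ q ∈ Finset.HasAntidiagonal.antidiagonal n,
        {i : Σ n, Fin (d n) | i.1 = q.1} ×ˢ {j : Σ n, Fin (d' n) | j.1 = q.2} := by
    ext ⟨i, j⟩
    simp only [pdeg, Set.mem_ofPred_eq, Set.mem_iUnion, Set.mem_prod, Finset.HasAntidiagonal.mem_antidiagonal,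
      exists_prop]
    exact ⟨fun h => ⟨(i.1, j.1), h, rfl, rfl⟩, fun ⟨q, h, h1, h2⟩ => by rw [h1, h2, h]⟩
  have hfin : ∀ q : ℕ × ℕ, ({i : Σ n, Fin (d n) | i.1 = q.1} ×ˢ
      {j : Σ n, Fin (d' n) | j.1 = q.2}).Finite := fun q => (s.fin q.1).prod (s'.fin q.2)
  have hU' : (⋃ q ∈ Finset.HasAntidiagonal.antidiagonal n,
        {i : Σ n, Fin (d n) | i.1 = q.1} ×ˢ {j : Σ n, Fin (d' n) | j.1 = q.2}) =
      ↑((Finset.HasAntidiagonal.antidiagonal n).biUnion fun q => (hfin q).toFinset) := by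
    ext; simp
  rw [hU, hU', Set.ncard_coe_finset, Finset.card_biUnion]
  · refine Finset.sum_congr rfl fun q _ => ?_
    rw [← Set.ncard_eq_toFinset_card _ (hfin q), Set.ncard_prod]
  · intro q _ q' _ hne
    rw [Function.onFun, Finset.disjoint_left]
    rintro ⟨i, j⟩ h h'
    simp only [Set.Finite.mem_toFinset, Set.mem_prod, Set.mem_ofPred_eq] at h h'
    exact hne (Prod.ext (h.1.symm.trans h'.1) (h.2.symm.trans h'.2))

end Kunneth

section Exterior
variable {k : Type*} [Field k] {V : Type*}

/-- The sign of the inversion of `a` and `b` in an exterior product. -/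
def eps (k : Type*) [Field k] (a b : V) : k :=
  if a = b then 0 else if (vOrd V).lt b a then -1 else 1

theorem eps_self (a : V) : eps k a a = 0 := by simp [eps]

theorem eps_mul_eps {a b : V} (h : a ≠ b) : eps k a b * eps k b a = -1 := by
  let _ := vOrd V
  rcases lt_or_gt_of_ne h with h1 | h1
  · have h2 : ¬ (vOrd V).lt b a := not_lt_of_gt h1
    have h3 : (vOrd V).lt a b := h1
    simp [eps, h, h.symm, h2, h3]
  · have h2 : ¬ (vOrd V).lt a b := not_lt_of_gt h1
    have h3 : (vOrd V).lt b a := h1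
    simp [eps, h, h.symm, h2, h3]

theorem eps_mul_self {a b : V} (h : a ≠ b) : eps k a b * eps k a b = 1 := by
  unfold eps; rw [if_neg h]; split_ifs <;> simp

/-- The sign of the exterior product of the simplices `S` and `T`. -/
def sg (k : Type*) [Field k] (S T : Finset V) : k := ∏ s ∈ S, ∏ t ∈ T, eps k s t

@[simp] theorem sg_empty_left (T : Finset V) : sg k ∅ T = 1 := by simp [sg]

@[simp] theorem sg_empty_right (S : Finset V) : sg k S ∅ = 1 := by simp [sg]

theorem sg_union_right {T U : Finset V} (S : Finset V) (h : Disjoint T U) :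
    sg k S (T ∪ U) = sg k S T * sg k S U := by
  simp [sg, Finset.prod_union h, Finset.prod_mul_distrib]

theorem sg_union_left {S T : Finset V} (U : Finset V) (h : Disjoint S T) :
    sg k (S ∪ T) U = sg k S U * sg k T U := by
  simp [sg, Finset.prod_union h]

theorem sg_eq_zero {S T : Finset V} (h : ¬ Disjoint S T) : sg k S T = 0 := by
  obtain ⟨x, hx, hx'⟩ := Finset.not_disjoint_iff.1 h
  exact Finset.prod_eq_zero hx (Finset.prod_eq_zero hx' (eps_self x))

theorem sg_mul_self {S T : Finset V} (h : Disjoint S T) : sg k S T * sg k S T = 1 := by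
  simp only [sg, ← Finset.prod_mul_distrib]
  refine Finset.prod_eq_one fun s hs => Finset.prod_eq_one fun t ht => eps_mul_self ?_
  rintro rfl
  exact Finset.disjoint_left.1 h hs ht

theorem sg_ne_zero {S T : Finset V} (h : Disjoint S T) : sg k S T ≠ 0 := by
  intro h0
  have := sg_mul_self (k := k) h
  simp [h0] at this

theorem sg_eq_zero_iff {S T : Finset V} : sg k S T = 0 ↔ ¬ Disjoint S T :=
  ⟨fun h hd => sg_ne_zero hd h, sg_eq_zero⟩

theorem sg_assoc (S T U : Finset V) :
    sg k S T * sg k (S ∪ T) U = sg k T U * sg k S (T ∪ U) := by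
  by_cases h1 : Disjoint S T
  · by_cases h2 : Disjoint T U
    · rw [sg_union_left U h1, sg_union_right S h2]; ring
    · rw [sg_eq_zero h2, sg_eq_zero (S := S ∪ T)]
      · simp
      · rw [Finset.disjoint_union_left]; tauto
  · rw [sg_eq_zero h1, sg_eq_zero (T := T ∪ U)]
    · simp
    · rw [Finset.disjoint_union_right]; tauto

theorem neg_one_pow_rankIn {F : Finset V} {x : V} (hx : x ∈ F) :
    (-1 : k) ^ rankIn F x = sg k {x} (F.erase x) := by
  have h : sg k {x} (F.erase x) = ∏ t ∈ F.erase x, if (vOrd V).lt t x then (-1 : k) else 1 := by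
    simp only [sg, Finset.prod_singleton]
    refine Finset.prod_congr rfl fun t ht => ?_
    rw [eps, if_neg (Finset.ne_of_mem_erase ht).symm]
  have hxx : ¬ (vOrd V).lt x x := let _ := vOrd V; lt_irrefl x
  rw [h, rankIn, Finset.prod_erase _ (by simp), ← Finset.prod_filter, Finset.prod_const]

theorem bdry_single (F : Finset V) : bdry k V (Finsupp.single F 1) =
    ∑ x ∈ F, sg k {x} (F.erase x) • Finsupp.single (F.erase x) (1 : k) := by
  rw [bdry, Finsupp.linearCombination_single, one_smul, bdryAux]
  exact Finset.sum_congr rfl fun x hx => by rw [neg_one_pow_rankIn hx]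

theorem bdry_single_erase {F : Finset V} {x : V} (hx : x ∈ F) :
    bdry k V (Finsupp.single F 1) (F.erase x) = sg k {x} (F.erase x) := by
  rw [bdry_single, Finsupp.finsetSum_apply, Finset.sum_eq_single x]
  · simp
  · intro y hy hne
    rw [Finsupp.smul_apply, Finsupp.single_eq_of_ne, smul_zero]
    intro h
    have : x ∈ F.erase y := Finset.mem_erase.2 ⟨hne.symm, hx⟩
    rw [← h] at this
    simp at this
  · exact fun h => absurd hx h

theorem bdry_single_ne_zero {F G : Finset V} (h : bdry k V (Finsupp.single F 1) G ≠ 0) :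
    ∃ x ∈ F, G = F.erase x := by
  by_contra! hne
  apply h
  rw [bdry_single, Finsupp.finsetSum_apply]
  refine Finset.sum_eq_zero fun x hx => ?_
  rw [Finsupp.smul_apply, Finsupp.single_eq_of_ne (hne x hx), smul_zero]

theorem bdry_single_erase_ne_zero {F : Finset V} {x : V} (hx : x ∈ F) :
    bdry k V (Finsupp.single F 1) (F.erase x) ≠ 0 := by
  rw [bdry_single_erase hx]
  exact sg_ne_zero (by simp)

/-- The exterior product. -/
def emul (k : Type*) [Field k] (V : Type*) :
    (Finset V →₀ k) →ₗ[k] (Finset V →₀ k) →ₗ[k] (Finset V →₀ k) :=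
  Finsupp.linearCombination k fun S => Finsupp.linearCombination k fun T =>
    sg k S T • Finsupp.single (S ∪ T) (1 : k)

theorem emul_single (S T : Finset V) : emul k V (Finsupp.single S 1) (Finsupp.single T 1) =
    sg k S T • Finsupp.single (S ∪ T) (1 : k) := by
  simp [emul]

/-- The grading involution. -/
def ebar (k : Type*) [Field k] (V : Type*) : (Finset V →₀ k) →ₗ[k] (Finset V →₀ k) :=
  Finsupp.linearCombination k fun S => (-1 : k) ^ S.card • Finsupp.single S (1 : k)

theorem ebar_single (S : Finset V) : ebar k V (Finsupp.single S 1) =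
    (-1 : k) ^ S.card • Finsupp.single S (1 : k) := by
  simp [ebar]

theorem emul_assoc (a b c : Finset V →₀ k) :
    emul k V (emul k V a b) c = emul k V a (emul k V b c) := by
  induction a using Finsupp.induction_linear with
  | zero => simp
  | add f g hf hg => simp [hf, hg]
  | single S r =>
  induction b using Finsupp.induction_linear with
  | zero => simp
  | add f g hf hg => simp [hf, hg]
  | single T r' =>
  induction c using Finsupp.induction_linear with
  | zero => simp
  | add f g hf hg => simp [hf, hg]
  | single U r'' =>
  rw [← mul_one r, ← mul_one r', ← mul_one r'', ← smul_eq_mul r, ← smul_eq_mul r',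
    ← smul_eq_mul r'', ← Finsupp.smul_single, ← Finsupp.smul_single, ← Finsupp.smul_single]
  simp only [map_smul, LinearMap.smul_apply]
  congr 3
  rw [emul_single, emul_single, map_smul, map_smul, LinearMap.smul_apply, emul_single, emul_single,
    smul_smul, smul_smul, sg_assoc, Finset.union_assoc]

theorem bdry_emul_vertex (x : V) (b : Finset V →₀ k) :
    bdry k V (emul k V (Finsupp.single {x} 1) b) =
      b - emul k V (Finsupp.single {x} 1) (bdry k V b) := by
  have : bdry k V ∘ₗ emul k V (Finsupp.single {x} 1) =
      LinearMap.id - emul k V (Finsupp.single {x} 1) ∘ₗ bdry k V := by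
    ext1 S
    ext1
    simp only [LinearMap.comp_apply, LinearMap.sub_apply, LinearMap.id_apply,
      Finsupp.lsingle_apply]
    rw [emul_single, map_smul, bdry_single, bdry_single]
    simp only [map_sum, map_smul, emul_single]
    by_cases hx : x ∈ S
    · rw [sg_eq_zero (by simpa using hx), zero_smul, Finset.sum_eq_single x]
      · rw [smul_smul, sg_mul_self (by simp), ← Finset.insert_eq, Finset.insert_erase hx]
        simp
      · intro y _ hne
        rw [sg_eq_zero (S := {x}), zero_smul, smul_zero]
        simp [hx, hne.symm]
      · exact fun h => absurd hx h
    · rw [← Finset.insert_eq, Finset.sum_insert hx, Finset.erase_insert hx, smul_add, smul_smul,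
        sg_mul_self (by simpa using hx), one_smul, sub_eq_add_neg, ← Finset.sum_neg_distrib,
        Finset.smul_sum]
      congr 1
      refine Finset.sum_congr rfl fun y hy => ?_
      have hne : x ≠ y := fun h => hx (h ▸ hy)
      rw [Finset.erase_insert_of_ne hne, smul_smul, smul_smul, ← neg_smul, ← Finset.insert_eq]
      congr 1
      have e1 : sg k {x} S = eps k x y * sg k {x} (S.erase y) := by
        rw [← Finset.insert_erase hy, Finset.insert_eq, sg_union_right _ (by simp)]
        simp [sg]
      have e2 : sg k {y} (insert x (S.erase y)) = eps k y x * sg k {y} (S.erase y) := by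
        rw [Finset.insert_eq, sg_union_right _ (by simp [hx])]
        simp [sg]
      rw [e1, e2]
      linear_combination (sg k {x} (S.erase y) * sg k {y} (S.erase y)) * eps_mul_eps (k := k) hne
  exact LinearMap.congr_fun this b

/-- Induction on exterior products of vertices. -/
theorem ext_induction {p : (Finset V →₀ k) → Prop} (h0 : p (Finsupp.single ∅ 1))
    (hadd : ∀ a b, p a → p b → p (a + b)) (hsmul : ∀ (c : k) a, p a → p (c • a))
    (hmul : ∀ x a, p a → p (emul k V (Finsupp.single {x} 1) a)) (a : Finset V →₀ k) : p a := by
  have hz : p 0 := by simpa using hsmul 0 _ h0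
  have hs : ∀ S : Finset V, p (Finsupp.single S 1) := by
    intro S
    induction S using Finset.induction_on with
    | empty => exact h0
    | insert x S hx ih =>
      have := hsmul (sg k {x} S) _ (hmul x _ ih)
      rwa [emul_single, smul_smul, sg_mul_self (by simpa using hx), one_smul,
        ← Finset.insert_eq] at this
  induction a using Finsupp.induction_linear with
  | zero => exact hz
  | add f g hf hg => exact hadd _ _ hf hg
  | single S r => simpa using hsmul r _ (hs S)

theorem bdry_one : bdry k V (Finsupp.single ∅ 1) = 0 := by simp [bdry_single]

theorem bdry_bdry (a : Finset V →₀ k) : bdry k V (bdry k V a) = 0 := by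
  refine ext_induction (p := fun a => bdry k V (bdry k V a) = 0) ?_ ?_ ?_ ?_ a
  · rw [bdry_one, map_zero]
  · intro a b ha hb; simp [ha, hb]
  · intro c a ha; simp [ha]
  · intro x a ha
    rw [bdry_emul_vertex, map_sub, bdry_emul_vertex, ha]
    simp

theorem ebar_ebar (a : Finset V →₀ k) : ebar k V (ebar k V a) = a := by
  have : ebar k V ∘ₗ ebar k V = LinearMap.id := by
    ext1 S
    ext1
    simp only [LinearMap.comp_apply, Finsupp.lsingle_apply, LinearMap.id_apply]
    rw [ebar_single, map_smul, ebar_single, smul_smul, ← mul_pow]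
    simp
  exact LinearMap.congr_fun this a

theorem ebar_emul (a b : Finset V →₀ k) :
    ebar k V (emul k V a b) = emul k V (ebar k V a) (ebar k V b) := by
  induction a using Finsupp.induction_linear with
  | zero => simp
  | add f g hf hg => simp [hf, hg]
  | single S r =>
  induction b using Finsupp.induction_linear with
  | zero => simp
  | add f g hf hg => simp [hf, hg]
  | single T r' =>
  rw [← mul_one r, ← mul_one r', ← smul_eq_mul r, ← smul_eq_mul r', ← Finsupp.smul_single,
    ← Finsupp.smul_single]
  simp only [map_smul, LinearMap.smul_apply]
  congr 2
  simp only [ebar_single, emul_single, map_smul, LinearMap.smul_apply, smul_smul]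
  by_cases h : Disjoint S T
  · rw [Finset.card_union_of_disjoint h, pow_add]
    congr 1
    ring
  · simp [sg_eq_zero h]

theorem bdry_ebar (a : Finset V →₀ k) : bdry k V (ebar k V a) = -ebar k V (bdry k V a) := by
  have : bdry k V ∘ₗ ebar k V = -(ebar k V ∘ₗ bdry k V) := by
    ext1 S
    ext1
    simp only [LinearMap.comp_apply, Finsupp.lsingle_apply, LinearMap.neg_apply]
    rw [ebar_single, map_smul, bdry_single, map_sum, Finset.smul_sum, ← Finset.sum_neg_distrib]
    refine Finset.sum_congr rfl fun x hx => ?_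
    rw [map_smul, ebar_single, smul_smul, smul_smul, ← neg_smul,
      ← Finset.card_erase_add_one hx, pow_succ]
    congr 1
    ring
  exact LinearMap.congr_fun this a

theorem emul_one (a : Finset V →₀ k) : emul k V (Finsupp.single ∅ 1) a = a := by
  have : emul k V (Finsupp.single ∅ 1) = LinearMap.id := by
    ext1 S
    ext1
    simp [emul_single]
  exact LinearMap.congr_fun this a

theorem bdry_emul (a b : Finset V →₀ k) : bdry k V (emul k V a b) =
    emul k V (bdry k V a) b + emul k V (ebar k V a) (bdry k V b) := by
  refine ext_induction (p := fun a => bdry k V (emul k V a b) =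
    emul k V (bdry k V a) b + emul k V (ebar k V a) (bdry k V b)) ?_ ?_ ?_ ?_ a
  · simp [bdry_one, ebar_single, emul_one]
  · intro a a' ha ha'
    simp only [map_add, LinearMap.add_apply, ha, ha']
    abel
  · intro c a ha
    simp only [map_smul, LinearMap.smul_apply, ha, smul_add]
  · intro x a ha
    rw [emul_assoc, bdry_emul_vertex, ha, bdry_emul_vertex, ebar_emul, ebar_single]
    simp only [Finset.card_singleton, pow_one, neg_smul, one_smul, map_neg, LinearMap.neg_apply,
      map_add, map_sub, LinearMap.sub_apply, emul_assoc]
    abel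

/-- The full simplex on a finite vertex set, as a complex. -/
theorem bdry_cx (N : Finset V) : Cx (bdry k V) {S | S ⊆ N} Finset.card where
  face := by
    intro S hS T h
    obtain ⟨x, hx, rfl⟩ := bdry_single_ne_zero h
    exact ⟨(Finset.erase_subset _ _).trans hS, Finset.card_erase_add_one hx⟩
  sq := fun S _ => bdry_bdry _
  fin := fun n => (Finset.finite_toSet N.powerset).subset fun S hS => by simpa using hS.1

end Exterior

section Pairs
variable {k : Type*} [Field k] {V W : Type*}

/-- The differential on pairs of simplices. -/
abbrev pairD (k : Type*) [Field k] (V W : Type*) :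
    (Finset V × Finset W →₀ k) →ₗ[k] (Finset V × Finset W →₀ k) :=
  tensD Finset.card (bdry k V) (bdry k W)

/-- The total degree of a pair of simplices. -/
abbrev pairDeg (V W : Type*) : Finset V × Finset W → ℕ := pdeg Finset.card Finset.card

theorem pairD_face {p q : Finset V × Finset W} (h : pairD k V W (Finsupp.single p 1) q ≠ 0) :
    (∃ x ∈ p.1, q = (p.1.erase x, p.2)) ∨ ∃ x ∈ p.2, q = (p.1, p.2.erase x) := by
  obtain ⟨S, G⟩ := p
  obtain ⟨S', G'⟩ := q
  rw [pairD, tensD_apply] at h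
  by_cases h1 : G = G'
  · by_cases h2 : bdry k V (Finsupp.single S 1) S' = 0
    · right
      rw [h2, ite_self, zero_add] at h
      split_ifs at h with h3
      · obtain ⟨x, hx, rfl⟩ := bdry_single_ne_zero (right_ne_zero_of_mul h)
        exact ⟨x, hx, by rw [h3]⟩
      · exact absurd rfl h
    · obtain ⟨x, hx, rfl⟩ := bdry_single_ne_zero h2
      exact Or.inl ⟨x, hx, by rw [h1]⟩
  · right
    rw [if_neg h1, zero_add] at h
    split_ifs at h with h3
    · obtain ⟨x, hx, rfl⟩ := bdry_single_ne_zero (right_ne_zero_of_mul h)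
      exact ⟨x, hx, by rw [h3]⟩
    · exact absurd rfl h

theorem pairD_coeff_left {S : Finset V} {G : Finset W} {x : V} (hx : x ∈ S) :
    pairD k V W (Finsupp.single (S, G) 1) (S.erase x, G) ≠ 0 := by
  rw [pairD, tensD_apply, if_pos rfl, if_neg, add_zero]
  · exact bdry_single_erase_ne_zero hx
  · exact (Finset.erase_ne_self.2 hx).symm

theorem pairD_coeff_right {S : Finset V} {G : Finset W} {x : W} (hx : x ∈ G) :
    pairD k V W (Finsupp.single (S, G) 1) (S, G.erase x) ≠ 0 := by
  rw [pairD, tensD_apply, if_pos rfl, if_neg, zero_add]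
  · exact mul_ne_zero (pow_ne_zero _ (by simp)) (bdry_single_erase_ne_zero hx)
  · exact (Finset.erase_ne_self.2 hx).symm

/-- A matching toggling a vertex of the second simplex depending on the first one only. -/
theorem exists_matching_right {Y : Set (Finset V × Finset W)}
    (hY : ∀ S, (∃ G, (S, G) ∈ Y) → ∃ w, ∀ G, (S, insert w G) ∈ Y ↔ (S, G) ∈ Y) :
    ∃ Lo up, Matching (pairD k V W) (pairDeg V W) Y Lo up (fun p => p.1.card) := by
  choose h hh using hY
  let up : Finset V × Finset W → Finset V × Finset W := fun p =>
    if H : ∃ G, (p.1, G) ∈ Y then (p.1, insert (h p.1 H) p.2) else p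
  have hup : ∀ p (hp : p ∈ Y), up p = (p.1, insert (h p.1 ⟨p.2, hp⟩) p.2) := fun p hp =>
    dif_pos ⟨p.2, hp⟩
  refine ⟨{p | ∃ hp : p ∈ Y, h p.1 ⟨p.2, hp⟩ ∉ p.2}, up, ⟨fun p hp => hp.1, ?_, ?_, ?_, ?_⟩⟩
  · rintro ⟨S, G⟩ ⟨hp, hp'⟩
    rw [hup _ hp]
    refine ⟨(hh S _ G).2 hp, ?_, ?_⟩
    · rintro ⟨_, h2⟩
      exact h2 (Finset.mem_insert_self _ _)
    · simp only [pairDeg, pdeg]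
      rw [Finset.card_insert_of_notMem hp', add_assoc]
  · rintro ⟨S, G⟩ hp hp'
    have hm : h S ⟨G, hp⟩ ∈ G := by
      by_contra hc
      exact hp' ⟨hp, hc⟩
    have hmem : (S, G.erase (h S ⟨G, hp⟩)) ∈ Y := by
      rw [← hh S ⟨G, hp⟩, Finset.insert_erase hm]; exact hp
    refine ⟨(S, G.erase (h S ⟨G, hp⟩)), ⟨hmem, Finset.notMem_erase _ _⟩, ?_⟩
    rw [hup _ hmem]
    simp only [Finset.insert_erase hm]
  · rintro ⟨S, G⟩ ⟨hp, hp'⟩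
    rw [hup _ hp]
    have := pairD_coeff_right (k := k) (S := S) (Finset.mem_insert_self (h S ⟨G, hp⟩) G)
    rwa [Finset.erase_insert hp'] at this
  · rintro ⟨S, G⟩ ⟨hp, hp'⟩ y ⟨hy, hy'⟩ hne hD
    rw [hup _ hp] at hD
    obtain ⟨x, hx, rfl⟩ | ⟨x, hx, rfl⟩ := pairD_face hD
    · exact Finset.card_erase_lt_of_mem hx
    · exfalso
      by_cases hxh : x = h S ⟨G, hp⟩
      · subst hxh
        rw [Finset.erase_insert hp'] at hne
        exact hne rfl
      · exact hy' (Finset.mem_erase.2 ⟨Ne.symm hxh, Finset.mem_insert_self _ _⟩)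

/-- A matching toggling a vertex of the first simplex depending on the second one only. -/
theorem exists_matching_left {Y : Set (Finset V × Finset W)}
    (hY : ∀ G, (∃ S, (S, G) ∈ Y) → ∃ v, ∀ S, (insert v S, G) ∈ Y ↔ (S, G) ∈ Y) :
    ∃ Lo up, Matching (pairD k V W) (pairDeg V W) Y Lo up (fun p => p.2.card) := by
  choose h hh using hY
  let up : Finset V × Finset W → Finset V × Finset W := fun p =>
    if H : ∃ S, (S, p.2) ∈ Y then (insert (h p.2 H) p.1, p.2) else p
  have hup : ∀ p (hp : p ∈ Y), up p = (insert (h p.2 ⟨p.1, hp⟩) p.1, p.2) := fun p hp =>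
    dif_pos ⟨p.1, hp⟩
  refine ⟨{p | ∃ hp : p ∈ Y, h p.2 ⟨p.1, hp⟩ ∉ p.1}, up, ⟨fun p hp => hp.1, ?_, ?_, ?_, ?_⟩⟩
  · rintro ⟨S, G⟩ ⟨hp, hp'⟩
    rw [hup _ hp]
    refine ⟨(hh G _ S).2 hp, ?_, ?_⟩
    · rintro ⟨_, h2⟩
      exact h2 (Finset.mem_insert_self _ _)
    · simp only [pairDeg, pdeg]
      rw [Finset.card_insert_of_notMem hp', add_right_comm]
  · rintro ⟨S, G⟩ hp hp'
    have hm : h G ⟨S, hp⟩ ∈ S := by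
      by_contra hc
      exact hp' ⟨hp, hc⟩
    have hmem : (S.erase (h G ⟨S, hp⟩), G) ∈ Y := by
      rw [← hh G ⟨S, hp⟩, Finset.insert_erase hm]; exact hp
    refine ⟨(S.erase (h G ⟨S, hp⟩), G), ⟨hmem, Finset.notMem_erase _ _⟩, ?_⟩
    rw [hup _ hmem]
    simp only [Finset.insert_erase hm]
  · rintro ⟨S, G⟩ ⟨hp, hp'⟩
    rw [hup _ hp]
    have := pairD_coeff_left (k := k) (G := G) (Finset.mem_insert_self (h G ⟨S, hp⟩) S)
    rwa [Finset.erase_insert hp'] at this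
  · rintro ⟨S, G⟩ ⟨hp, hp'⟩ y ⟨hy, hy'⟩ hne hD
    rw [hup _ hp] at hD
    obtain ⟨x, hx, rfl⟩ | ⟨x, hx, rfl⟩ := pairD_face hD
    · exfalso
      by_cases hxh : x = h G ⟨S, hp⟩
      · subst hxh
        rw [Finset.erase_insert hp'] at hne
        exact hne rfl
      · exact hy' (Finset.mem_erase.2 ⟨Ne.symm hxh, Finset.mem_insert_self _ _⟩)
    · exact Finset.card_erase_lt_of_mem hx

/-- The matching of a set of simplices that is a cone with apex `v`. -/
theorem cone_matching {Y : Set (Finset V)} (v : V) (hY : ∀ S, insert v S ∈ Y ↔ S ∈ Y) :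
    Matching (bdry k V) Finset.card Y {S | S ∈ Y ∧ v ∉ S} (insert v) (fun _ => (0 : ℕ)) where
  lo_sub := fun S hS => hS.1
  up_mem := fun S hS => ⟨(hY S).2 hS.1, fun h => h.2 (Finset.mem_insert_self _ _),
    Finset.card_insert_of_notMem hS.2⟩
  surj := by
    intro S hS hS'
    have hm : v ∈ S := by by_contra hc; exact hS' ⟨hS, hc⟩
    exact ⟨S.erase v, ⟨by rwa [← hY, Finset.insert_erase hm], Finset.notMem_erase _ _⟩,
      Finset.insert_erase hm⟩
  coeff := by
    intro S hS
    have := bdry_single_erase_ne_zero (k := k) (Finset.mem_insert_self v S)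
    rwa [Finset.erase_insert hS.2] at this
  lt := by
    intro S hS T hT hne h
    exfalso
    obtain ⟨x, hx, rfl⟩ := bdry_single_ne_zero h
    by_cases hxv : x = v
    · subst hxv
      exact hne (Finset.erase_insert hS.2)
    · exact hT.2 (Finset.mem_erase.2 ⟨Ne.symm hxv, Finset.mem_insert_self _ _⟩)

theorem hh_pair_left {C : Set (Finset V)} (hC : Cx (bdry k V) C Finset.card)
    (hC' : Cx (pairD k V W) (C ×ˢ {∅}) (pairDeg V W)) (n : ℕ) :
    hh (bdry k V) (Fam k C Finset.card) n =
      hh (pairD k V W) (Fam k (C ×ˢ {∅}) (pairDeg V W)) n := by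
  refine hh_relabel hC hC' (fun S => (S, ∅)) (fun _ => 1) 0 1 one_ne_zero ?_
    (fun _ _ => one_ne_zero) ?_ ((box k _ _).flip (Finsupp.single ∅ 1)) ?_ ?_ n
  · refine ⟨fun S hS => ⟨hS, rfl⟩, fun S _ T _ h => congrArg Prod.fst h, ?_⟩
    rintro ⟨S, G⟩ ⟨hS, rfl⟩
    exact ⟨S, hS, rfl⟩
  · intro S _; simp [pdeg]
  · intro S _; rw [LinearMap.flip_apply, box_single, one_smul]
  · intro S _
    rw [LinearMap.flip_apply, box_single, tensD_single, bdry_one]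
    simp

theorem hh_pair_right {C : Set (Finset W)} (hC : Cx (bdry k W) C Finset.card)
    (hC' : Cx (pairD k V W) ({∅} ×ˢ C) (pairDeg V W)) (n : ℕ) :
    hh (bdry k W) (Fam k C Finset.card) n =
      hh (pairD k V W) (Fam k ({∅} ×ˢ C) (pairDeg V W)) n := by
  refine hh_relabel hC hC' (fun S => (∅, S)) (fun _ => 1) 0 1 one_ne_zero ?_
    (fun _ _ => one_ne_zero) ?_ (box k _ _ (Finsupp.single ∅ 1)) ?_ ?_ n
  · refine ⟨fun S hS => ⟨rfl, hS⟩, fun S _ T _ h => congrArg Prod.snd h, ?_⟩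
    rintro ⟨S, G⟩ ⟨rfl, hG⟩
    exact ⟨G, hG, rfl⟩
  · intro S _; simp [pdeg]
  · intro S _; rw [box_single, one_smul]
  · intro S _
    rw [box_single, tensD_single, bdry_one]
    simp

theorem hdim_eq_hh (Δ : Set (Finset V)) (n : ℕ) :
    hdim k Δ n = hh (bdry k V) (Fam k Δ Finset.card) n := by
  rw [hdim, cycles, bdries, chainSub, chainSub, hh, Fam_eq_span, Fam_eq_span]

/-- The crosscut theorem: the homology of a finite poset `P` of subsets `A p` of `N`. -/
theorem hdim_orderComplex {Q : Type*} [PartialOrder Q] {P : Set Q} (hP : P.Finite) {N : Finset V}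
    (hN : N.Nonempty) (A : Q → Finset V) (hA : ∀ p ∈ P, (A p).Nonempty ∧ A p ⊆ N)
    (hmono : ∀ p ∈ P, ∀ q ∈ P, p ≤ q → A p ⊆ A q)
    (hcl : ∀ T, T.Nonempty → (∃ p ∈ P, T ⊆ A p) → ∃ p ∈ P, T ⊆ A p ∧ ∀ q ∈ P, T ⊆ A q → p ≤ q)
    (n : ℕ) :
    hdim k (orderComplex P) n =
      hh (tr (bdry k V) {T | T ⊆ N ∧ T.Nonempty ∧ ∀ p ∈ P, ¬ T ⊆ A p})
        (Fam k {T | T ⊆ N ∧ T.Nonempty ∧ ∀ p ∈ P, ¬ T ⊆ A p} Finset.card) (n + 1) := by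
  set Δ : Set (Finset V) := {T | T ⊆ N ∧ (T = ∅ ∨ ∃ p ∈ P, T ⊆ A p)} with hΔ
  have hZ : {T | T ⊆ N ∧ T.Nonempty ∧ ∀ p ∈ P, ¬ T ⊆ A p} = {T | T ⊆ N} \ Δ := by
    ext T
    simp only [hΔ, Set.mem_sdiff, Set.mem_ofPred_eq, Finset.nonempty_iff_ne_empty]
    push Not
    tauto
  obtain ⟨v, hv⟩ := hN
  have hΔc : Closed (bdry k V) Δ := by
    intro T hT T' h
    obtain ⟨x, hx, rfl⟩ := bdry_single_ne_zero h
    refine ⟨(Finset.erase_subset _ _).trans hT.1, ?_⟩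
    obtain h | ⟨p, hp, hT2⟩ := hT.2
    · simp [h] at hx
    · exact Or.inr ⟨p, hp, (Finset.erase_subset _ _).trans hT2⟩
  have hΔN : Δ ⊆ {T | T ⊆ N} := fun T hT => hT.1
  rw [hZ, Matching.hh_shift (bdry_cx N)
    (cone_matching v fun S => by simp [Finset.insert_subset_iff, hv]) hΔN hΔc, hdim_eq_hh]
  have hΔx := (bdry_cx (k := k) N).sub hΔN hΔc
  have hO : orderComplex P ⊆ {c : Finset Q | c ⊆ hP.toFinset} := fun c hc x hx =>
    hP.mem_toFinset.2 (hc.1 hx)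
  have hOe : ∀ {c : Finset Q} (x), c ∈ orderComplex P → c.erase x ∈ orderComplex P := by
    intro c x hc
    have hs : (↑(c.erase x) : Set Q) ⊆ ↑c := Finset.coe_subset.2 (Finset.erase_subset _ _)
    exact ⟨hs.trans hc.1, hc.2.mono hs⟩
  have hOc : Closed (bdry k Q) (orderComplex P) := by
    intro T hT T' h
    obtain ⟨x, hx, rfl⟩ := bdry_single_ne_zero h
    exact hOe x hT
  have hOx := (bdry_cx (k := k) hP.toFinset).sub hO hOc
  let U : Set (Finset V × Finset Q) :=
    {w | w.1 ∈ Δ ∧ w.2 ∈ orderComplex P ∧ ∀ p ∈ w.2, w.1 ⊆ A p}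
  have hUc : Closed (pairD k V Q) U := by
    rintro ⟨T, c⟩ ⟨h1, h2, h3⟩ y hy
    obtain ⟨x, hx, rfl⟩ | ⟨x, hx, rfl⟩ := pairD_face hy
    · exact ⟨hΔc T h1 _ (bdry_single_erase_ne_zero hx), h2, fun p hp =>
        (Finset.erase_subset _ _).trans (h3 p hp)⟩
    · exact ⟨h1, hOe x h2, fun p hp => h3 p (Finset.mem_of_mem_erase hp)⟩
  have hUx : Cx (pairD k V Q) U (pairDeg V Q) :=
    ((bdry_cx (k := k) N).tens (bdry_cx (k := k) hP.toFinset)).sub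
      (fun w hw => ⟨hΔN hw.1, hO hw.2.1⟩) hUc
  have hL : Δ ×ˢ {(∅ : Finset Q)} ⊆ U := by
    rintro ⟨T, c⟩ ⟨hT, rfl⟩
    exact ⟨hT, ⟨by simp, by simp⟩, by simp⟩
  have hR : {(∅ : Finset V)} ×ˢ orderComplex P ⊆ U := by
    rintro ⟨T, c⟩ ⟨rfl, hc⟩
    exact ⟨⟨by simp, Or.inl rfl⟩, hc, by simp⟩
  have hLc : Closed (pairD k V Q) (Δ ×ˢ {(∅ : Finset Q)}) := by
    rintro ⟨T, c⟩ hw y hy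
    have hyU := hUc _ (hL hw) y hy
    obtain ⟨hT, rfl⟩ := hw
    obtain ⟨x, hx, rfl⟩ | ⟨x, hx, rfl⟩ := pairD_face hy
    · exact ⟨hyU.1, rfl⟩
    · simp at hx
  have hRc : Closed (pairD k V Q) ({(∅ : Finset V)} ×ˢ orderComplex P) := by
    rintro ⟨T, c⟩ hw y hy
    have hyU := hUc _ (hR hw) y hy
    obtain ⟨rfl, hc⟩ := hw
    obtain ⟨x, hx, rfl⟩ | ⟨x, hx, rfl⟩ := pairD_face hy
    · simp at hx
    · exact ⟨rfl, hyU.2.1⟩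
  obtain ⟨Lo, up, hM⟩ := exists_matching_right (k := k) (Y := U \ ({(∅ : Finset V)} ×ˢ orderComplex P))
    (by
      rintro T ⟨c, hc, hcn⟩
      have hT : T.Nonempty := by
        rw [Finset.nonempty_iff_ne_empty]
        rintro rfl
        exact hcn ⟨rfl, hc.2.1⟩
      obtain ⟨w, hw, hTw, hmin⟩ := hcl T hT (hc.1.2.resolve_left hT.ne_empty)
      refine ⟨w, fun G => ?_⟩
      have hn : ∀ G : Finset Q, (T, G) ∈ U \ ({(∅ : Finset V)} ×ˢ orderComplex P) ↔ (T, G) ∈ U := by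
        intro G
        exact ⟨fun h => h.1, fun h => ⟨h, fun h' => hT.ne_empty h'.1⟩⟩
      rw [hn, hn]
      constructor
      · rintro ⟨h1, h2, h3⟩

        refine ⟨h1, ⟨fun x hx => h2.1 (by simp only [Finset.coe_insert]; exact Or.inr hx), h2.2.mono (by simp)⟩,
          fun p hp => h3 p (Finset.mem_insert_of_mem hp)⟩
      · rintro ⟨h1, h2, h3⟩
        refine ⟨h1, ⟨?_, ?_⟩, ?_⟩
        · rw [Finset.coe_insert]
          exact Set.insert_subset hw h2.1
        · rw [Finset.coe_insert]
          exact h2.2.insert fun b hb _ => Or.inl (hmin b (h2.1 hb) (h3 b hb))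
        · intro p hp
          rcases Finset.mem_insert.1 hp with rfl | hp
          · exact hTw
          · exact h3 p hp)
  obtain ⟨Lo', up', hM'⟩ := exists_matching_left (k := k) (Y := U \ (Δ ×ˢ {(∅ : Finset Q)}))
    (by
      rintro c ⟨T0, hc, hcn⟩
      have hne : c.Nonempty := by
        rw [Finset.nonempty_iff_ne_empty]
        rintro rfl
        exact hcn ⟨hc.1, rfl⟩
      obtain ⟨p0, hp0⟩ := Finset.exists_minimal hne
      have hp0P : p0 ∈ P := hc.2.1.1 hp0.1
      obtain ⟨v, hv⟩ := (hA p0 hp0P).1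
      have hvp : ∀ p ∈ c, v ∈ A p := by
        intro p hp
        refine hmono p0 hp0P p (hc.2.1.1 hp) ?_ hv
        rcases hc.2.1.2.total hp0.1 hp with h | h
        · exact h
        · exact hp0.2 hp h
      refine ⟨v, fun S => ?_⟩
      have hn : ∀ S : Finset V, (S, c) ∈ U \ (Δ ×ˢ {(∅ : Finset Q)}) ↔ ∀ p ∈ c, S ⊆ A p := by
        intro S
        refine ⟨fun h => h.1.2.2, fun h => ⟨⟨⟨(h p0 hp0.1).trans (hA p0 hp0P).2,
          Or.inr ⟨p0, hp0P, h p0 hp0.1⟩⟩, hc.2.1, h⟩, fun h' => hne.ne_empty h'.2⟩⟩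
      rw [hn, hn]
      refine forall₂_congr fun p hp => ?_
      simp [Finset.insert_subset_iff, hvp p hp])
  rw [hh_pair_left hΔx (hUx.sub hL hLc), hh_pair_right (V := V) hOx (hUx.sub hR hRc), ← Matching.hh_sub hUx hL hLc hM',
    ← Matching.hh_sub hUx hR hRc hM]

end Pairs

section PairTrunc
variable {k : Type*} [Field k] {V W : Type*}

theorem proj_single {X : Type*} (Z : Set X) (x : X) :
    proj k Z (Finsupp.single x 1) = if x ∈ Z then Finsupp.single x (1 : k) else 0 := by
  simp [proj]

theorem hh_tr_pair_left {C : Set (Finset V)} (hC : Cx (tr (bdry k V) C) C Finset.card)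
    (hC' : Cx (tr (pairD k V W) (C ×ˢ {∅})) (C ×ˢ {∅}) (pairDeg V W)) (n : ℕ) :
    hh (tr (bdry k V) C) (Fam k C Finset.card) n =
      hh (tr (pairD k V W) (C ×ˢ {∅})) (Fam k (C ×ˢ {∅}) (pairDeg V W)) n := by
  have hp : ∀ v, proj k (C ×ˢ {(∅ : Finset W)}) (box k _ _ v (Finsupp.single ∅ 1)) =
      box k _ _ (proj k C v) (Finsupp.single ∅ 1) := by
    intro v
    ext ⟨S, G⟩
    rw [proj_apply, box_apply, box_apply, proj_apply]
    by_cases hG : G = ∅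
    · subst hG; simp
    · simp [hG, Finsupp.single_eq_of_ne hG]
  refine hh_relabel hC hC' (fun S => (S, ∅)) (fun _ => 1) 0 1 one_ne_zero ?_
    (fun _ _ => one_ne_zero) ?_ ((box k _ _).flip (Finsupp.single ∅ 1)) ?_ ?_ n
  · refine ⟨fun S hS => ⟨hS, rfl⟩, fun S _ T _ h => congrArg Prod.fst h, ?_⟩
    rintro ⟨S, G⟩ ⟨hS, rfl⟩
    exact ⟨S, hS, rfl⟩
  · intro S _; simp [pdeg]
  · intro S _; rw [LinearMap.flip_apply, box_single, one_smul]
  · intro S _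
    rw [LinearMap.flip_apply, box_single, tr, LinearMap.comp_apply, tensD_single, bdry_one,
      map_zero, smul_zero, add_zero, hp]
    simp [tr]

theorem hh_tr_pair_right {C : Set (Finset W)} (hC : Cx (tr (bdry k W) C) C Finset.card)
    (hC' : Cx (tr (pairD k V W) ({∅} ×ˢ C)) ({∅} ×ˢ C) (pairDeg V W)) (n : ℕ) :
    hh (tr (bdry k W) C) (Fam k C Finset.card) n =
      hh (tr (pairD k V W) ({∅} ×ˢ C)) (Fam k ({∅} ×ˢ C) (pairDeg V W)) n := by
  have hp : ∀ v, proj k ({(∅ : Finset V)} ×ˢ C) (box k _ _ (Finsupp.single ∅ 1) v) =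
      box k _ _ (Finsupp.single ∅ 1) (proj k C v) := by
    intro v
    ext ⟨S, G⟩
    rw [proj_apply, box_apply, box_apply, proj_apply]
    by_cases hG : S = ∅
    · subst hG; simp
    · simp [hG, Finsupp.single_eq_of_ne hG]
  refine hh_relabel hC hC' (fun S => (∅, S)) (fun _ => 1) 0 1 one_ne_zero ?_
    (fun _ _ => one_ne_zero) ?_ (box k _ _ (Finsupp.single ∅ 1)) ?_ ?_ n
  · refine ⟨fun S hS => ⟨rfl, hS⟩, fun S _ T _ h => congrArg Prod.snd h, ?_⟩
    rintro ⟨S, G⟩ ⟨rfl, hG⟩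
    exact ⟨G, hG, rfl⟩
  · intro S _; simp [pdeg]
  · intro S _; rw [box_single, one_smul]
  · intro S _
    rw [box_single, tr, LinearMap.comp_apply, tensD_single, bdry_one, map_zero,
      LinearMap.zero_apply, zero_add, Finset.card_empty, pow_zero, one_smul, hp]
    simp [tr]

end PairTrunc

/-- The classical decision procedure for equality of indices. -/
abbrev finDecEq (t : ℕ) : DecidableEq (Fin t) := fun a b => Classical.propDecidable (a = b)

/-- The classical decision procedure for equality of monomials. -/
abbrev monDecEq (σ : Type*) : DecidableEq (Mon σ) := fun a b => Classical.propDecidable (a = b)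

section Koszul
attribute [local instance] finDecEq monDecEq
variable {t : ℕ}

theorem mlcm_mono {σ : Type*} {S T : Finset (Mon σ)} (h : S ⊆ T) : mlcm S ≤ mlcm T :=
  Finset.sup_mono h

theorem mlcm_le_iff {σ : Type*} {S : Finset (Mon σ)} {m : Mon σ} :
    mlcm S ≤ m ↔ ∀ s ∈ S, s ≤ m := Finset.sup_le_iff

theorem le_mlcm {σ : Type*} {S : Finset (Mon σ)} {m : Mon σ} (h : m ∈ S) : m ≤ mlcm S :=
  Finset.le_sup (f := id) h

theorem mlcm_insert {σ : Type*} (S : Finset (Mon σ)) (m : Mon σ) :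
    mlcm (insert m S) = m ⊔ mlcm S := by simp [mlcm, Finset.sup_insert]

@[simp] theorem mlcm_empty {σ : Type*} : mlcm (∅ : Finset (Mon σ)) = 0 := by
  simp [mlcm]; rfl

theorem upperSet_mono {σ : Type*} {M : Finset (Mon σ)} {a b : Mon σ} (ha : a ∈ upperSet M)
    (h : a ≤ b) : b ∈ upperSet M := by
  obtain ⟨m, hm, hma⟩ := ha
  exact ⟨m, hm, hma.trans h⟩

theorem chi_mono {F G : Finset (Fin t)} (h : F ⊆ G) : chi F ≤ chi G := by
  intro i
  simp only [chi]
  split_ifs with h1 h2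
  · exact le_rfl
  · exact absurd (h h1) h2
  · exact Nat.zero_le _
  · exact le_rfl

/-- The multigraded Betti numbers via the Taylor complex. -/
theorem bettiDim_eq_hh (k : Type*) [Field k] (M : Finset (Mon (Fin t))) (n : ℕ)
    (α : Mon (Fin t)) : bettiDim k (upperSet M) n α =
      hh (tr (bdry k _) {S | S ⊆ M ∧ mlcm S = α}) (Fam k {S | S ⊆ M ∧ mlcm S = α} Finset.card) n := by
  set J := upperSet M
  set K : Set (Finset (Fin t)) := {F | chi F ≤ α ∧ (fun j => α j - chi F j) ∉ J} with hK
  set L : Set (Finset (Mon (Fin t))) := {S | S ⊆ M ∧ mlcm S = α} with hL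
  have h1 : bettiDim k J n α = hh (tr (bdry k _) K) (Fam k K Finset.card) n := by
    have hs : ∀ m, koszulSub k J α m = Fam k K Finset.card m := by
      intro m
      rw [koszulSub, Fam_eq_span]
      congr 2
      ext F
      simp only [hK, Set.mem_ofPred_eq]
      tauto
    rw [bettiDim, hs, hs]
    refine hh_congr (D := koszulD k J α) (fun F hF => ?_) n
    rw [koszulD, Finsupp.linearCombination_single, one_smul, koszulAux, tr, LinearMap.comp_apply,
      bdry_single, map_sum]
    refine Finset.sum_congr rfl fun i hi => ?_
    rw [map_smul, proj_single, neg_one_pow_rankIn hi]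
    have : chi (F.erase i) ≤ α := (chi_mono (Finset.erase_subset _ _)).trans hF.1
    have he : @Finset.erase _ (instDecidableEqFin t) F i = F.erase i := by
      congr 1
      exact Subsingleton.elim _ _
    rw [he]
    simp only [hK, Set.mem_ofPred_eq, this, true_and]
    by_cases hJ : (fun j => α j - chi (F.erase i) j) ∈ J <;> simp [hJ]
  rw [h1]
  have hchi : {F : Finset (Fin t) | chi F ≤ α} ⊆ {F | F ⊆ Finset.univ} := fun F _ => by simp
  have hchic : Closed (bdry k _) {F : Finset (Fin t) | chi F ≤ α} := by
    intro F hF G hG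
    obtain ⟨x, hx, rfl⟩ := bdry_single_ne_zero hG
    exact (chi_mono (Finset.erase_subset _ _)).trans hF
  have hJ : ∀ {F G : Finset (Fin t)}, G ⊆ F → (fun j => α j - chi F j) ∈ J →
      (fun j => α j - chi G j) ∈ J := fun h hF =>
    upperSet_mono hF fun j => Nat.sub_le_sub_left (chi_mono h j) _
  have hKx : Cx (tr (bdry k _) K) K Finset.card := by
    refine ((bdry_cx (k := k) Finset.univ).sub hchi hchic).quot (fun F hF => hF.1) ?_
    intro F hF G hG
    obtain ⟨x, hx, rfl⟩ := bdry_single_ne_zero hG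
    refine ⟨hchic F hF.1 _ hG, fun h => h.2 (hJ (Finset.erase_subset _ _) ?_)⟩
    by_contra h'
    exact hF.2 ⟨hF.1, h'⟩
  have hLx : Cx (tr (bdry k _) L) L Finset.card := by
    refine Cx.quot (C := {S | S ⊆ M ∧ mlcm S ≤ α}) ((bdry_cx (k := k) M).sub (fun S hS => hS.1) ?_) (fun S hS => ⟨hS.1, hS.2.le⟩) ?_
    · intro S hS G hG
      obtain ⟨x, hx, rfl⟩ := bdry_single_ne_zero hG
      exact ⟨(Finset.erase_subset _ _).trans hS.1, (mlcm_mono (Finset.erase_subset _ _)).trans hS.2⟩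
    · intro S hS G hG
      obtain ⟨x, hx, rfl⟩ := bdry_single_ne_zero hG
      have hle := mlcm_mono (Finset.erase_subset x S)
      exact ⟨⟨(Finset.erase_subset _ _).trans hS.1.1, hle.trans hS.1.2⟩, fun h =>
        hS.2 ⟨hS.1.1, le_antisymm hS.1.2 (h.2 ▸ hle)⟩⟩
  let C : Set (Finset (Mon (Fin t)) × Finset (Fin t)) := {p | p.1 ⊆ M ∧ mlcm p.1 + chi p.2 ≤ α}
  have hCmono : ∀ {S S' : Finset (Mon (Fin t))} {G G' : Finset (Fin t)}, (S, G) ∈ C → S' ⊆ S →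
      G' ⊆ G → (S', G') ∈ C := fun h hS hG =>
    ⟨hS.trans h.1, (add_le_add (mlcm_mono hS) (chi_mono hG)).trans h.2⟩
  have hCc : Closed (pairD k (Mon (Fin t)) (Fin t)) C := by
    rintro ⟨S, G⟩ hp y hy
    obtain ⟨x, hx, rfl⟩ | ⟨x, hx, rfl⟩ := pairD_face hy
    · exact hCmono hp (Finset.erase_subset _ _) subset_rfl
    · exact hCmono hp subset_rfl (Finset.erase_subset _ _)
  have hCx : Cx (pairD k (Mon (Fin t)) (Fin t)) C (pairDeg _ _) :=
    ((bdry_cx (k := k) M).tens (bdry_cx (k := k) Finset.univ)).sub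
      (fun w hw => ⟨hw.1, by simp⟩) hCc
  have hCiff : ∀ S G, (S, G) ∈ C ↔ S ⊆ M ∧ chi G ≤ α ∧ mlcm S ≤ fun j => α j - chi G j := by
    intro S G
    refine and_congr_right fun _ => ⟨fun h => ⟨fun i => ?_, fun i => ?_⟩, fun h i => ?_⟩
    · have : mlcm S i + chi G i ≤ α i := h i
      exact le_trans (Nat.le_add_left _ _) this
    · have : mlcm S i + chi G i ≤ α i := h i
      change mlcm S i ≤ α i - chi G i
      omega
    · have h1 : chi G i ≤ α i := h.1 i
      have h2 : mlcm S i ≤ α i - chi G i := h.2 i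
      change mlcm S i + chi G i ≤ α i
      omega
  have hsub1 : {(∅ : Finset (Mon (Fin t)))} ×ˢ K ⊆ C := by
    rintro ⟨S, G⟩ ⟨rfl, hG⟩
    rw [hCiff]
    exact ⟨by simp, hG.1, by simp⟩
  have hdiff1 : ∀ S G, (S, G) ∈ C \ ({(∅ : Finset (Mon (Fin t)))} ×ˢ K) ↔
      (S, G) ∈ C ∧ (fun j => α j - chi G j) ∈ J := by
    intro S G
    refine ⟨fun h => ⟨h.1, ?_⟩, fun h => ⟨h.1, fun h' => h'.2.2 h.2⟩⟩
    by_contra hn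
    have hp := (hCiff _ _).1 h.1
    have hS : S ≠ ∅ := by
      rintro rfl
      exact h.2 ⟨rfl, hp.2.1, hn⟩
    obtain ⟨s, hs⟩ := Finset.nonempty_iff_ne_empty.2 hS
    exact hn ⟨s, hp.1 hs, (le_mlcm hs).trans hp.2.2⟩
  have hcl1 : Closed (pairD k (Mon (Fin t)) (Fin t)) (C \ ({(∅ : Finset (Mon (Fin t)))} ×ˢ K)) := by
    rintro ⟨S, G⟩ hp ⟨S', G'⟩ hy
    rw [hdiff1] at hp ⊢
    refine ⟨hCc _ hp.1 _ hy, ?_⟩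
    obtain ⟨x, hx, h⟩ | ⟨x, hx, h⟩ := pairD_face hy
    · obtain ⟨rfl, rfl⟩ := Prod.mk.inj h; exact hp.2
    · obtain ⟨rfl, rfl⟩ := Prod.mk.inj h; exact hJ (Finset.erase_subset _ _) hp.2
  obtain ⟨Lo, up, hM⟩ := exists_matching_left (k := k)
    (Y := C \ ({(∅ : Finset (Mon (Fin t)))} ×ˢ K)) (by
      rintro G ⟨S0, hS0⟩
      obtain ⟨hS0, m, hm, hmG⟩ := (hdiff1 _ _).1 hS0
      refine ⟨m, fun S => ?_⟩
      rw [hdiff1, hdiff1, hCiff, hCiff, mlcm_insert, Finset.insert_subset_iff, sup_le_iff]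
      tauto)
  have hsub2 : L ×ˢ {(∅ : Finset (Fin t))} ⊆ C := by
    rintro ⟨S, G⟩ ⟨hS, rfl⟩
    refine ⟨hS.1, ?_⟩
    rw [show mlcm S = α from hS.2]
    intro i
    simp [chi]
  have hdiff2 : ∀ S G, (S, G) ∈ C \ (L ×ˢ {(∅ : Finset (Fin t))}) ↔ (S, G) ∈ C ∧ mlcm S ≠ α := by
    intro S G
    refine ⟨fun h => ⟨h.1, fun hS => h.2 ⟨⟨h.1.1, hS⟩, ?_⟩⟩, fun h => ⟨h.1, fun h' => h.2 h'.1.2⟩⟩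
    refine Finset.eq_empty_of_forall_notMem fun i hi => ?_
    have := h.1.2 i
    simp only [Pi.add_apply, hS, chi, if_pos hi] at this
    omega
  have hcl2 : Closed (pairD k (Mon (Fin t)) (Fin t)) (C \ (L ×ˢ {(∅ : Finset (Fin t))})) := by
    rintro ⟨S, G⟩ hp ⟨S', G'⟩ hy
    rw [hdiff2] at hp ⊢
    refine ⟨hCc _ hp.1 _ hy, ?_⟩
    obtain ⟨x, hx, h⟩ | ⟨x, hx, h⟩ := pairD_face hy
    · obtain ⟨rfl, rfl⟩ := Prod.mk.inj h
      intro h'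
      refine hp.2 (le_antisymm ?_ (h' ▸ mlcm_mono (Finset.erase_subset _ _)))
      exact ((hCiff _ _).1 hp.1).2.2.trans fun i => Nat.sub_le _ _
    · obtain ⟨rfl, rfl⟩ := Prod.mk.inj h; exact hp.2
  obtain ⟨Lo', up', hM'⟩ := exists_matching_right (k := k)
    (Y := C \ (L ×ˢ {(∅ : Finset (Fin t))})) (by
      rintro S ⟨G0, hG0⟩
      obtain ⟨hG0, hSα⟩ := (hdiff2 _ _).1 hG0
      have hle : mlcm S ≤ α := ((hCiff _ _).1 hG0).2.2.trans fun i => Nat.sub_le _ _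
      obtain ⟨i, hi⟩ : ∃ i, mlcm S i < α i := by
        by_contra! hcon
        exact hSα (le_antisymm hle hcon)
      refine ⟨i, fun G => ?_⟩
      rw [hdiff2, hdiff2]
      refine and_congr_left fun _ => ⟨fun h => hCmono h subset_rfl (Finset.subset_insert _ _),
        fun h => ⟨h.1, fun j => ?_⟩⟩
      have := h.2 j
      simp only [Pi.add_apply, chi, Finset.mem_insert] at this ⊢
      by_cases hj : j = i
      · subst hj; simpa using hi
      · simp only [hj, false_or]
        convert this using 3)
  rw [hh_tr_pair_right (V := Mon (Fin t)) hKx (hCx.quot hsub1 hcl1), ← Matching.hh_quot hCx hsub1 hcl1 hM,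
    hh_tr_pair_left (W := Fin t) hLx (hCx.quot hsub2 hcl2), ← Matching.hh_quot hCx hsub2 hcl2 hM']

end Koszul

section TaylorBar
variable {k : Type*} [Field k] {σ : Type*}

/-- Basis elements `x^γ e_S` of the Taylor algebra, indexed by total multidegree `γ`. -/
abbrev TX (σ : Type*) := Mon σ × Finset (Mon σ)

/-- The inclusion of the exterior algebra in multidegree `γ`. -/
def emb (k : Type*) [Field k] (γ : Mon σ) : (Finset (Mon σ) →₀ k) →ₗ[k] (TX σ →₀ k) :=
  Finsupp.lmapDomain k k (Prod.mk γ)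

@[simp] theorem emb_single (γ : Mon σ) (S : Finset (Mon σ)) (c : k) :
    emb k γ (Finsupp.single S c) = Finsupp.single (γ, S) c := by simp [emb]

theorem emb_apply (γ γ' : Mon σ) (u : Finset (Mon σ) →₀ k) (S : Finset (Mon σ)) :
    emb k γ u (γ', S) = if γ = γ' then u S else 0 := by
  induction u using Finsupp.induction_linear with
  | zero => simp
  | add f g hf hg => rw [map_add, Finsupp.add_apply, hf, hg]; split_ifs <;> simp
  | single T r =>
    rw [emb_single, Finsupp.single_apply, Finsupp.single_apply]
    simp only [Prod.mk.injEq]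
    split_ifs <;> simp_all

/-- The multiplication of the Taylor algebra. -/
def tmul (k : Type*) [Field k] (σ : Type*) :
    (TX σ →₀ k) →ₗ[k] (TX σ →₀ k) →ₗ[k] (TX σ →₀ k) :=
  Finsupp.linearCombination k fun a => Finsupp.linearCombination k fun b =>
    emb k (a.1 + b.1) (emul k _ (Finsupp.single a.2 1) (Finsupp.single b.2 1))

/-- The differential of the Taylor algebra. -/
def tdif (k : Type*) [Field k] (σ : Type*) : (TX σ →₀ k) →ₗ[k] (TX σ →₀ k) :=
  Finsupp.linearCombination k fun a => emb k a.1 (bdry k _ (Finsupp.single a.2 1))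

/-- The grading involution of the Taylor algebra. -/
def tbar (k : Type*) [Field k] (σ : Type*) : (TX σ →₀ k) →ₗ[k] (TX σ →₀ k) :=
  Finsupp.linearCombination k fun a => emb k a.1 (ebar k _ (Finsupp.single a.2 1))

theorem tmul_emb (γ γ' : Mon σ) (u v : Finset (Mon σ) →₀ k) :
    tmul k σ (emb k γ u) (emb k γ' v) = emb k (γ + γ') (emul k _ u v) := by
  induction u using Finsupp.induction_linear with
  | zero => simp
  | add f g hf hg => simp [hf, hg]
  | single S r =>
  induction v using Finsupp.induction_linear with
  | zero => simp
  | add f g hf hg => simp only [map_add, hf, hg]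
  | single T s =>
    have hS : (Finsupp.single S r : Finset (Mon σ) →₀ k) = r • Finsupp.single S 1 := by simp
    have hT : (Finsupp.single T s : Finset (Mon σ) →₀ k) = s • Finsupp.single T 1 := by simp
    rw [hS, hT]
    simp only [map_smul, LinearMap.smul_apply, emb_single]
    simp [tmul]

theorem tdif_emb (γ : Mon σ) (u : Finset (Mon σ) →₀ k) :
    tdif k σ (emb k γ u) = emb k γ (bdry k _ u) := by
  have : tdif k σ ∘ₗ emb k γ = emb k γ ∘ₗ bdry k _ := by
    ext1 S
    ext1
    simp [tdif]
  exact LinearMap.congr_fun this u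

theorem tbar_emb (γ : Mon σ) (u : Finset (Mon σ) →₀ k) :
    tbar k σ (emb k γ u) = emb k γ (ebar k _ u) := by
  have : tbar k σ ∘ₗ emb k γ = emb k γ ∘ₗ ebar k _ := by
    ext1 S
    ext1
    simp [tbar]
  exact LinearMap.congr_fun this u

theorem single_eq_emb (a : TX σ) : Finsupp.single a (1 : k) = emb k a.1 (Finsupp.single a.2 1) := by
  simp

theorem tx_induction {p : (TX σ →₀ k) → Prop} (a : TX σ →₀ k) (h0 : p 0)
    (hadd : ∀ a b, p a → p b → p (a + b)) (he : ∀ γ u, p (emb k γ u)) : p a := by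
  induction a using Finsupp.induction_linear with
  | zero => exact h0
  | add f g hf hg => exact hadd f g hf hg
  | single x r =>
    have := he x.1 (Finsupp.single x.2 r)
    rwa [emb_single] at this

theorem tmul_assoc (a b c : TX σ →₀ k) :
    tmul k σ (tmul k σ a b) c = tmul k σ a (tmul k σ b c) := by
  induction a using tx_induction with
  | h0 => simp
  | hadd a b ha hb => simp [ha, hb]
  | he γ u =>
  induction b using tx_induction with
  | h0 => simp
  | hadd a b ha hb => simp [ha, hb]
  | he γ' v =>
  induction c using tx_induction with
  | h0 => simp
  | hadd a b ha hb => simp only [map_add, ha, hb]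
  | he γ'' w => simp only [tmul_emb, emul_assoc, add_assoc]

theorem tdif_tmul (a b : TX σ →₀ k) : tdif k σ (tmul k σ a b) =
    tmul k σ (tdif k σ a) b + tmul k σ (tbar k σ a) (tdif k σ b) := by
  induction a using tx_induction with
  | h0 => simp
  | hadd a b ha hb => simp only [map_add, LinearMap.add_apply, ha, hb]; abel
  | he γ u =>
  induction b using tx_induction with
  | h0 => simp
  | hadd a b ha hb => simp only [map_add, ha, hb]; abel
  | he γ' v => simp only [tmul_emb, tdif_emb, tbar_emb, bdry_emul, map_add]

theorem tbar_tmul (a b : TX σ →₀ k) : tbar k σ (tmul k σ a b) =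
    tmul k σ (tbar k σ a) (tbar k σ b) := by
  induction a using tx_induction with
  | h0 => simp
  | hadd a b ha hb => simp only [map_add, LinearMap.add_apply, ha, hb]
  | he γ u =>
  induction b using tx_induction with
  | h0 => simp
  | hadd a b ha hb => simp only [map_add, ha, hb]
  | he γ' v => simp only [tmul_emb, tbar_emb, ebar_emul]

theorem tdif_tdif (a : TX σ →₀ k) : tdif k σ (tdif k σ a) = 0 := by
  induction a using tx_induction with
  | h0 => simp
  | hadd a b ha hb => simp only [map_add, ha, hb, add_zero]
  | he γ u => simp only [tdif_emb, bdry_bdry, map_zero]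

theorem tbar_tbar (a : TX σ →₀ k) : tbar k σ (tbar k σ a) = a := by
  induction a using tx_induction with
  | h0 => simp
  | hadd a b ha hb => simp only [map_add, ha, hb]
  | he γ u => simp only [tbar_emb, ebar_ebar]

theorem tdif_tbar (a : TX σ →₀ k) : tdif k σ (tbar k σ a) = -tbar k σ (tdif k σ a) := by
  induction a using tx_induction with
  | h0 => simp
  | hadd a b ha hb => simp only [map_add, ha, hb]; abel
  | he γ u => simp only [tdif_emb, tbar_emb, bdry_ebar, map_neg]

theorem tbar_single (a : TX σ) : tbar k σ (Finsupp.single a 1) =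
    (-1 : k) ^ a.2.card • Finsupp.single a (1 : k) := by
  rw [single_eq_emb, tbar_emb, ebar_single, map_smul]

theorem tmul_single (a b : TX σ) : tmul k σ (Finsupp.single a 1) (Finsupp.single b 1) =
    sg k a.2 b.2 • Finsupp.single (a.1 + b.1, a.2 ∪ b.2) (1 : k) := by
  rw [single_eq_emb a, single_eq_emb b, tmul_emb, emul_single, map_smul, emb_single]

theorem tdif_single_apply (a b : TX σ) : tdif k σ (Finsupp.single a 1) b =
    if a.1 = b.1 then bdry k _ (Finsupp.single a.2 1) b.2 else 0 := by
  rw [single_eq_emb a, tdif_emb, ← emb_apply]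

theorem tdif_single_ne_zero_iff {a b : TX σ} : tdif k σ (Finsupp.single a 1) b ≠ 0 ↔
    ∃ m ∈ a.2, b = (a.1, a.2.erase m) := by
  rw [tdif_single_apply]
  constructor
  · intro h
    have h1 : a.1 = b.1 := by by_contra h1; exact h (if_neg h1)
    rw [if_pos h1] at h
    obtain ⟨m, hm, h2⟩ := bdry_single_ne_zero h
    exact ⟨m, hm, Prod.ext h1.symm h2⟩
  · rintro ⟨m, hm, rfl⟩
    simpa using bdry_single_erase_ne_zero hm

theorem tmul_single_ne_zero_iff {a b c : TX σ} :
    tmul k σ (Finsupp.single a 1) (Finsupp.single b 1) c ≠ 0 ↔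
      Disjoint a.2 b.2 ∧ c = (a.1 + b.1, a.2 ∪ b.2) := by
  rw [tmul_single, Finsupp.smul_apply, smul_eq_mul, mul_ne_zero_iff, Ne, sg_eq_zero_iff, not_not]
  refine and_congr_right fun _ => ?_
  rw [Finsupp.single_apply_ne_zero]
  simp

/-- Prepending an element. -/
def consL (k : Type*) [Field k] (X : Type*) :
    (X →₀ k) →ₗ[k] (List X →₀ k) →ₗ[k] (List X →₀ k) :=
  (box k X (List X)).compr₂ (Finsupp.lmapDomain k k fun p => p.1 :: p.2)

theorem consL_single {X : Type*} (a : X) (l : List X) :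
    consL k X (Finsupp.single a 1) (Finsupp.single l 1) = Finsupp.single (a :: l) 1 := by
  simp [consL, box_single]

theorem consL_nil {X : Type*} (u : X →₀ k) (v : List X →₀ k) : consL k X u v [] = 0 := by
  rw [consL, LinearMap.compr₂_apply, Finsupp.lmapDomain_apply, Finsupp.mapDomain_of_notMem_range]
  simp

theorem consL_cons {X : Type*} (u : X →₀ k) (v : List X →₀ k) (a : X) (l : List X) :
    consL k X u v (a :: l) = u a * v l := by
  have hinj : Function.Injective fun p : X × List X => p.1 :: p.2 := by
    rintro ⟨a, l⟩ ⟨b, l'⟩ h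
    simpa using h
  rw [consL, LinearMap.compr₂_apply, Finsupp.lmapDomain_apply, ← box_apply]
  exact Finsupp.mapDomain_apply hinj _ (a, l)

/-- Multiplying into the first entry of a list, on basis elements. -/
def mrgAux (k : Type*) [Field k] (σ : Type*) :
    List (TX σ) → ((TX σ →₀ k) →ₗ[k] (List (TX σ) →₀ k))
  | [] => 0
  | b :: l => (consL k (TX σ)).flip (Finsupp.single l 1) ∘ₗ
      (tmul k σ).flip (Finsupp.single b 1)

/-- Multiplying into the first entry of a list. -/
def mrg (k : Type*) [Field k] (σ : Type*) :
    (TX σ →₀ k) →ₗ[k] (List (TX σ) →₀ k) →ₗ[k] (List (TX σ) →₀ k) :=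
  (Finsupp.linearCombination k (mrgAux k σ)).flip

theorem mrg_nil (u : TX σ →₀ k) : mrg k σ u (Finsupp.single [] 1) = 0 := by
  simp [mrg, mrgAux]

theorem mrg_consL (u v : TX σ →₀ k) (w : List (TX σ) →₀ k) :
    mrg k σ u (consL k _ v w) = consL k _ (tmul k σ u v) w := by
  induction v using Finsupp.induction_linear with
  | zero => simp
  | add f g hf hg => simp [hf, hg]
  | single b r =>
  induction w using Finsupp.induction_linear with
  | zero => simp
  | add f g hf hg => simp only [map_add, hf, hg]
  | single l s =>
    have h1 : (Finsupp.single b r : TX σ →₀ k) = r • Finsupp.single b 1 := by simp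
    have h2 : (Finsupp.single l s : List (TX σ) →₀ k) = s • Finsupp.single l 1 := by simp
    rw [h1, h2]
    simp only [map_smul, LinearMap.smul_apply, consL_single]
    congr 2
    simp [mrg, mrgAux]

theorem mrg_mrg (u v : TX σ →₀ k) (w : List (TX σ) →₀ k) :
    mrg k σ u (mrg k σ v w) = mrg k σ (tmul k σ u v) w := by
  induction w using Finsupp.induction_linear with
  | zero => simp
  | add f g hf hg => simp only [map_add, hf, hg]
  | single l s =>
    have h2 : (Finsupp.single l s : List (TX σ) →₀ k) = s • Finsupp.single l 1 := by simp
    rw [h2, map_smul, map_smul, map_smul]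
    congr 1
    cases l with
    | nil => simp [mrg_nil]
    | cons b l => rw [← consL_single, mrg_consL, mrg_consL, mrg_consL, tmul_assoc]

/-- The differential of the bar construction of the Taylor algebra on basis elements. -/
def tbarDAux (k : Type*) [Field k] (σ : Type*) : List (TX σ) → (List (TX σ) →₀ k)
  | [] => 0
  | a :: l => consL k _ (tdif k σ (Finsupp.single a 1)) (Finsupp.single l 1)
      - mrg k σ (tbar k σ (Finsupp.single a 1)) (Finsupp.single l 1)
      - consL k _ (tbar k σ (Finsupp.single a 1)) (tbarDAux k σ l)

/-- The differential of the bar construction of the Taylor algebra. -/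
def tbarD (k : Type*) [Field k] (σ : Type*) :
    (List (TX σ) →₀ k) →ₗ[k] (List (TX σ) →₀ k) :=
  Finsupp.linearCombination k (tbarDAux k σ)

theorem tbarD_single (l : List (TX σ)) : tbarD k σ (Finsupp.single l 1) = tbarDAux k σ l := by
  simp [tbarD]

theorem tbarD_consL (u : TX σ →₀ k) (w : List (TX σ) →₀ k) : tbarD k σ (consL k _ u w) =
    consL k _ (tdif k σ u) w - mrg k σ (tbar k σ u) w - consL k _ (tbar k σ u) (tbarD k σ w) := by
  induction u using Finsupp.induction_linear with
  | zero => simp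
  | add f g hf hg => simp only [map_add, LinearMap.add_apply, hf, hg]; abel
  | single b r =>
  induction w using Finsupp.induction_linear with
  | zero => simp
  | add f g hf hg => simp only [map_add, hf, hg]; abel
  | single l s =>
    have h1 : (Finsupp.single b r : TX σ →₀ k) = r • Finsupp.single b 1 := by simp
    have h2 : (Finsupp.single l s : List (TX σ) →₀ k) = s • Finsupp.single l 1 := by simp
    rw [h1, h2]
    simp only [map_smul, LinearMap.smul_apply, consL_single, tbarD_single, tbarDAux, smul_sub]

theorem tbarD_mrg (u : TX σ →₀ k) (w : List (TX σ) →₀ k) : tbarD k σ (mrg k σ (tbar k σ u) w) =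
    mrg k σ (tdif k σ (tbar k σ u)) w + mrg k σ u (tbarD k σ w) := by
  induction w using Finsupp.induction_linear with
  | zero => simp
  | add f g hf hg => simp only [map_add, hf, hg]; abel
  | single l s =>
    have h2 : (Finsupp.single l s : List (TX σ) →₀ k) = s • Finsupp.single l 1 := by simp
    rw [h2]
    simp only [map_smul]
    rw [← smul_add]
    congr 1
    cases l with
    | nil => simp [mrg_nil, tbarD_single, tbarDAux]
    | cons b l =>
      rw [← consL_single, mrg_consL, mrg_consL, tbarD_consL, tbarD_consL, tdif_tmul, tbar_tmul,
        tbar_tbar, map_sub, map_sub, mrg_consL, mrg_consL, mrg_mrg, map_add, LinearMap.add_apply]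
      abel

theorem tbarD_tbarD (w : List (TX σ) →₀ k) : tbarD k σ (tbarD k σ w) = 0 := by
  have key : ∀ l : List (TX σ), tbarD k σ (tbarD k σ (Finsupp.single l 1)) = 0 := by
    intro l
    induction l with
    | nil => simp [tbarD_single, tbarDAux]
    | cons a l ih =>
      rw [← consL_single, tbarD_consL, map_sub, map_sub, tbarD_consL, tbarD_consL, tbarD_mrg, ih,
        tdif_tdif, tdif_tbar, tbar_tbar]
      simp only [map_zero, map_neg, LinearMap.zero_apply, LinearMap.neg_apply]
      abel
  induction w using Finsupp.induction_linear with
  | zero => simp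
  | add f g hf hg => simp only [map_add, hf, hg, add_zero]
  | single l s =>
    have h2 : (Finsupp.single l s : List (TX σ) →₀ k) = s • Finsupp.single l 1 := by simp
    rw [h2, map_smul, map_smul, key, smul_zero]

theorem tbarD_nil_right (l : List (TX σ)) : tbarD k σ (Finsupp.single l 1) [] = 0 := by
  cases l with
  | nil => simp [tbarD_single, tbarDAux]
  | cons a l =>
    rw [← consL_single, tbarD_consL]
    simp only [Finsupp.sub_apply, consL_nil, zero_sub, sub_zero, neg_eq_zero]
    cases l with
    | nil => simp [mrg_nil]
    | cons b l => rw [← consL_single, mrg_consL, consL_nil]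

theorem tbarD_single_one (a : TX σ) (b : TX σ) (l : List (TX σ)) :
    tbarD k σ (Finsupp.single [a] 1) (b :: l) =
      if l = [] then tdif k σ (Finsupp.single a 1) b else 0 := by
  rw [← consL_single, tbarD_consL, mrg_nil, tbarD_single, tbarDAux]
  simp only [map_zero, sub_zero, consL_cons, Finsupp.single_apply]
  simp [eq_comm]

/-- The coefficients of the differential. -/
theorem tbarD_cons_cons (a b c : TX σ) (l l' : List (TX σ)) :
    tbarD k σ (Finsupp.single (a :: c :: l) 1) (b :: l') =
      (if l' = c :: l then tdif k σ (Finsupp.single a 1) b else 0) -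
      (if l' = l then
        (-1 : k) ^ a.2.card * tmul k σ (Finsupp.single a 1) (Finsupp.single c 1) b else 0) -
      (if a = b then (-1 : k) ^ a.2.card * tbarD k σ (Finsupp.single (c :: l) 1) l' else 0) := by
  rw [← consL_single, tbarD_consL, tbar_single]
  have : mrg k σ ((-1 : k) ^ a.2.card • Finsupp.single a 1) (Finsupp.single (c :: l) 1) =
      (-1 : k) ^ a.2.card • consL k _ (tmul k σ (Finsupp.single a 1) (Finsupp.single c 1))
        (Finsupp.single l 1) := by
    rw [← consL_single, mrg_consL, map_smul, LinearMap.smul_apply, map_smul,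
      LinearMap.smul_apply]
  rw [this]
  simp only [Finsupp.sub_apply, consL_cons, Finsupp.single_apply, map_smul, LinearMap.smul_apply,
    Finsupp.smul_apply, smul_eq_mul]
  simp only [eq_comm (a := l'), mul_ite, mul_one, one_mul, mul_zero, ite_mul, zero_mul]

/-- `l'` appears in the differential of `l`. -/
inductive BFace : List (TX σ) → List (TX σ) → Prop
  | del (γ : Mon σ) {S : Finset (Mon σ)} {m : Mon σ} (hm : m ∈ S) (l : List (TX σ)) :
      BFace ((γ, S) :: l) ((γ, S.erase m) :: l)
  | merge {a b : TX σ} (h : Disjoint a.2 b.2) (l : List (TX σ)) :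
      BFace (a :: b :: l) ((a.1 + b.1, a.2 ∪ b.2) :: l)
  | cons (a : TX σ) {l l' : List (TX σ)} (h : BFace l l') : BFace (a :: l) (a :: l')

theorem BFace.of_coeff {l l' : List (TX σ)} (h : tbarD k σ (Finsupp.single l 1) l' ≠ 0) :
    BFace l l' := by
  induction l generalizing l' with
  | nil => simp [tbarD_single, tbarDAux] at h
  | cons a l ih =>
    cases l' with
    | nil => exact absurd (tbarD_nil_right _) h
    | cons b l' =>
      cases l with
      | nil =>
        rw [tbarD_single_one] at h
        obtain ⟨rfl, h3⟩ := ite_ne_right_iff.1 h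
        obtain ⟨m, hm, rfl⟩ := tdif_single_ne_zero_iff.1 h3
        exact .del a.1 hm []
      | cons c l =>
        rw [tbarD_cons_cons] at h
        by_cases h1 : (if l' = c :: l then tdif k σ (Finsupp.single a 1) b else 0) = 0
        · by_cases h2 : (if l' = l then
            (-1 : k) ^ a.2.card * tmul k σ (Finsupp.single a 1) (Finsupp.single c 1) b else 0) = 0
          · rw [h1, h2, sub_zero, zero_sub, neg_ne_zero] at h
            obtain ⟨rfl, h3⟩ := ite_ne_right_iff.1 h
            exact .cons a (ih (right_ne_zero_of_mul h3))
          · obtain ⟨rfl, h3⟩ := ite_ne_right_iff.1 h2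
            obtain ⟨hd, rfl⟩ := tmul_single_ne_zero_iff.1 (right_ne_zero_of_mul h3)
            exact .merge hd l'
        · obtain ⟨rfl, h3⟩ := ite_ne_right_iff.1 h1
          obtain ⟨m, hm, rfl⟩ := tdif_single_ne_zero_iff.1 h3
          exact .del a.1 hm (c :: l)

/-- The homological degree in the bar construction. -/
def tdeg (l : List (TX σ)) : ℕ := (l.map fun a => a.2.card + 1).sum

theorem tdeg_cons (a : TX σ) (l : List (TX σ)) : tdeg (a :: l) = a.2.card + 1 + tdeg l := by
  simp [tdeg]

theorem BFace.deg {l l' : List (TX σ)} (h : BFace l l') : tdeg l' + 1 = tdeg l := by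
  induction h with
  | del γ hm l =>
    simp only [tdeg_cons]
    rw [← Finset.card_erase_add_one hm]
    ring
  | merge h l =>
    simp only [tdeg_cons, Finset.card_union_of_disjoint h]
    ring
  | cons a h ih => simp only [tdeg_cons, ← ih]; ring

theorem BFace.coeff {l l' : List (TX σ)} (h : BFace l l') (hl : ∀ a ∈ l, a.1 ≠ 0) :
    tbarD k σ (Finsupp.single l 1) l' ≠ 0 := by
  induction h with
  | @del γ S m hm l =>
    have h1 : tdif k σ (Finsupp.single (γ, S) 1) (γ, S.erase m) ≠ 0 :=
      tdif_single_ne_zero_iff.2 ⟨m, hm, rfl⟩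
    cases l with
    | nil => rwa [tbarD_single_one, if_pos rfl]
    | cons c l =>
      rw [tbarD_cons_cons, if_pos rfl, if_neg (by simp), if_neg, sub_zero, sub_zero]
      · exact h1
      · rw [Prod.mk.injEq]
        exact fun h => (Finset.notMem_erase m S) (h.2 ▸ hm)
  | @merge a b h l =>
    rw [tbarD_cons_cons, if_neg (by simp), if_pos rfl, if_neg, zero_sub, sub_zero, neg_ne_zero]
    · exact mul_ne_zero (pow_ne_zero _ (by simp)) (tmul_single_ne_zero_iff.2 ⟨h, rfl⟩)
    · intro heq
      have := congrArg Prod.fst heq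
      exact hl b (by simp) (by simpa using this)
  | @cons a l l' h ih =>
    have hne := h.deg
    cases l with
    | nil => cases h
    | cons c l =>
      rw [tbarD_cons_cons, if_neg, if_pos rfl, zero_sub, ← neg_add']
      · rw [neg_ne_zero]
        have h3 : tmul k σ (Finsupp.single a 1) (Finsupp.single c 1) a = 0 := by
          by_contra h4
          have := congrArg Prod.fst (tmul_single_ne_zero_iff.1 h4).2
          exact hl c (by simp) (by simpa using this)
        rw [h3, mul_zero, ite_self, zero_add]
        exact mul_ne_zero (pow_ne_zero _ (by simp)) (ih fun x hx => hl x (by simp [hx]))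
      · rintro rfl
        omega

end TaylorBar

theorem finite_lists {X : Type*} {A : Set X} (hA : A.Finite) (n : ℕ) :
    {l : List X | (∀ a ∈ l, a ∈ A) ∧ l.length ≤ n}.Finite := by
  have : Finite A := hA
  refine ((List.finite_length_le A n).image (List.map Subtype.val)).subset ?_
  rintro l ⟨hl, hn⟩
  exact ⟨l.attach.map fun x => ⟨x.1, hl x.1 x.2⟩, by simpa using hn, by simp⟩

/-- Transfer of the complex property along an injective relabelling of basis elements. -/
theorem Cx.of_relabel {k : Type*} [Field k] {X Y : Type*} {D : (X →₀ k) →ₗ[k] (X →₀ k)}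
    {D' : (Y →₀ k) →ₗ[k] (Y →₀ k)} {C : Set X} {C' : Set Y} {deg : X → ℕ} {deg' : Y → ℕ}
    (hC' : Cx D' C' deg') (φ : X → Y) (hφ : Function.Injective φ) (hm : ∀ x, x ∈ C ↔ φ x ∈ C')
    (hdeg : ∀ x, deg' (φ x) = deg x)
    (hcomm : ∀ x ∈ C, D' (Finsupp.single (φ x) 1) =
      Finsupp.mapDomain φ (D (Finsupp.single x 1))) : Cx D C deg := by
  have hface : ∀ x ∈ C, ∀ y, D (Finsupp.single x 1) y ≠ 0 → y ∈ C ∧ deg y + 1 = deg x := by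
    intro x hx y hy
    have := hC'.face (φ x) ((hm x).1 hx) (φ y) (by rwa [hcomm x hx, Finsupp.mapDomain_apply hφ])
    rwa [← hm, hdeg, hdeg] at this
  refine ⟨hface, fun x hx => ?_, fun n => ?_⟩
  · have h1 : ∀ v : X →₀ k, (∀ y, v y ≠ 0 → y ∈ C) →
        D' (Finsupp.mapDomain φ v) = Finsupp.mapDomain φ (D v) := by
      intro v hv
      rw [← Finsupp.sum_single v, Finsupp.sum]
      change D' (Finsupp.lmapDomain k k φ _) = Finsupp.lmapDomain k k φ _
      simp only [map_sum]
      refine Finset.sum_congr rfl fun y hy => ?_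
      have hs : (Finsupp.single y (v y) : X →₀ k) = v y • Finsupp.single y 1 := by simp
      rw [hs]
      simp only [map_smul]
      congr 1
      simpa using hcomm y (hv y (by simpa using hy))
    have h2 := hC'.sq (φ x) ((hm x).1 hx)
    rw [hcomm x hx, h1 _ (fun y hy => (hface x hx y hy).1)] at h2
    exact Finsupp.mapDomain_injective hφ (by simpa using h2)
  · refine ((hC'.fin n).preimage hφ.injOn).subset ?_
    rintro x ⟨hx, hn⟩
    exact ⟨(hm x).1 hx, (hdeg x).trans hn⟩

section
variable {σ : Type*}

/-- The basis elements of the augmentation ideal of the Taylor algebra. -/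
def TV (M : Finset (Mon σ)) (a : TX σ) : Prop := a.1 ≠ 0 ∧ a.2 ⊆ M ∧ mlcm a.2 ≤ a.1

/-- The basis of the multidegree `α` part of the bar construction of the Taylor algebra. -/
def TBar (M : Finset (Mon σ)) (α : Mon σ) : Set (List (TX σ)) :=
  {l | (l.map Prod.fst).sum = α ∧ ∀ a ∈ l, TV M a}

theorem mlcm_union (S T : Finset (Mon σ)) : mlcm (S ∪ T) = mlcm S ⊔ mlcm T :=
  Finset.sup_union

theorem TV.mul {M : Finset (Mon σ)} {a b : TX σ} (ha : TV M a) (hb : TV M b) :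
    TV M (a.1 + b.1, a.2 ∪ b.2) := by
  refine ⟨fun h => ha.1 ?_, Finset.union_subset ha.2.1 hb.2.1, ?_⟩
  · funext i
    have := congrFun h i
    simp only [Pi.add_apply, Pi.zero_apply] at this ⊢
    omega
  · rw [mlcm_union]
    exact sup_le (ha.2.2.trans le_self_add) (hb.2.2.trans le_add_self)

theorem BFace.valid {M : Finset (Mon σ)} {l l' : List (TX σ)} (h : BFace l l')
    (hl : ∀ a ∈ l, TV M a) : ∀ a ∈ l', TV M a := by
  induction h with
  | @del γ S m hm l =>
    simp only [List.forall_mem_cons] at hl ⊢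
    exact ⟨⟨hl.1.1, (Finset.erase_subset _ _).trans hl.1.2.1,
      (mlcm_mono (Finset.erase_subset _ _)).trans hl.1.2.2⟩, hl.2⟩
  | merge h l =>
    simp only [List.forall_mem_cons] at hl ⊢
    exact ⟨hl.1.mul hl.2.1, hl.2.2⟩
  | cons a h ih =>
    simp only [List.forall_mem_cons] at hl ⊢
    exact ⟨hl.1, ih hl.2⟩

theorem BFace.sum {l l' : List (TX σ)} (h : BFace l l') :
    (l'.map Prod.fst).sum = (l.map Prod.fst).sum := by
  induction h with
  | del => simp
  | merge h l => simp [add_assoc]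
  | cons a h ih => simp [ih]

theorem BFace.mem_TBar {M : Finset (Mon σ)} {α : Mon σ} {l l' : List (TX σ)} (h : BFace l l')
    (hl : l ∈ TBar M α) : l' ∈ TBar M α := ⟨h.sum.trans hl.1, h.valid hl.2⟩

theorem length_le_tdeg (l : List (TX σ)) : l.length ≤ tdeg l := by
  induction l with
  | nil => simp
  | cons a l ih => rw [tdeg_cons, List.length_cons]; omega

theorem TBar_cx (k : Type*) [Field k] [Finite σ] (M : Finset (Mon σ)) (α : Mon σ) :
    Cx (tbarD k σ) (TBar M α) tdeg := by
  refine ⟨fun x hx y hy => ?_, fun x _ => tbarD_tbarD _, fun n => ?_⟩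
  · have h := BFace.of_coeff hy
    exact ⟨h.mem_TBar hx, h.deg⟩
  · have hfin : (Set.Iic α).Finite := by
      let _ := Fintype.ofFinite σ
      exact Set.finite_Iic α
    refine (finite_lists (hfin.prod (M.powerset.finite_toSet)) n).subset ?_
    rintro l ⟨⟨hs, hv⟩, hn⟩
    refine ⟨fun a ha => ⟨?_, by simpa using (hv a ha).2.1⟩, hn ▸ length_le_tdeg l⟩
    rw [Set.mem_Iic, ← hs]
    exact List.single_le_sum (by simp) _ (List.mem_map_of_mem ha)

/-- A chosen generator dividing a monomial of the ideal. -/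
def gen0 (M : Finset (Mon σ)) (γ : Mon σ) : Mon σ :=
  if h : γ ∈ upperSet M then h.choose else 0

theorem gen0_mem {M : Finset (Mon σ)} {γ : Mon σ} (h : γ ∈ upperSet M) : gen0 M γ ∈ M := by
  rw [gen0, dif_pos h]; exact h.choose_spec.1

theorem gen0_le {M : Finset (Mon σ)} {γ : Mon σ} (h : γ ∈ upperSet M) : gen0 M γ ≤ γ := by
  rw [gen0, dif_pos h]; exact h.choose_spec.2

/-- The lower elements of the matching contracting the Taylor resolution. -/
def lo1 (M : Finset (Mon σ)) : List (TX σ) → Prop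
  | [] => False
  | a :: l => if a.1 ∈ upperSet M then gen0 M a.1 ∉ a.2 else lo1 M l

/-- The partners of the lower elements. -/
def up1 (M : Finset (Mon σ)) : List (TX σ) → List (TX σ)
  | [] => []
  | a :: l => if a.1 ∈ upperSet M then (a.1, insert (gen0 M a.1) a.2) :: l else a :: up1 M l

/-- The partners of the upper elements. -/
def dn1 (M : Finset (Mon σ)) : List (TX σ) → List (TX σ)
  | [] => []
  | a :: l => if a.1 ∈ upperSet M then (a.1, a.2.erase (gen0 M a.1)) :: l else a :: dn1 M l

theorem TV.empty_of_notMem {M : Finset (Mon σ)} {a : TX σ} (ha : TV M a) (h : a.1 ∉ upperSet M) :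
    a.2 = ∅ := by
  refine Finset.eq_empty_of_forall_notMem fun s hs => h ⟨s, ha.2.1 hs, ?_⟩
  exact (le_mlcm hs).trans ha.2.2

theorem up1_face {M : Finset (Mon σ)} {l : List (TX σ)} (h : lo1 M l) : BFace (up1 M l) l := by
  induction l with
  | nil => exact h.elim
  | cons a l ih =>
    by_cases ha : a.1 ∈ upperSet M
    · simp only [lo1, up1, if_pos ha] at h ⊢
      have := BFace.del a.1 (Finset.mem_insert_self (gen0 M a.1) a.2) l
      rwa [Finset.erase_insert h] at this
    · simp only [lo1, up1, if_neg ha] at h ⊢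
      exact .cons a (ih h)

theorem up1_not_lo1 {M : Finset (Mon σ)} {l : List (TX σ)} (h : lo1 M l) : ¬ lo1 M (up1 M l) := by
  induction l with
  | nil => exact h.elim
  | cons a l ih =>
    by_cases ha : a.1 ∈ upperSet M
    · simp [up1, lo1, ha]
    · simp only [up1, lo1, ha, if_false] at h ⊢
      exact ih h

theorem up1_valid {M : Finset (Mon σ)} {l : List (TX σ)} (h : ∀ a ∈ l, TV M a) :
    ∀ a ∈ up1 M l, TV M a := by
  induction l with
  | nil => simp [up1]
  | cons a l ih =>
    rw [List.forall_mem_cons] at h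
    by_cases ha : a.1 ∈ upperSet M
    · simp only [up1, if_pos ha, List.forall_mem_cons]
      refine ⟨⟨h.1.1, Finset.insert_subset (gen0_mem ha) h.1.2.1, ?_⟩, h.2⟩
      rw [mlcm_insert]
      exact sup_le (gen0_le ha) h.1.2.2
    · simp only [up1, if_neg ha, List.forall_mem_cons]
      exact ⟨h.1, ih h.2⟩

theorem up1_fst (M : Finset (Mon σ)) (l : List (TX σ)) :
    (up1 M l).map Prod.fst = l.map Prod.fst := by
  induction l with
  | nil => simp [up1]
  | cons a l ih => by_cases ha : a.1 ∈ upperSet M <;> simp [up1, ha, ih]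

theorem dn1_fst (M : Finset (Mon σ)) (l : List (TX σ)) :
    (dn1 M l).map Prod.fst = l.map Prod.fst := by
  induction l with
  | nil => simp [dn1]
  | cons a l ih => by_cases ha : a.1 ∈ upperSet M <;> simp [dn1, ha, ih]

theorem dn1_valid {M : Finset (Mon σ)} {l : List (TX σ)} (h : ∀ a ∈ l, TV M a) :
    ∀ a ∈ dn1 M l, TV M a := by
  induction l with
  | nil => simp [dn1]
  | cons a l ih =>
    rw [List.forall_mem_cons] at h
    by_cases ha : a.1 ∈ upperSet M
    · simp only [dn1, if_pos ha, List.forall_mem_cons]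
      exact ⟨⟨h.1.1, (Finset.erase_subset _ _).trans h.1.2.1,
        (mlcm_mono (Finset.erase_subset _ _)).trans h.1.2.2⟩, h.2⟩
    · simp only [dn1, if_neg ha, List.forall_mem_cons]
      exact ⟨h.1, ih h.2⟩

theorem dn1_spec {M : Finset (Mon σ)} {l : List (TX σ)} (h : ¬ lo1 M l)
    (hJ : ∃ a ∈ l, a.1 ∈ upperSet M) : lo1 M (dn1 M l) ∧ up1 M (dn1 M l) = l := by
  induction l with
  | nil => simp at hJ
  | cons a l ih =>
    by_cases ha : a.1 ∈ upperSet M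
    · simp only [lo1, if_pos ha, not_not] at h
      simp [dn1, lo1, up1, ha, Finset.insert_erase h]
    · simp only [lo1, if_neg ha] at h
      have := ih h (by simpa [ha] using hJ)
      simp [dn1, lo1, up1, ha, this]

theorem up1_lt {M : Finset (Mon σ)} {x y : List (TX σ)} (hx : lo1 M x) (hv : ∀ a ∈ x, TV M a)
    (hy : lo1 M y) (h : BFace (up1 M x) y) : y = x ∨ y.length < x.length := by
  induction x generalizing y with
  | nil => exact hx.elim
  | cons a x ih =>
    rw [List.forall_mem_cons] at hv
    by_cases ha : a.1 ∈ upperSet M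
    · simp only [lo1, up1, if_pos ha] at h hx
      cases h with
      | @del _ _ m hm _ =>
        left
        simp only [lo1, if_pos ha] at hy
        obtain rfl : m = gen0 M a.1 := by
          by_contra hne
          exact hy (Finset.mem_erase.2 ⟨Ne.symm hne, Finset.mem_insert_self _ _⟩)
        rw [Finset.erase_insert hx]
      | merge h l => right; simp
      | cons _ h =>
        simp [lo1, ha] at hy
    · simp only [lo1, up1, if_neg ha] at h hx
      generalize hu : up1 M x = u at h
      cases h with
      | @del γ S m hm _ =>
        obtain rfl : S = ∅ := hv.1.empty_of_notMem ha
        simp at hm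
      | @merge _ b h l =>
        right
        have := congrArg List.length (up1_fst M x)
        rw [hu] at this
        simp only [List.length_map, List.length_cons] at this ⊢
        omega
      | cons _ h =>
        simp only [lo1, if_neg ha] at hy
        obtain rfl | h' := ih hx hv.2 hy (hu ▸ h)
        · exact .inl rfl
        · right; simpa using h'

theorem mem_upperSet_of_face {M : Finset (Mon σ)} {l l' : List (TX σ)} (h : BFace l l')
    (hJ : ∃ a ∈ l, a.1 ∈ upperSet M) : ∃ a ∈ l', a.1 ∈ upperSet M := by
  induction h with
  | del => simpa using hJ
  | @merge a b h l =>
    simp only [List.exists_mem_cons_iff] at hJ ⊢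
    rcases hJ with h | h | h
    · exact .inl (upperSet_mono h le_self_add)
    · exact .inl (upperSet_mono h le_add_self)
    · exact .inr h
  | cons a h ih =>
    simp only [List.exists_mem_cons_iff] at hJ ⊢
    exact hJ.imp_right ih

/-- The part of the bar construction of the Taylor algebra that survives in the quotient ring. -/
def TBarR (M : Finset (Mon σ)) (α : Mon σ) : Set (List (TX σ)) :=
  {l | l ∈ TBar M α ∧ ∀ a ∈ l, a.1 ∉ upperSet M}

theorem mem_diff_TBarR {M : Finset (Mon σ)} {α : Mon σ} {l : List (TX σ)} :
    l ∈ TBar M α \ TBarR M α ↔ l ∈ TBar M α ∧ ∃ a ∈ l, a.1 ∈ upperSet M := by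
  simp only [TBarR, Set.mem_sdiff, Set.mem_ofPred_eq, not_and, not_forall, not_not, exists_prop]
  tauto

theorem TBarR_closed (k : Type*) [Field k] (M : Finset (Mon σ)) (α : Mon σ) :
    Closed (tbarD k σ) (TBar M α \ TBarR M α) := by
  intro x hx y hy
  rw [mem_diff_TBarR] at hx ⊢
  have h := BFace.of_coeff hy
  exact ⟨h.mem_TBar hx.1, mem_upperSet_of_face h hx.2⟩

theorem hh_TBarR (k : Type*) [Field k] [Finite σ] (M : Finset (Mon σ)) (α : Mon σ) (n : ℕ) :
    hh (tbarD k σ) (Fam k (TBar M α) tdeg) n =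
      hh (tr (tbarD k σ) (TBarR M α)) (Fam k (TBarR M α) tdeg) n := by
  refine Matching.hh_quot (Lo := {l | l ∈ TBar M α \ TBarR M α ∧ lo1 M l}) (up := up1 M)
    (lev := List.length) (TBar_cx k M α) (fun l hl => hl.1) (TBarR_closed k M α) ?_ n
  have hJ : ∀ {l l' : List (TX σ)}, l.map Prod.fst = l'.map Prod.fst →
      (∃ a ∈ l, a.1 ∈ upperSet M) → ∃ a ∈ l', a.1 ∈ upperSet M := by
    rintro l l' h ⟨a, ha, haJ⟩
    have : a.1 ∈ l'.map Prod.fst := h ▸ List.mem_map_of_mem ha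
    obtain ⟨b, hb, hba⟩ := List.mem_map.1 this
    exact ⟨b, hb, hba ▸ haJ⟩
  have hu : ∀ {l}, l ∈ TBar M α \ TBarR M α → up1 M l ∈ TBar M α \ TBarR M α := by
    intro l hl
    rw [mem_diff_TBarR] at hl ⊢
    exact ⟨⟨by rw [up1_fst, hl.1.1], up1_valid hl.1.2⟩, hJ (up1_fst M l).symm hl.2⟩
  refine ⟨fun x hx => hx.1, fun x hx => ⟨hu hx.1, fun h => up1_not_lo1 hx.2 h.2,
    (up1_face hx.2).deg.symm⟩, fun y hy hyl => ?_, fun x hx => ?_, fun x hx y hy hne hc => ?_⟩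
  · have hy' := mem_diff_TBarR.1 hy
    have := dn1_spec (fun h => hyl ⟨hy, h⟩) hy'.2
    refine ⟨dn1 M y, ⟨mem_diff_TBarR.2 ⟨⟨by rw [dn1_fst, hy'.1.1], dn1_valid hy'.1.2⟩,
      hJ (dn1_fst M y).symm hy'.2⟩, this.1⟩, this.2⟩
  · exact (up1_face hx.2).coeff fun a ha => ((hu hx.1).1.2 a ha).1
  · exact (up1_lt hx.2 hx.1.1.2 hy.2 (BFace.of_coeff hc)).resolve_left hne

end

section
variable {k : Type*} [Field k] {σ : Type*}

theorem mergeAt_zero (a b : Mon σ) (l : List (Mon σ)) : mergeAt (a :: b :: l) 0 = (a + b) :: l := by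
  simp [mergeAt]

theorem mergeAt_succ (a : Mon σ) (l : List (Mon σ)) (j : ℕ) :
    mergeAt (a :: l) (j + 1) = a :: mergeAt l j := by
  simp [mergeAt]

theorem barAux_nil (J : Set (Mon σ)) : barAux k J [] = 0 := by simp [barAux]

theorem barAux_single (J : Set (Mon σ)) (a : Mon σ) : barAux k J [a] = 0 := by simp [barAux]

theorem barAux_cons_cons (J : Set (Mon σ)) (a b : Mon σ) (l : List (Mon σ)) :
    barAux k J (a :: b :: l) =
      -(if a + b ∉ J then Finsupp.single ((a + b) :: l) (1 : k) else 0) -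
        consL k _ (Finsupp.single a 1) (barAux k J (b :: l)) := by
  rw [barAux]
  simp only [List.length_cons, Nat.add_sub_cancel]
  rw [Finset.sum_range_succ', add_comm, sub_eq_add_neg]
  congr 1
  · simp only [List.getD_cons_zero, List.getD_cons_succ, mergeAt_zero]
    split_ifs <;> simp
  · rw [barAux, map_sum, ← Finset.sum_neg_distrib]
    refine Finset.sum_congr (by simp) fun j _ => ?_
    simp only [List.getD_cons_succ, mergeAt_succ]
    split_ifs
    · simp
    · rw [map_smul, consL_single, pow_succ (-1 : k) (j + 1), mul_neg_one, neg_smul]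

/-- The inclusion of lists of monomials. -/
def emL : List (Mon σ) → List (TX σ) := List.map fun γ => (γ, ∅)

theorem emL_injective : Function.Injective (emL (σ := σ)) :=
  List.map_injective_iff.2 fun _ _ h => congrArg Prod.fst h

theorem emL_eq {l : List (TX σ)} (h : ∀ a ∈ l, a.2 = ∅) : emL (l.map Prod.fst) = l := by
  induction l with
  | nil => rfl
  | cons a l ih =>
    rw [List.forall_mem_cons] at h
    simp only [List.map_cons, emL] at ih ⊢
    rw [ih h.2, ← h.1]

theorem emL_mem_TBarR {M : Finset (Mon σ)} {α : Mon σ} {l : List (Mon σ)} :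
    emL l ∈ TBarR M α ↔ l.sum = α ∧ ∀ β ∈ l, β ≠ 0 ∧ β ∉ upperSet M := by
  simp only [TBarR, TBar, emL, List.map_map, Set.mem_ofPred_eq, List.forall_mem_map, TV,
    Finset.empty_subset, mlcm_empty, zero_le, and_true]
  have : (Prod.fst ∘ fun γ : Mon σ => ((γ, ∅) : TX σ)) = id := rfl
  rw [this, List.map_id, and_assoc, forall₂_and]

theorem mapDomain_consL (a : Mon σ) (v : List (Mon σ) →₀ k) :
    Finsupp.mapDomain emL (consL k _ (Finsupp.single a 1) v) =
      consL k (TX σ) (Finsupp.single (a, ∅) 1) (Finsupp.mapDomain emL v) := by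
  induction v using Finsupp.induction_linear with
  | zero => simp
  | add f g hf hg => simp only [map_add, Finsupp.mapDomain_add, hf, hg]
  | single l r =>
    have h2 : (Finsupp.single l r : List (Mon σ) →₀ k) = r • Finsupp.single l 1 := by simp
    rw [h2]
    simp only [map_smul, Finsupp.mapDomain_smul, consL_single, Finsupp.mapDomain_single]
    rfl

theorem proj_consL_emL {M : Finset (Mon σ)} {a : Mon σ} (ha : a ∉ upperSet M)
    (v : List (TX σ) →₀ k) :
    proj k {l | ∀ b ∈ l, b.1 ∉ upperSet M} (consL k (TX σ) (Finsupp.single (a, ∅) 1) v) =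
      consL k (TX σ) (Finsupp.single (a, ∅) 1) (proj k {l | ∀ b ∈ l, b.1 ∉ upperSet M} v) := by
  ext l
  rw [proj_apply]
  cases l with
  | nil => simp [consL_nil]
  | cons b l =>
    rw [consL_cons, consL_cons, proj_apply]
    simp only [Set.mem_ofPred_eq, List.forall_mem_cons]
    by_cases hb : b = (a, ∅)
    · subst hb; simp [ha]
    · simp [Finsupp.single_eq_of_ne hb]

theorem tbarD_emL_cons (a b : Mon σ) (l : List (Mon σ)) :
    tbarD k σ (Finsupp.single (emL (a :: b :: l)) 1) =
      - Finsupp.single (emL ((a + b) :: l)) (1 : k) -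
      consL k (TX σ) (Finsupp.single (a, ∅) 1) (tbarD k σ (Finsupp.single (emL (b :: l)) 1)) := by
  have h : ∀ a (l : List (Mon σ)), emL (a :: l) = (a, ∅) :: emL l := fun _ _ => rfl
  simp only [h]
  rw [tbarD_single, tbarDAux, tbar_single, ← tbarD_single]
  nth_rewrite 2 [← consL_single]
  simp only [Finset.card_empty, pow_zero, one_smul]
  rw [mrg_consL, tmul_single, single_eq_emb, tdif_emb]
  simp [bdry_one, consL_single]

theorem tr_emL (M : Finset (Mon σ)) {l : List (Mon σ)} (hl : ∀ a ∈ l, a ∉ upperSet M) :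
    proj k {l | ∀ b ∈ l, b.1 ∉ upperSet M} (tbarD k σ (Finsupp.single (emL l) 1)) =
      Finsupp.mapDomain emL (barAux k (upperSet M) l) := by
  induction l with
  | nil => simp [emL, barAux_nil, tbarD_single, tbarDAux]
  | cons a l ih =>
    rw [List.forall_mem_cons] at hl
    cases l with
    | nil =>
      rw [barAux_single]
      simp only [emL, List.map_cons, List.map_nil]
      rw [tbarD_single, tbarDAux, mrg_nil, single_eq_emb, tdif_emb]
      simp [bdry_one, tbarDAux]
    | cons b l =>
      rw [tbarD_emL_cons, map_sub, map_neg, proj_consL_emL hl.1, ih hl.2, barAux_cons_cons,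
        ← Finsupp.lmapDomain_apply k k, ← Finsupp.lmapDomain_apply k k, map_sub, map_neg,
        Finsupp.lmapDomain_apply k k, Finsupp.lmapDomain_apply k k, Finsupp.lmapDomain_apply k k,
        mapDomain_consL, proj_single]
      congr 2
      have hl' : ∀ c ∈ l, c ∉ upperSet M := fun c hc => hl.2 c (by simp [hc])
      have hm : emL ((a + b) :: l) ∈ {l | ∀ b ∈ l, b.1 ∉ upperSet M} ↔ a + b ∉ upperSet M := by
        simp only [emL, Set.mem_ofPred_eq, List.forall_mem_map, List.forall_mem_cons]
        exact and_iff_left hl'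
      by_cases h : a + b ∈ upperSet M
      · rw [if_neg (mt hm.1 (not_not.2 h)), if_neg (not_not.2 h), Finsupp.mapDomain_zero]
      · rw [if_pos (hm.2 h), if_pos h, Finsupp.mapDomain_single]

theorem torDim_eq_hh (k : Type*) [Field k] [Finite σ] (M : Finset (Mon σ)) (i : ℕ) (α : Mon σ) :
    torDim k (upperSet M) i α = hh (tbarD k σ) (Fam k (TBar M α) tdeg) i := by
  set B : Set (List (Mon σ)) := {l | l.sum = α ∧ ∀ β ∈ l, β ≠ 0 ∧ β ∉ upperSet M} with hB
  have h1 : torDim k (upperSet M) i α = hh (barD k (upperSet M)) (Fam k B List.length) i := by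
    have hs : ∀ m, barSub k (upperSet M) m α = Fam k B List.length m := by
      intro m
      rw [barSub, Fam_eq_span]
      congr 2
      ext l
      simp only [hB, barBasis, Set.mem_ofPred_eq]
      tauto
    rw [torDim, hs, hs]
    rfl
  rw [h1, hh_TBarR]
  have hC' : Cx (tr (tbarD k σ) (TBarR M α)) (TBarR M α) tdeg :=
    (TBar_cx k M α).quot (fun l hl => hl.1) (TBarR_closed k M α)
  have hdeg : ∀ l : List (Mon σ), tdeg (emL l) = l.length := by
    intro l
    induction l with
    | nil => rfl
    | cons a l ih =>
      change tdeg ((a, ∅) :: emL l) = _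
      rw [tdeg_cons, ih]; simp; ring
  have hcomm : ∀ l ∈ B, tr (tbarD k σ) (TBarR M α) (Finsupp.single (emL l) 1) =
      Finsupp.mapDomain emL (barD k (upperSet M) (Finsupp.single l 1)) := by
    intro l hl
    rw [barD, Finsupp.linearCombination_single, one_smul, ← tr_emL M fun a ha => (hl.2 a ha).2]
    ext y
    rw [tr_apply, proj_apply]
    by_cases hy : tbarD k σ (Finsupp.single (emL l) 1) y = 0
    · simp [hy]
    · have : y ∈ TBar M α := (BFace.of_coeff hy).mem_TBar (emL_mem_TBarR.2 hl).1
      simp [TBarR, this]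
  have hC : Cx (barD k (upperSet M)) B List.length :=
    hC'.of_relabel emL emL_injective (fun l => emL_mem_TBarR.symm) hdeg hcomm
  refine hh_relabel hC hC' emL (fun _ => 1) 0 1 one_ne_zero ⟨fun l hl => emL_mem_TBarR.2 hl,
    emL_injective.injOn, fun l hl => ?_⟩ (fun _ _ => one_ne_zero) (fun l _ => hdeg l)
    (Finsupp.lmapDomain k k emL) (fun l _ => by simp) (fun l hl => ?_) i
  · have he := emL_eq fun a ha => (hl.1.2 a ha).empty_of_notMem (hl.2 a ha)
    exact ⟨_, emL_mem_TBarR.1 (by rwa [he]), he⟩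
  · rw [one_smul, Finsupp.lmapDomain_apply, Finsupp.lmapDomain_apply, Finsupp.mapDomain_single,
      hcomm l hl]

end

/-- Blocks carrying a multiset of pairwise compatible colours, with a partial product that adds up
the colours and along which every colour can be split off in a unique way. -/
structure Blocks (B C : Type*) where
  /-- the admissible blocks -/
  V : B → Prop
  /-- the colours of a block -/
  col : B → Multiset C
  /-- compatibility of colours -/
  good : C → C → Prop
  /-- the product of blocks -/
  mul : B → B → B
  /-- the block with a colour removed -/
  rem : B → C → B
  /-- the part of a given colour -/
  prt : B → C → B
  col_ne : ∀ {a}, V a → col a ≠ 0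
  clique : ∀ {a c s d}, V a → col a = c ::ₘ s → d ∈ s → good d c
  mul_V : ∀ {a b}, V a → V b → (∀ c ∈ col a, ∀ d ∈ col b, good c d) → V (mul a b)
  mul_col : ∀ {a b}, V a → V b → (∀ c ∈ col a, ∀ d ∈ col b, good c d) →
    col (mul a b) = col a + col b
  rem_V : ∀ {a c}, V a → c ∈ col a → col a ≠ {c} → V (rem a c)
  prt_V : ∀ {a c}, V a → c ∈ col a → V (prt a c)
  prt_col : ∀ {a c}, V a → c ∈ col a → col (prt a c) = {c}
  mul_rem : ∀ {a c}, V a → c ∈ col a → col a ≠ {c} → mul (rem a c) (prt a c) = a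
  rem_col : ∀ {a c}, V a → c ∈ col a → col a ≠ {c} → col a = c ::ₘ col (rem a c)
  rem_mul : ∀ {a b c}, V a → V b → (∀ d ∈ col a, good d c) → col b = {c} → rem (mul a b) c = a
  prt_mul : ∀ {a b c}, V a → V b → (∀ d ∈ col a, good d c) → col b = {c} → prt (mul a b) c = b

namespace Blocks
variable {B C : Type*} (K : Blocks B C)

/-- All colours of `a` are compatible with `c`. -/
def Ga (a : B) (c : C) : Prop := ∀ d ∈ K.col a, K.good d c

/-- The colour `c` occurs in a list after blocks compatible with it. -/
def Occ (c : C) : List B → Prop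
  | [] => False
  | a :: l => c ∈ K.col a ∨ (K.Ga a c ∧ Occ c l)

/-- The last reachable occurrence of `c` lies in the tail of `a :: l`. -/
def Stp (c : C) (a : B) (l : List B) : Prop := K.Ga a c ∧ K.Occ c l

/-- The last reachable occurrence of `c` is the head, which consists of `c` alone. -/
def Hd (c : C) : List B → Prop
  | [] => False
  | a :: l => ¬K.Stp c a l ∧ K.col a = {c}

/-- The block of the last reachable occurrence of `c` has further colours. -/
def Low (c : C) : List B → Prop
  | [] => False
  | a :: l => if K.Stp c a l then Low c l else K.col a ≠ {c}

/-- Split off `c` in the block of its last reachable occurrence. -/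
def upc (c : C) : List B → List B
  | [] => []
  | a :: l => if K.Stp c a l then a :: upc c l else K.rem a c :: K.prt a c :: l

/-- The number of blocks after the last reachable occurrence of `c`. -/
def aft (c : C) : List B → ℕ
  | [] => 0
  | a :: l => if K.Stp c a l then aft c l else l.length

/-- A good merge of two consecutive blocks. -/
inductive GM : List B → List B → Prop
  | merge {a b : B} (h : ∀ c ∈ K.col a, ∀ d ∈ K.col b, K.good c d) (l : List B) :
      GM (a :: b :: l) (K.mul a b :: l)
  | cons (a : B) {l l' : List B} (h : GM l l') : GM (a :: l) (a :: l')

variable {K}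
variable {a b : B} {c d : C} {l l' x y : List B}

theorem Ga_mul (ha : K.V a) (hb : K.V b) (h : ∀ c ∈ K.col a, ∀ d ∈ K.col b, K.good c d) :
    K.Ga (K.mul a b) c ↔ K.Ga a c ∧ K.Ga b c := by
  simp only [Ga, K.mul_col ha hb h, Multiset.mem_add, or_imp, forall_and]

theorem GM.occ (h : K.GM l l') (hl : ∀ a ∈ l, K.V a) : K.Occ c l' ↔ K.Occ c l := by
  induction h with
  | merge h l =>
    simp only [List.forall_mem_cons] at hl
    simp only [Occ, K.mul_col hl.1 hl.2.1 h, Ga_mul hl.1 hl.2.1 h, Multiset.mem_add]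
    constructor
    · rintro ((hc | hc) | hc)
      · exact .inl hc
      · exact .inr ⟨fun d hd => h d hd c hc, .inl hc⟩
      · exact .inr ⟨hc.1.1, .inr ⟨hc.1.2, hc.2⟩⟩
    · tauto
  | cons a h ih =>
    rw [List.forall_mem_cons] at hl
    simp only [Occ, ih hl.2]

theorem Ga_rem (ha : K.V a) (hc : c ∈ K.col a) (hne : K.col a ≠ {c}) : K.Ga (K.rem a c) c :=
  fun _ hd => K.clique ha (K.rem_col ha hc hne) hd

theorem Ga_of_self (ha : K.V a) (hc : c ∈ K.col a) (h : K.good c c) : K.Ga a c := by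
  obtain ⟨s, hs⟩ := Multiset.exists_cons_of_mem hc
  intro d hd
  rw [hs, Multiset.mem_cons] at hd
  obtain rfl | hd := hd
  · exact h
  · exact K.clique ha hs hd

theorem good_of_Ga_prt (ha : K.V a) (hc : c ∈ K.col a) (h : K.Ga (K.prt a c) c) : K.good c c :=
  h c (by simp [K.prt_col ha hc])

theorem rem_prt_good (ha : K.V a) (hc : c ∈ K.col a) (hne : K.col a ≠ {c}) :
    ∀ d ∈ K.col (K.rem a c), ∀ e ∈ K.col (K.prt a c), K.good d e := by
  intro d hd e he
  rw [K.prt_col ha hc, Multiset.mem_singleton] at he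
  exact he ▸ Ga_rem ha hc hne d hd

theorem mem_of_not_stp (h : K.Occ c (a :: l)) (hs : ¬K.Stp c a l) : c ∈ K.col a :=
  h.resolve_right hs

/-- The block in which `c` is split off does not see later occurrences of `c`. -/
theorem not_stp_prt (ha : K.V a) (hc : c ∈ K.col a) (hs : ¬K.Stp c a l) (hl : K.Occ c l' → K.Occ c l) :
    ¬K.Stp c (K.prt a c) l' :=
  fun h => hs ⟨Ga_of_self ha hc (good_of_Ga_prt ha hc h.1), hl h.2⟩

theorem stp_rem (ha : K.V a) (hc : c ∈ K.col a) (hne : K.col a ≠ {c}) (hl : K.Occ c l) :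
    K.Stp c (K.rem a c) l := ⟨Ga_rem ha hc hne, hl⟩

theorem occ_prt (ha : K.V a) (hc : c ∈ K.col a) : K.Occ c (K.prt a c :: l) :=
  .inl (by simp [K.prt_col ha hc])

theorem upc_GM (hl : ∀ a ∈ l, K.V a) (ho : K.Occ c l) (h : K.Low c l) :
    K.GM (K.upc c l) l ∧ ∀ a ∈ K.upc c l, K.V a := by
  induction l with
  | nil => exact h.elim
  | cons a l ih =>
    rw [List.forall_mem_cons] at hl
    by_cases hs : K.Stp c a l
    · simp only [upc, Low, if_pos hs] at h ⊢
      have := ih hl.2 hs.2 h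
      exact ⟨.cons a this.1, by rw [List.forall_mem_cons]; exact ⟨hl.1, this.2⟩⟩
    · simp only [upc, Low, if_neg hs] at h ⊢
      have hc := mem_of_not_stp ho hs
      constructor
      · have := GM.merge (K := K) (rem_prt_good hl.1 hc h) l
        rwa [K.mul_rem hl.1 hc h] at this
      · simp only [List.forall_mem_cons]
        exact ⟨K.rem_V hl.1 hc h, K.prt_V hl.1 hc, hl.2⟩

theorem upc_not (hl : ∀ a ∈ l, K.V a) (ho : K.Occ c l) (h : K.Low c l) :
    ¬K.Hd c (K.upc c l) ∧ ¬K.Low c (K.upc c l) := by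
  induction l with
  | nil => exact h.elim
  | cons a l ih =>
    have hl' := hl
    rw [List.forall_mem_cons] at hl
    by_cases hs : K.Stp c a l
    · simp only [upc, Low, if_pos hs] at h ⊢
      have hs' : K.Stp c a (K.upc c l) :=
        ⟨hs.1, ((upc_GM hl.2 hs.2 h).1.occ (upc_GM hl.2 hs.2 h).2).1 hs.2⟩
      rw [Hd, if_pos hs']
      exact ⟨fun h => h.1 hs', (ih hl.2 hs.2 h).2⟩
    · simp only [upc, Low, if_neg hs] at h ⊢
      have hc := mem_of_not_stp ho hs
      have hs' := stp_rem hl.1 hc h (occ_prt (l := l) hl.1 hc)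
      rw [Hd, if_pos hs', if_neg (not_stp_prt hl.1 hc hs id)]
      exact ⟨fun h => h.1 hs', fun h => h (K.prt_col hl.1 hc)⟩

theorem col_mul_ne (ha : K.V a) (hb : K.V b)
    (h : ∀ c ∈ K.col a, ∀ d ∈ K.col b, K.good c d) : K.col (K.mul a b) ≠ {c} := by
  intro h'
  have := congrArg Multiset.card h'
  have h1 := Multiset.card_pos.2 (K.col_ne ha)
  have h2 := Multiset.card_pos.2 (K.col_ne hb)
  rw [K.mul_col ha hb h, Multiset.card_add, Multiset.card_singleton] at this
  omega

theorem upc_lt (hl : ∀ a ∈ x, K.V a) (ho : K.Occ c x) (h : K.Low c x) (hy : K.GM (K.upc c x) y) :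
    y = x ∨ (¬K.Hd c y ∧ (K.Low c y → K.aft c y < K.aft c x)) := by
  induction x generalizing y with
  | nil => exact h.elim
  | cons a l ih =>
    have hl' := hl
    rw [List.forall_mem_cons] at hl
    by_cases hs : K.Stp c a l
    · simp only [upc, Low, if_pos hs] at h hy
      have hu := upc_GM hl.2 hs.2 h
      simp only [aft, if_pos hs]
      generalize hL : K.upc c l = L at hy hu
      cases hy with
      | @cons _ _ y' hy' =>
        have hs' : K.Stp c a y' := ⟨hs.1, (hy'.occ hu.2).2 ((hu.1.occ hu.2).1 hs.2)⟩
        rcases ih hl.2 hs.2 h (hL ▸ hy') with rfl | h'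
        · exact .inl rfl
        · refine .inr ⟨fun h => h.1 hs', ?_⟩
          simp only [Low, aft, if_pos hs']
          exact h'.2
      | @merge _ b hg l'' =>
        have hb := hu.2
        rw [List.forall_mem_cons] at hb
        refine .inr ⟨fun h' => col_mul_ne hl.1 hb.1 hg h'.2, fun hlow => ?_⟩
        exfalso
        cases l with
        | nil => exact h
        | cons d l2 =>
          rw [List.forall_mem_cons] at hl
          by_cases hs2 : K.Stp c d l2
          · simp only [upc, Low, if_pos hs2, List.cons.injEq] at h hL
            obtain ⟨rfl, rfl⟩ := hL
            have hu2 := upc_GM hl.2.2 hs2.2 h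
            have : K.Stp c (K.mul a d) (K.upc c l2) :=
              ⟨(Ga_mul hl.1 hl.2.1 hg).2 ⟨hs.1, hs2.1⟩, (hu2.1.occ hu2.2).1 hs2.2⟩
            rw [Low, if_pos this] at hlow
            exact (upc_not hl.2.2 hs2.2 h).2 hlow
          · simp only [upc, Low, if_neg hs2, List.cons.injEq] at h hL
            obtain ⟨rfl, rfl⟩ := hL
            have hc := mem_of_not_stp hs.2 hs2
            have : K.Stp c (K.mul a (K.rem d c)) (K.prt d c :: l2) :=
              ⟨(Ga_mul hl.1 hb.1 hg).2 ⟨hs.1, Ga_rem hl.2.1 hc h⟩, occ_prt hl.2.1 hc⟩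
            rw [Low, if_pos this, Low, if_neg (not_stp_prt hl.2.1 hc hs2 id)] at hlow
            exact hlow (K.prt_col hl.2.1 hc)
    · simp only [upc, Low, if_neg hs] at h hy
      have hc := mem_of_not_stp ho hs
      simp only [aft, if_neg hs]
      cases hy with
      | merge hg => exact .inl (by rw [K.mul_rem hl.1 hc h])
      | @cons _ _ y' hy' =>
        have hv : ∀ b ∈ K.prt a c :: l, K.V b := by
          rw [List.forall_mem_cons]; exact ⟨K.prt_V hl.1 hc, hl.2⟩
        have hs' : K.Stp c (K.rem a c) y' :=
          stp_rem hl.1 hc h ((hy'.occ hv).2 (occ_prt hl.1 hc))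
        refine .inr ⟨fun h => h.1 hs', ?_⟩
        simp only [Low, aft, if_pos hs']
        cases hy' with
        | @merge _ b hg l2 =>
          intro _
          rw [aft, if_neg]
          · simp
          · intro hs2
            simp only [List.forall_mem_cons] at hl
            have hg2 := (Ga_mul (K.prt_V hl.1 hc) hl.2.1 hg).1 hs2.1
            exact hs ⟨Ga_of_self hl.1 hc (good_of_Ga_prt hl.1 hc hg2.1), .inr ⟨hg2.2, hs2.2⟩⟩
        | @cons _ _ l' hl2 =>
          intro hlow
          rw [Low, if_neg (not_stp_prt hl.1 hc hs (hl2.occ hl.2).1)] at hlow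
          exact absurd (K.prt_col hl.1 hc) hlow

theorem upc_surj (hl : ∀ a ∈ y, K.V a) (ho : K.Occ c y) (h1 : ¬K.Low c y) (h2 : ¬K.Hd c y) :
    ∃ x, (∀ a ∈ x, K.V a) ∧ K.Low c x ∧ K.upc c x = y ∧ K.GM y x := by
  induction y with
  | nil => exact ho.elim
  | cons a l ih =>
    rw [List.forall_mem_cons] at hl
    by_cases hs : K.Stp c a l
    swap
    · simp only [Low, if_neg hs, not_not] at h1
      exact (h2 ⟨hs, h1⟩).elim
    simp only [Low, if_pos hs] at h1
    by_cases hd : K.Hd c l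
    · cases l with
      | nil => exact hd.elim
      | cons b l' =>
        simp only [List.forall_mem_cons] at hl
        have hg : ∀ d ∈ K.col a, ∀ e ∈ K.col b, K.good d e := by
          intro d hd' e he
          rw [hd.2, Multiset.mem_singleton] at he
          exact he ▸ hs.1 d hd'
        have hs' : ¬K.Stp c (K.mul a b) l' :=
          fun h => hd.1 ⟨((Ga_mul hl.1 hl.2.1 hg).1 h.1).2, h.2⟩
        refine ⟨K.mul a b :: l', ?_, ?_, ?_, .merge hg l'⟩
        · rw [List.forall_mem_cons]
          exact ⟨K.mul_V hl.1 hl.2.1 hg, hl.2.2⟩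
        · rw [Low, if_neg hs']
          exact col_mul_ne hl.1 hl.2.1 hg
        · rw [upc, if_neg hs', K.rem_mul hl.1 hl.2.1 hs.1 hd.2, K.prt_mul hl.1 hl.2.1 hs.1 hd.2]
    · obtain ⟨x, hx, hlow, hux, hgm⟩ := ih hl.2 hs.2 h1 hd
      have hs' : K.Stp c a x := ⟨hs.1, (hgm.occ hl.2).2 hs.2⟩
      refine ⟨a :: x, ?_, ?_, ?_, .cons a hgm⟩
      · rw [List.forall_mem_cons]; exact ⟨hl.1, hx⟩
      · rwa [Low, if_pos hs']
      · rw [upc, if_pos hs', hux]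

theorem Low.not_hd (h : K.Low c l) : ¬K.Hd c l := by
  cases l with
  | nil => exact h.elim
  | cons a l =>
    rintro ⟨h1, h2⟩
    rw [Low, if_neg h1] at h
    exact h h2

theorem upc_inj (hx : ∀ a ∈ x, K.V a) (hy : ∀ a ∈ y, K.V a) (hox : K.Occ c x) (hoy : K.Occ c y)
    (hlx : K.Low c x) (hly : K.Low c y) (h : K.upc c x = K.upc c y) : x = y := by
  have key : ∀ {a b : B} {l l' : List B}, K.V b → (∀ a ∈ l, K.V a) → K.Stp c a l → K.Low c l →
      c ∈ K.col b → ¬K.Stp c b l' → K.upc c l = K.prt b c :: l' → False := by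
    intro a b l l' hb hl hs hlow hc hs' h
    cases l with
    | nil => exact hlow
    | cons d l2 =>
      rw [List.forall_mem_cons] at hl
      by_cases hs2 : K.Stp c d l2
      · simp only [upc, Low, if_pos hs2, List.cons.injEq] at hlow h
        obtain ⟨h1, rfl⟩ := h
        have hu := upc_GM hl.2 hs2.2 hlow
        refine hs' ⟨Ga_of_self hb hc (good_of_Ga_prt hb hc (h1 ▸ hs2.1)), (hu.1.occ hu.2).1 hs2.2⟩
      · simp only [upc, Low, if_neg hs2, List.cons.injEq] at hlow h
        obtain ⟨h1, rfl⟩ := h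
        have hcd := mem_of_not_stp hs.2 hs2
        refine hs' ⟨Ga_of_self hb hc (good_of_Ga_prt hb hc ?_), occ_prt hl.1 hcd⟩
        rw [← h1]
        exact Ga_rem hl.1 hcd hlow
  induction x generalizing y with
  | nil => exact hlx.elim
  | cons a l ih =>
    cases y with
    | nil => exact hly.elim
    | cons b l' =>
      rw [List.forall_mem_cons] at hx hy
      by_cases hs : K.Stp c a l <;> by_cases hs' : K.Stp c b l'
      · simp only [upc, Low, if_pos hs, if_pos hs', List.cons.injEq] at hlx hly h
        rw [h.1, ih hx.2 hy.2 hs.2 hs'.2 hlx hly h.2]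
      · simp only [upc, Low, if_pos hs, if_neg hs', List.cons.injEq] at hlx hly h
        exact (key hy.1 hx.2 hs hlx (mem_of_not_stp hoy hs') hs' h.2).elim
      · simp only [upc, Low, if_pos hs', if_neg hs, List.cons.injEq] at hlx hly h
        exact (key hx.1 hy.2 hs' hly (mem_of_not_stp hox hs) hs h.2.symm).elim
      · simp only [upc, Low, if_neg hs, if_neg hs', List.cons.injEq] at hlx hly h
        rw [← K.mul_rem hx.1 (mem_of_not_stp hox hs) hlx,
          ← K.mul_rem hy.1 (mem_of_not_stp hoy hs') hly, h.1, h.2.1, h.2.2]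

variable [Nonempty C]

variable (K) in
/-- A chosen colour among the reachable ones. -/
def ch (l : List B) : C := Classical.epsilon fun c => K.Occ c l

theorem occ_ch (ha : K.V a) : K.Occ (K.ch (a :: l)) (a :: l) := by
  obtain ⟨c, hc⟩ := Multiset.exists_mem_of_ne_zero (K.col_ne ha)
  exact Classical.epsilon_spec (p := fun c => K.Occ c (a :: l)) ⟨c, .inl hc⟩

theorem GM.ch (h : K.GM l l') (hl : ∀ a ∈ l, K.V a) : K.ch l' = K.ch l := by
  simp only [Blocks.ch, h.occ hl]

variable (K) in
/-- The lower elements of the matching. -/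
def Lower : List B → Prop
  | [] => False
  | a :: l => if K.Hd (K.ch (a :: l)) (a :: l) then Lower l else K.Low (K.ch (a :: l)) (a :: l)

variable (K) in
/-- The critical elements of the matching. -/
def Crit : List B → Prop
  | [] => True
  | a :: l => K.Hd (K.ch (a :: l)) (a :: l) ∧ Crit l

variable (K) in
/-- The matching. -/
def up : List B → List B
  | [] => []
  | a :: l => if K.Hd (K.ch (a :: l)) (a :: l) then a :: up l else K.upc (K.ch (a :: l)) (a :: l)

variable (K) in
/-- The level of an element. -/
def lv : List B → ℕ ×ₗ ℕ
  | [] => toLex (0, 0)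
  | a :: l => if K.Hd (K.ch (a :: l)) (a :: l) then toLex ((ofLex (lv l)).1 + 1, (ofLex (lv l)).2)
      else toLex (0, K.aft (K.ch (a :: l)) (a :: l))

theorem up_GM (hl : ∀ a ∈ l, K.V a) (h : K.Lower l) :
    K.GM (K.up l) l ∧ ∀ a ∈ K.up l, K.V a := by
  induction l with
  | nil => exact h.elim
  | cons a l ih =>
    by_cases hd : K.Hd (K.ch (a :: l)) (a :: l)
    · rw [List.forall_mem_cons] at hl
      simp only [Lower, up, if_pos hd] at h ⊢
      exact ⟨.cons a (ih hl.2 h).1, by rw [List.forall_mem_cons]; exact ⟨hl.1, (ih hl.2 h).2⟩⟩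
    · simp only [Lower, up, if_neg hd] at h ⊢
      exact upc_GM hl (occ_ch (hl a (by simp))) h

theorem Crit.not_lower (h : K.Crit l) : ¬K.Lower l := by
  induction l with
  | nil => exact id
  | cons a l ih =>
    rw [Lower, if_pos h.1]
    exact ih h.2

theorem GM.hd_cons (h : K.GM l l') (hl : ∀ a ∈ l, K.V a) :
    K.Hd c (a :: l') ↔ K.Hd c (a :: l) := by
  simp only [Hd, Stp, h.occ hl]

theorem up_not (hl : ∀ a ∈ l, K.V a) (h : K.Lower l) :
    ¬K.Lower (K.up l) ∧ ¬K.Crit (K.up l) := by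
  induction l with
  | nil => exact h.elim
  | cons a l ih =>
    have hgm := up_GM hl h
    have hch := hgm.1.ch hgm.2
    by_cases hd : K.Hd (K.ch (a :: l)) (a :: l)
    · rw [List.forall_mem_cons] at hl
      simp only [up, if_pos hd] at hch ⊢
      simp only [Lower, if_pos hd] at h
      have hu := up_GM hl.2 h
      have hd' := hd
      rw [hch, hu.1.hd_cons hu.2] at hd'
      simp only [Lower, Crit, if_pos hd']
      exact ⟨(ih hl.2 h).1, fun h' => (ih hl.2 h).2 h'.2⟩
    · simp only [up, if_neg hd] at hch hgm ⊢
      simp only [Lower, if_neg hd] at h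
      have := upc_not hl (occ_ch (hl a (by simp))) h
      generalize hL : K.upc (K.ch (a :: l)) (a :: l) = L at *
      cases L with
      | nil => cases hgm.1
      | cons b L =>
        rw [hch] at this
        rw [Lower, if_neg this.1]
        exact ⟨this.2, fun h => this.1 h.1⟩

theorem up_lt (hl : ∀ a ∈ x, K.V a) (h : K.Lower x) (hy : K.GM (K.up x) y) (hly : K.Lower y) :
    y = x ∨ K.lv y < K.lv x := by
  induction x generalizing y with
  | nil => exact h.elim
  | cons a l ih =>
    have hgm := up_GM hl h
    have hch : K.ch y = K.ch (a :: l) := (hy.ch hgm.2).trans (hgm.1.ch hgm.2).symm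
    by_cases hd : K.Hd (K.ch (a :: l)) (a :: l)
    · have hl' := List.forall_mem_cons.1 hl
      simp only [up, if_pos hd] at hgm hy
      simp only [Lower, if_pos hd] at h
      have hu := up_GM hl'.2 h
      simp only [lv, if_pos hd]
      generalize hL : K.up l = L at *
      cases hy with
      | @cons _ _ y' hy' =>
        have hd' : K.Hd (K.ch (a :: y')) (a :: y') := by
          rwa [hch, hy'.hd_cons hu.2, ← hu.1.hd_cons hu.2]
        rw [Lower, if_pos hd'] at hly
        rcases ih hl'.2 h hy' hly with rfl | h'
        · exact .inl rfl
        · right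
          rw [lv, if_pos hd', Prod.Lex.toLex_lt_toLex]
          rw [Prod.Lex.lt_iff] at h'
          simp only
          omega
      | @merge _ b hg l'' =>
        right
        have hb := hu.2 b (by simp)
        rw [lv, if_neg, Prod.Lex.toLex_lt_toLex]
        · exact .inl (by simp)
        · exact fun h' => col_mul_ne hl'.1 hb hg h'.2
    · simp only [up, if_neg hd] at hy
      simp only [Lower, if_neg hd] at h
      rcases upc_lt hl (occ_ch (hl a (by simp))) h hy with h' | h'
      · exact .inl h'
      · right
        cases y with
        | nil => exact hly.elim
        | cons b y =>
          rw [← hch] at h'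
          rw [Lower, if_neg h'.1] at hly
          rw [lv, if_neg h'.1, lv, if_neg hd, Prod.Lex.toLex_lt_toLex]
          refine .inr ⟨rfl, ?_⟩
          rw [hch]
          exact hch ▸ h'.2 hly

theorem up_surj (hl : ∀ a ∈ y, K.V a) (h1 : ¬K.Lower y) (h2 : ¬K.Crit y) :
    ∃ x, (∀ a ∈ x, K.V a) ∧ K.Lower x ∧ K.up x = y := by
  induction y with
  | nil => exact (h2 trivial).elim
  | cons a l ih =>
    by_cases hd : K.Hd (K.ch (a :: l)) (a :: l)
    · have hl' := List.forall_mem_cons.1 hl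
      rw [Lower, if_pos hd] at h1
      obtain ⟨x, hx, hlx, rfl⟩ := ih hl'.2 h1 fun h => h2 ⟨hd, h⟩
      have hu := up_GM hx hlx
      have hd' : K.Hd (K.ch (a :: x)) (a :: x) := by
        rwa [(GM.cons a hu.1).ch hl, hu.1.hd_cons hu.2]
      refine ⟨a :: x, ?_, ?_, ?_⟩
      · rw [List.forall_mem_cons]; exact ⟨hl'.1, hx⟩
      · rwa [Lower, if_pos hd']
      · rw [up, if_pos hd']
    · rw [Lower, if_neg hd] at h1
      obtain ⟨x, hx, hlow, hux, hgm⟩ := upc_surj hl (occ_ch (hl a (by simp))) h1 hd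
      have hch := hgm.ch hl
      rw [← hch] at hlow hux
      have hd' := hlow.not_hd
      cases x with
      | nil => exact hlow.elim
      | cons b x =>
        exact ⟨b :: x, hx, by rwa [Lower, if_neg hd'], by rwa [up, if_neg hd']⟩

theorem up_inj (hx : ∀ a ∈ x, K.V a) (hy : ∀ a ∈ y, K.V a) (hlx : K.Lower x) (hly : K.Lower y)
    (h : K.up x = K.up y) : x = y := by
  induction x generalizing y with
  | nil => exact hlx.elim
  | cons a l ih =>
    cases y with
    | nil => exact hly.elim
    | cons b l' =>
      have hch : K.ch (a :: l) = K.ch (b :: l') := by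
        rw [(up_GM hx hlx).1.ch (up_GM hx hlx).2, (up_GM hy hly).1.ch (up_GM hy hly).2, h]
      have hx' := List.forall_mem_cons.1 hx
      have hy' := List.forall_mem_cons.1 hy
      have key : ∀ {a b : B} {l l' : List B}, (∀ d ∈ l, K.V d) → (∀ d ∈ b :: l', K.V d) →
          K.ch (a :: l) = K.ch (b :: l') →
          K.Hd (K.ch (a :: l)) (a :: l) → ¬K.Hd (K.ch (b :: l')) (b :: l') → K.Lower (a :: l) →
          K.Lower (b :: l') → K.up (a :: l) = K.up (b :: l') → False := by
        intro a b l l' hx hy hch hd hd' hlx hly h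
        rw [up, up, if_pos hd, if_neg hd'] at h
        rw [Lower, if_pos hd] at hlx
        rw [Lower, if_neg hd'] at hly
        have := upc_not hy (occ_ch (hy b (by simp))) hly
        rw [← h, ← hch, ← (up_GM hx hlx).1.hd_cons (up_GM hx hlx).2] at this
        exact this.1 hd
      by_cases hd : K.Hd (K.ch (a :: l)) (a :: l) <;>
        by_cases hd' : K.Hd (K.ch (b :: l')) (b :: l')
      · simp only [up, Lower, if_pos hd, if_pos hd', List.cons.injEq] at hlx hly h
        rw [h.1, ih hx'.2 hy'.2 hlx hly h.2]
      · exact (key hx'.2 hy hch hd hd' hlx hly h).elim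
      · exact (key hy'.2 hx hch.symm hd' hd hly hlx h.symm).elim
      · simp only [up, Lower, if_neg hd, if_neg hd'] at hlx hly h
        rw [hch] at hlx h
        exact upc_inj hx hy (hch ▸ occ_ch hx'.1) (occ_ch hy'.1) hlx hly h

theorem Crit.single (h : K.Crit l) : ∀ a ∈ l, ∃ c, K.col a = {c} := by
  induction l with
  | nil => simp
  | cons a l ih =>
    rw [List.forall_mem_cons]
    exact ⟨⟨_, h.1.2⟩, ih h.2⟩

/-- Being critical only depends on the colours, even across different systems of blocks. -/
theorem crit_iff_of_map_col {B' : Type*} {K' : Blocks B' C} (hK : K.good = K'.good) {l' : List B'}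
    (h : l.map K.col = l'.map K'.col) : K.Crit l ↔ K'.Crit l' := by
  have hocc : ∀ {l : List B} {l' : List B'}, l.map K.col = l'.map K'.col →
      ∀ c, K.Occ c l ↔ K'.Occ c l' := by
    intro l
    induction l with
    | nil => intro l' h c; cases l' <;> simp_all [Occ]
    | cons a l ih =>
      intro l' h c
      cases l' with
      | nil => simp at h
      | cons b l' =>
        simp only [List.map_cons, List.cons.injEq] at h
        simp only [Occ, Ga, h.1, hK, ih h.2 c]
  induction l generalizing l' with
  | nil => cases l' <;> simp_all [Crit]
  | cons a l ih =>
    cases l' with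
    | nil => simp at h
    | cons b l' =>
      have hch : K.ch (a :: l) = K'.ch (b :: l') := by
        simp only [ch, hocc h]
      simp only [List.map_cons, List.cons.injEq] at h
      simp only [Crit, Hd, Stp, Ga, hch, h.1, hK, hocc h.2, ih h.2]

end Blocks

section
variable {σ : Type*} {S T C C' : Finset (Mon σ)} {a b : Mon σ}

theorem NCF.symm {a b : Mon σ} (h : NCF a b) : NCF b a := by
  obtain ⟨i, h1, h2⟩ := h; exact ⟨i, h2, h1⟩

theorem NCF.mono {a b a' b' : Mon σ} (h : NCF a b) (ha : a ≤ a') (hb : b ≤ b') : NCF a' b' := by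
  obtain ⟨i, h1, h2⟩ := h
  have h3 : a i ≤ a' i := ha i
  have h4 : b i ≤ b' i := hb i
  exact ⟨i, by omega, by omega⟩

theorem NCF_self (h : a ≠ 0) : NCF a a := by
  obtain ⟨i, hi⟩ := Function.ne_iff.1 h
  exact ⟨i, hi, hi⟩

theorem mlcm_apply (S : Finset (Mon σ)) (i : σ) : mlcm S i = S.sup fun m => m i := by
  induction S using Finset.induction with
  | empty => simp [mlcm]
  | insert a S ha ih => rw [mlcm_insert, Pi.sup_apply, ih, Finset.sup_insert]

theorem mlcm_apply_ne_zero {i : σ} : mlcm S i ≠ 0 ↔ ∃ m ∈ S, m i ≠ 0 := by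
  rw [mlcm_apply, ← Nat.bot_eq_zero, ne_eq, Finset.sup_eq_bot_iff]
  push Not
  rfl

theorem NCF_mlcm : NCF (mlcm S) (mlcm T) ↔ ∃ m ∈ S, ∃ n ∈ T, NCF m n := by
  simp only [NCF, mlcm_apply_ne_zero]
  constructor
  · rintro ⟨i, ⟨m, hm, hmi⟩, n, hn, hni⟩
    exact ⟨m, hm, n, hn, i, hmi, hni⟩
  · rintro ⟨m, hm, n, hn, i, hmi, hni⟩
    exact ⟨i, ⟨m, hm, hmi⟩, n, hn, hni⟩

theorem NCF_mlcm_right : NCF a (mlcm T) ↔ ∃ n ∈ T, NCF a n := by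
  simpa [mlcm] using NCF_mlcm (S := {a}) (T := T)

theorem ConnIn.mono (h : ConnIn S a b) (hST : S ⊆ T) : ConnIn T a b :=
  ⟨hST h.1, hST h.2.1, Relation.ReflTransGen.mono (fun _ _ h => ⟨hST h.1, hST h.2.1, h.2.2⟩) _ _ h.2.2⟩

theorem ConnIn.symm (h : ConnIn S a b) : ConnIn S b a := by
  refine ⟨h.2.1, h.1, ?_⟩
  obtain ⟨-, -, this⟩ := h
  induction this with
  | refl => exact .refl
  | tail _ h ih => exact .head ⟨h.2.1, h.1, h.2.2.1.symm, h.2.2.2.symm⟩ ih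

theorem ConnIn.trans {c : Mon σ} (h : ConnIn S a b) (h' : ConnIn S b c) : ConnIn S a c :=
  ⟨h.1, h'.2.1, h.2.2.trans h'.2.2⟩

theorem ConnIn.of_NCF (ha : a ∈ S) (hb : b ∈ S) (h : NCF a b) : ConnIn S a b := by
  by_cases hab : a = b
  · subst hab; exact ⟨ha, ha, .refl⟩
  · exact ⟨ha, hb, .single ⟨ha, hb, hab, h⟩⟩

theorem ConnIn.mem_of_closed (h : ConnIn S a b) (hC : ∀ u ∈ C, ∀ v ∈ S, NCF u v → v ∈ C)
    (ha : a ∈ C) : b ∈ C := by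
  have h2 := h.2.2
  clear h
  induction h2 with
  | refl => exact ha
  | tail _ h ih => exact hC _ ih _ h.2.1 h.2.2.2

/-- A connected set has no proper non-empty subset closed under common factors. -/
theorem isConnected_iff : IsConnected S ↔ S.Nonempty ∧
    ∀ A ⊆ S, A.Nonempty → (∀ u ∈ A, ∀ v ∈ S, NCF u v → v ∈ A) → A = S := by
  refine and_congr_right fun _ => ⟨fun h A hA ⟨a, ha⟩ hcl => ?_, fun h a ha b hb => ?_⟩
  · exact Finset.Subset.antisymm hA fun b hb => (h a (hA ha) b hb).mem_of_closed hcl ha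
  · have := h (S.filter (ConnIn S a)) (Finset.filter_subset _ _)
      ⟨a, Finset.mem_filter.2 ⟨ha, ha, ha, .refl⟩⟩ fun u hu v hv huv => by
        rw [Finset.mem_filter] at hu ⊢
        exact ⟨hv, hu.2.trans (.of_NCF hu.1 hv huv)⟩
    exact (Finset.mem_filter.1 (this ▸ hb)).2

theorem mem_components : C ∈ components S ↔
    C ⊆ S ∧ IsConnected C ∧ ∀ u ∈ C, ∀ v ∈ S, NCF u v → v ∈ C := by
  simp only [components, Finset.mem_image]
  constructor
  · rintro ⟨a, ha, rfl⟩
    have hcl : ∀ u ∈ compOf S a, ∀ v ∈ S, NCF u v → v ∈ compOf S a := by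
      intro u hu v hv huv
      simp only [compOf, Finset.mem_filter] at hu ⊢
      exact ⟨hv, hu.2.trans (.of_NCF hu.1 hv huv)⟩
    refine ⟨Finset.filter_subset _ _, ?_, hcl⟩
    have haa : a ∈ compOf S a := Finset.mem_filter.2 ⟨ha, ha, ha, .refl⟩
    rw [isConnected_iff]
    refine ⟨⟨a, haa⟩, fun A hA ⟨b, hb⟩ hAcl => Finset.Subset.antisymm hA fun c hc => ?_⟩
    have h1 := (Finset.mem_filter.1 (hA hb)).2
    have h2 := (Finset.mem_filter.1 hc).2
    exact (h1.symm.trans h2).mem_of_closed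
      (fun u hu v hv huv => hAcl u hu v (hcl u (hA hu) v hv huv) huv) hb
  · rintro ⟨hCS, ⟨⟨a, ha⟩, hcon⟩, hcl⟩
    refine ⟨a, hCS ha, ?_⟩
    ext b
    simp only [compOf, Finset.mem_filter]
    exact ⟨fun h => h.2.mem_of_closed hcl ha, fun h => ⟨hCS h, (hcon a ha b h).mono hCS⟩⟩

theorem exists_component (ha : a ∈ S) : ∃ C ∈ components S, a ∈ C :=
  ⟨compOf S a, Finset.mem_image_of_mem _ ha, Finset.mem_filter.2 ⟨ha, ha, ha, .refl⟩⟩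

theorem IsConnected.subset_component (hT : IsConnected T) (hTS : T ⊆ S) (hC : C ∈ components S)
    (ha : a ∈ T) (haC : a ∈ C) : T ⊆ C :=
  fun b hb => ((hT.2 a ha b hb).mono hTS).mem_of_closed (mem_components.1 hC).2.2 haC

theorem component_eq (hC : C ∈ components S) (hC' : C' ∈ components S) (ha : a ∈ C)
    (ha' : a ∈ C') : C = C' :=
  Finset.Subset.antisymm
    ((mem_components.1 hC).2.1.subset_component (mem_components.1 hC).1 hC' ha ha')
    ((mem_components.1 hC').2.1.subset_component (mem_components.1 hC').1 hC ha' ha)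

theorem component_eq_of_NCF (hC : C ∈ components S) (hC' : C' ∈ components S)
    (h : NCF (mlcm C) (mlcm C')) : C = C' := by
  obtain ⟨m, hm, n, hn, hmn⟩ := NCF_mlcm.1 h
  exact component_eq hC hC' ((mem_components.1 hC).2.2 m hm n ((mem_components.1 hC').1 hn) hmn) hn

theorem mlcm_ne_zero (h0 : (0 : Mon σ) ∉ S) (hS : S.Nonempty) : mlcm S ≠ 0 := by
  obtain ⟨m, hm⟩ := hS
  intro h
  exact h0 ((le_antisymm (h ▸ le_mlcm hm) zero_le : m = 0) ▸ hm)

theorem component_mlcm_ne_zero (h0 : (0 : Mon σ) ∉ S) (hC : C ∈ components S) : mlcm C ≠ 0 :=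
  mlcm_ne_zero (fun h => h0 ((mem_components.1 hC).1 h)) (mem_components.1 hC).2.1.1

theorem component_mlcm_injOn (h0 : (0 : Mon σ) ∉ S) : Set.InjOn mlcm (components S : Set (Finset (Mon σ))) :=
  fun _ hC _ hC' h => component_eq_of_NCF hC hC' (h ▸ NCF_self (component_mlcm_ne_zero h0 hC))

theorem divisorsIn_component (h0 : (0 : Mon σ) ∉ S) (hC : C ∈ components S) :
    divisorsIn S (mlcm C) = C := by
  ext m
  simp only [divisorsIn, Finset.mem_filter]
  refine ⟨fun ⟨hm, hle⟩ => ?_, fun hm => ⟨(mem_components.1 hC).1 hm, le_mlcm hm⟩⟩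
  have : NCF m (mlcm C) := (NCF_self fun h => h0 (h ▸ hm)).mono le_rfl hle
  obtain ⟨n, hn, hmn⟩ := NCF_mlcm_right.1 this
  exact (mem_components.1 hC).2.2 n hn m hm hmn.symm

theorem components_eq_empty : components S = ∅ ↔ S = ∅ := by simp [components]

theorem components_of_isConnected (h : IsConnected S) : components S = {S} := by
  have hS : S ∈ components S := mem_components.2 ⟨Finset.Subset.refl _, h, fun _ _ _ h _ => h⟩
  obtain ⟨a, ha⟩ := h.1
  ext C
  rw [Finset.mem_singleton]
  refine ⟨fun hC => ?_, fun h => h ▸ hS⟩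
  obtain ⟨b, hb⟩ := (mem_components.1 hC).2.1.1
  exact component_eq hC hS hb ((mem_components.1 hC).1 hb)

theorem components_eq_singleton (h : components S = {C}) : S = C := by
  have hC : C ∈ components S := by simp [h]
  refine Finset.Subset.antisymm (fun m hm => ?_) (mem_components.1 hC).1
  obtain ⟨D, hD, hmD⟩ := exists_component hm
  rw [h, Finset.mem_singleton] at hD
  exact hD ▸ hmD

theorem components_union (h : ∀ m ∈ S, ∀ n ∈ T, ¬NCF m n) :
    components (S ∪ T) = components S ∪ components T := by
  have key : ∀ {S T : Finset (Mon σ)}, (∀ m ∈ S, ∀ n ∈ T, ¬NCF m n) →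
      components S ⊆ components (S ∪ T) := by
    intro S T h C hC
    rw [mem_components] at hC ⊢
    refine ⟨hC.1.trans Finset.subset_union_left, hC.2.1, fun u hu v hv huv => ?_⟩
    rcases Finset.mem_union.1 hv with hv | hv
    · exact hC.2.2 u hu v hv huv
    · exact (h u (hC.1 hu) v hv huv).elim
  have h1 := key h
  have h2 := key (S := T) (T := S) fun m hm n hn hmn => h n hn m hm hmn.symm
  rw [Finset.union_comm T S] at h2
  refine Finset.Subset.antisymm (fun C hC => ?_) (Finset.union_subset h1 h2)
  obtain ⟨a, ha⟩ := (mem_components.1 hC).2.1.1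
  rw [Finset.mem_union]
  rcases Finset.mem_union.1 ((mem_components.1 hC).1 ha) with haS | haS
  · obtain ⟨D, hD, haD⟩ := exists_component haS
    exact .inl (component_eq (h1 hD) hC haD ha ▸ hD)
  · obtain ⟨D, hD, haD⟩ := exists_component haS
    exact .inr (component_eq (h2 hD) hC haD ha ▸ hD)

theorem mlcm_union_of_not_NCF (h : ¬NCF (mlcm S) (mlcm T)) :
    mlcm (S ∪ T) = mlcm S + mlcm T := by
  rw [mlcm_union]
  ext i
  by_contra h'
  exact h ⟨i, fun hi => h' (by simp [hi]), fun hi => h' (by simp [hi])⟩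

theorem components_disjoint (h0 : (0 : Mon σ) ∉ S) (h : ¬NCF (mlcm S) (mlcm T)) :
    Disjoint (components S) (components T) := by
  rw [Finset.disjoint_left]
  intro C hC hC'
  obtain ⟨a, ha⟩ := (mem_components.1 hC).2.1.1
  have haS := (mem_components.1 hC).1 ha
  exact h (NCF_mlcm.2 ⟨a, haS, a, (mem_components.1 hC').1 ha,
    NCF_self fun h => h0 (h ▸ haS)⟩)

theorem not_NCF_component_sdiff (hC : C ∈ components S) : ¬NCF (mlcm (S \ C)) (mlcm C) := by
  rw [NCF_mlcm]
  rintro ⟨m, hm, n, hn, hmn⟩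
  rw [Finset.mem_sdiff] at hm
  exact hm.2 ((mem_components.1 hC).2.2 n hn m hm.1 hmn.symm)

end

section
variable {σ : Type*} [Finite σ]

/-- An exponent vector as a finitely supported function. -/
def fs (m : Mon σ) : σ →₀ ℕ := Finsupp.equivFunOnFinite.symm m

theorem fs_add (a b : Mon σ) : fs (a + b) = fs a + fs b := by ext; rfl

theorem fs_zero : fs (0 : Mon σ) = 0 := by ext; rfl

@[simp] theorem fs_apply (a : Mon σ) (i : σ) : fs a i = a i := rfl

theorem fs_eq_zero {a : Mon σ} : fs a = 0 ↔ a = 0 := by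
  constructor
  · intro h; ext i; exact DFunLike.congr_fun h i
  · rintro rfl; exact fs_zero

theorem toMultiset_injective : Function.Injective (Finsupp.toMultiset : (σ →₀ ℕ) → Multiset σ) := by
  intro f g h
  ext i
  rw [← Finsupp.count_toMultiset, h, Finsupp.count_toMultiset]

theorem toMultiset_eq_zero {f : σ →₀ ℕ} : Finsupp.toMultiset f = 0 ↔ f = 0 :=
  ⟨fun h => toMultiset_injective (h.trans (map_zero _).symm), fun h => by rw [h, map_zero]⟩

/-- The colours of an element of the Taylor algebra: a colour for each variable of the coefficient
monomial and one for each connected component. -/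
def pcol (a : TX σ) : Multiset (σ ⊕ Mon σ) :=
  (Finsupp.toMultiset (fs (a.1 - mlcm a.2))).map Sum.inl +
    (components a.2).val.map (Sum.inr ∘ mlcm)

/-- Compatibility of colours. -/
def cgood : σ ⊕ Mon σ → σ ⊕ Mon σ → Prop
  | .inr m, .inr n => ¬NCF m n
  | _, _ => True

variable {M : Finset (Mon σ)} {a b : TX σ}

theorem inl_mem_pcol {i : σ} : Sum.inl i ∈ pcol a ↔ mlcm a.2 i < a.1 i := by
  have : a.1 i - mlcm a.2 i ≠ 0 ↔ mlcm a.2 i < a.1 i := by omega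
  simp [pcol, this]

theorem inr_mem_pcol {m : Mon σ} : Sum.inr m ∈ pcol a ↔ ∃ C ∈ components a.2, mlcm C = m := by
  simp [pcol]

theorem pcol_eq_zero (h : TV M a) : pcol a ≠ 0 := by
  intro h'
  rw [pcol, add_eq_zero, Multiset.map_eq_zero, Multiset.map_eq_zero, Finset.val_eq_zero,
    components_eq_empty] at h'
  rw [h'.2, mlcm_empty, tsub_zero, toMultiset_eq_zero, fs_eq_zero] at h'
  exact h.1 h'.1

theorem TV.zero_notMem (h0 : (0 : Mon σ) ∉ M) (h : TV M a) : (0 : Mon σ) ∉ a.2 := fun h' => h0 (h.2.1 h')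

theorem pcol_clique (h0 : (0 : Mon σ) ∉ M) (h : TV M a) {c d : σ ⊕ Mon σ} {s : Multiset (σ ⊕ Mon σ)}
    (hs : pcol a = c ::ₘ s) (hd : d ∈ s) : cgood d c := by
  rcases c with i | m
  · cases d <;> trivial
  rcases d with j | n
  · trivial
  have hdis : (Multiset.filter (fun x => x.isRight) (pcol a)).Nodup := by
    rw [pcol, Multiset.filter_add, Multiset.filter_eq_nil.2 (by simp), zero_add,
      Multiset.filter_eq_self.2 (by simp)]
    refine Multiset.Nodup.map_on (fun C hC D hD hCD => ?_) (components a.2).nodup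
    exact component_mlcm_injOn (h.zero_notMem h0) hC hD (Sum.inr_injective hCD)
  rw [hs, Multiset.filter_cons_of_pos _ (by simp), Multiset.nodup_cons] at hdis
  have hne : n ≠ m := by
    rintro rfl
    exact hdis.1 (Multiset.mem_filter.2 ⟨hd, by simp⟩)
  obtain ⟨C, hC, rfl⟩ := inr_mem_pcol.1 (hs ▸ Multiset.mem_cons_self _ _ : Sum.inr m ∈ pcol a)
  obtain ⟨D, hD, rfl⟩ := inr_mem_pcol.1 (hs ▸ Multiset.mem_cons_of_mem hd : Sum.inr n ∈ pcol a)
  exact fun h' => hne (by rw [component_eq_of_NCF hD hC h'])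

theorem pcol_good_iff : (∀ c ∈ pcol a, ∀ d ∈ pcol b, cgood c d) ↔
    ¬NCF (mlcm a.2) (mlcm b.2) := by
  constructor
  · intro h h'
    obtain ⟨m, hm, n, hn, hmn⟩ := NCF_mlcm.1 h'
    obtain ⟨C, hC, hmC⟩ := exists_component hm
    obtain ⟨D, hD, hnD⟩ := exists_component hn
    exact h _ (inr_mem_pcol.2 ⟨C, hC, rfl⟩) _ (inr_mem_pcol.2 ⟨D, hD, rfl⟩)
      (NCF_mlcm.2 ⟨m, hmC, n, hnD, hmn⟩)
  · rintro h (i | m) hc (j | n) hd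
    any_goals trivial
    obtain ⟨C, hC, rfl⟩ := inr_mem_pcol.1 hc
    obtain ⟨D, hD, rfl⟩ := inr_mem_pcol.1 hd
    exact fun h' => h (h'.mono (mlcm_mono (mem_components.1 hC).1) (mlcm_mono (mem_components.1 hD).1))

theorem pcol_mul (h0 : (0 : Mon σ) ∉ M) (ha : TV M a) (hb : TV M b)
    (h : ¬NCF (mlcm a.2) (mlcm b.2)) : pcol (a.1 + b.1, a.2 ∪ b.2) = pcol a + pcol b := by
  have h1 : a.1 + b.1 - mlcm (a.2 ∪ b.2) = (a.1 - mlcm a.2) + (b.1 - mlcm b.2) := by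
    rw [mlcm_union_of_not_NCF h]
    ext i
    have h3 : mlcm a.2 i ≤ a.1 i := ha.2.2 i
    have h4 : mlcm b.2 i ≤ b.1 i := hb.2.2 i
    simp only [Pi.sub_apply, Pi.add_apply]
    omega
  have h2 : (components (a.2 ∪ b.2)).val = (components a.2).val + (components b.2).val := by
    rw [components_union fun m hm n hn hmn => h (NCF_mlcm.2 ⟨m, hm, n, hn, hmn⟩),
      ← Finset.disjUnion_eq_union _ _ (components_disjoint (ha.zero_notMem h0) h)]
    rfl
  simp only [pcol, h1, h2, fs_add, map_add, Multiset.map_add]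
  abel

/-- Removing a colour. -/
def trem (a : TX σ) : σ ⊕ Mon σ → TX σ
  | .inl i => (a.1 - Pi.single i 1, a.2)
  | .inr m => (a.1 - m, a.2 \ divisorsIn a.2 m)

/-- The part of a given colour. -/
def tprt (a : TX σ) : σ ⊕ Mon σ → TX σ
  | .inl i => (Pi.single i 1, ∅)
  | .inr m => (m, divisorsIn a.2 m)

theorem pcol_single (i : σ) : pcol (Pi.single i 1, (∅ : Finset (Mon σ))) = {Sum.inl i} := by
  have : fs (Pi.single i 1 : Mon σ) = Finsupp.single i 1 := by
    ext j; simp [Finsupp.single_apply, Pi.single_apply, eq_comm]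
  simp [pcol, mlcm_empty, this, components]

theorem pcol_of_isConnected {C : Finset (Mon σ)} (h : IsConnected C) :
    pcol (mlcm C, C) = {Sum.inr (mlcm C)} := by
  simp [pcol, fs_zero, components_of_isConnected h]

theorem Finsupp_toMultiset_eq_singleton {f : σ →₀ ℕ} {i : σ} (h : Finsupp.toMultiset f = {i}) :
    f = Finsupp.single i 1 := by
  refine toMultiset_injective (h.trans ?_)
  simp

theorem pcol_eq_inl {i : σ} (h : pcol a = {Sum.inl i}) : a = (Pi.single i 1, ∅) := by
  have hS : a.2 = ∅ := by
    rw [← components_eq_empty, Finset.eq_empty_iff_forall_notMem]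
    intro C hC
    have : Sum.inr (mlcm C) ∈ pcol a := inr_mem_pcol.2 ⟨C, hC, rfl⟩
    simp [h] at this
  have h1 : (Finsupp.toMultiset (fs a.1)).map (Sum.inl : σ → σ ⊕ Mon σ) = ({i} : Multiset σ).map Sum.inl := by
    simpa [pcol, hS, mlcm_empty, components] using h
  have h2 := Finsupp_toMultiset_eq_singleton (Multiset.map_injective Sum.inl_injective h1)
  refine Prod.ext ?_ hS
  ext j
  have := DFunLike.congr_fun h2 j
  simpa [Finsupp.single_apply, Pi.single_apply, eq_comm] using this

theorem pcol_eq_inr {m : Mon σ} (ha : TV M a) (h : pcol a = {Sum.inr m}) :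
    IsConnected a.2 ∧ a.1 = m ∧ mlcm a.2 = m := by
  obtain ⟨C, hC, hCm⟩ := inr_mem_pcol.1 (h ▸ Multiset.mem_singleton_self _ : Sum.inr m ∈ pcol a)
  have hcard := congrArg Multiset.card h
  simp only [pcol, Multiset.card_add, Multiset.card_map, Multiset.card_singleton] at hcard
  have hpos : 0 < (components a.2).card := Finset.card_pos.2 ⟨C, hC⟩
  have h1 : Finsupp.toMultiset (fs (a.1 - mlcm a.2)) = 0 :=
    Multiset.card_eq_zero.1 (by rw [Finset.card_val] at hcard; omega)
  have h2 : (components a.2).card = 1 := by rw [Finset.card_val] at hcard; omega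
  obtain ⟨D, hD⟩ := Finset.card_eq_one.1 h2
  obtain rfl : C = D := by simpa [hD] using hC
  have hC2 := components_eq_singleton hD
  rw [toMultiset_eq_zero, fs_eq_zero, tsub_eq_zero_iff_le] at h1
  rw [hC2] at h1 ⊢
  refine ⟨(mem_components.1 hC).2.1, ?_, hCm⟩
  rw [← hCm]
  exact le_antisymm h1 (hC2 ▸ ha.2.2)

/-- Splitting off a variable colour. -/
theorem split_inl {i : σ} (ha : TV M a) (hi : Sum.inl i ∈ pcol a) :
    (a.1 - Pi.single i 1) + Pi.single i 1 = a.1 ∧ mlcm a.2 ≤ a.1 - Pi.single i 1 := by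
  rw [inl_mem_pcol] at hi
  constructor <;> [ext j; intro j]
  all_goals
    have := ha.2.2 j
    by_cases hj : j = i
    · subst hj; simp; omega
    · simp [hj, this]

/-- Splitting off a component. -/
theorem split_inr {C : Finset (Mon σ)} (h0 : (0 : Mon σ) ∉ M) (ha : TV M a)
    (hC : C ∈ components a.2) : divisorsIn a.2 (mlcm C) = C ∧ (a.2 \ C) ∪ C = a.2 ∧
      (a.1 - mlcm C) + mlcm C = a.1 ∧ mlcm (a.2 \ C) ≤ a.1 - mlcm C := by
  have h1 := divisorsIn_component (ha.zero_notMem h0) hC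
  have h2 : (a.2 \ C) ∪ C = a.2 := Finset.sdiff_union_of_subset (mem_components.1 hC).1
  have h3 := mlcm_union_of_not_NCF (not_NCF_component_sdiff hC)
  rw [h2] at h3
  have h4 := ha.2.2
  rw [h3] at h4
  refine ⟨h1, h2, ?_, ?_⟩
  · ext i; have : mlcm (a.2 \ C) i + mlcm C i ≤ a.1 i := h4 i; simp only [Pi.add_apply, Pi.sub_apply]; omega
  · intro i; have : mlcm (a.2 \ C) i + mlcm C i ≤ a.1 i := h4 i; simp only [Pi.sub_apply]; omega

theorem TV_prt_inl (i : σ) : TV M ((Pi.single i 1, ∅) : TX σ) :=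
  ⟨by simp, by simp, by simp [mlcm_empty]⟩

theorem TV_prt_inr {C : Finset (Mon σ)} (h0 : (0 : Mon σ) ∉ M) (ha : TV M a)
    (hC : C ∈ components a.2) : TV M ((mlcm C, C) : TX σ) :=
  ⟨component_mlcm_ne_zero (ha.zero_notMem h0) hC, (mem_components.1 hC).1.trans ha.2.1, le_rfl⟩

theorem TV_rem {c : σ ⊕ Mon σ} (h0 : (0 : Mon σ) ∉ M) (ha : TV M a) (hc : c ∈ pcol a)
    (hne : pcol a ≠ {c}) : TV M (trem a c) := by
  rcases c with i | m
  · have := split_inl ha hc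
    refine ⟨fun h => hne ?_, ha.2.1, this.2⟩
    simp only [trem] at h
    rw [h] at this
    have hS : a.2 = ∅ := by
      by_contra hS
      exact mlcm_ne_zero (ha.zero_notMem h0) (Finset.nonempty_iff_ne_empty.2 hS)
        (le_antisymm this.2 zero_le)
    rw [← pcol_single i]
    congr 1
    exact Prod.ext (by simpa using this.1.symm) hS
  · obtain ⟨C, hC, rfl⟩ := inr_mem_pcol.1 hc
    have := split_inr h0 ha hC
    simp only [trem, this.1]
    refine ⟨fun h => hne ?_, Finset.sdiff_subset.trans ha.2.1, this.2.2.2⟩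
    simp only at h
    rw [h] at this
    have hS : a.2 \ C = ∅ := by
      by_contra hS
      exact mlcm_ne_zero (fun h => ha.zero_notMem h0 (Finset.sdiff_subset h))
        (Finset.nonempty_iff_ne_empty.2 hS) (le_antisymm this.2.2.2 zero_le)
    rw [← pcol_of_isConnected (mem_components.1 hC).2.1]
    congr 1
    refine Prod.ext (by simpa using this.2.2.1.symm) ?_
    rw [← this.2.1, hS, Finset.empty_union]

theorem rem_prt {c : σ ⊕ Mon σ} (h0 : (0 : Mon σ) ∉ M) (ha : TV M a) (hc : c ∈ pcol a) :
    ((trem a c).1 + (tprt a c).1, (trem a c).2 ∪ (tprt a c).2) = a ∧ TV M (tprt a c) ∧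
      pcol (tprt a c) = {c} ∧ ¬NCF (mlcm (trem a c).2) (mlcm (tprt a c).2) := by
  rcases c with i | m
  · refine ⟨Prod.ext (split_inl ha hc).1 (Finset.union_empty _), TV_prt_inl i, pcol_single i, ?_⟩
    simp [trem, tprt, NCF, mlcm_empty]
  · obtain ⟨C, hC, rfl⟩ := inr_mem_pcol.1 hc
    have := split_inr h0 ha hC
    simp only [trem, tprt, this.1]
    exact ⟨Prod.ext this.2.2.1 this.2.1, TV_prt_inr h0 ha hC,
      pcol_of_isConnected (mem_components.1 hC).2.1, not_NCF_component_sdiff hC⟩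

theorem split_mul {c : σ ⊕ Mon σ} (h0 : (0 : Mon σ) ∉ M) (ha : TV M a) (hb : TV M b)
    (hg : ∀ d ∈ pcol a, cgood d c) (hc : pcol b = {c}) :
    trem (a.1 + b.1, a.2 ∪ b.2) c = a ∧ tprt (a.1 + b.1, a.2 ∪ b.2) c = b := by
  rcases c with i | m
  · rw [pcol_eq_inl hc]
    simp [trem, tprt]
  · obtain ⟨h1, h2, h3⟩ := pcol_eq_inr hb hc
    have hcop : ¬NCF (mlcm a.2) (mlcm b.2) :=
      pcol_good_iff.1 fun d hd e he => by
        rw [hc, Multiset.mem_singleton] at he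
        exact he ▸ hg d hd
    have hdiv : divisorsIn (a.2 ∪ b.2) m = b.2 := by
      ext n
      simp only [divisorsIn, Finset.mem_filter, Finset.mem_union]
      refine ⟨fun ⟨hn, hnm⟩ => hn.resolve_left fun hn => ?_, fun hn => ⟨.inr hn, h3 ▸ le_mlcm hn⟩⟩
      have hn0 : n ≠ 0 := fun h => ha.zero_notMem h0 (h ▸ hn)
      exact hcop ((NCF_self hn0).mono (le_mlcm hn) (h3 ▸ hnm))
    have hdis : Disjoint a.2 b.2 := by
      rw [Finset.disjoint_left]
      intro n hn hn'
      have hn0 : n ≠ 0 := fun h => ha.zero_notMem h0 (h ▸ hn)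
      exact hcop ((NCF_self hn0).mono (le_mlcm hn) (le_mlcm hn'))
    simp only [trem, tprt, hdiv]
    refine ⟨Prod.ext ?_ ?_, Prod.ext h2.symm rfl⟩
    · simp [h2]
    · rw [Finset.union_sdiff_right, Finset.sdiff_eq_self_of_disjoint hdis]

/-- The elements of the Taylor algebra as coloured blocks. -/
def txBlocks (M : Finset (Mon σ)) (h0 : (0 : Mon σ) ∉ M) : Blocks (TX σ) (σ ⊕ Mon σ) where
  V := TV M
  col := pcol
  good := cgood
  mul a b := (a.1 + b.1, a.2 ∪ b.2)
  rem := trem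
  prt := tprt
  col_ne := pcol_eq_zero
  clique ha hs hd := pcol_clique h0 ha hs hd
  mul_V ha hb _ := ha.mul hb
  mul_col ha hb hg := pcol_mul h0 ha hb (pcol_good_iff.1 hg)
  rem_V ha hc hne := TV_rem h0 ha hc hne
  prt_V ha hc := (rem_prt h0 ha hc).2.1
  prt_col ha hc := (rem_prt h0 ha hc).2.2.1
  mul_rem ha hc _ := (rem_prt h0 ha hc).1
  rem_col {a c} ha hc hne := by
    have h := rem_prt h0 ha hc
    have h2 := pcol_mul h0 (TV_rem h0 ha hc hne) h.2.1 h.2.2.2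
    rw [h.1, h.2.2.1] at h2
    rw [h2, add_comm, Multiset.singleton_add]
  rem_mul ha hb hg hc := (split_mul h0 ha hb hg hc).1
  prt_mul ha hb hg hc := (split_mul h0 ha hb hg hc).2

end

section
variable {σ : Type*} [Finite σ] {M : Finset (Mon σ)} {a b : TX σ}

theorem IsConnected.insert {C : Finset (Mon σ)} {m : Mon σ} (hC : IsConnected C)
    (hm : NCF m (mlcm C)) : IsConnected (insert m C) := by
  obtain ⟨n, hn, hmn⟩ := NCF_mlcm_right.1 hm
  rw [isConnected_iff] at hC ⊢
  refine ⟨Finset.insert_nonempty _ _, fun A hA ⟨a, ha⟩ hcl => Finset.Subset.antisymm hA ?_⟩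
  have hex : (A ∩ C).Nonempty := by
    rcases Finset.mem_insert.1 (hA ha) with rfl | haC
    · exact ⟨n, Finset.mem_inter.2 ⟨hcl _ ha n (Finset.mem_insert_of_mem hn) hmn, hn⟩⟩
    · exact ⟨a, Finset.mem_inter.2 ⟨ha, haC⟩⟩
  have hAC := hC.2 (A ∩ C) Finset.inter_subset_right hex fun u hu v hv huv =>
    Finset.mem_inter.2 ⟨hcl u (Finset.mem_inter.1 hu).1 v (Finset.mem_insert_of_mem hv) huv, hv⟩
  rw [Finset.inter_eq_right] at hAC
  exact Finset.insert_subset (hcl n (hAC hn) m (Finset.mem_insert_self _ _) hmn.symm) hAC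

theorem pcol_of_erase {γ : Mon σ} {S : Finset (Mon σ)} {m : Mon σ} {c : σ ⊕ Mon σ}
    (h0 : (0 : Mon σ) ∉ M) (h1 : ∀ m ∈ M, ∀ i, ¬m ≤ Pi.single i 1) (ha : TV M (γ, S)) (hm : m ∈ S)
    (h : pcol (γ, S.erase m) = {c}) : pcol (γ, S) = {c} := by
  rcases c with i | μ
  · have h2 : γ = Pi.single i 1 := congrArg Prod.fst (pcol_eq_inl h)
    exact (h1 m (ha.2.1 hm) i (h2 ▸ (le_mlcm hm).trans ha.2.2)).elim
  · have ha' : TV M (γ, S.erase m) := ⟨ha.1, (Finset.erase_subset _ _).trans ha.2.1,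
      (mlcm_mono (Finset.erase_subset _ _)).trans ha.2.2⟩
    obtain ⟨hcon, h2, h3⟩ := pcol_eq_inr ha' h
    have hcon : IsConnected (S.erase m) := hcon
    have h2 : γ = μ := h2
    have h3 : mlcm (S.erase m) = μ := h3
    have ha2 : mlcm S ≤ γ := ha.2.2
    have hS : mlcm S = μ :=
      le_antisymm (h2 ▸ ha2) (h3 ▸ mlcm_mono (Finset.erase_subset _ _))
    have hm0 : m ≠ 0 := fun h => h0 (h ▸ ha.2.1 hm)
    have := hcon.insert ((NCF_self hm0).mono le_rfl (h3.symm ▸ h2 ▸ (le_mlcm hm).trans ha2))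
    rw [Finset.insert_erase hm] at this
    have := pcol_of_isConnected this
    rw [hS] at this
    rwa [h2]

theorem pcol_mul_ne {c : σ ⊕ Mon σ} (h0 : (0 : Mon σ) ∉ M) (ha : TV M a) (hb : TV M b) :
    pcol (a.1 + b.1, a.2 ∪ b.2) ≠ {c} := by
  intro h
  rcases c with i | μ
  · have := congrArg Prod.fst (pcol_eq_inl h)
    obtain ⟨j, hj⟩ := Function.ne_iff.1 ha.1
    obtain ⟨j', hj'⟩ := Function.ne_iff.1 hb.1
    have e1 := congrFun this j
    have e2 := congrFun this j'
    simp only [Pi.add_apply, Pi.single_apply, Pi.zero_apply] at e1 e2 hj hj'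
    split_ifs at e1 e2 <;> first | omega | (subst_vars; omega)
  · obtain ⟨hcon, h2, h3⟩ := pcol_eq_inr (ha.mul hb) h
    simp only at hcon h2 h3
    rw [← h3, mlcm_union] at h2
    have h4 : ∀ j, a.1 j + b.1 j = max (mlcm a.2 j) (mlcm b.2 j) := fun j => congrFun h2 j
    have h5 : ∀ j, mlcm a.2 j ≤ a.1 j := ha.2.2
    have h6 : ∀ j, mlcm b.2 j ≤ b.1 j := hb.2.2
    have ha2 : a.2.Nonempty := by
      by_contra hne
      rw [Finset.not_nonempty_iff_eq_empty] at hne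
      refine ha.1 (funext fun j => ?_)
      have := h4 j; have := h5 j; have := h6 j
      simp only [hne, mlcm_empty, Pi.zero_apply] at *
      omega
    have hb2 : b.2.Nonempty := by
      by_contra hne
      rw [Finset.not_nonempty_iff_eq_empty] at hne
      refine hb.1 (funext fun j => ?_)
      have := h4 j; have := h5 j; have := h6 j
      simp only [hne, mlcm_empty, Pi.zero_apply] at *
      omega
    have hN : ¬NCF (mlcm a.2) (mlcm b.2) := by
      rintro ⟨j, h7, h8⟩
      have := h4 j; have := h5 j; have := h6 j
      omega
    have := (isConnected_iff.1 hcon).2 a.2 Finset.subset_union_left ha2 fun u hu v hv huv =>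
      (Finset.mem_union.1 hv).resolve_right fun hv => hN (NCF_mlcm.2 ⟨u, hu, v, hv, huv⟩)
    obtain ⟨n, hn⟩ := hb2
    exact hN (NCF_mlcm.2 ⟨n, this ▸ Finset.mem_union_right _ hn, n, hn,
      NCF_self fun h => h0 (h ▸ hb.2.1 hn)⟩)

theorem BFace.map_pcol {l l' : List (TX σ)} (h0 : (0 : Mon σ) ∉ M)
    (h1 : ∀ m ∈ M, ∀ i, ¬m ≤ Pi.single i 1) (h : BFace l l') (hl : ∀ a ∈ l, TV M a)
    (hl' : ∀ a ∈ l', ∃ c, pcol a = {c}) : l.map pcol = l'.map pcol := by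
  induction h with
  | del γ hm l =>
    rw [List.forall_mem_cons] at hl hl'
    obtain ⟨c, hc⟩ := hl'.1
    rw [List.map_cons, List.map_cons, hc, pcol_of_erase h0 h1 hl.1 hm hc]
  | merge h l =>
    simp only [List.forall_mem_cons] at hl hl'
    obtain ⟨c, hc⟩ := hl'.1
    exact (pcol_mul_ne h0 hl.1 hl.2.1 hc).elim
  | cons a h ih =>
    rw [List.forall_mem_cons] at hl hl'
    rw [List.map_cons, List.map_cons, ih hl.2 hl'.2]

/-- The total degree of an exponent vector. -/
def md (m : Mon σ) : ℕ := (Finsupp.toMultiset (fs m)).card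

theorem md_add (a b : Mon σ) : md (a + b) = md a + md b := by simp [md, fs_add]

theorem md_mono {a b : Mon σ} (h : a ≤ b) : md a ≤ md b := by
  rw [← add_tsub_cancel_of_le h, md_add]; omega

theorem md_eq_zero {a : Mon σ} : md a = 0 ↔ a = 0 := by
  rw [md, Multiset.card_eq_zero, toMultiset_eq_zero, fs_eq_zero]

theorem md_sup_lt {a b : Mon σ} (h : NCF a b) : md (a ⊔ b) < md a + md b := by
  have h1 : a ⊔ b + a ⊓ b = a + b := by
    ext i; simp only [Pi.add_apply, Pi.sup_apply, Pi.inf_apply]; omega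
  have h2 : md (a ⊓ b) ≠ 0 := by
    rw [ne_eq, md_eq_zero]
    intro h'
    obtain ⟨i, h3, h4⟩ := h
    have := congrFun h' i
    simp only [Pi.inf_apply, Pi.zero_apply] at this
    omega
  have := congrArg md h1
  rw [md_add, md_add] at this
  omega

/-- The weight of a list, which drops along all faces except the good merges. -/
def wt (l : List (TX σ)) : ℕ := (l.map fun a => md (mlcm a.2) + a.2.card).sum

theorem BFace.gm_or_lt {l l' : List (TX σ)} (h0 : (0 : Mon σ) ∉ M) (h : BFace l l') :
    (txBlocks M h0).GM l l' ∨ wt l' < wt l := by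
  induction h with
  | @del γ S m hm l =>
    right
    have h2 := Finset.card_erase_lt_of_mem hm
    have h3 := md_mono (mlcm_mono (Finset.erase_subset m S))
    simp only [wt, List.map_cons, List.sum_cons]
    omega
  | @merge a b h l =>
    by_cases hN : NCF (mlcm a.2) (mlcm b.2)
    · right
      have h2 := md_sup_lt hN
      simp only [wt, List.map_cons, List.sum_cons, mlcm_union, Finset.card_union_of_disjoint h]
      omega
    · exact .inl (.merge (pcol_good_iff.2 hN) l)
  | cons a h ih =>
    refine ih.imp (.cons a) fun h => ?_
    simpa [wt] using h

theorem GM_face {l l' : List (TX σ)} {h0 : (0 : Mon σ) ∉ M} (h : (txBlocks M h0).GM l l')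
    (hl : ∀ a ∈ l, TV M a) : BFace l l' ∧ wt l' = wt l := by
  induction h with
  | @merge a b h l =>
    rw [List.forall_mem_cons] at hl
    have hN := pcol_good_iff.1 h
    have hdis : Disjoint a.2 b.2 := by
      rw [Finset.disjoint_left]
      intro n hn hn'
      exact hN ((NCF_self fun h => h0 (h ▸ hl.1.2.1 hn)).mono (le_mlcm hn) (le_mlcm hn'))
    refine ⟨.merge hdis l, ?_⟩
    simp only [wt, List.map_cons, List.sum_cons, txBlocks, mlcm_union_of_not_NCF hN, md_add,
      Finset.card_union_of_disjoint hdis]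
    omega
  | cons a h ih =>
    rw [List.forall_mem_cons] at hl
    refine ⟨.cons a (ih hl.2).1, ?_⟩
    simpa [wt] using (ih hl.2).2

instance : Nonempty (σ ⊕ Mon σ) := ⟨.inr 0⟩

/-- The critical lists of the bar construction of the Taylor algebra. -/
def TCrit (M : Finset (Mon σ)) (h0 : (0 : Mon σ) ∉ M) (α : Mon σ) : Set (List (TX σ)) :=
  {l | l ∈ TBar M α ∧ (txBlocks M h0).Crit l}

theorem TCrit_closed (k : Type*) [Field k] (h0 : (0 : Mon σ) ∉ M)
    (h1 : ∀ m ∈ M, ∀ i, ¬m ≤ Pi.single i 1) (α : Mon σ) :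
    Closed (tbarD k σ) (TBar M α \ TCrit M h0 α) := by
  intro x hx y hy
  have h := BFace.of_coeff hy
  refine ⟨h.mem_TBar hx.1, fun hc => hx.2 ⟨hx.1, ?_⟩⟩
  exact (Blocks.crit_iff_of_map_col (K := txBlocks M h0) (K' := txBlocks M h0) rfl
    (h.map_pcol h0 h1 hx.1.2 hc.2.single)).2 hc.2

theorem hh_TCrit (k : Type*) [Field k] (h0 : (0 : Mon σ) ∉ M)
    (h1 : ∀ m ∈ M, ∀ i, ¬m ≤ Pi.single i 1) (α : Mon σ) (n : ℕ) :
    hh (tbarD k σ) (Fam k (TBar M α) tdeg) n =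
      hh (tr (tbarD k σ) (TCrit M h0 α)) (Fam k (TCrit M h0 α) tdeg) n := by
  let K := txBlocks M h0
  have hsub : {l | l ∈ TBar M α ∧ K.Lower l} ⊆ TBar M α \ TCrit M h0 α :=
    fun l hl => ⟨hl.1, fun h => h.2.not_lower hl.2⟩
  refine Matching.hh_quot (Lo := {l | l ∈ TBar M α ∧ K.Lower l}) (up := K.up)
    (lev := fun l => toLex (wt l, K.lv l)) (TBar_cx k M α) (fun l hl => hl.1)
    (TCrit_closed k h0 h1 α) ⟨hsub, fun x hx => ?_, fun y hy hyl => ?_, fun x hx => ?_,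
      fun x hx y hy hne hc => ?_⟩ n
  · have h := Blocks.up_GM hx.1.2 hx.2
    have hf := (GM_face h.1 h.2).1
    have hn := Blocks.up_not hx.1.2 hx.2
    exact ⟨⟨⟨by rw [← hf.sum, hx.1.1], h.2⟩, fun h' => hn.2 h'.2⟩, fun h' => hn.1 h'.2, hf.deg.symm⟩
  · obtain ⟨x, hx, hlx, rfl⟩ := Blocks.up_surj (K := K) hy.1.2 (fun h => hyl ⟨hy.1, h⟩)
      (fun h => hy.2 ⟨hy.1, h⟩)
    have h := Blocks.up_GM hx hlx
    exact ⟨x, ⟨⟨by rw [(GM_face h.1 h.2).1.sum, hy.1.1], hx⟩, hlx⟩, rfl⟩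
  · have h := Blocks.up_GM hx.1.2 hx.2
    exact (GM_face h.1 h.2).1.coeff fun a ha => (h.2 a ha).1
  · have h := Blocks.up_GM hx.1.2 hx.2
    have hw := (GM_face h.1 h.2).2
    rw [Prod.Lex.toLex_lt_toLex]
    rcases (BFace.of_coeff hc).gm_or_lt h0 with hg | hlt
    · refine .inr ⟨?_, (Blocks.up_lt hx.1.2 hx.2 hg hy.2).resolve_left hne⟩
      rw [(GM_face hg h.2).2, ← hw]
    · exact .inl (by rw [hw]; exact hlt)

end

section
variable {k : Type*} [Field k] {X : Type*} {D D' : (X →₀ k) →ₗ[k] (X →₀ k)} {deg : X → ℕ}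

theorem Cx.congr {C : Set X} (hC : Cx D C deg)
    (h : ∀ x ∈ C, D (Finsupp.single x 1) = D' (Finsupp.single x 1)) : Cx D' C deg := by
  have hface : ∀ x ∈ C, ∀ y, D' (Finsupp.single x 1) y ≠ 0 → y ∈ C ∧ deg y + 1 = deg x :=
    fun x hx y hy => hC.face x hx y (by rwa [h x hx])
  refine ⟨hface, fun x hx => ?_, hC.fin⟩
  rw [← h x hx, ← hC.sq x hx]
  refine (Fam_map_eq (deg := fun _ => 0) (n := 0) (fun y hy _ => h y hy) ?_).symm
  exact mem_Fam.2 fun y hy => ⟨(hC.face _ hx y hy).1, rfl⟩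

theorem Cx.union {A B : Set X} (hA : Cx D A deg) (hB : Cx D B deg) : Cx D (A ∪ B) deg where
  face x hx y hy := hx.elim (fun hx => (hA.face x hx y hy).imp .inl id)
    (fun hx => (hB.face x hx y hy).imp .inr id)
  sq _ hx := hx.elim (hA.sq _) (hB.sq _)
  fin n := ((hA.fin n).union (hB.fin n)).subset fun x hx => hx.1.imp (⟨·, hx.2⟩) (⟨·, hx.2⟩)

theorem Cx.empty : Cx D ∅ deg := ⟨fun _ h => h.elim, fun _ h => h.elim, fun n => by simp⟩

theorem hh_biUnion {ι : Type*} (G : Finset ι) (Z : ι → Set X)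
    (hdis : ∀ g ∈ G, ∀ h ∈ G, g ≠ h → Disjoint (Z g) (Z h)) (hZ : ∀ g ∈ G, Cx D (Z g) deg) (n : ℕ) :
    Cx D (⋃ g ∈ G, Z g) deg ∧
    hh D (Fam k (⋃ g ∈ G, Z g) deg) n = ∑ g ∈ G, hh D (Fam k (Z g) deg) n := by
  induction G using Finset.induction_on with
  | empty =>
    simp only [Finset.notMem_empty, Set.iUnion_of_empty, Set.iUnion_empty, Finset.sum_empty]
    refine ⟨Cx.empty, ?_⟩
    rw [hh_congr (D' := 0) (by simp), hh_zero_map (by simp)]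
    simp
  | insert a G ha ih =>
    obtain ⟨h1, h2⟩ := ih (fun g hg h hh => hdis g (Finset.mem_insert_of_mem hg) h
      (Finset.mem_insert_of_mem hh)) (fun g hg => hZ g (Finset.mem_insert_of_mem hg))
    have h3 := hZ a (Finset.mem_insert_self _ _)
    rw [Finset.set_biUnion_insert, Finset.sum_insert ha, ← h2]
    refine ⟨h3.union h1, hh_union ?_ h3 h1 n⟩
    rw [Set.disjoint_iUnion₂_right]
    exact fun g hg => hdis a (Finset.mem_insert_self _ _) g (Finset.mem_insert_of_mem hg)
      fun h => ha (h ▸ hg)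

end

section
variable {σ : Type*} [Finite σ] {M : Finset (Mon σ)} {a b : TX σ} {c : σ ⊕ Mon σ}

/-- The degree of a colour. -/
def cdeg : σ ⊕ Mon σ → Mon σ
  | .inl i => Pi.single i 1
  | .inr m => m

/-- The blocks of a single colour. -/
def ZB (M : Finset (Mon σ)) (c : σ ⊕ Mon σ) : Set (TX σ) := {a | TV M a ∧ pcol a = {c}}

/-- The lists of blocks of given colours. -/
def ZL (M : Finset (Mon σ)) (g : List (σ ⊕ Mon σ)) : Set (List (TX σ)) :=
  {l | (∀ a ∈ l, TV M a) ∧ l.map pcol = g.map fun c => {c}}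

/-- The degree of a block in the bar construction. -/
def bdeg (a : TX σ) : ℕ := a.2.card + 1

theorem fst_of_mem_ZB (h : a ∈ ZB M c) : a.1 = cdeg c := by
  rcases c with i | m
  · exact congrArg Prod.fst (pcol_eq_inl h.2)
  · exact (pcol_eq_inr h.1 h.2).2.1

theorem cons_mem_ZL {l : List (TX σ)} {g : List (σ ⊕ Mon σ)} :
    a :: l ∈ ZL M (c :: g) ↔ a ∈ ZB M c ∧ l ∈ ZL M g := by
  simp only [ZL, ZB, Set.mem_ofPred_eq, List.forall_mem_cons, List.map_cons, List.cons.injEq]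
  tauto

theorem ZL_nil : ZL M [] = {[]} := by
  ext l
  simp only [ZL, List.map_nil, List.map_eq_nil_iff, Set.mem_ofPred_eq, Set.mem_singleton_iff]
  constructor
  · exact fun h => h.2
  · rintro rfl; simp

theorem ZL_subset (g : List (σ ⊕ Mon σ)) : ZL M g ⊆ TBar M (g.map cdeg).sum := by
  intro l hl
  induction g generalizing l with
  | nil => rw [ZL_nil] at hl; subst hl; exact ⟨rfl, by simp⟩
  | cons c g ih =>
    cases l with
    | nil => simp [ZL] at hl
    | cons a l =>
      rw [cons_mem_ZL] at hl
      refine ⟨by simp [(ih hl.2).1, fst_of_mem_ZB hl.1], ?_⟩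
      rw [List.forall_mem_cons]
      exact ⟨hl.1.1, (ih hl.2).2⟩

theorem ZL_single {l : List (TX σ)} {g : List (σ ⊕ Mon σ)} (hl : l ∈ ZL M g) :
    ∀ a ∈ l, ∃ c, pcol a = {c} := fun a ha => by
  have := List.mem_map_of_mem (f := pcol) ha
  rw [hl.2, List.mem_map] at this
  obtain ⟨c, -, hc⟩ := this
  exact ⟨c, hc.symm⟩

theorem ZL_of_BFace (h0 : (0 : Mon σ) ∉ M) (h1 : ∀ m ∈ M, ∀ i, ¬m ≤ Pi.single i 1)
    {l l' : List (TX σ)} {g : List (σ ⊕ Mon σ)} (h : BFace l l') (hl : ∀ a ∈ l, TV M a)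
    (hl' : l' ∈ ZL M g) : l ∈ ZL M g :=
  ⟨hl, by rw [h.map_pcol h0 h1 hl (ZL_single hl'), hl'.2]⟩

theorem ZL_cx (k : Type*) [Field k] (h0 : (0 : Mon σ) ∉ M) (h1 : ∀ m ∈ M, ∀ i, ¬m ≤ Pi.single i 1)
    (g : List (σ ⊕ Mon σ)) : Cx (tr (tbarD k σ) (ZL M g)) (ZL M g) tdeg := by
  refine (TBar_cx k M _).quot (ZL_subset g) fun x hx y hy => ?_
  have h := BFace.of_coeff hy
  exact ⟨h.mem_TBar hx.1, fun hy => hx.2 (ZL_of_BFace h0 h1 h hx.1.2 hy)⟩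

theorem ZB_cx (k : Type*) [Field k] (h0 : (0 : Mon σ) ∉ M) (h1 : ∀ m ∈ M, ∀ i, ¬m ≤ Pi.single i 1)
    (c : σ ⊕ Mon σ) : Cx (tr (tdif k σ) (ZB M c)) (ZB M c) bdeg := by
  have hC : Cx (tdif k σ) {a | TV M a ∧ a.1 = cdeg c} bdeg := by
    refine ⟨fun a ha b hb => ?_, fun a ha => tdif_tdif _, fun n => ?_⟩
    · obtain ⟨m, hm, rfl⟩ := tdif_single_ne_zero_iff.1 hb
      refine ⟨⟨⟨ha.1.1, (Finset.erase_subset _ _).trans ha.1.2.1,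
        (mlcm_mono (Finset.erase_subset _ _)).trans ha.1.2.2⟩, ha.2⟩, ?_⟩
      simp only [bdeg, Finset.card_erase_add_one hm]
    · refine ((Set.finite_singleton (cdeg c)).prod M.powerset.finite_toSet).subset fun a ha => ?_
      exact ⟨ha.1.2, by simpa using ha.1.1.2.1⟩
  refine hC.quot (fun a ha => ⟨ha.1, fst_of_mem_ZB ha⟩) fun a ha b hb => ?_
  refine ⟨(hC.face a ha.1 b hb).1, fun h => ha.2 ⟨ha.1.1, ?_⟩⟩
  obtain ⟨m, hm, rfl⟩ := tdif_single_ne_zero_iff.1 hb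
  exact pcol_of_erase h0 h1 ha.1.1 hm h.2

/-- The contribution of a colour to the Poincaré series. -/
def cser (k : Type*) [Field k] (M : Finset (Mon σ)) (c : σ ⊕ Mon σ) : PowerSeries ℤ :=
  PowerSeries.mk fun n => (hh (tr (tdif k σ) (ZB M c)) (Fam k (ZB M c) bdeg) n : ℤ)

theorem hh_ZL_cons (k : Type*) [Field k] (h0 : (0 : Mon σ) ∉ M)
    (h1 : ∀ m ∈ M, ∀ i, ¬m ≤ Pi.single i 1) (c : σ ⊕ Mon σ) (g : List (σ ⊕ Mon σ)) (n : ℕ) :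
    hh (tensD bdeg (tr (tdif k σ) (ZB M c)) (tr (tbarD k σ) (ZL M g)))
      (Fam k (ZB M c ×ˢ ZL M g) (pdeg bdeg tdeg)) n =
    hh (tr (tbarD k σ) (ZL M (c :: g))) (Fam k (ZL M (c :: g)) tdeg) n := by
  refine hh_relabel (s := 0) ((ZB_cx k h0 h1 c).tens (ZL_cx k h0 h1 g)) (ZL_cx k h0 h1 _)
    (fun p => p.1 :: p.2) (fun _ => 1) 1 one_ne_zero ⟨?_, ?_, ?_⟩ (fun _ _ => one_ne_zero) ?_
    (Finsupp.lmapDomain k k fun p => p.1 :: p.2) (fun x _ => by simp) ?_ n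
  · exact fun p hp => cons_mem_ZL.2 hp
  · rintro ⟨a, l⟩ - ⟨b, l'⟩ - h; simpa using h
  · rintro (_ | ⟨a, l⟩) hl
    · simp [ZL] at hl
    · exact ⟨(a, l), cons_mem_ZL.1 hl, rfl⟩
  · rintro ⟨a, l⟩ -
    simp [pdeg, bdeg, tdeg_cons]
  · rintro ⟨a, l⟩ ⟨ha, hl⟩
    simp only at ha hl
    have hbox : ∀ u v, Finsupp.lmapDomain k k (fun p : TX σ × List (TX σ) => p.1 :: p.2)
      (box k _ _ u v) = consL k _ u v := fun u v => rfl
    rw [one_smul, tensD_single, map_add, map_smul, hbox, hbox, Finsupp.lmapDomain_apply,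
      Finsupp.mapDomain_single]
    ext y
    rw [tr_apply]
    rcases y with _ | ⟨b, l'⟩
    · rw [if_neg (by simp [ZL])]
      simp [consL_nil]
    simp only [cons_mem_ZL, Finsupp.add_apply, Finsupp.smul_apply, consL_cons, tr_apply]
    by_cases hb : b ∈ ZB M c
    · by_cases hl' : l' ∈ ZL M g
      · rw [if_pos ⟨hb, hl'⟩, if_pos hb, if_pos hl', ← consL_single, tbarD_consL, tbar_single]
        have hm : mrg k σ ((-1 : k) ^ a.2.card • Finsupp.single a 1) (Finsupp.single l 1) (b :: l')
            = 0 := by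
          cases l with
          | nil => rw [mrg_nil]; rfl
          | cons d l =>
            rw [← consL_single, mrg_consL, consL_cons, map_smul, LinearMap.smul_apply,
              Finsupp.smul_apply]
            by_contra hne
            have h2 := (tmul_single_ne_zero_iff.1 (right_ne_zero_of_mul (left_ne_zero_of_mul hne))).2
            refine pcol_mul_ne h0 ha.1 (hl.1 d (by simp)) ?_ (c := c)
            rw [← hb.2, h2]
        simp only [Finsupp.sub_apply, hm, consL_cons, Finsupp.smul_apply, smul_eq_mul, bdeg, pow_succ]
        ring
      · have : l ≠ l' := fun h => hl' (h ▸ hl)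
        rw [if_neg (fun h => hl' h.2), if_neg hl', Finsupp.single_eq_of_ne' this]
        simp
    · have : a ≠ b := fun h => hb (h ▸ ha)
      rw [if_neg (fun h => hb h.1), if_neg hb, Finsupp.single_eq_of_ne' this]
      simp

theorem hh_ZL (k : Type*) [Field k] (h0 : (0 : Mon σ) ∉ M)
    (h1 : ∀ m ∈ M, ∀ i, ¬m ≤ Pi.single i 1) (g : List (σ ⊕ Mon σ)) :
    (PowerSeries.mk fun n => (hh (tr (tbarD k σ) (ZL M g)) (Fam k (ZL M g) tdeg) n : ℤ)) =
      (g.map (cser k M)).prod := by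
  induction g with
  | nil =>
    ext n
    rw [PowerSeries.coeff_mk, ZL_nil, hh_congr (D' := 0) (by
      rintro x rfl
      ext y
      rw [tr_apply]
      split_ifs with h
      · rw [h, tbarD_nil_right]; rfl
      · rfl), hh_zero_map ((Set.finite_singleton []).subset fun x hx => hx.1)]
    simp only [List.map_nil, List.prod_nil, PowerSeries.coeff_one]
    have : {x : List (TX σ) | x ∈ ({[]} : Set (List (TX σ))) ∧ tdeg x = n} = if n = 0 then {[]} else ∅ := by
      split_ifs with h
      · subst h; ext x; simp; rintro rfl; rfl
      · ext x; simp; rintro rfl; exact fun h' => h h'.symm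
    rw [this]
    split_ifs <;> simp
  | cons c g ih =>
    rw [List.map_cons, List.prod_cons, ← ih]
    ext n
    rw [PowerSeries.coeff_mk, PowerSeries.coeff_mul, ← hh_ZL_cons k h0 h1,
      hh_tens (ZB_cx k h0 h1 c) (ZL_cx k h0 h1 g)]
    push_cast
    simp only [cser, PowerSeries.coeff_mk]

theorem cser_inl (k : Type*) [Field k] (i : σ) : cser k M (.inl i) = PowerSeries.X := by
  have hZ : ZB M (.inl i) = {(Pi.single i 1, ∅)} := by
    ext a
    rw [Set.mem_singleton_iff]
    constructor
    · exact fun h => pcol_eq_inl h.2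
    · rintro rfl
      refine ⟨⟨fun h => ?_, by simp, by simp [mlcm_empty]⟩, pcol_single i⟩
      simpa using congrFun h i
  ext n
  rw [cser, PowerSeries.coeff_mk, hZ, hh_congr (D' := 0) (by
      rintro x rfl
      rw [tr, LinearMap.comp_apply]
      have : tdif k σ (Finsupp.single ((Pi.single i 1 : Mon σ), (∅ : Finset (Mon σ))) 1) = 0 := by
        ext y
        by_contra hne
        obtain ⟨m, hm, -⟩ := tdif_single_ne_zero_iff.1 hne
        simp at hm
      rw [this]; simp), hh_zero_map ((Set.finite_singleton _).subset fun x hx => hx.1),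
      PowerSeries.coeff_X]
  have : {x : TX σ | x ∈ ({(Pi.single i 1, ∅)} : Set (TX σ)) ∧ bdeg x = n} =
      if n = 1 then {(Pi.single i 1, ∅)} else ∅ := by
    split_ifs with h
    · subst h; ext x; simp; rintro rfl; rfl
    · ext x; simp; rintro rfl; exact fun h' => h h'.symm
  rw [this]
  split_ifs <;> simp

/-- The colours occurring in the Taylor algebra of `M`. -/
def Allowed (M : Finset (Mon σ)) : σ ⊕ Mon σ → Prop
  | .inl _ => True
  | .inr m => ∃ C ⊆ M, IsConnected C ∧ mlcm C = m

/-- Multisets of pairwise compatible colours. -/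
def Clq (s : Multiset (σ ⊕ Mon σ)) : Prop := ∀ c t, s = c ::ₘ t → ∀ d ∈ t, cgood d c

theorem cgood_symm {c d : σ ⊕ Mon σ} (h : cgood c d) : cgood d c := by
  rcases c with i | m <;> rcases d with j | n <;> try trivial
  exact fun h' => h h'.symm

theorem Clq_cons {c : σ ⊕ Mon σ} {s : Multiset (σ ⊕ Mon σ)} :
    Clq (c ::ₘ s) ↔ Clq s ∧ ∀ d ∈ s, cgood d c := by
  constructor
  · refine fun h => ⟨fun d t ht e he => h d (c ::ₘ t) (by rw [ht, Multiset.cons_swap]) e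
      (Multiset.mem_cons_of_mem he), h c s rfl⟩
  · rintro ⟨h1, h2⟩ d t ht e he
    by_cases hcd : c = d
    · subst hcd
      rw [Multiset.cons_inj_right] at ht
      exact h2 e (ht ▸ he)
    · obtain ⟨u, hu⟩ := Multiset.exists_cons_of_mem
        ((Multiset.mem_cons.1 (ht ▸ Multiset.mem_cons_self d t : d ∈ c ::ₘ s)).resolve_left (Ne.symm hcd))
      subst hu
      rw [Multiset.cons_swap, Multiset.cons_inj_right] at ht
      subst ht
      rcases Multiset.mem_cons.1 he with rfl | he
      · exact cgood_symm (h2 d (Multiset.mem_cons_self _ _))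
      · exact h1 d u rfl e he

theorem Clq.add {s t : Multiset (σ ⊕ Mon σ)} (hs : Clq s) (ht : Clq t)
    (h : ∀ c ∈ s, ∀ d ∈ t, cgood c d) : Clq (s + t) := by
  induction s using Multiset.induction_on with
  | empty => simpa
  | cons c s ih =>
    rw [Multiset.cons_add, Clq_cons]
    rw [Clq_cons] at hs
    refine ⟨ih hs.1 fun c hc => h c (Multiset.mem_cons_of_mem hc), fun d hd => ?_⟩
    rcases Multiset.mem_add.1 hd with hd | hd
    · exact hs.2 d hd
    · exact cgood_symm (h c (Multiset.mem_cons_self _ _) d hd)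

theorem Clq_singleton (c : σ ⊕ Mon σ) : Clq {c} := by
  rw [← Multiset.cons_zero, Clq_cons]
  exact ⟨fun d t h => by simp [eq_comm] at h, by simp⟩

/-- Non-empty multisets of pairwise compatible allowed colours. -/
def CV (M : Finset (Mon σ)) (s : Multiset (σ ⊕ Mon σ)) : Prop :=
  s ≠ 0 ∧ (∀ c ∈ s, Allowed M c) ∧ Clq s

/-- The blocks given by multisets of colours. -/
def cBlocks (M : Finset (Mon σ)) : Blocks (Multiset (σ ⊕ Mon σ)) (σ ⊕ Mon σ) where
  V := CV M
  col := id
  good := cgood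
  mul := (· + ·)
  rem s c := s.erase c
  prt _ c := {c}
  col_ne h := h.1
  clique h hs hd := h.2.2 _ _ hs _ hd
  mul_V {a b} ha hb h := ⟨fun h' => ha.1 (add_eq_zero.1 h').1,
    fun c hc => (Multiset.mem_add.1 hc).elim (ha.2.1 c) (hb.2.1 c), ha.2.2.add hb.2.2 h⟩
  mul_col _ _ _ := rfl
  rem_V {a c} ha hc hne := by
    obtain ⟨t, rfl⟩ := Multiset.exists_cons_of_mem hc
    rw [Multiset.erase_cons_head]
    exact ⟨fun h => hne (by simp [h]), fun d hd => ha.2.1 d (Multiset.mem_cons_of_mem hd),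
      (Clq_cons.1 ha.2.2).1⟩
  prt_V {a c} ha hc := ⟨by simp, fun d hd => by
    rw [Multiset.mem_singleton.1 hd]; exact ha.2.1 c hc, Clq_singleton c⟩
  prt_col _ _ := rfl
  mul_rem {a c} _ hc _ := by
    rw [add_comm, Multiset.singleton_add]
    exact Multiset.cons_erase hc
  rem_col {a c} _ hc _ := (Multiset.cons_erase hc).symm
  rem_mul {a b c} _ _ _ hb := by
    simp only [id] at hb
    rw [hb, add_comm, Multiset.singleton_add, Multiset.erase_cons_head]
  prt_mul {a b c} _ _ _ hb := hb.symm

/-- The critical sequences of colours of degree `α`. -/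
def CritSeq (M : Finset (Mon σ)) (α : Mon σ) : Set (List (σ ⊕ Mon σ)) :=
  {g | (∀ c ∈ g, Allowed M c) ∧ (g.map cdeg).sum = α ∧ (cBlocks M).Crit (g.map fun c => {c})}

theorem Allowed.cdeg_ne_zero (h0 : (0 : Mon σ) ∉ M) (hc : Allowed M c) : cdeg c ≠ 0 := by
  rcases c with i | m
  · intro h; simpa [cdeg] using congrFun h i
  · obtain ⟨C, hC, hcon, rfl⟩ := hc
    obtain ⟨n, hn⟩ := hcon.1
    intro h
    exact h0 (le_antisymm (h ▸ le_mlcm hn : n ≤ 0) (by intro; simp) ▸ hC hn)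

theorem length_le_md (h0 : (0 : Mon σ) ∉ M) {g : List (σ ⊕ Mon σ)} (hg : ∀ c ∈ g, Allowed M c) :
    g.length ≤ md (g.map cdeg).sum := by
  induction g with
  | nil => simp
  | cons c g ih =>
    rw [List.forall_mem_cons] at hg
    have := ih hg.2
    have := md_eq_zero.not.2 (hg.1.cdeg_ne_zero h0)
    rw [List.map_cons, List.sum_cons, md_add, List.length_cons]
    omega

theorem finite_Allowed (M : Finset (Mon σ)) : {c | Allowed M c}.Finite := by
  refine ((Set.finite_range (Sum.inl : σ → σ ⊕ Mon σ)).union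
    ((M.powerset.finite_toSet).image fun C => Sum.inr (mlcm C))).subset ?_
  rintro (i | m) h
  · exact .inl ⟨i, rfl⟩
  · obtain ⟨C, hC, -, rfl⟩ := h
    exact .inr ⟨C, by simpa using hC, rfl⟩

theorem CritSeq_finite (h0 : (0 : Mon σ) ∉ M) (α : Mon σ) : (CritSeq M α).Finite :=
  (finite_lists (finite_Allowed M) (md α)).subset fun _ hg =>
    ⟨hg.1, (length_le_md h0 hg.1).trans (by rw [hg.2.1])⟩

theorem exists_colours {l : List (TX σ)} (h : ∀ a ∈ l, ∃ c, pcol a = {c}) :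
    ∃ g : List (σ ⊕ Mon σ), l.map pcol = g.map fun c => {c} := by
  induction l with
  | nil => exact ⟨[], rfl⟩
  | cons a l ih =>
    rw [List.forall_mem_cons] at h
    obtain ⟨c, hc⟩ := h.1
    obtain ⟨g, hg⟩ := ih h.2
    exact ⟨c :: g, by simp [hc, hg]⟩

theorem ZL_allowed {l : List (TX σ)} {g : List (σ ⊕ Mon σ)} (hl : l ∈ ZL M g) :
    ∀ c ∈ g, Allowed M c := by
  induction g generalizing l with
  | nil => simp
  | cons c g ih =>
    cases l with
    | nil => simp [ZL] at hl
    | cons a l =>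
      rw [cons_mem_ZL] at hl
      rw [List.forall_mem_cons]
      refine ⟨?_, ih hl.2⟩
      rcases c with i | m
      · trivial
      · have := pcol_eq_inr hl.1.1 hl.1.2
        exact ⟨a.2, hl.1.1.2.1, this.1, this.2.2⟩

theorem ZL_crit_iff (h0 : (0 : Mon σ) ∉ M) {l : List (TX σ)} {g : List (σ ⊕ Mon σ)}
    (hl : l ∈ ZL M g) : (txBlocks M h0).Crit l ↔ (cBlocks M).Crit (g.map fun c => {c}) :=
  Blocks.crit_iff_of_map_col (K := txBlocks M h0) (K' := cBlocks M) rfl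
    (hl.2.trans (List.map_id _).symm)

theorem TCrit_eq (h0 : (0 : Mon σ) ∉ M) (α : Mon σ) :
    TCrit M h0 α = ⋃ g ∈ (CritSeq_finite h0 α).toFinset, ZL M g := by
  ext l
  simp only [Set.Finite.mem_toFinset, Set.mem_iUnion, exists_prop]
  constructor
  · rintro ⟨⟨hl, hv⟩, hc⟩
    obtain ⟨g, hg⟩ := exists_colours hc.single
    have hlg : l ∈ ZL M g := ⟨hv, hg⟩
    exact ⟨g, ⟨ZL_allowed hlg, (ZL_subset g hlg).1.symm.trans hl, (ZL_crit_iff h0 hlg).1 hc⟩, hlg⟩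
  · rintro ⟨g, ⟨hg, hα, hc⟩, hl⟩
    exact ⟨⟨(ZL_subset g hl).1.trans hα, hl.1⟩, (ZL_crit_iff h0 hl).2 hc⟩

theorem ZL_disjoint {g g' : List (σ ⊕ Mon σ)} (h : g ≠ g') : Disjoint (ZL M g) (ZL M g') := by
  rw [Set.disjoint_left]
  exact fun l hl hl' => h (List.map_injective_iff.2 (fun _ _ => Multiset.singleton_inj.1) (hl.2.symm.trans hl'.2))

/-- The Poincaré series as a sum over critical sequences of colours. -/
theorem torSeries_eq (k : Type*) [Field k] (h0 : (0 : Mon σ) ∉ M)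
    (h1 : ∀ m ∈ M, ∀ i, ¬m ≤ Pi.single i 1) (α : Mon σ) :
    (PowerSeries.mk fun n => (torDim k (upperSet M) n α : ℤ)) =
      ∑ g ∈ (CritSeq_finite h0 α).toFinset, (g.map (cser k M)).prod := by
  have hD : ∀ g ∈ (CritSeq_finite h0 α).toFinset, ∀ x ∈ ZL M g,
      tr (tbarD k σ) (ZL M g) (Finsupp.single x 1) =
        tr (tbarD k σ) (TCrit M h0 α) (Finsupp.single x 1) := by
    intro g hg x hx
    ext y
    simp only [tr_apply]
    by_cases hy : tbarD k σ (Finsupp.single x 1) y = 0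
    · simp [hy]
    have h := BFace.of_coeff hy
    congr 1
    rw [eq_iff_iff, TCrit_eq]
    refine ⟨fun h => Set.mem_biUnion hg h, fun hy' => ?_⟩
    obtain ⟨g', hg', hyg'⟩ := Set.mem_iUnion₂.1 hy'
    have := ZL_of_BFace h0 h1 h hx.1 hyg'
    by_contra hyg
    have hne : g ≠ g' := by rintro rfl; exact hyg hyg'
    exact Set.disjoint_left.1 (ZL_disjoint hne) hx this
  simp only [← hh_ZL k h0 h1]
  ext n
  rw [map_sum]
  simp only [PowerSeries.coeff_mk]
  rw [torDim_eq_hh, hh_TCrit k h0 h1, Finset.sum_congr rfl fun g hg => by rw [hh_congr (hD g hg)]]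
  rw [← Nat.cast_sum]
  conv_lhs => rw [TCrit_eq]
  have := (hh_biUnion (D := tr (tbarD k σ) (TCrit M h0 α)) (deg := tdeg)
    (CritSeq_finite h0 α).toFinset (ZL M)
    (fun _ _ _ _ h => ZL_disjoint h) (fun g hg => (ZL_cx k h0 h1 g).congr (hD g hg)) n).2
  rw [← this, TCrit_eq]

end

section
variable {σ : Type*} [Finite σ] {A : Type*} [CommRing A] {ι κ : Type*}
  {d : ι → Mon σ} {S S' : Set ι} {u : ι → A} {d' : κ → Mon σ} {R : Set κ} {v : κ → A}

/-- The generating series of the weights `u` on `S` with respect to the degree `d`. -/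
def gs (d : ι → Mon σ) (S : Set ι) (u : ι → A) : MvPowerSeries σ A :=
  fun e => ∑ᶠ i ∈ {i | i ∈ S ∧ d i = ⇑e}, u i

/-- All fibres of the degree function are finite. -/
def FinFib (d : ι → Mon σ) (S : Set ι) : Prop := ∀ α, {i | i ∈ S ∧ d i = α}.Finite

theorem FinFib.mono (h : FinFib d S') (hS : S ⊆ S') : FinFib d S :=
  fun α => (h α).subset fun _ hi => ⟨hS hi.1, hi.2⟩

theorem coeff_gs (e : σ →₀ ℕ) : MvPowerSeries.coeff e (gs d S u) = ∑ᶠ i ∈ {i | i ∈ S ∧ d i = ⇑e}, u i :=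
  rfl

theorem gs_bij (φ : ι → κ) (hφ : Set.BijOn φ S R) (hd : ∀ i ∈ S, d' (φ i) = d i)
    (hu : ∀ i ∈ S, v (φ i) = u i) : gs d' R v = gs d S u := by
  ext e
  rw [coeff_gs, coeff_gs]
  refine (finsum_mem_eq_of_bijOn φ ⟨?_, ?_, ?_⟩ fun i hi => (hu i hi.1).symm).symm
  · exact fun i hi => ⟨hφ.mapsTo hi.1, (hd i hi.1).trans hi.2⟩
  · exact hφ.injOn.mono fun i hi => hi.1
  · rintro j ⟨hj, hje⟩
    obtain ⟨i, hi, rfl⟩ := hφ.surjOn hj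
    exact ⟨i, ⟨hi, (hd i hi).symm.trans hje⟩, rfl⟩

theorem gs_union (hdis : Disjoint S S') (hS : FinFib d S) (hS' : FinFib d S') :
    gs d (S ∪ S') u = gs d S u + gs d S' u := by
  ext e
  rw [map_add, coeff_gs, coeff_gs, coeff_gs, ← finsum_mem_union _ (hS e) (hS' e)]
  · refine finsum_mem_congr ?_ fun _ _ => rfl
    ext i
    simp only [Set.mem_union, Set.mem_ofPred_eq]; tauto
  · exact Set.disjoint_of_subset (fun i hi => hi.1) (fun i hi => hi.1) hdis

theorem gs_neg (hS : FinFib d S) : gs d S (fun i => -u i) = -gs d S u := by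
  ext e
  rw [map_neg, coeff_gs, coeff_gs, finsum_mem_neg_distrib _ (hS e)]

theorem gs_singleton {i : ι} (hi : d i = 0) (hu : u i = 1) : gs d {i} u = 1 := by
  ext e
  rw [coeff_gs, MvPowerSeries.coeff_one]
  split_ifs with h
  · subst h
    rw [finsum_mem_congr (t := {i}) _ fun _ _ => rfl, finsum_mem_singleton, hu]
    ext j; simp only [Set.mem_ofPred_eq, Set.mem_singleton_iff, and_iff_left_iff_imp]
    rintro rfl; rw [hi]; rfl
  · rw [finsum_mem_congr (t := ∅) _ fun _ _ => rfl, finsum_mem_empty]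
    ext j; simp only [Set.mem_ofPred_eq, Set.mem_singleton_iff, Set.mem_empty_iff_false, iff_false]
    rintro ⟨rfl, h'⟩
    exact h (DFunLike.coe_injective (h'.symm.trans hi))

theorem gs_mul (hS : FinFib d S) (hR : FinFib d' R) : gs d S u * gs d' R v =
    gs (fun p : ι × κ => d p.1 + d' p.2) (S ×ˢ R) (fun p => u p.1 * v p.2) := by
  ext e
  rw [MvPowerSeries.coeff_mul, coeff_gs]
  have hT : {p : ι × κ | p ∈ S ×ˢ R ∧ d p.1 + d' p.2 = ⇑e}.Finite := by
    refine ((Finset.HasAntidiagonal.antidiagonal e).finite_toSet.biUnion fun p _ =>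
      (hS p.1).prod (hR p.2)).subset ?_
    rintro ⟨i, j⟩ ⟨⟨hi, hj⟩, h⟩
    refine Set.mem_biUnion (x := (fs (d i), fs (d' j))) ?_ ⟨⟨hi, ?_⟩, ⟨hj, ?_⟩⟩
    · rw [Finset.mem_coe, Finset.HasAntidiagonal.mem_antidiagonal]
      ext x; simpa [fs_apply] using congrFun h x
    · ext x; simp [fs_apply]
    · ext x; simp [fs_apply]
  rw [finsum_mem_eq_finite_toFinset_sum _ hT,
    ← Finset.sum_fiberwise_of_maps_to (s := hT.toFinset) (t := Finset.HasAntidiagonal.antidiagonal e)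
      (g := fun p => (fs (d p.1), fs (d' p.2)))]
  · refine Finset.sum_congr rfl fun p hp => ?_
    rw [Finset.HasAntidiagonal.mem_antidiagonal] at hp
    rw [coeff_gs, coeff_gs, finsum_mem_eq_finite_toFinset_sum _ (hS _),
      finsum_mem_eq_finite_toFinset_sum _ (hR _), Finset.sum_mul_sum, ← Finset.sum_product']
    refine Finset.sum_congr ?_ fun _ _ => rfl
    ext ⟨i, j⟩
    have hfs : ∀ (m : Mon σ) (e : σ →₀ ℕ), fs m = e ↔ m = ⇑e := by
      intro m e
      constructor
      · rintro rfl; ext x; simp [fs_apply]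
      · rintro rfl; ext x; simp [fs_apply]
    simp only [Finset.mem_product, Set.Finite.mem_toFinset, Set.mem_ofPred_eq, Finset.mem_filter,
      Set.mem_prod, Prod.ext_iff, hfs]
    constructor
    · rintro ⟨⟨h1, h2⟩, h3, h4⟩
      exact ⟨⟨⟨h1, h3⟩, by rw [h2, h4, ← hp]; rfl⟩, h2, h4⟩
    · rintro ⟨⟨⟨h1, h3⟩, -⟩, h2, h4⟩
      exact ⟨⟨h1, h2⟩, h3, h4⟩
  · rintro ⟨i, j⟩ h
    rw [Set.Finite.mem_toFinset] at h
    rw [Finset.HasAntidiagonal.mem_antidiagonal]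
    ext x; simpa [fs_apply] using congrFun h.2 x

end

section
variable {σ : Type*} [Finite σ] {A : Type*} [CommRing A] {M : Finset (Mon σ)}

/-- The degree of a multiset of colours. -/
def sdeg (s : Multiset (σ ⊕ Mon σ)) : Mon σ := (s.map cdeg).sum

theorem sdeg_add (s t : Multiset (σ ⊕ Mon σ)) : sdeg (s + t) = sdeg s + sdeg t := by simp [sdeg]

/-- The degree of a list of multisets of colours. -/
def ldeg (l : List (Multiset (σ ⊕ Mon σ))) : Mon σ := (l.map sdeg).sum

/-- The weight of a list of multisets of colours. -/
def lwt (f : σ ⊕ Mon σ → A) (l : List (Multiset (σ ⊕ Mon σ))) : A :=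
  (l.map fun s => -(s.map f).prod).prod

/-- The lists of blocks of colours. -/
def LS (M : Finset (Mon σ)) : Set (List (Multiset (σ ⊕ Mon σ))) := {l | ∀ s ∈ l, CV M s}

/-- The multisets of pairwise compatible allowed colours. -/
def CL (M : Finset (Mon σ)) : Set (Multiset (σ ⊕ Mon σ)) := {s | (∀ c ∈ s, Allowed M c) ∧ Clq s}

theorem card_le_md (h0 : (0 : Mon σ) ∉ M) {s : Multiset (σ ⊕ Mon σ)} (hs : ∀ c ∈ s, Allowed M c) :
    s.card ≤ md (sdeg s) := by
  induction s using Quot.inductionOn with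
  | _ g => simpa [sdeg] using length_le_md h0 (g := g) (by simpa using hs)

theorem finite_multisets (M : Finset (Mon σ)) (n : ℕ) :
    {s : Multiset (σ ⊕ Mon σ) | (∀ c ∈ s, Allowed M c) ∧ s.card ≤ n}.Finite := by
  refine ((finite_lists (finite_Allowed M) n).image
    (fun l : List (σ ⊕ Mon σ) => (l : Multiset (σ ⊕ Mon σ)))).subset ?_
  intro s hs
  induction s using Quot.inductionOn with
  | _ g => exact ⟨g, by simpa using hs, rfl⟩

theorem CL_fin (h0 : (0 : Mon σ) ∉ M) : FinFib sdeg (CL M) := fun α =>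
  (finite_multisets M (md α)).subset fun _ hs => ⟨hs.1.1, hs.2 ▸ card_le_md h0 hs.1.1⟩

theorem CV.sdeg_ne_zero (h0 : (0 : Mon σ) ∉ M) {s : Multiset (σ ⊕ Mon σ)} (hs : CV M s) :
    md (sdeg s) ≠ 0 := by
  have := card_le_md h0 hs.2.1
  have := Multiset.card_pos.2 hs.1
  omega

theorem LS_fin (h0 : (0 : Mon σ) ∉ M) : FinFib ldeg (LS M) := by
  refine fun α => (finite_lists (finite_multisets M (md α)) (md α)).subset ?_
  rintro l ⟨hl, rfl⟩
  constructor
  · refine fun s hs => ⟨(hl s hs).2.1, (card_le_md h0 (hl s hs).2.1).trans (md_mono ?_)⟩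
    exact List.single_le_sum (by simp) _ (List.mem_map_of_mem hs)
  · induction l with
    | nil => simp
    | cons s l ih =>
      have hl' : (∀ t ∈ s :: l, CV M t) := hl
      rw [List.forall_mem_cons] at hl'
      have := ih hl'.2
      have := hl'.1.sdeg_ne_zero h0
      simp only [ldeg, List.map_cons, List.sum_cons, md_add, List.length_cons] at *
      omega

theorem GM_ldeg {l l' : List (Multiset (σ ⊕ Mon σ))} (h : (cBlocks M).GM l l') :
    ldeg l' = ldeg l := by
  induction h with
  | merge h l => simp [ldeg, cBlocks, sdeg_add, add_assoc]
  | cons a h ih => simpa [ldeg] using ih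

theorem GM_lwt (f : σ ⊕ Mon σ → A) {l l' : List (Multiset (σ ⊕ Mon σ))} (h : (cBlocks M).GM l l') :
    lwt f l' = -lwt f l := by
  induction h with
  | merge h l => simp [lwt, cBlocks, mul_assoc]
  | cons a h ih => simp only [lwt, List.map_cons, List.prod_cons] at *; rw [ih]; ring

theorem gs_LS_eq (h0 : (0 : Mon σ) ∉ M) (f : σ ⊕ Mon σ → A) :
    gs ldeg (LS M) (lwt f) = gs ldeg {l | l ∈ LS M ∧ (cBlocks M).Crit l} (lwt f) := by
  let K := cBlocks M
  let Lo : Set (List (Multiset (σ ⊕ Mon σ))) := {l | l ∈ LS M ∧ K.Lower l}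
  let Up : Set (List (Multiset (σ ⊕ Mon σ))) := {l | l ∈ LS M ∧ ¬K.Lower l ∧ ¬K.Crit l}
  let Cr : Set (List (Multiset (σ ⊕ Mon σ))) := {l | l ∈ LS M ∧ K.Crit l}
  have h1 : LS M = Cr ∪ (Lo ∪ Up) := by
    ext l
    simp only [Cr, Lo, Up, Set.mem_union, Set.mem_ofPred_eq]
    tauto
  have hLo : FinFib ldeg Lo := (LS_fin h0).mono fun l hl => hl.1
  have hUp : FinFib ldeg Up := (LS_fin h0).mono fun l hl => hl.1
  have hCr : FinFib ldeg Cr := (LS_fin h0).mono fun l hl => hl.1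
  have hLU : FinFib ldeg (Lo ∪ Up) := (LS_fin h0).mono fun l hl => hl.elim (·.1) (·.1)
  have h2 : gs ldeg Up (lwt f) = gs ldeg Lo (fun l => -lwt f l) := by
    refine gs_bij K.up ⟨?_, ?_, ?_⟩ ?_ ?_
    · exact fun l hl => ⟨(Blocks.up_GM (K := K) hl.1 hl.2).2, Blocks.up_not (K := K) hl.1 hl.2⟩
    · exact fun l hl l' hl' h => Blocks.up_inj (K := K) hl.1 hl'.1 hl.2 hl'.2 h
    · rintro l ⟨hl, hl1, hl2⟩
      obtain ⟨x, hx, hlx, rfl⟩ := Blocks.up_surj (K := K) hl hl1 hl2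
      exact ⟨x, ⟨hx, hlx⟩, rfl⟩
    · exact fun l hl => (GM_ldeg (Blocks.up_GM (K := K) hl.1 hl.2).1).symm
    · exact fun l hl => by rw [GM_lwt f (Blocks.up_GM (K := K) hl.1 hl.2).1, neg_neg]
  rw [h1, gs_union ?_ hCr hLU, gs_union ?_ hLo hUp, h2, gs_neg hLo]
  · rw [add_neg_cancel, add_zero, ← h1]
  · exact Set.disjoint_left.2 fun l hl hl' => hl'.2.1 hl.2
  · exact Set.disjoint_left.2 fun l hl hl' => hl'.elim (fun h => hl.2.not_lower h.2) fun h => h.2.2 hl.2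

theorem gs_CL_mul (h0 : (0 : Mon σ) ∉ M) (f : σ ⊕ Mon σ → A) :
    gs sdeg (CL M) (fun s => (s.map f).prod) * gs ldeg (LS M) (lwt f) = 1 := by
  have hV : FinFib sdeg {s | CV M s} := (CL_fin h0).mono fun s hs => hs.2
  have h1 : gs sdeg (CL M) (fun s => (s.map f).prod) =
      1 + gs sdeg {s | CV M s} fun s => (s.map f).prod := by
    have : CL M = {0} ∪ {s | CV M s} := by
      ext s
      simp only [CL, CV, Set.mem_ofPred_eq, Set.mem_union, Set.mem_singleton_iff]
      by_cases hs : s = 0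
      · subst hs; simp [Clq]
      · simp [hs]
    rw [this, gs_union _ _ hV, gs_singleton (by simp [sdeg]) (by simp)]
    · exact Set.disjoint_left.2 fun s hs hs' => hs'.1 hs
    · exact (CL_fin h0).mono (by simp [CL, Clq])
  have h2 : gs ldeg (LS M) (lwt f) =
      1 - (gs sdeg {s | CV M s} fun s => (s.map f).prod) * gs ldeg (LS M) (lwt f) := by
    have : LS M = {[]} ∪ {l | l ∈ LS M ∧ l ≠ []} := by
      ext l
      by_cases hl : l = []
      · subst hl; simp [LS]
      · simp [hl]
    have hc : FinFib ldeg {l | l ∈ LS M ∧ l ≠ []} := (LS_fin h0).mono fun l hl => hl.1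
    rw [gs_mul hV (LS_fin h0), sub_eq_add_neg, ← gs_neg]
    · conv_lhs => rw [this]
      rw [gs_union _ _ hc, gs_singleton (by simp [ldeg]) (by simp [lwt])]
      · congr 1
        refine gs_bij (fun p => p.1 :: p.2) ⟨?_, ?_, ?_⟩ ?_ ?_
        · exact fun p hp => ⟨List.forall_mem_cons.2 hp, by simp⟩
        · rintro ⟨a, l⟩ - ⟨b, l'⟩ - h; simpa using h
        · rintro (_ | ⟨a, l⟩) hl
          · exact (hl.2 rfl).elim
          · exact ⟨(a, l), List.forall_mem_cons.1 hl.1, rfl⟩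
        · rintro ⟨a, l⟩ -; simp [ldeg]
        · rintro ⟨a, l⟩ -; simp [lwt]
      · exact Set.disjoint_left.2 fun l hl hl' => hl'.2 hl
      · exact (LS_fin h0).mono (by simp [LS])
    · intro α
      refine ((LS_fin h0 α).preimage (f := fun p : _ × List _ => p.1 :: p.2) ?_).subset ?_
      · rintro ⟨a, l⟩ - ⟨b, l'⟩ - h; simpa using h
      · rintro ⟨a, l⟩ ⟨h, h'⟩
        exact ⟨List.forall_mem_cons.2 h, by simpa [ldeg] using h'⟩
  rw [h1]
  linear_combination h2

/-- The Poincaré series as a multigraded series with coefficients in `ℤ⟦z⟧`. -/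
def torSer (k : Type*) [Field k] (M : Finset (Mon σ)) : MvPowerSeries σ (PowerSeries ℤ) :=
  fun e => PowerSeries.mk fun n => (torDim k (upperSet M) n ⇑e : ℤ)

theorem torSer_eq (k : Type*) [Field k] (h0 : (0 : Mon σ) ∉ M)
    (h1 : ∀ m ∈ M, ∀ i, ¬m ≤ Pi.single i 1) :
    torSer k M = gs ldeg (LS M) (lwt fun c => -cser k M c) := by
  rw [gs_LS_eq h0]
  have h2 : gs ldeg {l | l ∈ LS M ∧ (cBlocks M).Crit l} (lwt fun c => -cser k M c) =
      gs (fun g : List (σ ⊕ Mon σ) => (g.map cdeg).sum)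
        {g | (∀ c ∈ g, Allowed M c) ∧ (cBlocks M).Crit (g.map fun c => {c})}
        (fun g => (g.map (cser k M)).prod) := by
    refine gs_bij (List.map fun c => {c}) ⟨?_, ?_, ?_⟩ ?_ ?_
    · refine fun g hg => ⟨fun s hs => ?_, hg.2⟩
      obtain ⟨c, hc, rfl⟩ := List.mem_map.1 hs
      exact ⟨by simp, fun d hd => Multiset.mem_singleton.1 hd ▸ hg.1 c hc, Clq_singleton c⟩
    · exact (List.map_injective_iff.2 (fun _ _ => Multiset.singleton_inj.1)).injOn
    · rintro l ⟨hl, hc⟩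
      have h3 : ∃ g : List (σ ⊕ Mon σ), (g.map fun c => ({c} : Multiset (σ ⊕ Mon σ))) = l := by
        have := hc.single
        clear hc hl
        induction l with
        | nil => exact ⟨[], rfl⟩
        | cons a l ih =>
          rw [List.forall_mem_cons] at this
          obtain ⟨⟨c, hc⟩, h⟩ := this
          obtain ⟨g, rfl⟩ := ih h
          exact ⟨c :: g, congrArg (· :: _) hc.symm⟩
      obtain ⟨g, rfl⟩ := h3
      exact ⟨g, ⟨fun c hc => (hl {c} (List.mem_map_of_mem hc)).2.1 c (by simp), hc⟩, rfl⟩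
    · intro g _; simp [ldeg, sdeg, Function.comp_def]
    · intro g _; simp [lwt, Function.comp_def]
  rw [h2]
  ext1 e
  change PowerSeries.mk (fun n => (torDim k (upperSet M) n ⇑e : ℤ)) = _
  rw [torSeries_eq k h0 h1, coeff_gs, ← finsum_mem_eq_finite_toFinset_sum]
  refine finsum_mem_congr ?_ fun _ _ => rfl
  ext g
  simp only [CritSeq, Set.mem_ofPred_eq]
  tauto

end

section
variable {σ : Type*} [Finite σ] {M S T : Finset (Mon σ)}

theorem mlcm_eq_sum_components : mlcm S = ∑ C ∈ components S, mlcm C := by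
  ext i
  rw [Finset.sum_apply]
  by_cases hi : mlcm S i = 0
  · rw [hi]
    refine (Finset.sum_eq_zero fun C hC => ?_).symm
    have h : mlcm C i ≤ mlcm S i := mlcm_mono (mem_components.1 hC).1 i
    omega
  · have hne : S.Nonempty := Finset.nonempty_iff_ne_empty.2 fun h => hi (by rw [h, mlcm_empty]; rfl)
    obtain ⟨m, hm, hmi⟩ := Finset.exists_mem_eq_sup S hne fun m => m i
    rw [← mlcm_apply] at hmi
    obtain ⟨C, hC, hmC⟩ := exists_component hm
    have h1 : m i ≤ mlcm C i := le_mlcm hmC i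
    have h2 : mlcm C i ≤ mlcm S i := mlcm_mono (mem_components.1 hC).1 i
    rw [Finset.sum_eq_single_of_mem C hC]
    · omega
    · intro D hD hDC
      by_contra h
      exact hDC (component_eq_of_NCF hD hC ⟨i, h, by omega⟩)

theorem sdeg_pcol {a : TX σ} (ha : mlcm a.2 ≤ a.1) :
    sdeg (pcol a) = a.1 := by
  have h1 : ∀ e : σ →₀ ℕ, sdeg ((Finsupp.toMultiset e).map Sum.inl : Multiset (σ ⊕ Mon σ)) = ⇑e := by
    intro e
    induction e using Finsupp.induction_linear with
    | zero => simp [sdeg]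
    | add f g hf hg => rw [map_add, Multiset.map_add, sdeg_add, hf, hg]; rfl
    | single i n =>
      rw [Finsupp.toMultiset_single, Multiset.map_nsmul, Multiset.map_singleton, sdeg,
        Multiset.map_nsmul, Multiset.sum_nsmul]
      ext j
      simp [cdeg, Finsupp.single_apply, Pi.single_apply, eq_comm]
  rw [pcol, sdeg_add, h1]
  have h2 : sdeg ((components a.2).val.map (Sum.inr ∘ mlcm) : Multiset (σ ⊕ Mon σ)) = mlcm a.2 := by
    rw [mlcm_eq_sum_components, sdeg, Multiset.map_map]
    rfl
  rw [h2]
  exact tsub_add_cancel_of_le ha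

theorem saturated_iff (h0 : (0 : Mon σ) ∉ M) : Saturated M S ↔
    S ⊆ M ∧ ∀ C ∈ components S, divisorsIn M (mlcm C) ⊆ C := by
  refine and_congr_right fun hS => ⟨fun h C hC m hm => ?_, fun h m hm T hT hTc hle => ?_⟩
  · obtain ⟨hm, hle⟩ := Finset.mem_filter.1 hm
    have hmS := h m hm C (mem_components.1 hC).1 (mem_components.1 hC).2.1 hle
    have : NCF m (mlcm C) := (NCF_self fun h => h0 (h ▸ hm)).mono le_rfl hle
    obtain ⟨n, hn, hmn⟩ := NCF_mlcm_right.1 this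
    exact (mem_components.1 hC).2.2 n hn m hmS hmn.symm
  · obtain ⟨a, ha⟩ := hTc.1
    obtain ⟨C, hC, haC⟩ := exists_component (hT ha)
    exact (mem_components.1 hC).1 (h C hC (Finset.mem_filter.2
      ⟨hm, hle.trans (mlcm_mono (hTc.subset_component hT hC ha haC))⟩))

theorem Saturated.divisorsIn_eq (h0 : (0 : Mon σ) ∉ M) (h : Saturated M S) {C : Finset (Mon σ)}
    (hC : C ∈ components S) : divisorsIn M (mlcm C) = C :=
  Finset.Subset.antisymm (((saturated_iff h0).1 h).2 C hC) fun _ hm =>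
    Finset.mem_filter.2 ⟨h.1 ((mem_components.1 hC).1 hm), le_mlcm hm⟩

theorem Saturated.empty (h0 : (0 : Mon σ) ∉ M) : Saturated M ∅ :=
  (saturated_iff h0).2 ⟨by simp, by simp [components]⟩

/-- The divisors of the lcm of a connected set form a connected set with the same lcm. -/
theorem IsConnected.divisorsIn (h0 : (0 : Mon σ) ∉ M) (hT : IsConnected T) (hTM : T ⊆ M) :
    IsConnected (divisorsIn M (mlcm T)) ∧ mlcm (divisorsIn M (mlcm T)) = mlcm T := by
  have hsub : T ⊆ MonomialRings.divisorsIn M (mlcm T) := fun m hm =>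
    Finset.mem_filter.2 ⟨hTM hm, le_mlcm hm⟩
  have hlcm : mlcm (MonomialRings.divisorsIn M (mlcm T)) ≤ mlcm T :=
    mlcm_le_iff.2 fun m hm => (Finset.mem_filter.1 hm).2
  refine ⟨isConnected_iff.2 ⟨hT.1.mono hsub, fun A hA hne hcl => ?_⟩,
    le_antisymm hlcm (mlcm_mono hsub)⟩
  have key : ∀ u ∈ MonomialRings.divisorsIn M (mlcm T), ∃ v ∈ T, NCF u v := by
    intro u hu
    obtain ⟨hu, hle⟩ := Finset.mem_filter.1 hu
    exact NCF_mlcm_right.1 ((NCF_self fun h => h0 (h ▸ hu)).mono le_rfl hle)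
  have hTA : T ⊆ A := by
    obtain ⟨u, hu⟩ := hne
    obtain ⟨v, hv, huv⟩ := key u (hA hu)
    have := (isConnected_iff.1 hT).2 (A ∩ T) Finset.inter_subset_right
      ⟨v, Finset.mem_inter.2 ⟨hcl u hu v (hsub hv) huv, hv⟩⟩
      (fun a ha b hb hab => Finset.mem_inter.2
        ⟨hcl a (Finset.mem_inter.1 ha).1 b (hsub hb) hab, hb⟩)
    exact this ▸ Finset.inter_subset_left
  refine Finset.Subset.antisymm hA fun u hu => ?_
  obtain ⟨v, hv, huv⟩ := key u hu
  exact hcl v (hTA hv) u hu huv.symm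

/-- The colours of a pair of a coefficient and a saturated set. -/
def scol (p : Mon σ × Finset (Mon σ)) : Multiset (σ ⊕ Mon σ) := pcol (p.1 + mlcm p.2, p.2)

theorem scol_eq (p : Mon σ × Finset (Mon σ)) : scol p =
    (Finsupp.toMultiset (fs p.1)).map Sum.inl + (components p.2).val.map (Sum.inr ∘ mlcm) := by
  simp [scol, pcol]

theorem count_inl_scol (p : Mon σ × Finset (Mon σ)) (i : σ) : (scol p).count (.inl i) = p.1 i := by
  rw [scol_eq, Multiset.count_add, Multiset.count_map_eq_count' _ _ Sum.inl_injective,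
    Finsupp.count_toMultiset, Multiset.count_eq_zero_of_notMem]
  · rfl
  · simp

theorem inr_mem_scol {p : Mon σ × Finset (Mon σ)} {m : Mon σ} :
    .inr m ∈ scol p ↔ ∃ C ∈ components p.2, mlcm C = m := by
  simp [scol_eq]

theorem count_inr_scol_le (h0 : (0 : Mon σ) ∉ S) (b m : Mon σ) : (scol (b, S)).count (.inr m) ≤ 1 := by
  rw [scol_eq, Multiset.count_add, Multiset.count_eq_zero_of_notMem (by simp), zero_add]
  refine Multiset.nodup_iff_count_le_one.1 ((components S).nodup.map_on ?_) _
  intro C hC D hD h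
  exact component_mlcm_injOn h0 hC hD (Sum.inr_injective h)

theorem scol_mem_CL (h0 : (0 : Mon σ) ∉ M) (hS : S ⊆ M) (b : Mon σ) : scol (b, S) ∈ CL M := by
  constructor
  · rintro (i | m) hc
    · trivial
    · obtain ⟨C, hC, rfl⟩ := inr_mem_scol.1 hc
      exact ⟨C, (mem_components.1 hC).1.trans hS, (mem_components.1 hC).2.1, rfl⟩
  · by_cases h : b + mlcm S = 0
    · have h1 : b = 0 := by
        ext i; have : b i + mlcm S i = 0 := congrFun h i
        show b i = 0; omega
      have h2 : S = ∅ := by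
        by_contra hne
        refine mlcm_ne_zero (fun h => h0 (hS h)) (Finset.nonempty_iff_ne_empty.2 hne) ?_
        rw [h1, zero_add] at h; exact h
      subst h1 h2
      have : scol ((0 : Mon σ), (∅ : Finset (Mon σ))) = 0 := by simp [scol_eq, components, fs_zero]
      rw [this]
      simp [Clq]
    · intro c t hc d hd
      exact pcol_clique (M := M) h0 (a := (b + mlcm S, S)) ⟨h, hS, le_add_self⟩ hc hd

theorem Saturated.eq_filter (h0 : (0 : Mon σ) ∉ M) (h : Saturated M S) (b : Mon σ) :
    S = M.filter fun m => ∃ n, .inr n ∈ scol (b, S) ∧ m ≤ n := by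
  ext m
  simp only [Finset.mem_filter, inr_mem_scol]
  constructor
  · intro hm
    obtain ⟨C, hC, hmC⟩ := exists_component hm
    exact ⟨h.1 hm, _, ⟨C, hC, rfl⟩, le_mlcm hmC⟩
  · rintro ⟨hm, _, ⟨C, hC, rfl⟩, hle⟩
    exact (mem_components.1 hC).1 (((saturated_iff h0).1 h).2 C hC (Finset.mem_filter.2 ⟨hm, hle⟩))

theorem CL.count_inr_le (h0 : (0 : Mon σ) ∉ M) {s : Multiset (σ ⊕ Mon σ)} (hs : s ∈ CL M)
    (m : Mon σ) : s.count (.inr m) ≤ 1 := by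
  by_contra h
  obtain ⟨t, rfl⟩ := Multiset.exists_cons_of_mem (Multiset.count_pos.1 (by omega : 0 < s.count (.inr m)))
  rw [Multiset.count_cons_self] at h
  have hm : Sum.inr m ∈ t := Multiset.count_pos.1 (by omega)
  refine (Clq_cons.1 hs.2).2 _ hm (NCF_self ?_)
  exact (hs.1 (.inr m) (Multiset.mem_cons_self _ _)).cdeg_ne_zero h0

theorem CL.eq_of_NCF {s : Multiset (σ ⊕ Mon σ)} (hs : s ∈ CL M) {m n : Mon σ}
    (hm : .inr m ∈ s) (hn : .inr n ∈ s) (h : NCF m n) : m = n := by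
  by_contra hne
  obtain ⟨t, rfl⟩ := Multiset.exists_cons_of_mem hm
  rw [Multiset.mem_cons] at hn
  rcases hn with hn | hn
  · exact hne (Sum.inr_injective hn).symm
  · exact (Clq_cons.1 hs.2).2 _ hn h.symm

theorem scol_bijOn (h0 : (0 : Mon σ) ∉ M) :
    Set.BijOn scol (Set.univ ×ˢ {S | Saturated M S}) (CL M) := by
  refine ⟨fun p hp => scol_mem_CL h0 hp.2.1 p.1, ?_, ?_⟩
  · rintro ⟨b, S⟩ ⟨-, hS⟩ ⟨b', S'⟩ ⟨-, hS'⟩ h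
    have hb : b = b' := by
      ext i
      exact (count_inl_scol (b, S) i).symm.trans (h ▸ count_inl_scol (b', S') i)
    rw [Prod.mk.injEq]
    refine ⟨hb, ?_⟩
    have h1 : S = _ := Saturated.eq_filter h0 hS b
    have h2 : S' = _ := Saturated.eq_filter h0 hS' b'
    rw [h] at h1
    exact h1.trans h2.symm
  · intro s hs
    have hdiv : ∀ m, .inr m ∈ s → IsConnected (divisorsIn M m) ∧ mlcm (divisorsIn M m) = m := by
      intro m hm
      obtain ⟨C, hCM, hC, rfl⟩ := hs.1 _ hm
      exact hC.divisorsIn h0 hCM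
    let S := M.filter fun m => ∃ n, .inr n ∈ s ∧ m ≤ n
    have hsub : ∀ m, .inr m ∈ s → divisorsIn M m ∈ components S := by
      intro m hm
      refine mem_components.2 ⟨fun u hu => ?_, (hdiv m hm).1, fun u hu v hv huv => ?_⟩
      · obtain ⟨hu, hle⟩ := Finset.mem_filter.1 hu
        exact Finset.mem_filter.2 ⟨hu, m, hm, hle⟩
      · obtain ⟨hv, n, hn, hvn⟩ := Finset.mem_filter.1 hv
        have := CL.eq_of_NCF hs hm hn (huv.mono (Finset.mem_filter.1 hu).2 hvn)
        exact Finset.mem_filter.2 ⟨hv, this ▸ hvn⟩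
    have hcomp : ∀ C ∈ components S, ∃ m, .inr m ∈ s ∧ divisorsIn M m = C := by
      intro C hC
      obtain ⟨a, ha⟩ := (mem_components.1 hC).2.1.1
      obtain ⟨haM, m, hm, ham⟩ := Finset.mem_filter.1 ((mem_components.1 hC).1 ha)
      exact ⟨m, hm, component_eq (hsub m hm) hC (Finset.mem_filter.2 ⟨haM, ham⟩) ha⟩
    have hSM : S ⊆ M := Finset.filter_subset _ _
    refine ⟨(fun i => s.count (.inl i), S), ⟨trivial, (saturated_iff h0).2 ⟨hSM, ?_⟩⟩, ?_⟩
    · intro C hC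
      obtain ⟨m, hm, rfl⟩ := hcomp C hC
      rw [(hdiv m hm).2]
    · ext c
      rcases c with i | m
      · exact count_inl_scol _ i
      · have h1 := CL.count_inr_le h0 hs m
        have h2 := count_inr_scol_le (fun h => h0 (hSM h)) (fun i => s.count (.inl i)) m
        have h3 : .inr m ∈ scol ((fun i => s.count (.inl i) : Mon σ), S) ↔ .inr m ∈ s := by
          rw [inr_mem_scol]
          constructor
          · rintro ⟨C, hC, rfl⟩
            obtain ⟨m, hm, rfl⟩ := hcomp C hC
            rwa [(hdiv m hm).2]
          · exact fun hm => ⟨_, hsub m hm, (hdiv m hm).2⟩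
        rw [← Multiset.count_pos, ← Multiset.count_pos] at h3
        omega

/-- The series whose product with the Poincaré series is `∏ᵢ (1 + xᵢ z)`. -/
def denSer (k : Type*) [Field k] (M : Finset (Mon σ)) : MvPowerSeries σ (PowerSeries ℤ) :=
  gs mlcm {S | Saturated M S} fun S => ∏ C ∈ components S, -cser k M (.inr (mlcm C))

theorem Saturated.finFib : FinFib mlcm {S | Saturated M S} := fun _ =>
  M.powerset.finite_toSet.subset fun _ hS => Finset.mem_coe.2 (Finset.mem_powerset.2 hS.1.1)

theorem gs_CL_eq (k : Type*) [Field k] (h0 : (0 : Mon σ) ∉ M) :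
    gs sdeg (CL M) (fun s => (s.map fun c => -cser k M c).prod) =
      gs (fun b : Mon σ => b) Set.univ (fun b => (-PowerSeries.X) ^ md b) * denSer k M := by
  rw [denSer, gs_mul (fun α => (Set.finite_singleton α).subset fun _ h => h.2) Saturated.finFib]
  refine gs_bij scol (scol_bijOn h0) ?_ ?_
  · rintro ⟨b, S⟩ -
    exact sdeg_pcol (a := (b + mlcm S, S)) le_add_self
  · rintro ⟨b, S⟩ -
    rw [scol_eq, Multiset.map_add, Multiset.prod_add, Multiset.map_map, Multiset.map_map]
    simp [Function.comp_def, cser_inl, Multiset.map_const', md]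

theorem denSer_mul_torSer (k : Type*) [Field k] (h0 : (0 : Mon σ) ∉ M)
    (h1 : ∀ m ∈ M, ∀ i, ¬m ≤ Pi.single i 1) :
    gs (fun b : Mon σ => b) Set.univ (fun b => (-PowerSeries.X) ^ md b) * (denSer k M * torSer k M)
      = 1 := by
  rw [← mul_assoc, ← gs_CL_eq k h0, torSer_eq k h0 h1]
  exact gs_CL_mul h0 _

end

section
variable {k : Type*} [Field k] {V : Type*} {N N' T : Finset V} {Z Z' : Set (Finset V)}

/-- `Z` is an up-closed family of subsets of `N`. -/
def UpIn (N : Finset V) (Z : Set (Finset V)) : Prop :=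
  (∀ T ∈ Z, T ⊆ N) ∧ ∀ T ∈ Z, ∀ U, T ⊆ U → U ⊆ N → U ∈ Z

/-- The homology series of a family of simplices. -/
def hser (k : Type*) [Field k] (Z : Set (Finset V)) : PowerSeries ℤ :=
  PowerSeries.mk fun n => (hh (tr (bdry k V) Z) (Fam k Z Finset.card) n : ℤ)

theorem UpIn.cx (k : Type*) [Field k] (h : UpIn N Z) : Cx (tr (bdry k V) Z) Z Finset.card := by
  refine (bdry_cx N).quot h.1 fun T hT T' hT' => ?_
  obtain ⟨x, hx, rfl⟩ := bdry_single_ne_zero hT'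
  have hT1 : T ⊆ N := hT.1
  exact ⟨(Finset.erase_subset _ _).trans hT1, fun h' => hT.2 (h.2 _ h' _ (Finset.erase_subset _ _) hT1)⟩

theorem UpIn.join (h : UpIn N Z) (h' : UpIn N' Z') :
    UpIn (N ∪ N') {T | T ⊆ N ∪ N' ∧ T ∩ N ∈ Z ∧ T ∩ N' ∈ Z'} :=
  ⟨fun _ hT => hT.1, fun _ hT _ hTT' hT' => ⟨hT',
    h.2 _ hT.2.1 _ (Finset.inter_subset_inter_right hTT') Finset.inter_subset_right,
    h'.2 _ hT.2.2 _ (Finset.inter_subset_inter_right hTT') Finset.inter_subset_right⟩⟩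

theorem union_inter_of_disjoint (hdis : Disjoint N N') {S T : Finset V} (hS : S ⊆ N) (hT : T ⊆ N') :
    (S ∪ T) ∩ N = S ∧ (S ∪ T) ∩ N' = T := by
  rw [Finset.disjoint_left] at hdis
  constructor <;> ext x <;> have := @hS x <;> have := @hT x <;> have := @hdis x <;>
    simp only [Finset.mem_inter, Finset.mem_union] <;> tauto

theorem hser_join (hdis : Disjoint N N') (h : UpIn N Z) (h' : UpIn N' Z') :
    hser k {T | T ⊆ N ∪ N' ∧ T ∩ N ∈ Z ∧ T ∩ N' ∈ Z'} = hser k Z * hser k Z' := by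
  set Y := {T | T ⊆ N ∪ N' ∧ T ∩ N ∈ Z ∧ T ∩ N' ∈ Z'} with hY
  have hmem : ∀ S T, S ⊆ N → T ⊆ N' → (S ∪ T ∈ Y ↔ S ∈ Z ∧ T ∈ Z') := by
    intro S T hS hT
    obtain ⟨e1, e2⟩ := union_inter_of_disjoint hdis hS hT
    rw [hY, Set.mem_ofPred_eq, e1, e2]
    exact and_iff_right (Finset.union_subset_union hS hT)
  let f : (Finset V × Finset V →₀ k) →ₗ[k] (Finset V →₀ k) :=
    Finsupp.linearCombination k fun p => sg k p.1 p.2 • Finsupp.single (p.1 ∪ p.2) (1 : k)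
  have hf : ∀ p, f (Finsupp.single p 1) = sg k p.1 p.2 • Finsupp.single (p.1 ∪ p.2) (1 : k) := by
    intro p; simp [f]
  have hbox : ∀ u v, f (box k _ _ u v) = emul k V u v := by
    intro u v
    have : (box k (Finset V) (Finset V)).compr₂ f = emul k V := by
      ext1 S; ext1; ext1 T; ext1
      simp [box_single, hf, emul_single]
    exact LinearMap.congr_fun (LinearMap.congr_fun this u) v
  have hproj : ∀ X : Set (Finset V), ∀ S, proj k X (Finsupp.single S 1) =
      if S ∈ X then Finsupp.single S 1 else 0 := by
    intro X S; simp [proj]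
  have key := hh_relabel (k := k) (h.cx k |>.tens (h'.cx k)) ((h.join h').cx k)
    (fun p => p.1 ∪ p.2) (fun p => sg k p.1 p.2) 0 1 one_ne_zero ⟨?_, ?_, ?_⟩ ?_ ?_ f
    (fun p _ => hf p) ?_
  · ext n
    rw [hser, hser, hser, PowerSeries.coeff_mk, PowerSeries.coeff_mul]
    have := key n
    rw [Nat.add_zero, hh_tens (h.cx k) (h'.cx k)] at this
    rw [← this]
    simp only [PowerSeries.coeff_mk]
    push_cast
    rfl
  · exact fun p hp => (hmem _ _ (h.1 _ hp.1) (h'.1 _ hp.2)).2 hp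
  · rintro ⟨S, T⟩ ⟨hS, hT⟩ ⟨S', T'⟩ ⟨hS', hT'⟩ he
    have e1 := union_inter_of_disjoint hdis (h.1 _ hS) (h'.1 _ hT)
    have e2 := union_inter_of_disjoint hdis (h.1 _ hS') (h'.1 _ hT')
    have he' : S ∪ T = S' ∪ T' := he
    rw [he'] at e1
    exact Prod.ext (e1.1.symm.trans e2.1) (e1.2.symm.trans e2.2)
  · rintro T ⟨hT, h1, h2⟩
    refine ⟨(T ∩ N, T ∩ N'), ⟨h1, h2⟩, ?_⟩
    show T ∩ N ∪ T ∩ N' = T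
    rw [← Finset.inter_union_distrib_left, Finset.inter_eq_left.2 hT]
  · rintro ⟨S, T⟩ ⟨hS, hT⟩
    exact sg_ne_zero (Finset.disjoint_of_subset_left (h.1 _ hS) (Finset.disjoint_of_subset_right (h'.1 _ hT) hdis))
  · rintro ⟨S, T⟩ ⟨hS, hT⟩
    exact Finset.card_union_of_disjoint (Finset.disjoint_of_subset_left (h.1 _ hS)
      (Finset.disjoint_of_subset_right (h'.1 _ hT) hdis))
  · rintro ⟨S, T⟩ ⟨hS, hT⟩
    simp only at hS hT
    have hf' : f (Finsupp.single (S, T) 1) = emul k V (Finsupp.single S 1) (Finsupp.single T 1) := by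
      rw [← hbox, box_single]
    have hl : ∀ F, F ⊆ N → proj k Y (emul k V (Finsupp.single F 1) (Finsupp.single T 1)) =
        emul k V (proj k Z (Finsupp.single F 1)) (Finsupp.single T 1) := by
      intro F hF
      rw [emul_single, map_smul, hproj, hproj]
      have := hmem F T hF (h'.1 _ hT)
      by_cases hFZ : F ∈ Z
      · rw [if_pos (this.2 ⟨hFZ, hT⟩), if_pos hFZ, emul_single]
      · rw [if_neg fun h => hFZ (this.1 h).1, if_neg hFZ, smul_zero, map_zero, LinearMap.zero_apply]
    have hr : ∀ F, F ⊆ N' → proj k Y (emul k V (Finsupp.single S 1) (Finsupp.single F 1)) =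
        emul k V (Finsupp.single S 1) (proj k Z' (Finsupp.single F 1)) := by
      intro F hF
      rw [emul_single, map_smul, hproj, hproj]
      have := hmem S F (h.1 _ hS) hF
      by_cases hFZ : F ∈ Z'
      · rw [if_pos (this.2 ⟨hS, hFZ⟩), if_pos hFZ, emul_single]
      · rw [if_neg fun h => hFZ (this.1 h).2, if_neg hFZ, smul_zero, map_zero]
    rw [one_smul, tensD_single, map_add, map_smul, hbox, hbox, hf']
    change proj k Y (bdry k V _) = emul k V (proj k Z (bdry k V _)) _ +
      _ • emul k V _ (proj k Z' (bdry k V _))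
    rw [bdry_emul, map_add, ebar_single, map_smul, LinearMap.smul_apply, map_smul,
      bdry_single S, bdry_single T]
    simp only [map_sum, map_smul, LinearMap.sum_apply, LinearMap.smul_apply]
    congr 1
    · exact Finset.sum_congr rfl fun x _ => by rw [hl _ ((Finset.erase_subset _ _).trans (h.1 _ hS))]
    · congr 1
      exact Finset.sum_congr rfl fun x _ => by rw [hr _ ((Finset.erase_subset _ _).trans (h'.1 _ hT))]

end

section
variable {k : Type*} [Field k] {V : Type*} {P : Finset (Finset V)} {Z : Finset V → Set (Finset V)}

/-- Subsets of the union of the blocks in `P` whose trace on each block `C` belongs to `Z C`. -/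
def joinAll (P : Finset (Finset V)) (Z : Finset V → Set (Finset V)) : Set (Finset V) :=
  {T | T ⊆ P.sup id ∧ ∀ C ∈ P, T ∩ C ∈ Z C}

theorem joinAll_upIn (hZ : ∀ C ∈ P, UpIn C (Z C)) : UpIn (P.sup id) (joinAll P Z) :=
  ⟨fun _ hT => hT.1, fun _ hT _ hTT' hT' => ⟨hT', fun C hC =>
    (hZ C hC).2 _ (hT.2 C hC) _ (Finset.inter_subset_inter_right hTT') Finset.inter_subset_right⟩⟩

theorem joinAll_insert {C : Finset V} :
    joinAll (insert C P) Z = {T | T ⊆ C ∪ P.sup id ∧ T ∩ C ∈ Z C ∧ T ∩ P.sup id ∈ joinAll P Z} := by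
  ext T
  have : ∀ D ∈ P, T ∩ P.sup id ∩ D = T ∩ D := fun D hD => by
    rw [Finset.inter_assoc, Finset.inter_eq_right.2 (show D ⊆ P.sup id from Finset.le_sup (f := id) hD)]
  simp only [joinAll, Finset.sup_insert, id, Set.mem_ofPred_eq, Finset.forall_mem_insert,
    Finset.inter_subset_right, true_and, Finset.sup_eq_union]
  refine and_congr_right fun _ => and_congr_right fun _ => forall₂_congr fun D hD => ?_
  rw [← this D hD]

theorem hser_singleton_empty : hser k ({∅} : Set (Finset V)) = 1 := by
  ext n
  have h0 : ∀ T ∈ ({∅} : Set (Finset V)), tr (bdry k V) {∅} (Finsupp.single T 1) =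
      (0 : (Finset V →₀ k) →ₗ[k] (Finset V →₀ k)) (Finsupp.single T 1) := by
    rintro T rfl
    change proj k _ (bdry k V _) = 0
    rw [bdry_single]; simp
  rw [hser, PowerSeries.coeff_mk, hh_congr h0,
    hh_zero_map ((Set.finite_singleton ∅).subset fun _ h => h.1), PowerSeries.coeff_one]
  split_ifs with h
  · subst h
    rw [show {x : Finset V | x ∈ ({∅} : Set (Finset V)) ∧ x.card = 0} = {∅} from by
      ext x; simp]
    simp
  · rw [show {x : Finset V | x ∈ ({∅} : Set (Finset V)) ∧ x.card = n} = ∅ from by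
      ext x
      simp only [Set.mem_singleton_iff, Set.mem_ofPred_eq, Set.mem_empty_iff_false, iff_false]
      rintro ⟨rfl, h'⟩
      exact h h'.symm]
    simp

theorem hser_joinAll (hdis : (P : Set (Finset V)).PairwiseDisjoint id)
    (hZ : ∀ C ∈ P, UpIn C (Z C)) : hser k (joinAll P Z) = ∏ C ∈ P, hser k (Z C) := by
  induction P using Finset.induction_on with
  | empty =>
    rw [Finset.prod_empty, ← hser_singleton_empty (k := k) (V := V)]
    congr 1
    ext T
    simp [joinAll]
  | insert C P hC ih =>
    rw [Finset.forall_mem_insert] at hZ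
    rw [Finset.prod_insert hC, ← ih (hdis.subset (by simp)) hZ.2, joinAll_insert,
      hser_join (k := k) ?_ hZ.1 (joinAll_upIn hZ.2)]
    rw [Finset.disjoint_sup_right]
    exact fun D hD => hdis (by simp) (by simp [hD]) (by rintro rfl; exact hC hD)

end

section
variable {k : Type*} [Field k] {σ : Type*} [Finite σ] {M S C : Finset (Mon σ)}

/-- The connected subsets of `C` with the same least common multiple. -/
def zconn (C : Finset (Mon σ)) : Set (Finset (Mon σ)) :=
  {T | T ⊆ C ∧ IsConnected T ∧ mlcm T = mlcm C}

theorem zconn_upIn (h0 : (0 : Mon σ) ∉ C) : UpIn C (zconn C) := by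
  refine ⟨fun T hT => hT.1, fun T hT T' hTT' hT' => ⟨hT', ?_, le_antisymm (mlcm_mono hT')
    (hT.2.2 ▸ mlcm_mono hTT')⟩⟩
  have hlc : mlcm T = mlcm C := hT.2.2
  refine isConnected_iff.2 ⟨hT.2.1.1.mono hTT', fun A hA hAne hcl => ?_⟩
  have hstep : ∀ u ∈ T', ∃ n ∈ T, NCF u n := fun u hu => by
    refine NCF_mlcm_right.1 ?_
    rw [hlc]
    exact (NCF_self fun h => h0 (h ▸ hT' hu)).mono le_rfl (le_mlcm (hT' hu))
  have hTA : T ⊆ A := by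
    obtain ⟨u, hu⟩ := hAne
    obtain ⟨n, hn, hun⟩ := hstep u (hA hu)
    have := (isConnected_iff.1 hT.2.1).2 (A ∩ T) Finset.inter_subset_right
      ⟨n, Finset.mem_inter.2 ⟨hcl u hu n (hTT' hn) hun, hn⟩⟩ fun u hu v hv huv =>
        Finset.mem_inter.2 ⟨hcl u (Finset.mem_inter.1 hu).1 v (hTT' hv) huv, hv⟩
    exact Finset.inter_eq_right.1 this
  refine hA.antisymm fun u hu => ?_
  obtain ⟨n, hn, hun⟩ := hstep u hu
  exact hcl n (hTA hn) u hu hun.symm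

theorem mem_ZB_inr {m : Mon σ} (hm : m ≠ 0) {a : TX σ} : a ∈ ZB M (.inr m) ↔
    a.1 = m ∧ a.2 ⊆ M ∧ IsConnected a.2 ∧ mlcm a.2 = m := by
  constructor
  · rintro ⟨h, h'⟩
    have := pcol_eq_inr h h'
    exact ⟨this.2.1, h.2.1, this.1, this.2.2⟩
  · rintro ⟨h, h', h'', h3⟩
    refine ⟨⟨h ▸ hm, h', (h3.trans h.symm).le⟩, ?_⟩
    rw [← h3, ← pcol_of_isConnected h'', h3, ← h]

theorem cser_inr (k : Type*) [Field k] (h0 : (0 : Mon σ) ∉ M)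
    (h1 : ∀ m ∈ M, ∀ i, ¬m ≤ Pi.single i 1) (hS : Saturated M S) (hC : C ∈ components S) :
    cser k M (.inr (mlcm C)) = PowerSeries.X * hser k (zconn C) := by
  have hm : mlcm C ≠ 0 := component_mlcm_ne_zero (fun h => h0 (hS.1 h)) hC
  have hdiv := hS.divisorsIn_eq h0 hC
  have hCM : C ⊆ M := (mem_components.1 hC).1.trans hS.1
  have hTC : ∀ T, T ⊆ M → mlcm T = mlcm C → T ⊆ C := fun T hT h x hx => by
    rw [← hdiv]
    exact Finset.mem_filter.2 ⟨hT hx, h ▸ le_mlcm hx⟩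
  have key := hh_relabel (k := k) ((zconn_upIn fun h => h0 (hCM h)).cx k)
    (ZB_cx k h0 h1 (.inr (mlcm C))) (Prod.mk (mlcm C)) (fun _ => 1) 1 1 one_ne_zero
    ⟨?_, ?_, ?_⟩ (fun _ _ => one_ne_zero) (fun _ _ => rfl) (emb k (mlcm C))
    (fun T _ => by rw [emb_single, one_smul]) ?_
  · ext n
    rcases n with _ | n
    · rw [cser, PowerSeries.coeff_mk, PowerSeries.coeff_zero_X_mul]
      have : Fam k (ZB M (.inr (mlcm C))) bdeg 0 = ⊥ := by
        refine (Submodule.eq_bot_iff _).2 fun v hv => Finsupp.ext fun a => ?_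
        by_contra ha
        exact absurd (mem_Fam.1 hv a ha).2 (Nat.succ_ne_zero _)
      rw [hh, this, bot_inf_eq, finrank_bot, Nat.zero_sub, Nat.cast_zero]
    · rw [cser, PowerSeries.coeff_mk, PowerSeries.coeff_succ_X_mul, hser, PowerSeries.coeff_mk, key]
  · exact fun T hT => (mem_ZB_inr hm).2 ⟨rfl, hT.1.trans hCM, hT.2.1, hT.2.2⟩
  · exact fun T _ T' _ h => (Prod.ext_iff.1 h).2
  · rintro ⟨m, T⟩ h
    obtain ⟨e1, e2, e3, e4⟩ := (mem_ZB_inr hm).1 h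
    simp only at e1 e2 e3 e4
    exact ⟨T, ⟨hTC T e2 e4, e3, e4⟩, by rw [e1]⟩
  · intro T hT
    rw [one_smul, emb_single]
    ext ⟨m, U⟩
    rw [tr_apply, tdif_single_apply, emb_apply, tr_apply]
    simp only
    by_cases e : mlcm C = m
    · subst e
      simp only [if_true]
      refine if_congr ?_ rfl rfl
      rw [mem_ZB_inr hm]
      exact ⟨fun h => ⟨hTC U h.2.1 h.2.2.2, h.2.2⟩, fun h => ⟨rfl, h.1.trans hCM, h.2⟩⟩
    · simp [e]

/-- The family of subsets of `S` that meet every component of `S` in a connected set with the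
same least common multiple. -/
def zsat (S : Finset (Mon σ)) : Set (Finset (Mon σ)) := joinAll (components S) zconn

theorem prod_cser (k : Type*) [Field k] (h0 : (0 : Mon σ) ∉ M)
    (h1 : ∀ m ∈ M, ∀ i, ¬m ≤ Pi.single i 1) (hS : Saturated M S) :
    ∏ C ∈ components S, -cser k M (.inr (mlcm C)) =
      (-PowerSeries.X) ^ ncomp S * hser k (zsat S) := by
  rw [zsat, hser_joinAll, ncomp, ← Finset.prod_const, ← Finset.prod_mul_distrib]
  · exact Finset.prod_congr rfl fun C hC => by rw [cser_inr k h0 h1 hS hC, neg_mul]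
  · intro C hC C' hC' hne
    rw [Function.onFun, id, id, Finset.disjoint_left]
    exact fun a ha ha' => hne (component_eq hC hC' ha ha')
  · exact fun C hC => zconn_upIn fun h => h0 (hS.1 ((mem_components.1 hC).1 h))

end

section
variable {k : Type*} [Field k] {σ : Type*} [Finite σ] {M S C : Finset (Mon σ)}

theorem md_single (i : σ) : md (Pi.single i 1 : Mon σ) = 1 := by
  have : fs (Pi.single i 1 : Mon σ) = Finsupp.single i 1 := by
    ext j; rw [fs_apply, Finsupp.single_apply, Pi.single_apply]; simp [eq_comm]
  rw [md, this]; simp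

/-- The inverse of `∏ i, (1 + x_i z)`, as a multigraded series. -/
def cofree (σ : Type*) [Finite σ] : MvPowerSeries σ (PowerSeries ℤ) :=
  gs (fun b => b) Set.univ (fun b => (-PowerSeries.X) ^ md b)

theorem coeff_cofree (e : σ →₀ ℕ) :
    MvPowerSeries.coeff e (cofree σ) = (-PowerSeries.X) ^ md (⇑e : Mon σ) := by
  rw [cofree, coeff_gs, show {i : Mon σ | i ∈ Set.univ ∧ i = ⇑e} = {⇑e} from by ext; simp,
    finsum_mem_singleton]

theorem coeff_cofree_mul_prod (s : Finset σ) (e : σ →₀ ℕ) :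
    MvPowerSeries.coeff e (cofree σ * ∏ i ∈ s,
      (1 + MvPowerSeries.monomial (Finsupp.single i 1) (PowerSeries.X : PowerSeries ℤ))) =
      if ∀ i ∈ s, e i = 0 then (-PowerSeries.X) ^ md (⇑e : Mon σ) else 0 := by
  induction s using Finset.induction_on generalizing e with
  | empty => simp [coeff_cofree]
  | insert i s hi ih =>
    rw [Finset.prod_insert hi, mul_comm (1 + _), ← mul_assoc, mul_add, mul_one, map_add,
      MvPowerSeries.coeff_mul_monomial, ih, if_congr (Finset.forall_mem_insert i s (fun j => e j = 0)) rfl rfl]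
    simp only [Finsupp.single_le_iff, Nat.one_le_iff_ne_zero]
    by_cases he : e i = 0
    · simp [he]
    · rw [if_pos he, ih, if_neg (fun h => he h.1 : ¬(e i = 0 ∧ ∀ j ∈ s, e j = 0))]
      have h1 : (∀ j ∈ s, (e - Finsupp.single i 1 : σ →₀ ℕ) j = 0) ↔ ∀ j ∈ s, e j = 0 :=
        forall₂_congr fun j hj => by
          rw [Finsupp.tsub_apply, Finsupp.single_eq_of_ne (by rintro rfl; exact hi hj), tsub_zero]
      rw [if_congr h1 rfl rfl]
      split_ifs
      · have : (⇑e : Mon σ) = ⇑(e - Finsupp.single i 1 : σ →₀ ℕ) + Pi.single i 1 := by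
          ext j
          rw [Pi.add_apply, Finsupp.tsub_apply, Finsupp.single_apply, Pi.single_apply]
          by_cases h : i = j
          · subst h; simp only [if_true]; omega
          · simp [h, Ne.symm h]
        rw [this, md_add, md_single, pow_succ]
        ring
      · simp

/-- The function underlying `collect`. -/
def collectFun (f : MvPowerSeries (Option σ) ℤ) : MvPowerSeries σ (PowerSeries ℤ) :=
  fun e => PowerSeries.mk fun n => MvPowerSeries.coeff (e.optionElim n) f

theorem coeff_collectFun (f : MvPowerSeries (Option σ) ℤ) (e : σ →₀ ℕ) (n : ℕ) :
    PowerSeries.coeff n (MvPowerSeries.coeff e (collectFun f)) =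
      MvPowerSeries.coeff (e.optionElim n) f := by
  have : MvPowerSeries.coeff e (collectFun f) =
    PowerSeries.mk fun n => MvPowerSeries.coeff (e.optionElim n) f := rfl
  rw [this, PowerSeries.coeff_mk]

/-- Collecting the powers of the variable `none`. -/
def collect (σ : Type*) [Finite σ] : MvPowerSeries (Option σ) ℤ →+* MvPowerSeries σ (PowerSeries ℤ) where
  toFun := collectFun
  map_zero' := by
    ext e n
    simp [coeff_collectFun]
  map_one' := by
    ext e n
    rw [coeff_collectFun, MvPowerSeries.coeff_one, MvPowerSeries.coeff_one]
    by_cases he : e = 0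
    · subst he
      rw [if_pos rfl, PowerSeries.coeff_one, Finsupp.optionElim_zero]
      simp
    · rw [if_neg he, if_neg (Finsupp.optionElim_ne_zero_of_right _ _ he), map_zero]
  map_add' f g := by
    ext e n
    simp [coeff_collectFun]
  map_mul' f g := by
    ext e n
    rw [coeff_collectFun, ← MvPowerSeries.coeff_coeff_optionEquivLeft, map_mul,
      PowerSeries.coeff_mul, map_sum, MvPowerSeries.coeff_mul, map_sum]
    simp only [MvPowerSeries.coeff_mul, PowerSeries.coeff_mul,
      MvPowerSeries.coeff_coeff_optionEquivLeft, coeff_collectFun]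
    rw [Finset.sum_comm]

theorem coeff_collect (f : MvPowerSeries (Option σ) ℤ) (e : σ →₀ ℕ) (n : ℕ) :
    PowerSeries.coeff n (MvPowerSeries.coeff e (collect σ f)) =
      MvPowerSeries.coeff (e.optionElim n) f := coeff_collectFun f e n

theorem collect_injective : Function.Injective (collect σ) := by
  intro f g h
  ext e
  rw [← Finsupp.optionElim_some e, ← coeff_collect, h, coeff_collect]

theorem collect_X_none : collect σ (MvPowerSeries.X none) = MvPowerSeries.C PowerSeries.X := by
  ext e n
  rw [coeff_collect, MvPowerSeries.coeff_X, MvPowerSeries.coeff_C]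
  by_cases he : e = 0
  · subst he
    rw [if_pos rfl, PowerSeries.coeff_X, Finsupp.optionElim_zero]
    refine if_congr ⟨fun h => ?_, fun h => by rw [h]⟩ rfl rfl
    simpa using DFunLike.congr_fun h none
  · rw [if_neg he, map_zero, if_neg]
    intro h
    refine he ?_
    have := congrArg Finsupp.some h
    rwa [Finsupp.some_optionElim, Finsupp.some_single_none] at this

theorem collect_X_some (i : σ) : collect σ (MvPowerSeries.X (some i)) = MvPowerSeries.X i := by
  ext e n
  rw [coeff_collect, MvPowerSeries.coeff_X, MvPowerSeries.coeff_X]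
  have : e.optionElim n = Finsupp.single (some i) 1 ↔ e = Finsupp.single i 1 ∧ n = 0 := by
    constructor
    · intro h
      refine ⟨?_, ?_⟩
      · have := congrArg Finsupp.some h
        rwa [Finsupp.some_optionElim, Finsupp.some_single_some] at this
      · have := DFunLike.congr_fun h none
        simpa using this
    · rintro ⟨rfl, rfl⟩
      ext a
      cases a <;> simp [Finsupp.single_apply]
  rw [if_congr this rfl rfl]
  by_cases he : e = Finsupp.single i 1
  · simp [he, PowerSeries.coeff_one]
  · simp [he]

theorem collect_prod (s : Finset σ) :
    collect σ (∏ i ∈ s, (1 + MvPowerSeries.X (some i) * MvPowerSeries.X none)) =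
      ∏ i ∈ s, (1 + MvPowerSeries.monomial (Finsupp.single i 1) (PowerSeries.X : PowerSeries ℤ)) := by
  rw [map_prod]
  refine Finset.prod_congr rfl fun i _ => ?_
  rw [map_add, map_one, map_mul, collect_X_none, collect_X_some, mul_comm]
  congr 1
  ext e
  rw [MvPowerSeries.coeff_C_mul, MvPowerSeries.coeff_X, MvPowerSeries.coeff_monomial]
  simp

/-- The multigraded series of the Betti numbers. -/
def bettiSer (k : Type*) [Field k] (M : Finset (Mon σ)) : MvPowerSeries σ (PowerSeries ℤ) :=
  fun e => hser k {S | S ⊆ M ∧ mlcm S = ⇑e}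

theorem golod_iff_denSer (k : Type*) [Field k] (h0 : (0 : Mon σ) ∉ M)
    (h1 : ∀ m ∈ M, ∀ i, ¬m ≤ Pi.single i 1) (s : Finset σ) (hs : ∀ i, i ∈ s)
    {P B : MvPowerSeries (Option σ) ℤ} (hP : collect σ P = torSer k M)
    (hB : collect σ B = bettiSer k M) :
    P * (1 - MvPowerSeries.X none * (B - 1)) =
      ∏ i ∈ s, (1 + MvPowerSeries.X (some i) * MvPowerSeries.X none) ↔
    denSer k M = 1 - MvPowerSeries.C PowerSeries.X * (bettiSer k M - 1) := by
  rw [← collect_injective.eq_iff, collect_prod, map_mul, map_sub, map_mul, map_sub, map_one, hP, hB,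
    collect_X_none]
  set Q := ∏ i ∈ s, (1 + MvPowerSeries.monomial (Finsupp.single i 1) (PowerSeries.X : PowerSeries ℤ))
  have e1 : cofree σ * Q = 1 := by
    ext1 e
    rw [coeff_cofree_mul_prod, MvPowerSeries.coeff_one]
    have : (∀ i ∈ s, e i = 0) ↔ e = 0 :=
      ⟨fun h => Finsupp.ext fun i => h i (hs i), fun h i _ => by rw [h]; rfl⟩
    rw [if_congr this rfl rfl]
    split_ifs with h
    · rw [h, Finsupp.coe_zero, md_eq_zero.2 rfl, pow_zero]
    · rfl
  have e2 : cofree σ * (denSer k M * torSer k M) = 1 := denSer_mul_torSer k h0 h1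
  have e3 : denSer k M * torSer k M = Q := by
    calc _ = (cofree σ * Q) * (denSer k M * torSer k M) := by rw [e1, one_mul]
      _ = Q * (cofree σ * (denSer k M * torSer k M)) := by ring
      _ = Q := by rw [e2, mul_one]
  have hu : IsUnit (torSer k M) :=
    IsUnit.of_mul_eq_one (cofree σ * denSer k M) (by rw [← e2]; ring)
  rw [← e3, mul_comm, hu.mul_left_inj, eq_comm]

theorem coeff_denSer (k : Type*) [Field k] (h0 : (0 : Mon σ) ∉ M)
    (h1 : ∀ m ∈ M, ∀ i, ¬m ≤ Pi.single i 1) (e : σ →₀ ℕ) (he : e ≠ 0) :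
    MvPowerSeries.coeff e (denSer k M) = ∑ S ∈ (satSets M).filter (fun S => mlcm S = ⇑e),
      (-PowerSeries.X) ^ ncomp S * hser k (zsat S) := by
  rw [denSer, coeff_gs]
  have : {S | S ∈ {S | Saturated M S} ∧ mlcm S = ⇑e} =
      ↑((satSets M).filter fun S => mlcm S = ⇑e) := by
    ext S
    simp only [satSets, Finset.coe_filter, Finset.mem_filter, Finset.mem_powerset, Set.mem_ofPred_eq]
    refine and_congr_left fun h => ⟨fun hS => ⟨hS.1, ?_, hS⟩, fun hS => hS.2.2⟩
    refine Finset.nonempty_iff_ne_empty.2 fun hS => he ?_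
    subst hS
    exact DFunLike.coe_injective (h.symm.trans mlcm_empty)
  rw [this, finsum_mem_coe_finset]
  exact Finset.sum_congr rfl fun S hS => prod_cser k h0 h1
    (Finset.mem_filter.1 (Finset.mem_filter.1 hS).1).2.2

theorem coeff_zero_denSer (k : Type*) [Field k] (h0 : (0 : Mon σ) ∉ M) :
    MvPowerSeries.coeff 0 (denSer k M) = 1 := by
  rw [denSer, coeff_gs]
  have : {S | S ∈ {S | Saturated M S} ∧ mlcm S = ⇑(0 : σ →₀ ℕ)} = {∅} := by
    ext S
    simp only [Set.mem_ofPred_eq, Set.mem_singleton_iff]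
    constructor
    · rintro ⟨hS, h⟩
      by_contra hne
      exact mlcm_ne_zero (fun h => h0 (hS.1 h)) (Finset.nonempty_iff_ne_empty.2 hne) h
    · rintro rfl
      exact ⟨Saturated.empty h0, mlcm_empty⟩
  rw [this, finsum_mem_singleton, components_eq_empty.2 rfl, Finset.prod_empty]

theorem coeff_zero_bettiSer (k : Type*) [Field k] (h0 : (0 : Mon σ) ∉ M) :
    MvPowerSeries.coeff 0 (bettiSer k M) = 1 := by
  have : {S : Finset (Mon σ) | S ⊆ M ∧ mlcm S = ⇑(0 : σ →₀ ℕ)} = {∅} := by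
    ext S
    simp only [Set.mem_ofPred_eq, Set.mem_singleton_iff]
    constructor
    · rintro ⟨hS, h⟩
      by_contra hne
      exact mlcm_ne_zero (fun h => h0 (hS h)) (Finset.nonempty_iff_ne_empty.2 hne) h
    · rintro rfl
      exact ⟨Finset.empty_subset _, mlcm_empty⟩
  change hser k _ = 1
  rw [this, hser_singleton_empty]

theorem denSer_eq_iff (k : Type*) [Field k] (h0 : (0 : Mon σ) ∉ M)
    (h1 : ∀ m ∈ M, ∀ i, ¬m ≤ Pi.single i 1) :
    denSer k M = 1 - MvPowerSeries.C PowerSeries.X * (bettiSer k M - 1) ↔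
    ∀ m : Mon σ, m ≠ 0 → ∑ S ∈ (satSets M).filter (fun S => mlcm S = m),
      (-PowerSeries.X) ^ ncomp S * hser k (zsat S) =
      -PowerSeries.X * hser k {S | S ⊆ M ∧ mlcm S = m} := by
  have hc : ∀ e : σ →₀ ℕ, MvPowerSeries.coeff e
      (1 - MvPowerSeries.C PowerSeries.X * (bettiSer k M - 1)) =
      if e = 0 then 1 else -PowerSeries.X * hser k {S | S ⊆ M ∧ mlcm S = ⇑e} := by
    intro e
    rw [map_sub, MvPowerSeries.coeff_C_mul, map_sub]
    split_ifs with h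
    · rw [h, coeff_zero_bettiSer k h0, MvPowerSeries.coeff_one, if_pos rfl]; ring
    · rw [MvPowerSeries.coeff_one, if_neg h, sub_zero, zero_sub, neg_mul]; rfl
  constructor
  · intro h m hm
    have he : fs m ≠ 0 := fun h => hm (fs_eq_zero.1 h)
    have := hc (fs m)
    rw [if_neg he, ← h, coeff_denSer k h0 h1 _ he] at this
    exact this
  · intro h
    ext1 e
    rw [hc]
    split_ifs with he
    · rw [he, coeff_zero_denSer k h0]
    · rw [coeff_denSer k h0 h1 _ he, h _ fun h' => he (DFunLike.coe_injective h')]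

end

section
variable {k : Type*} [Field k] {σ : Type*} [Finite σ] {M N S T U C : Finset (Mon σ)}

theorem mem_saturation {m : Mon σ} :
    m ∈ saturation N T ↔ m ∈ N ∧ ∃ C ∈ components T, m ≤ mlcm C := Finset.mem_filter

theorem exists_component_mlcm_le (hU : IsConnected U) (hUT : U ⊆ saturation N T) :
    ∃ D ∈ components T, mlcm U ≤ mlcm D := by
  obtain ⟨u, hu⟩ := hU.1
  obtain ⟨D, hD, huD⟩ := (mem_saturation.1 (hUT hu)).2
  have := (isConnected_iff.1 hU).2 (U.filter fun v => v ≤ mlcm D) (Finset.filter_subset _ _)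
    ⟨u, Finset.mem_filter.2 ⟨hu, huD⟩⟩ fun v hv w hw hvw => by
      obtain ⟨D', hD', hwD'⟩ := (mem_saturation.1 (hUT hw)).2
      have := component_eq_of_NCF hD hD' (hvw.mono (Finset.mem_filter.1 hv).2 hwD')
      exact Finset.mem_filter.2 ⟨hw, this ▸ hwD'⟩
  refine ⟨D, hD, mlcm_le_iff.2 fun v hv => ?_⟩
  rw [← this] at hv
  exact (Finset.mem_filter.1 hv).2

theorem subset_saturation (hT : T ⊆ N) : T ⊆ saturation N T := fun m hm => by
  obtain ⟨C, hC, hmC⟩ := exists_component hm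
  exact mem_saturation.2 ⟨hT hm, C, hC, le_mlcm hmC⟩

theorem saturation_subset (hS : Saturated N S) (hT : T ⊆ S) : saturation N T ⊆ S := fun m hm => by
  obtain ⟨hmN, C, hC, hmC⟩ := mem_saturation.1 hm
  exact hS.2 m hmN C ((mem_components.1 hC).1.trans hT) (mem_components.1 hC).2.1 hmC

theorem saturated_saturation : Saturated N (saturation N T) :=
  ⟨Finset.filter_subset _ _, fun m hm _ hU hUc hle => by
    obtain ⟨D, hD, hle'⟩ := exists_component_mlcm_le hUc hU
    exact mem_saturation.2 ⟨hm, D, hD, hle.trans hle'⟩⟩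

theorem sup_components (S : Finset (Mon σ)) : (components S).sup id = S := by
  refine le_antisymm (Finset.sup_le fun C hC => (mem_components.1 hC).1) fun m hm => ?_
  obtain ⟨C, hC, hmC⟩ := exists_component hm
  exact (Finset.le_sup (f := id) hC : C ≤ _) hmC

theorem zsat_eq (h0 : (0 : Mon σ) ∉ N) (hS : Saturated N S) (hne : S.Nonempty) :
    {T | T ⊆ S ∧ T.Nonempty ∧ ∀ p ∈ openInterval N S, ¬T ⊆ p} = zsat S := by
  ext T
  rw [zsat, joinAll, sup_components]
  simp only [Set.mem_ofPred_eq]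
  refine and_congr_right fun hT => ⟨?_, ?_⟩
  · rintro ⟨hTne, hp⟩ C hC
    have hCc := mem_components.1 hC
    have hSat : S = saturation N T := by
      by_contra hne'
      refine hp (saturation N T) ⟨saturated_saturation, hTne.mono (subset_saturation (hT.trans hS.1)),
        (saturation_subset hS hT).ssubset_of_ne (Ne.symm hne')⟩ (subset_saturation (hT.trans hS.1))
    obtain ⟨D, hD, hle⟩ := exists_component_mlcm_le (N := N) hCc.2.1 (hSat ▸ hCc.1)
    have hDc := mem_components.1 hD
    have hDC : D ⊆ C := by
      obtain ⟨u, hu⟩ := hCc.2.1.1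
      have hu0 : u ≠ 0 := fun h => h0 (hS.1 (hCc.1 (h ▸ hu)))
      obtain ⟨d, hd, hud⟩ := NCF_mlcm_right.1 ((NCF_self hu0).mono le_rfl ((le_mlcm hu).trans hle))
      exact hDc.2.1.subset_component (hDc.1.trans hT) hC hd (hCc.2.2 u hu d (hT (hDc.1 hd)) hud)
    exact (zconn_upIn fun h => h0 (hS.1 (hCc.1 h))).2 D ⟨hDC, hDc.2.1, le_antisymm (mlcm_mono hDC) hle⟩
      _ (Finset.subset_inter hDc.1 hDC) Finset.inter_subset_right
  · intro h
    constructor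
    · obtain ⟨m, hm⟩ := hne
      obtain ⟨C, hC, -⟩ := exists_component hm
      exact (h C hC).2.1.1.mono Finset.inter_subset_left
    · rintro p ⟨hp, -, hpS⟩ hTp
      refine hpS.2 fun m hm => ?_
      obtain ⟨C, hC, hmC⟩ := exists_component hm
      obtain ⟨-, h1, h2⟩ := h C hC
      exact hp.2 m (hS.1 hm) (T ∩ C) (Finset.inter_subset_left.trans hTp) h1 (h2 ▸ le_mlcm hmC)

theorem hdim_openInterval (h0 : (0 : Mon σ) ∉ N) (hS : Saturated N S) (hne : S.Nonempty) (n : ℕ) :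
    (hdim k (orderComplex (openInterval N S)) n : ℤ) = PowerSeries.coeff (n + 1) (hser k (zsat S)) := by
  rw [hser, PowerSeries.coeff_mk, hdim_orderComplex (N := S) ?_ hne id ?_ ?_ ?_ n]
  · simp only [id]
    rw [zsat_eq h0 hS hne]
  · exact N.powerset.finite_toSet.subset fun p hp => Finset.mem_coe.2 (Finset.mem_powerset.2 hp.1.1)
  · exact fun p hp => ⟨hp.2.1, hp.2.2.1⟩
  · exact fun p _ q _ h => h
  · rintro T hT ⟨p, hp, hTp⟩
    have hTp : T ⊆ p := hTp
    have hTN := subset_saturation (hTp.trans hp.1.1)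
    exact ⟨saturation N T, ⟨saturated_saturation, hT.mono hTN,
      (saturation_subset hp.1 hTp).trans_ssubset hp.2.2⟩, hTN, fun q hq h => saturation_subset hq.1 h⟩

theorem mem_lcmLattice {l : Mon σ} : l ∈ lcmLattice N ↔ ∃ S ⊆ N, mlcm S = l := by
  simp [lcmLattice]

theorem subset_divisorsIn {l : Mon σ} : T ⊆ divisorsIn N l ↔ T ⊆ N ∧ mlcm T ≤ l := by
  refine ⟨fun h => ⟨fun x hx => (Finset.mem_filter.1 (h hx)).1,
    mlcm_le_iff.2 fun s hs => (Finset.mem_filter.1 (h hs)).2⟩, fun h x hx => ?_⟩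
  exact Finset.mem_filter.2 ⟨h.1 hx, mlcm_le_iff.1 h.2 x hx⟩

theorem mem_truncatedLcmLattice {l : Mon σ} :
    l ∈ truncatedLcmLattice N ↔ l ≠ mlcm N ∧ l ≠ 0 ∧ ∃ S ⊆ N, mlcm S = l := by
  rw [truncatedLcmLattice, Finset.mem_erase, Finset.mem_erase, mem_lcmLattice]

theorem mlcm_mem_truncatedLcmLattice (h0 : (0 : Mon σ) ∉ N) (hT : T.Nonempty) (hTN : T ⊆ N)
    (h : mlcm T ≠ mlcm N) : mlcm T ∈ truncatedLcmLattice N :=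
  mem_truncatedLcmLattice.2 ⟨h, mlcm_ne_zero (fun h => h0 (hTN h)) hT, T, hTN, rfl⟩

theorem hdim_truncatedLcmLattice (h0 : (0 : Mon σ) ∉ N) (hne : N.Nonempty) (n : ℕ) :
    (hdim k (orderComplex {l : Mon σ | l ∈ truncatedLcmLattice N}) n : ℤ) =
      PowerSeries.coeff (n + 1) (hser k {S | S ⊆ N ∧ mlcm S = mlcm N}) := by
  rw [hser, PowerSeries.coeff_mk, hdim_orderComplex (N := N) ?_ hne (divisorsIn N) ?_ ?_ ?_ n]
  · have : {T | T ⊆ N ∧ T.Nonempty ∧ ∀ p ∈ {l : Mon σ | l ∈ truncatedLcmLattice N},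
        ¬T ⊆ divisorsIn N p} = {S | S ⊆ N ∧ mlcm S = mlcm N} := by
      ext T
      simp only [Set.mem_ofPred_eq]
      refine and_congr_right fun hT => ⟨?_, ?_⟩
      · rintro ⟨hTne, h⟩
        by_contra hl
        exact h _ (mlcm_mem_truncatedLcmLattice h0 hTne hT hl) (subset_divisorsIn.2 ⟨hT, le_rfl⟩)
      · intro h
        refine ⟨?_, fun p hp hTp => ?_⟩
        · rw [Finset.nonempty_iff_ne_empty]
          rintro rfl
          exact mlcm_ne_zero h0 hne (h.symm.trans mlcm_empty)
        · obtain ⟨h1, -, S, hS, rfl⟩ := mem_truncatedLcmLattice.1 hp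
          exact h1 (le_antisymm (mlcm_mono hS) (h ▸ (subset_divisorsIn.1 hTp).2))
    rw [this]
  · exact (truncatedLcmLattice N).finite_toSet
  · intro p hp
    obtain ⟨h1, h2, S, hS, rfl⟩ := mem_truncatedLcmLattice.1 hp
    refine ⟨?_, Finset.filter_subset _ _⟩
    have hSne : S.Nonempty := Finset.nonempty_iff_ne_empty.2 fun h => h2 (by rw [h, mlcm_empty])
    exact hSne.mono (subset_divisorsIn.2 ⟨hS, le_rfl⟩)
  · exact fun p _ q _ h => subset_divisorsIn.2
      ⟨Finset.filter_subset _ _, mlcm_le_iff.2 fun s hs => (Finset.mem_filter.1 hs).2.trans h⟩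
  · rintro T hT ⟨p, hp, hTp⟩
    obtain ⟨hTN, hle⟩ := subset_divisorsIn.1 hTp
    obtain ⟨h1, -, S, hS, rfl⟩ := mem_truncatedLcmLattice.1 hp
    refine ⟨mlcm T, mlcm_mem_truncatedLcmLattice h0 hT hTN fun h => ?_,
      subset_divisorsIn.2 ⟨hTN, le_rfl⟩, fun q _ hq => (subset_divisorsIn.1 hq).2⟩
    exact h1 (le_antisymm (mlcm_mono hS) (h ▸ hle))

end

theorem coeff_hser_of_forall_ne {k : Type*} [Field k] {V : Type*} {Z : Set (Finset V)} {n : ℕ}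
    (h : ∀ T ∈ Z, T.card ≠ n) : PowerSeries.coeff n (hser k Z) = 0 := by
  have : Fam k Z Finset.card n = ⊥ := by
    refine (Submodule.eq_bot_iff _).2 fun v hv => Finsupp.ext fun a => ?_
    by_contra ha
    exact h a (mem_Fam.1 hv a ha).1 (mem_Fam.1 hv a ha).2
  rw [hser, PowerSeries.coeff_mk, hh, this, bot_inf_eq, finrank_bot, Nat.zero_sub, Nat.cast_zero]

theorem exists_toLaurent_eq {k : Type*} [Field k] {V : Type*} {Δ : Set (Finset V)} {B : ℕ}
    {f : PowerSeries ℤ} (h0 : PowerSeries.coeff 0 f = 0)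
    (h1 : ∀ n, (hdim k Δ n : ℤ) = PowerSeries.coeff (n + 1) f)
    (h2 : ∀ n, B + 1 < n → PowerSeries.coeff n f = 0) :
    ∃ p : Polynomial ℤ, Polynomial.toLaurent p = hgen k Δ B * LaurentPolynomial.T 2 ∧
      (p : PowerSeries ℤ) = f := by
  refine ⟨∑ n ∈ Finset.range (B + 1), Polynomial.monomial (n + 1) (hdim k Δ n : ℤ), ?_, ?_⟩
  · rw [hgen, map_sum, Finset.sum_mul]
    refine Finset.sum_congr rfl fun n _ => ?_
    rw [← Polynomial.C_mul_X_pow_eq_monomial, Polynomial.toLaurent_C_mul_X_pow, smul_mul_assoc,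
      ← LaurentPolynomial.T_add, ← LaurentPolynomial.smul_eq_C_mul]
    congr 2
    push_cast; ring
  · ext n
    rw [Polynomial.coeff_coe, Polynomial.finsetSum_coeff]
    rcases n with _ | n
    · rw [h0]
      exact Finset.sum_eq_zero fun i _ => by rw [Polynomial.coeff_monomial, if_neg (Nat.succ_ne_zero _)]
    · simp only [Polynomial.coeff_monomial, Nat.succ_inj, Finset.sum_ite_eq', Finset.mem_range]
      split_ifs with h
      · exact h1 n
      · exact (h2 _ (by omega)).symm

section
variable {k : Type*} [Field k] {σ : Type*} [Finite σ] {M N S T U C : Finset (Mon σ)}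

theorem card_le_card_lcmLattice : N.card ≤ (lcmLattice N).card :=
  Finset.card_le_card fun m hm => mem_lcmLattice.2
    ⟨{m}, Finset.singleton_subset_iff.2 hm, by simp [mlcm]⟩

theorem ncomp_pos (h : S.Nonempty) : 0 < ncomp S := by
  obtain ⟨m, hm⟩ := h
  obtain ⟨C, hC, -⟩ := exists_component hm
  exact Finset.card_pos.2 ⟨C, hC⟩

theorem isPreGolod_iff (h0 : (0 : Mon σ) ∉ N) (hne : N.Nonempty) : IsPreGolod k N ↔
    ∑ S ∈ (satSets N).filter (fun S => mlcm S = mlcm N),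
      (-PowerSeries.X) ^ ncomp S * hser k (zsat S) =
    -PowerSeries.X * hser k {S | S ⊆ N ∧ mlcm S = mlcm N} := by
  obtain ⟨p, hp, hp'⟩ := exists_toLaurent_eq (k := k)
    (Δ := orderComplex {l : Mon σ | l ∈ truncatedLcmLattice N}) (B := (lcmLattice N).card)
    (f := hser k {S | S ⊆ N ∧ mlcm S = mlcm N})
    (coeff_hser_of_forall_ne fun T hT h => mlcm_ne_zero h0 hne
      (by rw [← hT.2, Finset.card_eq_zero.1 h, mlcm_empty])) (hdim_truncatedLcmLattice h0 hne)
    (fun n hn => coeff_hser_of_forall_ne fun T hT h => by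
      have := Finset.card_le_card hT.1
      have := card_le_card_lcmLattice (N := N)
      omega)
  have hq : ∀ S : Finset (Mon σ), ∃ q : Polynomial ℤ, S ∈ satSets N →
      Polynomial.toLaurent q = hgen k (orderComplex (openInterval N S)) N.powerset.card *
        LaurentPolynomial.T 2 ∧ (q : PowerSeries ℤ) = hser k (zsat S) := by
    intro S
    by_cases hS : S ∈ satSets N
    · obtain ⟨hSN, hSne, hSs⟩ := Finset.mem_filter.1 hS
      have hz := zsat_eq h0 hSs hSne
      obtain ⟨q, hq⟩ := exists_toLaurent_eq (k := k) (Δ := orderComplex (openInterval N S))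
        (B := N.powerset.card) (f := hser k (zsat S))
        (coeff_hser_of_forall_ne fun T hT h => by
          rw [← hz] at hT
          exact hT.2.1.ne_empty (Finset.card_eq_zero.1 h)) (hdim_openInterval h0 hSs hSne)
        (fun n hn => coeff_hser_of_forall_ne fun T hT h => by
          rw [← hz] at hT
          have := Finset.card_le_card (hT.1.trans (Finset.mem_powerset.1 hSN))
          rw [Finset.card_powerset] at hn
          have := Nat.lt_two_pow_self (n := N.card)
          omega)
      exact ⟨q, fun _ => hq⟩
    · exact ⟨0, fun h => absurd h hS⟩
  choose q hq using hq
  have e1 : ∑ S ∈ (satSets N).filter (fun S => mlcm S = mlcm N),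
      (-PowerSeries.X) ^ ncomp S * hser k (zsat S) =
      ((∑ S ∈ (satSets N).filter (fun S => mlcm S = mlcm N),
        (-Polynomial.X) ^ ncomp S * q S : Polynomial ℤ) : PowerSeries ℤ) := by
    rw [← Polynomial.coeToPowerSeries.ringHom_apply, map_sum]
    refine Finset.sum_congr rfl fun S hS => ?_
    rw [map_mul, map_pow, map_neg, Polynomial.coeToPowerSeries.ringHom_apply,
      Polynomial.coeToPowerSeries.ringHom_apply, (hq S (Finset.mem_filter.1 hS).1).2,
      Polynomial.coe_X]
  have e2 : -PowerSeries.X * hser k {S | S ⊆ N ∧ mlcm S = mlcm N} =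
      ((-Polynomial.X * p : Polynomial ℤ) : PowerSeries ℤ) := by
    rw [Polynomial.coe_mul, hp', ← Polynomial.coeToPowerSeries.ringHom_apply, map_neg,
      Polynomial.coeToPowerSeries.ringHom_apply, Polynomial.coe_X]
  rw [e1, e2, Polynomial.coe_inj, ← Polynomial.toLaurent_injective.eq_iff]
  have e3 : Polynomial.toLaurent (∑ S ∈ (satSets N).filter (fun S => mlcm S = mlcm N),
        (-Polynomial.X) ^ ncomp S * q S : Polynomial ℤ) =
      (∑ S ∈ (satSets N).filter (fun S => mlcm S = mlcm N), ((-1 : ℤ) ^ (ncomp S - 1)) •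
          (LaurentPolynomial.T ((ncomp S : ℤ) - 1) *
            hgen k (orderComplex (openInterval N S)) N.powerset.card)) *
      (-LaurentPolynomial.T 3) := by
    rw [map_sum, Finset.sum_mul]
    refine Finset.sum_congr rfl fun S hS => ?_
    have hS := (Finset.mem_filter.1 hS).1
    obtain ⟨c, hc⟩ : ∃ c, ncomp S = c + 1 :=
      ⟨_, (Nat.sub_add_cancel (ncomp_pos (Finset.mem_filter.1 hS).2.1)).symm⟩
    rw [map_mul, (hq S hS).1, map_pow, map_neg, Polynomial.toLaurent_X, hc, neg_pow,
      LaurentPolynomial.T_pow, Nat.add_sub_cancel,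
      show (LaurentPolynomial.T 3 : LaurentPolynomial ℤ) = LaurentPolynomial.T 1 * LaurentPolynomial.T 2
        from by rw [← LaurentPolynomial.T_add]; rfl]
    rw [show ((c + 1 : ℕ) : ℤ) * 1 = (((c + 1 : ℕ) : ℤ) - 1) + 1 from by ring, LaurentPolynomial.T_add,
      zsmul_eq_mul]
    push_cast
    ring
  have e4 : Polynomial.toLaurent (-Polynomial.X * p) =
      hgen k (orderComplex {l : Mon σ | l ∈ truncatedLcmLattice N}) (lcmLattice N).card *
      (-LaurentPolynomial.T 3) := by
    rw [map_mul, hp, map_neg, Polynomial.toLaurent_X,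
      show (LaurentPolynomial.T 3 : LaurentPolynomial ℤ) = LaurentPolynomial.T 1 * LaurentPolynomial.T 2
        from by rw [← LaurentPolynomial.T_add]; rfl]
    ring
  have hu : IsUnit (-LaurentPolynomial.T 3 : LaurentPolynomial ℤ) :=
    (LaurentPolynomial.isUnit_T (R := ℤ) 3).neg
  rw [e3, e4, hu.mul_left_inj, eq_comm]
  exact Iff.rfl

theorem saturated_divisorsIn_iff {m : Mon σ} (hS : mlcm S = m) :
    Saturated (divisorsIn M m) S ↔ Saturated M S := by
  constructor
  · refine fun h => ⟨h.1.trans (Finset.filter_subset _ _), fun n hn T hT hTc hle => ?_⟩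
    exact h.2 n (Finset.mem_filter.2 ⟨hn, hle.trans (hS ▸ mlcm_mono hT)⟩) T hT hTc hle
  · exact fun h => ⟨subset_divisorsIn.2 ⟨h.1, hS.le⟩, fun n hn T hT hTc hle =>
      h.2 n (Finset.mem_filter.1 hn).1 T hT hTc hle⟩

theorem isPreGolod_divisorsIn_iff (h0 : (0 : Mon σ) ∉ M) {m : Mon σ} (hm : m ∈ lcmLattice M)
    (hne : (divisorsIn M m).Nonempty) : IsPreGolod k (divisorsIn M m) ↔
    ∑ S ∈ (satSets M).filter (fun S => mlcm S = m), (-PowerSeries.X) ^ ncomp S * hser k (zsat S) =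
      -PowerSeries.X * hser k {S | S ⊆ M ∧ mlcm S = m} := by
  have hmN : mlcm (divisorsIn M m) = m := by
    obtain ⟨S, hS, h⟩ := mem_lcmLattice.1 hm
    refine le_antisymm (mlcm_le_iff.2 fun s hs => (Finset.mem_filter.1 hs).2) ?_
    rw [← h] at *
    exact mlcm_mono (subset_divisorsIn.2 ⟨hS, le_rfl⟩)
  have hN : (0 : Mon σ) ∉ divisorsIn M m := fun h => h0 (Finset.mem_filter.1 h).1
  rw [isPreGolod_iff hN hne, hmN]
  have e1 : {S | S ⊆ divisorsIn M m ∧ mlcm S = m} = {S | S ⊆ M ∧ mlcm S = m} := by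
    ext S
    simp only [Set.mem_ofPred_eq]
    refine and_congr_left fun h => ?_
    rw [subset_divisorsIn]
    exact and_iff_left h.le
  have e2 : (satSets (divisorsIn M m)).filter (fun S => mlcm S = m) =
      (satSets M).filter (fun S => mlcm S = m) := by
    ext S
    simp only [satSets, Finset.mem_filter, Finset.mem_powerset]
    refine and_congr_left fun h => ?_
    rw [saturated_divisorsIn_iff h, subset_divisorsIn, and_iff_left h.le]
  rw [e1, e2]

theorem forall_isPreGolod_iff (h0 : (0 : Mon σ) ∉ M) :
    (∀ m ∈ lcmLattice M, (divisorsIn M m).Nonempty → IsPreGolod k (divisorsIn M m)) ↔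
    ∀ m : Mon σ, m ≠ 0 → ∑ S ∈ (satSets M).filter (fun S => mlcm S = m),
      (-PowerSeries.X) ^ ncomp S * hser k (zsat S) =
      -PowerSeries.X * hser k {S | S ⊆ M ∧ mlcm S = m} := by
  constructor
  · intro h m hm
    by_cases hml : m ∈ lcmLattice M
    · have hne : (divisorsIn M m).Nonempty := by
        obtain ⟨S, hS, rfl⟩ := mem_lcmLattice.1 hml
        have hSne : S.Nonempty := Finset.nonempty_iff_ne_empty.2 fun h => hm (by rw [h, mlcm_empty])
        exact hSne.mono (subset_divisorsIn.2 ⟨hS, le_rfl⟩)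
      exact (isPreGolod_divisorsIn_iff h0 hml hne).1 (h m hml hne)
    · have hS : ∀ S ⊆ M, mlcm S ≠ m := fun S hS h => hml (mem_lcmLattice.2 ⟨S, hS, h⟩)
      have hempty : (satSets M).filter (fun S => mlcm S = m) = ∅ :=
        Finset.filter_false_of_mem fun S hS' =>
          hS S (Finset.mem_powerset.1 (Finset.mem_filter.1 hS').1)
      rw [hempty, Finset.sum_empty]
      have : hser k {S | S ⊆ M ∧ mlcm S = m} = 0 := by
        ext n
        rw [coeff_hser_of_forall_ne fun T hT => absurd hT.2 (hS T hT.1), map_zero]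
      rw [this, mul_zero]
  · intro h m hm hne
    refine (isPreGolod_divisorsIn_iff h0 hm hne).2 (h m ?_)
    rintro rfl
    obtain ⟨a, ha⟩ := hne
    obtain ⟨ha, ha0⟩ := Finset.mem_filter.1 ha
    exact h0 ((le_antisymm ha0 zero_le : a = 0) ▸ ha)

end

theorem expSet_eq_upperSet {t : ℕ} {k : Type*} [Field k] {M : Finset (Mon (Fin t))}
    {I : Ideal (MvPolynomial (Fin t) k)} (h : IsMonomialIdealOf M I) : expSet I = upperSet M := by
  have himg : (fun m => MvPolynomial.monomial (Finsupp.equivFunOnFinite.symm m) (1 : k)) '' ↑M =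
      (fun s => MvPolynomial.monomial s (1 : k)) '' (Finsupp.equivFunOnFinite.symm '' (M : Set (Mon (Fin t)))) := by
    rw [Set.image_image]
  rw [IsMonomialIdealOf, himg] at h
  ext β
  rw [expSet, Set.mem_ofPred_eq, h, MvPolynomial.mem_ideal_span_monomial_image,
    MvPolynomial.support_monomial, if_neg one_ne_zero]
  simp only [Finset.mem_singleton, forall_eq, Set.exists_mem_image, upperSet, Set.mem_ofPred_eq,
    Finset.mem_coe]
  exact Iff.rfl

section
attribute [local instance] finDecEq monDecEq

theorem collect_poincareSeries (k : Type*) [Field k] {t : ℕ} (M : Finset (Mon (Fin t))) :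
    collect (Fin t) (poincareSeries k (upperSet M)) = torSer k M := by
  ext e n
  rw [coeff_collect]
  have h : MvPowerSeries.coeff e (torSer k M) =
    PowerSeries.mk fun n => (torDim k (upperSet M) n ⇑e : ℤ) := rfl
  have h' : MvPowerSeries.coeff (e.optionElim n) (poincareSeries k (upperSet M)) =
    torDim k (upperSet M) (e.optionElim n none) fun i => e.optionElim n (some i) := rfl
  rw [h, PowerSeries.coeff_mk, h']
  simp only [Finsupp.optionElim_apply_none, Finsupp.optionElim_apply_some]

theorem collect_bettiSeries (k : Type*) [Field k] {t : ℕ} (M : Finset (Mon (Fin t))) :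
    collect (Fin t) (bettiSeries k (upperSet M)) = bettiSer k M := by
  ext e n
  rw [coeff_collect]
  have h : MvPowerSeries.coeff e (bettiSer k M) = hser k {S | S ⊆ M ∧ mlcm S = ⇑e} := rfl
  have h' : MvPowerSeries.coeff (e.optionElim n) (bettiSeries k (upperSet M)) =
    bettiDim k (upperSet M) (e.optionElim n none) fun i => e.optionElim n (some i) := rfl
  rw [h, hser, PowerSeries.coeff_mk, h']
  simp only [Finsupp.optionElim_apply_none, Finsupp.optionElim_apply_some]
  exact congrArg Nat.cast (bettiDim_eq_hh k M n ⇑e)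

theorem isGolod_iff {t : ℕ} {k : Type*} [Field k] {M : Finset (Mon (Fin t))}
    (h0 : (0 : Mon (Fin t)) ∉ M) (h1 : ∀ m ∈ M, ∀ i, ¬ m ≤ Pi.single i 1) :
    IsGolod k (upperSet M) ↔
      ∀ l ∈ lcmLattice M, (divisorsIn M l).Nonempty → IsPreGolod k (divisorsIn M l) := by
  rw [forall_isPreGolod_iff h0, ← denSer_eq_iff k h0 h1]
  exact golod_iff_denSer k h0 h1 Finset.univ Finset.mem_univ (collect_poincareSeries k M)
    (collect_bettiSeries k M)

end

theorem zero_notMem_of_two_le_mdeg {t : ℕ} {M : Finset (Mon (Fin t))} (h : ∀ m ∈ M, 2 ≤ mdeg m) :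
    (0 : Mon (Fin t)) ∉ M := fun h0 => by
  simpa [mdeg] using h 0 h0

theorem mdeg_mono {t : ℕ} {a b : Mon (Fin t)} (h : a ≤ b) : mdeg a ≤ mdeg b :=
  Finset.sum_le_sum fun i _ => h i

end MonomialRings

open MonomialRings

/-- **Theorem (combinatorial Golod criterion).**
Let `I` be a monomial ideal of `k[x₁,…,x_t]` generated by monomials of degree at least 2,
with minimal generating set `M`.  Then `R = k[x₁,…,x_t]/I` is Golod if and only if every
non-empty subset of `M` of the form `M_m`, `m ∈ L_I`, is pre-Golod over `k`. -/
theorem golod_iff_preGolod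
    (t : ℕ) (k : Type) [Field k]
    (M : Finset (Mon (Fin t)))
    (I : Ideal (MvPolynomial (Fin t) k))
    (hgenI : IsMonomialIdealOf M I)
    (hmin : IsAntichain' M)
    (hdeg : ∀ m ∈ M, 2 ≤ mdeg m) :
    IsGolod k (expSet I) ↔
      ∀ l ∈ lcmLattice M, (divisorsIn M l).Nonempty → IsPreGolod k (divisorsIn M l) := by
  rw [expSet_eq_upperSet hgenI]
  refine isGolod_iff (zero_notMem_of_two_le_mdeg hdeg) fun m hm i hle => ?_
  have h := (hdeg m hm).trans (mdeg_mono hle)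
  simp [mdeg] at h
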